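/- Let d, n ≥ 1, 1 < p < ∞, let Ω ∈ L^∞(S^{d−1}) with ∫_{S^{d−1}} Ω = 0, and let W be a matrix A₁ weight on ℝ^d. Then the maximal weighted rough singular integral T*_{Ω,W,p} is bounded from L^p(ℝ^d; ℂⁿ) to L^p(ℝ^d): ‖T*_{Ω,W,p} f‖_{L^p(ℝ^d)} ≤ c · [W]_{A₁}^{1/p} · [W]_{A_{1,∞}^{sc}}^{1+1/p'} · ‖f‖_{L^p(ℝ^d;ℂⁿ)} ≤ c · [W]_{A₁}² · ‖f‖_{L^p(ℝ^d;ℂⁿ)}, where p' = p/(p−1) and c depends only on n, d, p and ‖Ω‖_{L^∞}. -/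

import Mathlib

open MeasureTheory ENNReal
open scoped ComplexOrder

noncomputable section

abbrev Rd (d : ℕ) := EuclideanSpace ℝ (Fin d)
abbrev Mat (n : ℕ) := Matrix (Fin n) (Fin n) ℂ
abbrev Vec (n : ℕ) := EuclideanSpace ℂ (Fin n)

/-- A cube in `ℝ^d` with sides parallel to the coordinate axes, given by its
lower-left corner and (positive) side length. -/
structure Cube (d : ℕ) where
  corner : Rd d
  side : ℝ
  side_pos : 0 < side

namespace Cube

/-- The underlying set of the cube. -/
def set {d : ℕ} (Q : Cube d) : Set (Rd d) :=
  {x | ∀ i, Q.corner i ≤ x i ∧ x i ≤ Q.corner i + Q.side}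

/-- The concentric triple `3Q` of a cube. -/
def triple {d : ℕ} (Q : Cube d) : Set (Rd d) :=
  {x | ∀ i, Q.corner i - Q.side ≤ x i ∧ x i ≤ Q.corner i + 2 * Q.side}

end Cube

/-- Operator norm of an `n × n` complex matrix acting on `ℂⁿ` with the Euclidean norm. -/
def opNorm {n : ℕ} (A : Mat n) : ℝ := ‖Matrix.toEuclideanCLM (𝕜 := ℂ) (n := Fin n) A‖

/-- A matrix acting on a Euclidean vector. -/
def mvec {n : ℕ} (A : Mat n) (v : Vec n) : Vec n := Matrix.toEuclideanLin A v

/-- Fractional power of a Hermitian matrix via the spectral calculus (junk value `1`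
for non-Hermitian matrices). -/
def matPow {n : ℕ} (A : Mat n) (s : ℝ) : Mat n :=
  if h : A.IsHermitian then
    (h.eigenvectorUnitary : Mat n) *
      Matrix.diagonal (fun i => ((h.eigenvalues i ^ s : ℝ) : ℂ)) *
      star (h.eigenvectorUnitary : Mat n)
  else 1

/-- A matrix weight: measurable, positive definite (hence Hermitian) a.e. -/
def IsMatrixWeight {d n : ℕ} (W : Rd d → Mat n) : Prop :=
  (∀ i j, Measurable fun x => W x i j) ∧ ∀ᵐ x : Rd d, (W x).PosDef


/-- Componentwise measurability of a `ℂⁿ`-valued function. -/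
def MeasurableV {d n : ℕ} (f : Rd d → Vec n) : Prop := ∀ i, Measurable fun x => f x i
/-- The matrix `A₁` characteristic of `W`. -/
def A1Const {d n : ℕ} (W : Rd d → Mat n) : ℝ≥0∞ :=
  ⨆ Q : Cube d,
    essSup (fun y => (volume Q.set)⁻¹ *
      ∫⁻ x in Q.set, ENNReal.ofReal (opNorm (W x * (W y)⁻¹))) (volume.restrict Q.set)

/-- The matrix `A_q` characteristic of `W`, `1 < q < ∞`. -/
def AqConst {d n : ℕ} (W : Rd d → Mat n) (q : ℝ) : ℝ≥0∞ :=
  ⨆ Q : Cube d, (volume Q.set)⁻¹ * ∫⁻ x in Q.set,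
    ((volume Q.set)⁻¹ * ∫⁻ y in Q.set,
        ENNReal.ofReal (opNorm (matPow (W x) (1/q) * matPow (W y) (-(1/q)))) ^ (q/(q-1))) ^ (q-1)

/-- Hardy–Littlewood maximal operator (over cubes) of an `ℝ≥0∞`-valued function. -/
def HLM {d : ℕ} (g : Rd d → ℝ≥0∞) (x : Rd d) : ℝ≥0∞ :=
  ⨆ (Q : Cube d) (_ : x ∈ Q.set), (volume Q.set)⁻¹ * ∫⁻ y in Q.set, g y

/-- The Fujii–Wilson `A∞` characteristic of a scalar weight `w`. -/
def AInftyConst {d : ℕ} (w : Rd d → ℝ≥0∞) : ℝ≥0∞ :=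
  ⨆ Q : Cube d, (∫⁻ x in Q.set, w x)⁻¹ * ∫⁻ x in Q.set, HLM (Q.set.indicator w) x

/-- The scalar `A_{q,∞}` characteristic of a matrix weight `W`. -/
def AqScConst {d n : ℕ} (W : Rd d → Mat n) (q : ℝ) : ℝ≥0∞ :=
  ⨆ e : Vec n, AInftyConst (fun x => (‖mvec (matPow (W x) (1/q)) e‖₊ : ℝ≥0∞) ^ q)

/-- `L^p` norm of an `ℝ≥0∞`-valued function. -/
def lpNormE {d : ℕ} (p : ℝ) (g : Rd d → ℝ≥0∞) : ℝ≥0∞ := (∫⁻ x, g x ^ p) ^ (1/p)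

/-- `L^p` norm of a `ℂⁿ`-valued function. -/
def lpNormV {d n : ℕ} (p : ℝ) (f : Rd d → Vec n) : ℝ≥0∞ :=
  (∫⁻ x, (‖f x‖₊ : ℝ≥0∞) ^ p) ^ (1/p)

/-- The weighted norm `‖f‖_{L^p(W)}`. -/
def lpWNorm {d n : ℕ} (p : ℝ) (W : Rd d → Mat n) (f : Rd d → Vec n) : ℝ≥0∞ :=
  (∫⁻ x, (‖mvec (matPow (W x) (1/p)) (f x)‖₊ : ℝ≥0∞) ^ p) ^ (1/p)


/-- The truncated rough singular integral `T_{Ω,δ}`, acting componentwise on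
`ℂⁿ`-valued functions. -/
def truncRough {d n : ℕ} (Ω : Rd d → ℂ) (δ : ℝ) (f : Rd d → Vec n) (x : Rd d) : Vec n :=
  ∫ y in {y : Rd d | δ < ‖x - y‖}, (Ω (x - y) * ((‖x - y‖ ^ (d : ℝ) : ℝ) : ℂ)⁻¹) • f y

/-- `Ω` is (the degree-zero homogeneous extension of) a bounded measurable function on the
unit sphere with vanishing mean, with `‖Ω‖_{L^∞(S^{d-1})} ≤ CΩ`.  The vanishing mean over
the sphere is expressed, equivalently, as vanishing integral over the annulus `1 < |x| < 2`. -/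
def IsRoughKernel {d : ℕ} (Ω : Rd d → ℂ) (CΩ : ℝ) : Prop :=
  Measurable Ω ∧ (∀ (r : ℝ) (x : Rd d), 0 < r → x ≠ 0 → Ω (r • x) = Ω x) ∧
  (∀ x : Rd d, x ≠ 0 → ‖Ω x‖ ≤ CΩ) ∧
  (∫ x in {x : Rd d | 1 < ‖x‖ ∧ ‖x‖ < 2}, Ω x) = 0

/-- The maximal weighted rough singular integral `T^*_{Ω,W,p}`. -/
def TstarRough {d n : ℕ} (Ω : Rd d → ℂ) (W : Rd d → Mat n) (p : ℝ)
    (f : Rd d → Vec n) (x : Rd d) : ℝ≥0∞ :=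
  ⨆ (δ : ℝ) (_ : 0 < δ),
    (‖mvec (matPow (W x) (1/p))
        (truncRough Ω δ (fun y => mvec (matPow (W y) (-(1/p))) (f y)) x)‖₊ : ℝ≥0∞)

namespace A1Rough

theorem eLpNorm_two_sq {α E : Type*} [MeasurableSpace α] [TopologicalSpace E] [ContinuousENorm E]
    (μ : Measure α) (h : α → E) : eLpNorm h 2 μ ^ 2 = ∫⁻ x, ‖h x‖ₑ ^ 2 ∂μ := by
  have := eLpNorm_nnreal_pow_eq_lintegral (p := 2) (f := h) (μ := μ) (by norm_num)
  simpa using this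

open FourierTransform in
theorem fourier_toLp_ae_eq {d : ℕ} {f : Rd d → ℂ} (hf1 : Integrable f) (hf2 : MemLp f 2) :
    ((𝓕 (hf2.toLp f) : Lp (α := Rd d) ℂ 2 volume) : Rd d → ℂ) =ᵐ[volume] 𝓕 f := by
  apply ae_eq_of_integral_contDiff_smul_eq
  · exact (Lp.memLp _).locallyIntegrable (by norm_num)
  · refine Continuous.locallyIntegrable ?_
    exact VectorFourier.fourierIntegral_continuous Real.continuous_fourierChar
      (by exact continuous_inner) hf1
  intro g hg hgc
  have hgs : HasCompactSupport (fun x => (g x : ℂ)) := hgc.comp_left Complex.ofReal_zero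
  have hgd : ContDiff ℝ (⊤ : ℕ∞) (fun x => (g x : ℂ)) := Complex.ofRealCLM.contDiff.comp hg
  set G : SchwartzMap (Rd d) ℂ := hgs.toSchwartzMap hgd with hG
  have hGg : ∀ x, G x = (g x : ℂ) := fun x => rfl
  have h1 := Lp.toTemperedDistribution_apply (𝓕 (hf2.toLp f) : Lp (α := Rd d) ℂ 2 volume) G
  have h2 := Lp.toTemperedDistribution_apply (hf2.toLp f) (𝓕 G)
  rw [← Lp.fourier_toTemperedDistribution_eq, TemperedDistribution.fourier_apply, h2] at h1
  have h3 : ∫ x, (𝓕 G) x • (hf2.toLp f) x = ∫ x, (𝓕 G) x • f x := by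
    apply integral_congr_ae
    filter_upwards [hf2.coeFn_toLp] with x hx
    rw [hx]
  have h4 : ∫ x, (𝓕 G) x • f x = ∫ x, G x • 𝓕 f x := by
    have := VectorFourier.integral_fourierIntegral_smul_eq_flip (μ := (volume : Measure (Rd d)))
      (ν := (volume : Measure (Rd d))) (L := innerₗ (Rd d)) (e := Real.fourierChar) (f := G) (g := f)
      Real.continuous_fourierChar (by exact continuous_inner) G.integrable hf1
    rw [flip_innerₗ] at this
    exact this
  rw [h3, h4] at h1
  simp only [hGg] at h1
  simpa using h1.symm

open FourierTransform in
theorem lintegral_fourier_sq {d : ℕ} {f : Rd d → ℂ} (hf1 : Integrable f) (hf2 : MemLp f 2) :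
    ∫⁻ ξ, ‖𝓕 f ξ‖ₑ ^ 2 = ∫⁻ x, ‖f x‖ₑ ^ 2 := by
  have h0 : eLpNorm (𝓕 f) 2 volume = eLpNorm f 2 volume := by
    rw [← eLpNorm_congr_ae (fourier_toLp_ae_eq hf1 hf2), ← Lp.enorm_def]
    have : ‖(𝓕 (hf2.toLp f) : Lp (α := Rd d) ℂ 2 volume)‖ₑ = ‖hf2.toLp f‖ₑ := by
      rw [← ofReal_norm, ← ofReal_norm, Lp.norm_fourier_eq]
    rw [this, Lp.enorm_toLp]
  rw [← eLpNorm_two_sq, ← eLpNorm_two_sq, h0]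


/-- Bounded measurable functions with bounded support. -/
def Nice {d : ℕ} (f : Rd d → ℂ) : Prop :=
  Measurable f ∧ (∃ M : ℝ, ∀ x, ‖f x‖ ≤ M) ∧ ∃ R : ℝ, ∀ x, R < ‖x‖ → f x = 0

/-- Convolution on `ℝ^d`. -/
def cv {d : ℕ} (k f : Rd d → ℂ) (x : Rd d) : ℂ := ∫ y, k (x - y) * f y

namespace Nice

variable {d : ℕ} {f g k : Rd d → ℂ}

theorem memLp (hf : Nice f) (p : ℝ≥0∞) : MemLp f p := by
  obtain ⟨hm, ⟨M, hM⟩, R, hR⟩ := hf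
  have h1 : f = (Metric.closedBall (0 : Rd d) R).indicator f := by
    ext x
    by_cases hx : x ∈ Metric.closedBall (0 : Rd d) R
    · simp [hx]
    · rw [Set.indicator_of_notMem hx]
      exact hR x (by simpa using hx)
  rw [h1, memLp_indicator_iff_restrict Metric.isClosed_closedBall.measurableSet]
  have : IsFiniteMeasure (volume.restrict (Metric.closedBall (0 : Rd d) R)) :=
    ⟨by simpa using measure_closedBall_lt_top⟩
  exact MemLp.of_bound hm.aestronglyMeasurable M (Filter.Eventually.of_forall hM)

theorem integrable (hf : Nice f) : Integrable f := memLp_one_iff_integrable.1 (hf.memLp 1)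

theorem add (hf : Nice f) (hg : Nice g) : Nice (fun x => f x + g x) := by
  obtain ⟨hm, ⟨M, hM⟩, R, hR⟩ := hf
  obtain ⟨hm', ⟨M', hM'⟩, R', hR'⟩ := hg
  refine ⟨hm.add hm', ⟨M + M', fun x => (norm_add_le _ _).trans (add_le_add (hM x) (hM' x))⟩,
    max R R', fun x hx => ?_⟩
  show f x + g x = 0; rw [hR x ((le_max_left _ _).trans_lt hx), hR' x ((le_max_right _ _).trans_lt hx), add_zero]

theorem const_mul (hf : Nice f) (c : ℂ) : Nice (fun x => c * f x) := by
  obtain ⟨hm, ⟨M, hM⟩, R, hR⟩ := hf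
  refine ⟨hm.const_mul c, ⟨‖c‖ * M, fun x => ?_⟩, R, fun x hx => by simp [hR x hx]⟩
  rw [norm_mul]
  exact mul_le_mul_of_nonneg_left (hM x) (norm_nonneg _)

theorem sub (hf : Nice f) (hg : Nice g) : Nice (fun x => f x - g x) := by
  have := hf.add (hg.const_mul (-1))
  simpa [sub_eq_add_neg] using this

theorem zero : Nice (fun _ : Rd d => (0 : ℂ)) :=
  ⟨measurable_const, ⟨0, by simp⟩, 0, by simp⟩

theorem sum {ι : Type*} (s : Finset ι) {F : ι → Rd d → ℂ} (h : ∀ i ∈ s, Nice (F i)) :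
    Nice (fun x => ∑ i ∈ s, F i x) := by
  classical
  induction s using Finset.induction_on with
  | empty => simpa using zero
  | insert a s ha ih =>
    simp only [Finset.sum_insert ha]
    exact (h a (by simp)).add (ih fun i hi => h i (by simp [hi]))

theorem of_le (hf : Nice f) (hg : Measurable g) (h : ∀ x, ‖g x‖ ≤ ‖f x‖) : Nice g := by
  obtain ⟨hm, ⟨M, hM⟩, R, hR⟩ := hf
  refine ⟨hg, ⟨M, fun x => (h x).trans (hM x)⟩, R, fun x hx => ?_⟩
  have := h x
  rw [hR x hx, norm_zero] at this
  exact norm_le_zero_iff.1 this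

theorem indicator (hf : Nice f) {s : Set (Rd d)} (hs : MeasurableSet s) :
    Nice (s.indicator f) :=
  hf.of_le (hf.1.indicator hs) fun x => norm_indicator_le_norm_self f x

theorem conj (hf : Nice f) : Nice (fun x => (starRingEnd ℂ) (f x)) :=
  hf.of_le (Complex.continuous_conj.measurable.comp hf.1) fun x => by simp

theorem shift (hf : Nice f) (u : Rd d) : Nice (fun x => f (x + u)) := by
  obtain ⟨hm, ⟨M, hM⟩, R, hR⟩ := hf
  refine ⟨hm.comp (measurable_add_const u), ⟨M, fun x => hM _⟩, R + ‖u‖, fun x hx => hR _ ?_⟩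
  have := norm_sub_le (x + u) u
  simp at this
  linarith

theorem int_cv (hk : Nice k) (hf : Nice f) (x : Rd d) : Integrable (fun y => k (x - y) * f y) := by
  obtain ⟨hm, ⟨M, hM⟩, R, hR⟩ := hk
  exact hf.integrable.bdd_mul (c := M) (hm.comp (measurable_const.sub measurable_id)).aestronglyMeasurable
    (Filter.Eventually.of_forall fun y => hM _)

theorem measurable_kernel (hk : Nice k) (hf : Nice f) :
    Measurable (fun z : Rd d × Rd d => k (z.1 - z.2) * f z.2) :=
  (hk.1.comp (measurable_fst.sub measurable_snd)).mul (hf.1.comp measurable_snd)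

theorem cv (hk : Nice k) (hf : Nice f) : Nice (cv k f) := by
  have hI := hf.integrable
  have hmm := (measurable_kernel hk hf).stronglyMeasurable
  obtain ⟨hm, ⟨M, hM⟩, R, hR⟩ := hk
  obtain ⟨hm', ⟨M', hM'⟩, R', hR'⟩ := hf
  refine ⟨(hmm.integral_prod_right').measurable, ⟨∫ y, M * ‖f y‖, fun x => ?_⟩,
    R + R', fun x hx => ?_⟩
  · refine norm_integral_le_of_norm_le (hI.norm.const_mul M) (Filter.Eventually.of_forall fun y => ?_)
    rw [norm_mul]
    exact mul_le_mul_of_nonneg_right (hM _) (norm_nonneg _)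
  · unfold A1Rough.cv
    rw [integral_eq_zero_of_ae]
    refine Filter.Eventually.of_forall fun y => ?_
    simp only [Pi.zero_apply, mul_eq_zero]
    by_cases hy : R' < ‖y‖
    · exact Or.inr (hR' y hy)
    · left
      apply hR
      have := norm_sub_norm_le x y
      linarith

end Nice

section cvlemmas

variable {d : ℕ} {f g k : Rd d → ℂ}

theorem cv_add (hk : Nice k) (hf : Nice f) (hg : Nice g) (x : Rd d) :
    cv k (fun y => f y + g y) x = cv k f x + cv k g x := by
  unfold cv
  simp only [mul_add]
  exact integral_add (hk.int_cv hf x) (hk.int_cv hg x)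

theorem cv_sum {ι : Type*} (s : Finset ι) {F : ι → Rd d → ℂ} (hk : Nice k)
    (h : ∀ i ∈ s, Nice (F i)) (x : Rd d) :
    cv k (fun y => ∑ i ∈ s, F i y) x = ∑ i ∈ s, cv k (F i) x := by
  unfold cv
  simp only [Finset.mul_sum]
  exact integral_finsetSum s fun i hi => hk.int_cv (h i hi) x

theorem cv_transpose (hk : Nice k) (hf : Nice f) (hg : Nice g) :
    ∫ x, cv k f x * g x = ∫ x, f x * cv (fun z => k (-z)) g x := by
  unfold cv
  simp only [← integral_mul_const, ← integral_const_mul]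
  rw [integral_integral_swap]
  · congr 1; ext y; congr 1; ext x
    rw [neg_sub]; ring
  · obtain ⟨hm, ⟨M, hM⟩, R, hR⟩ := hk
    have h1 : Integrable (fun z : Rd d × Rd d => g z.1 * f z.2) (volume.prod volume) :=
      hg.integrable.mul_prod hf.integrable
    have h2 := h1.bdd_mul (c := M) (f := fun z : Rd d × Rd d => k (z.1 - z.2))
      (hm.comp (measurable_fst.sub measurable_snd)).aestronglyMeasurable
      (Filter.Eventually.of_forall fun y => hM _)
    refine h2.congr (Filter.Eventually.of_forall fun z => ?_)
    simp [Function.uncurry]; ring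

open FourierTransform in
theorem fourier_cv (hk : Nice k) (hf : Nice f) (ξ : Rd d) :
    𝓕 (cv k f) ξ = 𝓕 k ξ * 𝓕 f ξ := by
  have h := Real.fourier_mul_convolution_eq hf.integrable hk.integrable ξ
  rw [mul_comm, ← h]
  have : cv k f = convolution f k (ContinuousLinearMap.mul ℂ ℂ) volume := by
    ext x
    simp only [cv, convolution_def, ContinuousLinearMap.mul_apply']
    congr 1; ext y; ring
  rw [this]

open FourierTransform in
theorem fourier_sub (hf : Nice f) (hg : Nice g) (ξ : Rd d) :
    𝓕 (fun x => f x - g x) ξ = 𝓕 f ξ - 𝓕 g ξ := by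
  simp only [Real.fourier_eq, smul_sub]
  exact integral_sub ((Real.fourierIntegral_convergent_iff ξ).2 hf.integrable)
    ((Real.fourierIntegral_convergent_iff ξ).2 hg.integrable)

open FourierTransform in
theorem fourier_sum {ι : Type*} (s : Finset ι) {F : ι → Rd d → ℂ}
    (h : ∀ i ∈ s, Nice (F i)) (ξ : Rd d) :
    𝓕 (fun x => ∑ i ∈ s, F i x) ξ = ∑ i ∈ s, 𝓕 (F i) ξ := by
  simp only [Real.fourier_eq, Finset.smul_sum]
  exact integral_finsetSum s fun i hi =>
    (Real.fourierIntegral_convergent_iff ξ).2 (h i hi).integrable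

open FourierTransform in
theorem fourier_shift (f : Rd d → ℂ) (u ξ : Rd d) :
    𝓕 (fun x => f (x + u)) ξ = (Real.fourierChar (inner ℝ u ξ) : ℂ) * 𝓕 f ξ := by
  have := congrFun (VectorFourier.fourierIntegral_comp_add_right Real.fourierChar
    (volume : Measure (Rd d)) (innerₗ (Rd d)) f u) ξ
  rw [Circle.smul_def, smul_eq_mul] at this
  exact this

open FourierTransform in
theorem continuous_fourier_nice (hf : Nice f) : Continuous (𝓕 f) :=
  VectorFourier.fourierIntegral_continuous Real.continuous_fourierChar
      (by exact continuous_inner) hf.integrable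

open FourierTransform in
theorem plancherel (hf : Nice f) : ∫⁻ ξ, ‖𝓕 f ξ‖ₑ ^ 2 = ∫⁻ x, ‖f x‖ₑ ^ 2 :=
  lintegral_fourier_sq hf.integrable (hf.memLp 2)

end cvlemmas

end A1Rough

namespace A1Rough

theorem integral_homogeneous_mul_radial {d : ℕ} (hd : 1 ≤ d) {Ω : Rd d → ℂ}
    (hΩ : ∀ (r : ℝ) (x : Rd d), 0 < r → x ≠ 0 → Ω (r • x) = Ω x) (h : ℝ → ℂ) :
    ∫ x, Ω x * h ‖x‖ = (∫ x : Metric.sphere (0 : Rd d) 1, Ω x ∂(volume : Measure (Rd d)).toSphere) *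
      ∫ r : Set.Ioi (0 : ℝ), h r ∂(Measure.volumeIoiPow (Module.finrank ℝ (Rd d) - 1)) := by
  have : Nonempty (Fin d) := ⟨⟨0, hd⟩⟩
  rw [← integral_prod_mul (fun x : Metric.sphere (0 : Rd d) 1 => Ω x) (fun r : Set.Ioi (0 : ℝ) => h r)]
  rw [← (volume : Measure (Rd d)).measurePreserving_homeomorphUnitSphereProd.integral_comp
    (Homeomorph.measurableEmbedding _)]
  have h1 : ∫ x, Ω x * h ‖x‖ = ∫ x in ({0}ᶜ : Set (Rd d)), Ω x * h ‖x‖ := by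
    rw [restrict_compl_singleton]
  rw [h1, ← integral_subtype_comap (measurableSet_singleton _).compl (fun x => Ω x * h ‖x‖)]
  congr 1; ext x
  have hx : (x : Rd d) ≠ 0 := x.2
  have h2 : ((homeomorphUnitSphereProd (Rd d) x).2 : ℝ) = ‖(x : Rd d)‖ := by simp
  have h3 : (((homeomorphUnitSphereProd (Rd d) x).1 : Metric.sphere (0 : Rd d) 1) : Rd d)
    = ‖(x : Rd d)‖⁻¹ • (x : Rd d) := by simp
  rw [h2, h3, hΩ _ _ (inv_pos.2 (norm_pos_iff.2 hx)) hx]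

theorem integral_radial_eq_zero {d : ℕ} (hd : 1 ≤ d) {Ω : Rd d → ℂ} {CΩ : ℝ}
    (hΩ : IsRoughKernel Ω CΩ) (h : ℝ → ℂ) :
    ∫ x, Ω x * h ‖x‖ = 0 := by
  have : Nonempty (Fin d) := ⟨⟨0, hd⟩⟩
  obtain ⟨hm, hh, hb, h0⟩ := hΩ
  set h1 : ℝ → ℂ := Set.indicator (Set.Ioo 1 2) 1 with hh1
  have hA : MeasurableSet {x : Rd d | 1 < ‖x‖ ∧ ‖x‖ < 2} :=
    (measurableSet_lt measurable_const measurable_norm).inter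
      (measurableSet_lt measurable_norm measurable_const)
  have key : ∀ F : Rd d → ℂ, ∫ x, F x * h1 ‖x‖ = ∫ x in {x : Rd d | 1 < ‖x‖ ∧ ‖x‖ < 2}, F x := by
    intro F
    rw [← integral_indicator hA]
    congr 1; ext x
    by_cases hx : 1 < ‖x‖ ∧ ‖x‖ < 2
    · simp [hh1, Set.indicator, hx]
    · simp [hh1, Set.indicator, hx]
  have e1 := integral_homogeneous_mul_radial hd hh h1
  have e2 := integral_homogeneous_mul_radial hd (Ω := fun _ => 1) (by simp) h1
  have e3 := integral_homogeneous_mul_radial hd hh h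
  rw [key, h0] at e1
  rw [key] at e2
  have hpos : (∫ x in {x : Rd d | 1 < ‖x‖ ∧ ‖x‖ < 2}, (1 : ℂ)) ≠ 0 := by
    rw [setIntegral_const]
    simp only [mul_one, Complex.real_smul, ne_eq, Complex.ofReal_eq_zero]
    have hopen : IsOpen {x : Rd d | 1 < ‖x‖ ∧ ‖x‖ < 2} :=
      (isOpen_lt continuous_const continuous_norm).inter (isOpen_lt continuous_norm continuous_const)
    have hne : {x : Rd d | 1 < ‖x‖ ∧ ‖x‖ < 2}.Nonempty := by
      refine ⟨EuclideanSpace.single ⟨0, hd⟩ (3/2 : ℝ), ?_⟩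
      simp; norm_num
    have hfin : volume {x : Rd d | 1 < ‖x‖ ∧ ‖x‖ < 2} ≠ ⊤ := by
      refine ((measure_mono (fun x hx => ?_)).trans_lt (measure_ball_lt_top (x := (0 : Rd d)) (r := 2))).ne
      simpa using hx.2
    exact (ENNReal.toReal_pos (hopen.measure_pos volume hne).ne' hfin).ne'
  have hr : (∫ r : Set.Ioi (0 : ℝ), h1 r ∂(Measure.volumeIoiPow (Module.finrank ℝ (Rd d) - 1))) ≠ 0 := by
    intro h; rw [h, mul_zero] at e2; exact hpos e2
  rw [e3]
  rcases mul_eq_zero.1 e1.symm with h | h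
  · rw [h, zero_mul]
  · exact absurd h hr

/-- The dyadic pieces of a rough kernel. -/
def ker {d : ℕ} (Ω : Rd d → ℂ) (j : ℤ) (x : Rd d) : ℂ :=
  if (2 : ℝ) ^ j < ‖x‖ ∧ ‖x‖ ≤ (2 : ℝ) ^ (j + 1) then Ω x * (((‖x‖ ^ d)⁻¹ : ℝ) : ℂ) else 0

/-- Bounded homogeneous functions of degree zero, without cancellation. -/
def Homog {d : ℕ} (Ω : Rd d → ℂ) (C : ℝ) : Prop :=
  0 ≤ C ∧ Measurable Ω ∧ (∀ (r : ℝ) (x : Rd d), 0 < r → x ≠ 0 → Ω (r • x) = Ω x) ∧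
    ∀ x : Rd d, x ≠ 0 → ‖Ω x‖ ≤ C

variable {d : ℕ} {Ω : Rd d → ℂ} {C : ℝ}

theorem measurable_ker (hΩ : Homog Ω C) (j : ℤ) : Measurable (ker Ω j) := by
  refine Measurable.ite ?_ (hΩ.2.1.mul ?_) measurable_const
  · exact (measurableSet_lt measurable_const measurable_norm).inter
      (measurableSet_le measurable_norm measurable_const)
  · exact Complex.measurable_ofReal.comp (measurable_norm.pow_const d).inv

theorem norm_ker_le (hΩ : Homog Ω C) (j : ℤ) (x : Rd d) :
    ‖ker Ω j x‖ ≤ C * (((2 : ℝ) ^ j) ^ d)⁻¹ := by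
  unfold ker
  have hC := hΩ.1
  split_ifs with h
  · have h2 : (0 : ℝ) < 2 ^ j := by positivity
    have hx : x ≠ 0 := norm_pos_iff.1 (h2.trans h.1)
    rw [norm_mul]
    refine mul_le_mul (hΩ.2.2.2 x hx) ?_ (norm_nonneg _) hC
    rw [Complex.norm_real, Real.norm_eq_abs, abs_of_nonneg (by positivity)]
    gcongr
    exact h.1.le
  · simp; positivity

theorem ker_eq_zero {j : ℤ} {x : Rd d} (hx : (2 : ℝ) ^ (j + 1) < ‖x‖) : ker Ω j x = 0 := by
  unfold ker
  rw [if_neg]; intro h; linarith [h.2]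

theorem nice_ker (hΩ : Homog Ω C) (j : ℤ) : Nice (ker Ω j) :=
  ⟨measurable_ker hΩ j, ⟨_, norm_ker_le hΩ j⟩, _, fun _ hx => ker_eq_zero hx⟩

theorem ker_scale (hΩ : Homog Ω C) (j : ℤ) (x : Rd d) :
    ker Ω j ((2 : ℝ) ^ j • x) = ((((2 : ℝ) ^ j) ^ d)⁻¹ : ℝ) * ker Ω 0 x := by
  have h2 : (0 : ℝ) < 2 ^ j := by positivity
  unfold ker
  rw [norm_smul, Real.norm_of_nonneg h2.le, zpow_add₀ (by norm_num : (2:ℝ) ≠ 0)]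
  have e1 : (2 : ℝ) ^ j < 2 ^ j * ‖x‖ ↔ 1 < ‖x‖ := by
    constructor <;> intro h <;> nlinarith
  have e2 : (2 : ℝ) ^ j * ‖x‖ ≤ 2 ^ j * 2 ↔ ‖x‖ ≤ 2 := by
    rw [mul_le_mul_iff_right₀ h2]
  simp only [zpow_zero, zero_add, zpow_one, e1, e2]
  split_ifs with h
  · have hx : x ≠ 0 := norm_pos_iff.1 (zero_lt_one.trans h.1)
    rw [hΩ.2.2.1 _ _ h2 hx, mul_pow, mul_inv]
    push_cast; ring
  · simp

theorem norm_ker_mul_integral_le (hΩ : Homog Ω C) (j : ℤ) :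
    ∫⁻ x, ‖ker Ω j x‖ₑ ≤ ENNReal.ofReal (C * 2 ^ d) * volume (Metric.closedBall (0 : Rd d) 1) := by
  have h2 : (0 : ℝ) < 2 ^ j := by positivity
  have h21 : (0 : ℝ) < 2 ^ (j + 1) := by positivity
  have hC := hΩ.1
  calc ∫⁻ x, ‖ker Ω j x‖ₑ ≤ ∫⁻ x, (Metric.closedBall (0 : Rd d) (2 ^ (j + 1))).indicator
        (fun _ => ENNReal.ofReal (C * (((2 : ℝ) ^ j) ^ d)⁻¹)) x := by
        refine lintegral_mono fun x => ?_
        by_cases hx : x ∈ Metric.closedBall (0 : Rd d) (2 ^ (j + 1))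
        · rw [Set.indicator_of_mem hx, ← ofReal_norm]
          exact ENNReal.ofReal_le_ofReal (norm_ker_le hΩ j x)
        · rw [ker_eq_zero (by simpa using hx)]; simp
    _ = _ := by
        rw [lintegral_indicator Metric.isClosed_closedBall.measurableSet, setLIntegral_const,
          Measure.addHaar_closedBall' _ _ h21.le, ← mul_assoc, ← ENNReal.ofReal_mul (by positivity)]
        congr 2
        rw [finrank_euclideanSpace_fin, zpow_add₀ (by norm_num : (2:ℝ) ≠ 0), zpow_one, mul_pow]
        field_simp

open FourierTransform in
theorem fourier_ker_scale (hΩ : Homog Ω C) (j : ℤ) (ξ : Rd d) :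
    𝓕 (ker Ω j) ξ = 𝓕 (ker Ω 0) ((2 : ℝ) ^ j • ξ) := by
  have h2 : (0 : ℝ) < 2 ^ j := by positivity
  simp only [Real.fourier_eq]
  have := Measure.integral_comp_smul (volume : Measure (Rd d))
    (fun v => (Real.fourierChar (-inner ℝ v ξ)) • ker Ω j v) ((2 : ℝ) ^ j)
  rw [finrank_euclideanSpace_fin, abs_of_pos (by positivity)] at this
  have h3 : (∫ v, (Real.fourierChar (-inner ℝ v ξ)) • ker Ω j v) = ((((2 : ℝ) ^ j) ^ d : ℝ) : ℂ) *
      ∫ x, (Real.fourierChar (-inner ℝ ((2 : ℝ) ^ j • x) ξ)) • ker Ω j ((2 : ℝ) ^ j • x) := by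
    rw [this, Complex.real_smul, ← mul_assoc, ← Complex.ofReal_mul, mul_inv_cancel₀ (by positivity)]
    simp
  rw [h3, ← integral_const_mul]
  congr 1; ext x
  rw [ker_scale hΩ, real_inner_smul_left, real_inner_smul_right]
  simp only [Circle.smul_def, smul_eq_mul]
  rw [mul_left_comm, ← mul_assoc (_ : ℂ) _ (ker Ω 0 x), ← Complex.ofReal_mul, mul_inv_cancel₀ (by positivity)]
  simp

end A1Rough

namespace A1Rough

variable {d : ℕ} {Ω : Rd d → ℂ} {C : ℝ}

theorem norm_fourierChar_sub_one_le (t : ℝ) : ‖(Real.fourierChar t : ℂ) - 1‖ ≤ 2 * Real.pi * |t| := by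
  have := Real.norm_exp_I_mul_ofReal_sub_one_le (x := 2 * Real.pi * t)
  rw [Real.fourierChar_apply, mul_comm _ Complex.I]
  refine this.trans ?_
  rw [Real.norm_eq_abs, abs_mul, abs_of_pos (by positivity)]

theorem integral_ker_eq_zero (hd : 1 ≤ d) {CΩ : ℝ} (hΩ : IsRoughKernel Ω CΩ) :
    ∫ x, ker Ω 0 x = 0 := by
  have := integral_radial_eq_zero hd hΩ (fun r => if 1 < r ∧ r ≤ 2 then (((r ^ d)⁻¹ : ℝ) : ℂ) else 0)
  rw [← this]
  congr 1; ext x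
  unfold ker
  simp

open FourierTransform in
theorem norm_fourier_le (k : Rd d → ℂ) (ξ : Rd d) : ‖𝓕 k ξ‖ ≤ ∫ x, ‖k x‖ := by
  rw [Real.fourier_eq]
  refine (norm_integral_le_integral_norm _).trans_eq ?_
  congr 1; ext x; simp

open FourierTransform in
theorem norm_fourier_sub_integral_le {k : Rd d → ℂ} (hk : Nice k) {R : ℝ}
    (hR : ∀ x, R < ‖x‖ → k x = 0) (ξ : Rd d) :
    ‖𝓕 k ξ - ∫ x, k x‖ ≤ 2 * Real.pi * R * ‖ξ‖ * ∫ x, ‖k x‖ := by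
  rw [Real.fourier_eq, ← integral_sub ((Real.fourierIntegral_convergent_iff ξ).2 hk.integrable)
    hk.integrable, ← integral_const_mul]
  refine norm_integral_le_of_norm_le (hk.integrable.norm.const_mul _)
    (Filter.Eventually.of_forall fun x => ?_)
  by_cases hx : R < ‖x‖
  · simp [hR x hx]
  · push Not at hx
    have e : (Real.fourierChar (-inner ℝ x ξ)) • k x - k x
        = ((Real.fourierChar (-inner ℝ x ξ) : ℂ) - 1) * k x := by
      rw [Circle.smul_def, smul_eq_mul]; ring
    rw [e, norm_mul]
    refine mul_le_mul_of_nonneg_right ((norm_fourierChar_sub_one_le _).trans ?_) (norm_nonneg _)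
    rw [abs_neg, mul_assoc (2 * Real.pi)]
    gcongr
    exact (abs_real_inner_le_norm x ξ).trans (mul_le_mul_of_nonneg_right hx (norm_nonneg _))

theorem integral_norm_ker_le (hΩ : Homog Ω C) (j : ℤ) :
    ∫ x, ‖ker Ω j x‖ ≤ C * 2 ^ d * (volume (Metric.closedBall (0 : Rd d) 1)).toReal := by
  rw [integral_norm_eq_lintegral_enorm (nice_ker hΩ j).integrable.aestronglyMeasurable]
  have hC := hΩ.1
  refine (ENNReal.toReal_mono ?_ (norm_ker_mul_integral_le hΩ j)).trans_eq ?_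
  · exact ENNReal.mul_ne_top ENNReal.ofReal_ne_top measure_closedBall_lt_top.ne
  · rw [ENNReal.toReal_mul, ENNReal.toReal_ofReal (by positivity)]

/-- A slab inside a ball has measure proportional to its width. -/
theorem slab_le {e : Rd d} (he : ‖e‖ = 1) {τ : ℝ} (h0 : 0 < τ) (h1 : τ ≤ 1) :
    volume {y : Rd d | ‖y‖ ≤ 2 ∧ |inner ℝ y e| ≤ τ} ≤
      ENNReal.ofReal τ * volume (Metric.closedBall (0 : Rd d) 8) := by
  set S := {y : Rd d | ‖y‖ ≤ 2 ∧ |inner ℝ y e| ≤ τ} with hS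
  have hSm : MeasurableSet S := by
    have h1 : Continuous fun y : Rd d => |inner ℝ y e| := by fun_prop
    exact (measurableSet_le measurable_norm measurable_const).inter
      (measurableSet_le h1.measurable measurable_const)
  set N := ⌈1 / τ⌉₊ with hN
  have hN1 : (1 / τ : ℝ) ≤ N := Nat.le_ceil _
  have hN2 : (N : ℝ) < 1 / τ + 1 := Nat.ceil_lt_add_one (by positivity)
  set T : Fin N → Set (Rd d) := fun k => (fun y => y + (-(3 * τ * (k : ℕ)) • e)) ⁻¹' S with hT
  have hvol : ∀ k, volume (T k) = volume S := fun k => measure_preimage_add_right _ _ _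
  have hmeas : ∀ k, MeasurableSet (T k) := fun k => hSm.preimage (measurable_add_const _)
  have hinner : ∀ (k : Fin N) y, y ∈ T k → |inner ℝ y e - 3 * τ * (k : ℕ)| ≤ τ := by
    intro k y hy
    have := hy.2
    rw [inner_add_left, real_inner_smul_left, real_inner_self_eq_norm_sq, he] at this
    convert this using 2; ring
  have hdisj : Pairwise (Function.onFun Disjoint T) := by
    intro k l hkl
    rw [Function.onFun, Set.disjoint_left]
    intro y hk hl
    have a1 := abs_le.1 (hinner k y hk)
    have a2 := abs_le.1 (hinner l y hl)
    have hne : (k : ℕ) ≠ l := fun h => hkl (Fin.ext h)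
    rcases Nat.lt_or_gt_of_ne hne with h | h
    · have : ((k : ℕ) : ℝ) + 1 ≤ (l : ℕ) := by exact_mod_cast h
      nlinarith
    · have : ((l : ℕ) : ℝ) + 1 ≤ (k : ℕ) := by exact_mod_cast h
      nlinarith
  have hsub : (⋃ k, T k) ⊆ Metric.closedBall (0 : Rd d) 8 := by
    intro y hy
    obtain ⟨k, hk⟩ := Set.mem_iUnion.1 hy
    have hk1 : ‖y + (-(3 * τ * (k : ℕ)) • e)‖ ≤ 2 := hk.1
    have hkN : ((k : ℕ) : ℝ) ≤ N := by exact_mod_cast k.2.le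
    have h3 : 3 * τ * (k : ℕ) ≤ 6 := by
      have : τ * (1 / τ) = 1 := by field_simp
      nlinarith
    have h4 : ‖(3 * τ * (k : ℕ)) • e‖ ≤ 6 := by
      rw [norm_smul, he, mul_one, Real.norm_of_nonneg (by positivity)]; exact h3
    have h5 : ‖y‖ ≤ ‖y + (-(3 * τ * (k : ℕ)) • e)‖ + ‖(3 * τ * (k : ℕ)) • e‖ := by
      have := norm_add_le (y + (-(3 * τ * (k : ℕ)) • e)) ((3 * τ * (k : ℕ)) • e)
      simpa using this
    simp only [Metric.mem_closedBall, dist_zero_right]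
    linarith
  have hsum : (N : ℝ≥0∞) * volume S ≤ volume (Metric.closedBall (0 : Rd d) 8) := by
    refine le_trans (le_of_eq ?_) (measure_mono hsub)
    rw [measure_iUnion hdisj hmeas]
    simp [hvol]
  calc volume S ≤ ENNReal.ofReal τ * (N * volume S) := by
        rw [← mul_assoc]
        refine le_mul_of_one_le_left zero_le ?_
        rw [← ENNReal.ofReal_natCast, ← ENNReal.ofReal_mul h0.le, ← ENNReal.ofReal_one]
        apply ENNReal.ofReal_le_ofReal
        have : τ * (1 / τ) = 1 := by field_simp
        nlinarith
    _ ≤ _ := by gcongr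

theorem norm_setIntegral_fourierChar_le {r s : ℝ} (hr : 0 < r) (hs : s ≠ 0) :
    ‖∫ t in Set.Ioc (1 : ℝ) 2, (if 1 < t * r ∧ t * r ≤ 2 then (Real.fourierChar (-(t * s)) : ℂ) else 0)‖
      ≤ min 1 (1 / |s|) := by
  set a := max 1 r⁻¹
  set b := min 2 (2 * r⁻¹)
  have hset : ∀ t : ℝ, (t ∈ Set.Ioc (1:ℝ) 2 ∧ (1 < t * r ∧ t * r ≤ 2)) ↔ t ∈ Set.Ioc a b := by
    intro t
    simp only [Set.mem_Ioc, a, b, max_lt_iff, le_min_iff, inv_lt_iff_one_lt_mul₀ hr,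
      ← div_eq_mul_inv, le_div_iff₀ hr]
    tauto
  have h1 : ∫ t in Set.Ioc (1 : ℝ) 2, (if 1 < t * r ∧ t * r ≤ 2 then (Real.fourierChar (-(t * s)) : ℂ) else 0)
      = ∫ t in Set.Ioc a b, (Real.fourierChar (-(t * s)) : ℂ) := by
    rw [← integral_indicator measurableSet_Ioc, ← integral_indicator measurableSet_Ioc]
    congr 1; ext t
    simp only [Set.indicator_apply, ← hset t, ite_and]
  rw [h1]
  rcases lt_or_ge b a with hab | hab
  · rw [Set.Ioc_eq_empty (not_lt.2 hab.le)]; simp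
  have ha1 : 1 ≤ a := le_max_left _ _
  have hb2 : b ≤ 2 := min_le_left _ _
  rw [← intervalIntegral.integral_of_le hab]
  refine le_min ?_ ?_
  · refine (intervalIntegral.norm_integral_le_of_norm_le_const (C := 1) ?_).trans ?_
    · intro x _; exact (Circle.norm_coe _).le
    · rw [one_mul, abs_of_nonneg (by linarith)]; linarith
  · have hc : (-(2 * Real.pi * s : ℝ) * Complex.I : ℂ) ≠ 0 := by
      simp [hs, Real.pi_ne_zero]
    have h2 : ∀ t : ℝ, (Real.fourierChar (-(t * s)) : ℂ) = Complex.exp ((-(2 * Real.pi * s : ℝ) * Complex.I : ℂ) * t) := by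
      intro t
      rw [Real.fourierChar_apply]
      congr 1; push_cast; ring
    simp only [h2]
    rw [integral_exp_mul_complex hc]
    simp only [← h2]
    rw [norm_div, div_le_div_iff₀ (norm_pos_iff.2 hc) (abs_pos.2 hs)]
    have h3 : ‖(-(2 * Real.pi * s : ℝ) * Complex.I : ℂ)‖ = 2 * Real.pi * |s| := by
      rw [norm_mul, Complex.norm_I, mul_one, norm_neg, Complex.norm_real, Real.norm_eq_abs, abs_mul,
        abs_of_pos (by positivity)]
    rw [h3]
    have h4 : ‖(Real.fourierChar (-(b * s)) : ℂ) - (Real.fourierChar (-(a * s)) : ℂ)‖ ≤ 2 := by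
      refine (norm_sub_le _ _).trans ?_
      rw [Circle.norm_coe, Circle.norm_coe]; norm_num
    have := Real.pi_gt_three
    nlinarith [abs_pos.2 hs]

end A1Rough

namespace A1Rough

variable {d : ℕ} {Ω : Rd d → ℂ} {C : ℝ}

open FourierTransform in
theorem fourier_ker_zero_decay (hΩ : Homog Ω C) {ξ : Rd d} (hξ : 1 ≤ ‖ξ‖) {τ : ℝ} (hτ : 0 < τ)
    (hτξ : τ ^ 2 * ‖ξ‖ = 1) :
    ‖𝓕 (ker Ω 0) ξ‖ ≤ C * 2 ^ d * (2 * (volume (Metric.closedBall (0 : Rd d) 8)).toReal) * τ := by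
  have hC := hΩ.1
  have hτ1 : τ ≤ 1 := by nlinarith
  set k0 : Rd d → ℂ := fun y =>
    if 1 / 2 < ‖y‖ ∧ ‖y‖ ≤ 2 then Ω y * (((‖y‖ ^ d)⁻¹ : ℝ) : ℂ) else 0 with hk0
  have hk0m : Measurable k0 := by
    refine Measurable.ite ?_ (hΩ.2.1.mul ?_) measurable_const
    · exact (measurableSet_lt measurable_const measurable_norm).inter
        (measurableSet_le measurable_norm measurable_const)
    · exact Complex.measurable_ofReal.comp (measurable_norm.pow_const d).inv
  have hk0b : ∀ y, ‖k0 y‖ ≤ C * 2 ^ d := by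
    intro y
    simp only [hk0]
    split_ifs with h
    · have hy : y ≠ 0 := norm_pos_iff.1 (by linarith [h.1])
      rw [norm_mul]
      refine mul_le_mul (hΩ.2.2.2 y hy) ?_ (norm_nonneg _) hC
      rw [Complex.norm_real, Real.norm_eq_abs, abs_of_nonneg (by positivity), ← inv_pow]
      have : ‖y‖⁻¹ ≤ 2 := by
        rw [inv_le_comm₀ (by linarith [h.1]) (by norm_num)]; linarith [h.1]
      gcongr
    · simp; positivity
  have hk0n : Nice k0 := ⟨hk0m, ⟨_, hk0b⟩, 2, fun x hx => by
    simp only [hk0]; rw [if_neg]; intro h; linarith [h.2]⟩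
  set e : ℝ → Rd d → ℂ := fun t y =>
    if 1 < t * ‖y‖ ∧ t * ‖y‖ ≤ 2 then (Real.fourierChar (-(t * inner ℝ y ξ)) : ℂ) else 0 with he
  have hem : Measurable (Function.uncurry e) := by
    have m1 : Measurable fun z : ℝ × Rd d => z.1 * ‖z.2‖ := measurable_fst.mul measurable_snd.norm
    refine Measurable.ite ?_ ?_ measurable_const
    · exact (measurableSet_lt measurable_const m1).inter (measurableSet_le m1 measurable_const)
    · have : Measurable fun z : ℝ × Rd d => -(z.1 * inner ℝ z.2 ξ) := by fun_prop
      exact (continuous_subtype_val.comp Real.continuous_fourierChar).measurable.comp this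
  have heb : ∀ t y, ‖e t y‖ ≤ 1 := by
    intro t y
    simp only [he]
    split_ifs
    · exact (Circle.norm_coe _).le
    · simp
  have h1 : ∀ t ∈ Set.Ioc (1 : ℝ) 2, 𝓕 (ker Ω 0) ξ = ∫ y, k0 y * e t y := by
    intro t ht
    have ht0 : 0 < t := by linarith [ht.1]
    rw [Real.fourier_eq]
    have := Measure.integral_comp_smul (volume : Measure (Rd d))
      (fun v => (Real.fourierChar (-inner ℝ v ξ)) • ker Ω 0 v) t
    rw [finrank_euclideanSpace_fin, abs_of_pos (by positivity)] at this
    have h3 : (∫ v, (Real.fourierChar (-inner ℝ v ξ)) • ker Ω 0 v) = ((t ^ d : ℝ) : ℂ) *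
        ∫ x, (Real.fourierChar (-inner ℝ (t • x) ξ)) • ker Ω 0 (t • x) := by
      rw [this, Complex.real_smul, ← mul_assoc, ← Complex.ofReal_mul, mul_inv_cancel₀ (by positivity)]
      simp
    rw [h3, ← integral_const_mul]
    congr 1; ext y
    simp only [ker, hk0, he, norm_smul, Real.norm_of_nonneg ht0.le, zpow_zero, zero_add, zpow_one,
      Circle.smul_def, smul_eq_mul, real_inner_smul_left]
    by_cases h : 1 < t * ‖y‖ ∧ t * ‖y‖ ≤ 2
    · have hy0 : 0 < ‖y‖ := by
        rcases (norm_nonneg y).eq_or_lt with h' | h'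
        · rw [← h'] at h; norm_num at h
        · exact h'
      have h' : 1 / 2 < ‖y‖ ∧ ‖y‖ ≤ 2 := by
        constructor <;> nlinarith [ht.1, ht.2]
      rw [if_pos h, if_pos h, if_pos h', hΩ.2.2.1 t y ht0 (norm_pos_iff.1 hy0), mul_pow, mul_inv]
      have : ((t ^ d : ℝ) : ℂ) * (((t ^ d)⁻¹ : ℝ) : ℂ) = 1 := by
        rw [← Complex.ofReal_mul, mul_inv_cancel₀ (by positivity), Complex.ofReal_one]
      rw [Complex.ofReal_mul (t ^ d)⁻¹]
      linear_combination (Real.fourierChar (-(t * inner ℝ y ξ)) : ℂ) * Ω y * (((‖y‖ ^ d)⁻¹ : ℝ) : ℂ) * this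
    · rw [if_neg h, if_neg h]; simp
  have h2 : 𝓕 (ker Ω 0) ξ = ∫ t in Set.Ioc (1 : ℝ) 2, ∫ y, k0 y * e t y := by
    rw [← setIntegral_congr_fun measurableSet_Ioc h1, setIntegral_const]
    norm_num
  rw [integral_integral_swap] at h2
  swap
  · have hi : Integrable (fun z : ℝ × Rd d => (1 : ℂ) * k0 z.2)
        ((volume.restrict (Set.Ioc (1 : ℝ) 2)).prod volume) :=
      Integrable.mul_prod (f := fun _ : ℝ => (1 : ℂ)) (integrable_const _) hk0n.integrable
    have := hi.bdd_mul (c := 1) hem.aestronglyMeasurable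
      (Filter.Eventually.of_forall fun z => heb z.1 z.2)
    refine this.congr (Filter.Eventually.of_forall fun z => ?_)
    simp [Function.uncurry]; ring
  simp only [integral_const_mul] at h2
  set S := {y : Rd d | ‖y‖ ≤ 2 ∧ |inner ℝ y (‖ξ‖⁻¹ • ξ)| ≤ τ} with hS
  have hSm : MeasurableSet S := by
    have h1 : Continuous fun y : Rd d => |inner ℝ y (‖ξ‖⁻¹ • ξ)| := by fun_prop
    exact (measurableSet_le measurable_norm measurable_const).inter
      (measurableSet_le h1.measurable measurable_const)
  have hξ0 : 0 < ‖ξ‖ := by linarith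
  have hSv : volume S ≤ ENNReal.ofReal τ * volume (Metric.closedBall (0 : Rd d) 8) :=
    slab_le (by rw [norm_smul, norm_inv, norm_norm, inv_mul_cancel₀ hξ0.ne']) hτ hτ1
  set B := Metric.closedBall (0 : Rd d) 8 with hB
  have hBm : MeasurableSet B := Metric.isClosed_closedBall.measurableSet
  have hBv : volume B ≠ ⊤ := measure_closedBall_lt_top.ne
  have hSf : volume S ≠ ⊤ := (hSv.trans_lt (ENNReal.mul_lt_top ENNReal.ofReal_lt_top hBv.lt_top)).ne
  have hSr : volume.real S ≤ τ * volume.real B := by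
    have := ENNReal.toReal_mono (ENNReal.mul_ne_top ENNReal.ofReal_ne_top hBv) hSv
    rwa [ENNReal.toReal_mul, ENNReal.toReal_ofReal hτ.le] at this
  have hbound : ∀ y, ‖k0 y * ∫ t in Set.Ioc (1 : ℝ) 2, e t y‖ ≤
      S.indicator (fun _ => C * 2 ^ d) y + B.indicator (fun _ => C * 2 ^ d * τ) y := by
    intro y
    have hpos1 : 0 ≤ S.indicator (fun _ => C * 2 ^ d) y :=
      Set.indicator_nonneg (fun _ _ => by positivity) _
    have hpos2 : 0 ≤ B.indicator (fun _ => C * 2 ^ d * τ) y :=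
      Set.indicator_nonneg (fun _ _ => by positivity) _
    by_cases hy : 1 / 2 < ‖y‖ ∧ ‖y‖ ≤ 2
    swap
    · have : k0 y = 0 := by simp only [hk0]; rw [if_neg hy]
      rw [this, zero_mul, norm_zero]; positivity
    have hy0 : 0 < ‖y‖ := by linarith [hy.1]
    have hyB : y ∈ B := by simp [hB]; linarith [hy.2]
    rw [norm_mul]
    by_cases hyS : y ∈ S
    · rw [Set.indicator_of_mem hyS]
      have : ‖∫ t in Set.Ioc (1 : ℝ) 2, e t y‖ ≤ 1 := by
        refine (norm_setIntegral_le_of_norm_le_const (C := 1) (by simp) (fun t _ => heb t y)).trans ?_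
        norm_num [Measure.real]
      nlinarith [hk0b y, norm_nonneg (k0 y), norm_nonneg (∫ t in Set.Ioc (1 : ℝ) 2, e t y)]
    · rw [Set.indicator_of_notMem hyS, Set.indicator_of_mem hyB, zero_add]
      have h5 : τ < |inner ℝ y (‖ξ‖⁻¹ • ξ)| := by
        by_contra h; exact hyS ⟨hy.2, not_lt.1 h⟩
      rw [real_inner_smul_right, abs_mul, abs_of_pos (inv_pos.2 hξ0), ← div_eq_inv_mul,
        lt_div_iff₀ hξ0] at h5
      have h6 : 0 < |inner ℝ y ξ| := lt_trans (by positivity) h5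
      refine mul_le_mul (hk0b y) ?_ (norm_nonneg _) (by positivity)
      refine (norm_setIntegral_fourierChar_le hy0 (abs_pos.1 h6)).trans ((min_le_right _ _).trans ?_)
      rw [div_le_iff₀ h6]
      nlinarith
  rw [h2]
  refine (norm_integral_le_of_norm_le ?_ (Filter.Eventually.of_forall hbound)).trans ?_
  · exact (integrable_indicator_iff hSm |>.2 (integrableOn_const hSf)).add
      (integrable_indicator_iff hBm |>.2 (integrableOn_const hBv))
  · rw [integral_add (integrable_indicator_iff hSm |>.2 (integrableOn_const hSf))
      (integrable_indicator_iff hBm |>.2 (integrableOn_const hBv)), integral_indicator hSm,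
      integral_indicator hBm, setIntegral_const, setIntegral_const, smul_eq_mul, smul_eq_mul]
    change _ ≤ C * 2 ^ d * (2 * volume.real B) * τ
    have : volume.real S * (C * 2 ^ d) ≤ τ * volume.real B * (C * 2 ^ d) := by gcongr
    nlinarith

end A1Rough

namespace A1Rough

variable {d : ℕ} {Ω : Rd d → ℂ} {C : ℝ}

/-- The geometric decay rate `2^{-1/8}`. -/
def kap : ℝ := (2 : ℝ) ^ (-(1 / 8) : ℝ)

theorem kap_pos : 0 < kap := Real.rpow_pos_of_pos (by norm_num) _

theorem kap_lt_one : kap < 1 := Real.rpow_lt_one_of_one_lt_of_neg (by norm_num) (by norm_num)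

theorem kap_pow_eight : kap ^ 8 = 1 / 2 := by
  rw [kap, ← Real.rpow_natCast, ← Real.rpow_mul (by norm_num)]
  norm_num [Real.rpow_neg_one]

theorem kap_pow_le {a b : ℕ} (h : b ≤ a) : kap ^ a ≤ kap ^ b :=
  pow_le_pow_of_le_one kap_pos.le kap_lt_one.le h

theorem two_zpow_neg (n : ℕ) : (2 : ℝ) ^ (-(n : ℤ)) = kap ^ (8 * n) := by
  rw [pow_mul, kap_pow_eight, zpow_neg, zpow_natCast]; simp

theorem norm_zpow_smul_mem {ξ : Rd d} {l : ℤ} (j : ℤ) (h1 : (2 : ℝ) ^ l ≤ ‖ξ‖)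
    (h2 : ‖ξ‖ < (2 : ℝ) ^ (l + 1)) :
    (2 : ℝ) ^ (j + l) ≤ ‖(2 : ℝ) ^ j • ξ‖ ∧ ‖(2 : ℝ) ^ j • ξ‖ < (2 : ℝ) ^ (j + l + 1) := by
  have h0 : (0 : ℝ) < 2 ^ j := by positivity
  rw [norm_smul, Real.norm_of_nonneg h0.le, add_assoc, zpow_add₀ (by norm_num : (2:ℝ) ≠ 0),
    zpow_add₀ (by norm_num : (2:ℝ) ≠ 0)]
  exact ⟨by gcongr, by gcongr⟩

theorem le_kap_of_nonpos {x : ℝ} {N : ℤ} (hN : N ≤ 0) (h : x < (2 : ℝ) ^ (N + 1)) :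
    x ≤ 2 * kap ^ (8 * (-N).toNat) := by
  rw [zpow_add₀ (by norm_num : (2:ℝ) ≠ 0), zpow_one] at h
  have : (N : ℤ) = -(((-N).toNat : ℕ) : ℤ) := by omega
  rw [← two_zpow_neg, ← this]; linarith

open FourierTransform in
theorem fourier_ker_zero_decay_kap (hΩ : Homog Ω C) {ζ : Rd d} {N : ℤ} (hN : 0 ≤ N)
    (h1 : (2 : ℝ) ^ N ≤ ‖ζ‖) :
    ‖𝓕 (ker Ω 0) ζ‖ ≤ C * 2 ^ d * (2 * (volume (Metric.closedBall (0 : Rd d) 8)).toReal)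
      * kap ^ (4 * N.toNat) := by
  have hC := hΩ.1
  have h2 : (1 : ℝ) ≤ 2 ^ N := one_le_zpow₀ (by norm_num) hN
  have h0 : 0 < ‖ζ‖ := by linarith
  have hs : (√‖ζ‖)⁻¹ ^ 2 = ‖ζ‖⁻¹ := by rw [inv_pow, Real.sq_sqrt h0.le]
  refine (fourier_ker_zero_decay hΩ (h2.trans h1) (τ := (√‖ζ‖)⁻¹) (by positivity) ?_).trans ?_
  · rw [hs, inv_mul_cancel₀ h0.ne']
  · have : (√‖ζ‖)⁻¹ ≤ kap ^ (4 * N.toNat) := by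
      refine abs_le_of_sq_le_sq' ?_ (pow_nonneg kap_pos.le _) |>.2
      rw [hs, ← pow_mul, show 4 * N.toNat * 2 = 8 * N.toNat by ring, ← two_zpow_neg, zpow_neg,
        Int.toNat_of_nonneg hN]
      gcongr
    gcongr

open FourierTransform in
/-- Decay of the Fourier transform of the kernel pieces. -/
theorem exists_fourier_ker_le (d : ℕ) (C : ℝ) : ∃ B : ℝ, 0 ≤ B ∧ ∀ Ω : Rd d → ℂ, Homog Ω C →
    ∀ (j l : ℤ) (ξ : Rd d), (2 : ℝ) ^ l ≤ ‖ξ‖ → ‖ξ‖ < (2 : ℝ) ^ (l + 1) →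
    ‖𝓕 (ker Ω j) ξ‖ ≤ B * kap ^ (4 * (j + l).toNat) ∧
    ‖𝓕 (ker Ω j) ξ - ∫ x, ker Ω 0 x‖ ≤ B * kap ^ (8 * (-(j + l)).toNat) ∧
    (∫ x, ker Ω 0 x = 0 → ‖𝓕 (ker Ω j) ξ‖ ≤ B * kap ^ (4 * (j + l).natAbs)) := by
  set I : ℝ := |C| * 2 ^ d * (volume (Metric.closedBall (0 : Rd d) 1)).toReal with hI
  set D : ℝ := |C| * 2 ^ d * (2 * (volume (Metric.closedBall (0 : Rd d) 8)).toReal) with hD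
  have hI0 : 0 ≤ I := by positivity
  have hD0 : 0 ≤ D := by positivity
  have hpi := Real.pi_pos
  refine ⟨D + 2 * I + 8 * Real.pi * I, by positivity, fun Ω hΩ j l ξ h1 h2 => ?_⟩
  have hC := hΩ.1
  have hII : ∫ x, ‖ker Ω 0 x‖ ≤ I := by
    rw [hI, abs_of_nonneg hC]; exact integral_norm_ker_le hΩ 0
  obtain ⟨h3, h4⟩ := norm_zpow_smul_mem j h1 h2
  rw [fourier_ker_scale hΩ]
  set ζ := (2 : ℝ) ^ j • ξ
  set N := j + l
  have hsm := norm_fourier_sub_integral_le (nice_ker hΩ 0) (R := 2)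
    (fun x hx => ker_eq_zero (by simpa using hx)) ζ
  have hbd := (norm_fourier_le (ker Ω 0) ζ).trans hII
  have hint : ‖∫ x, ker Ω 0 x‖ ≤ I := (norm_integral_le_integral_norm _).trans hII
  have hpiI : 0 ≤ Real.pi * I := by positivity
  have small : N ≤ 0 → ‖𝓕 (ker Ω 0) ζ - ∫ x, ker Ω 0 x‖ ≤
      (D + 2 * I + 8 * Real.pi * I) * kap ^ (8 * (-N).toNat) := by
    intro hN
    have hk := le_kap_of_nonpos hN h4
    calc _ ≤ 2 * Real.pi * 2 * ‖ζ‖ * ∫ x, ‖ker Ω 0 x‖ := hsm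
      _ ≤ 2 * Real.pi * 2 * (2 * kap ^ (8 * (-N).toNat)) * I := by
        have hkp := kap_pos
        gcongr
      _ = 8 * Real.pi * I * kap ^ (8 * (-N).toNat) := by ring
      _ ≤ _ := by
        refine mul_le_mul_of_nonneg_right ?_ (pow_nonneg kap_pos.le _)
        linarith
  have decay : 0 ≤ N → ‖𝓕 (ker Ω 0) ζ‖ ≤
      (D + 2 * I + 8 * Real.pi * I) * kap ^ (4 * N.toNat) := by
    intro hN
    refine (fourier_ker_zero_decay_kap hΩ hN h3).trans ?_
    refine mul_le_mul_of_nonneg_right ?_ (pow_nonneg kap_pos.le _)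
    rw [hD, abs_of_nonneg hC] at *
    linarith
  refine ⟨?_, ?_, fun h0 => ?_⟩
  · rcases le_total 0 N with hN | hN
    · exact decay hN
    · rw [Int.toNat_of_nonpos hN, mul_zero, pow_zero]; linarith
  · rcases le_total N 0 with hN | hN
    · exact small hN
    · rw [Int.toNat_of_nonpos (by omega), mul_zero, pow_zero]
      have := norm_sub_le (𝓕 (ker Ω 0) ζ) (∫ x, ker Ω 0 x)
      linarith
  · rcases le_total 0 N with hN | hN
    · convert decay hN using 4; omega
    · have := small hN
      rw [h0, sub_zero] at this
      refine this.trans (mul_le_mul_of_nonneg_left (kap_pow_le ?_) (by positivity))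
      omega

theorem exists_fourierChar_sub_one_le (R : ℝ) (hR : 0 ≤ R) : ∃ B : ℝ, 0 ≤ B ∧
    ∀ (d : ℕ) (u ξ : Rd d) (m l : ℤ), ‖u‖ ≤ R * 2 ^ m → (2 : ℝ) ^ l ≤ ‖ξ‖ → ‖ξ‖ < (2 : ℝ) ^ (l + 1) →
    ‖(Real.fourierChar (inner ℝ u ξ) : ℂ) - 1‖ ≤ B * kap ^ (8 * (-(m + l)).toNat) := by
  have hpi := Real.pi_pos
  refine ⟨2 + 4 * Real.pi * R, by positivity, fun d u ξ m l hu h1 h2 => ?_⟩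
  have hpR : 0 ≤ Real.pi * R := by positivity
  rcases le_total (m + l) 0 with hN | hN
  · refine (norm_fourierChar_sub_one_le _).trans ?_
    have h3 : (2 : ℝ) ^ m * ‖ξ‖ < 2 ^ (m + l + 1) := by
      have := (norm_zpow_smul_mem m h1 h2).2
      rwa [norm_smul, Real.norm_of_nonneg (by positivity)] at this
    have h4 := le_kap_of_nonpos hN h3
    have h5 : |inner ℝ u ξ| ≤ R * (2 * kap ^ (8 * (-(m + l)).toNat)) := by
      refine (abs_real_inner_le_norm u ξ).trans ?_
      calc ‖u‖ * ‖ξ‖ ≤ R * 2 ^ m * ‖ξ‖ := by gcongr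
        _ = R * (2 ^ m * ‖ξ‖) := by ring
        _ ≤ _ := by gcongr
    calc _ ≤ 2 * Real.pi * (R * (2 * kap ^ (8 * (-(m + l)).toNat))) := by gcongr
      _ ≤ _ := by
        have := pow_nonneg kap_pos.le (8 * (-(m + l)).toNat)
        nlinarith
  · rw [Int.toNat_of_nonpos (by omega), mul_zero, pow_zero]
    have := norm_sub_le (Real.fourierChar (inner ℝ u ξ) : ℂ) 1
    rw [Circle.norm_coe, norm_one] at this
    linarith

/-- Normalisation making the constant kernel an approximate identity. -/
def phiC (d : ℕ) : ℝ := (∫ x : Rd d, if (1 : ℝ) < ‖x‖ ∧ ‖x‖ ≤ 2 then (‖x‖ ^ d)⁻¹ else 0)⁻¹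

theorem phiC_nonneg (d : ℕ) : 0 ≤ phiC d := by
  refine inv_nonneg.2 (integral_nonneg fun x => ?_)
  dsimp only
  split_ifs <;> positivity

theorem homog_phi (d : ℕ) : Homog (fun _ : Rd d => (phiC d : ℂ)) (phiC d) := by
  refine ⟨phiC_nonneg d, measurable_const, fun _ _ _ _ => rfl, fun x _ => ?_⟩
  rw [Complex.norm_real, Real.norm_of_nonneg (phiC_nonneg d)]

/-- The averaging kernels. -/
def phi (d : ℕ) (J : ℤ) : Rd d → ℂ := ker (fun _ => (phiC d : ℂ)) J

theorem nice_phi (d : ℕ) (J : ℤ) : Nice (phi d J) := nice_ker (homog_phi d) J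

theorem integral_phi (hd : 1 ≤ d) : ∫ x, phi d 0 x = 1 := by
  have h1 : ∀ x, phi d 0 x = ((phiC d * (if (1 : ℝ) < ‖x‖ ∧ ‖x‖ ≤ 2 then (‖x‖ ^ d)⁻¹ else 0) : ℝ) : ℂ) := by
    intro x
    simp only [phi, ker, zpow_zero, zero_add, zpow_one]
    split_ifs <;> push_cast <;> simp
  simp only [h1]
  rw [integral_complex_ofReal, integral_const_mul, phiC, inv_mul_cancel₀]
  · simp
  have hpos : 0 < ∫ x : Rd d, if (1 : ℝ) < ‖x‖ ∧ ‖x‖ ≤ 2 then (‖x‖ ^ d)⁻¹ else 0 := by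
    rw [integral_pos_iff_support_of_nonneg]
    · have hopen : IsOpen {x : Rd d | 1 < ‖x‖ ∧ ‖x‖ < 2} :=
        (isOpen_lt continuous_const continuous_norm).inter (isOpen_lt continuous_norm continuous_const)
      have hne : {x : Rd d | 1 < ‖x‖ ∧ ‖x‖ < 2}.Nonempty := by
        refine ⟨EuclideanSpace.single ⟨0, hd⟩ (3/2 : ℝ), ?_⟩
        simp; norm_num
      refine (hopen.measure_pos volume hne).trans_le (measure_mono fun x hx => ?_)
      have h0 : 0 < ‖x‖ := by linarith [hx.1]
      simp only [Function.mem_support]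
      rw [if_pos ⟨hx.1, hx.2.le⟩]; positivity
    · intro x; dsimp only; split_ifs <;> simp
    · have := (nice_ker (Ω := fun _ : Rd d => (1 : ℂ)) (C := 1) ⟨by norm_num, measurable_const, by simp, by simp⟩ 0).integrable.re
      refine this.congr (Filter.Eventually.of_forall fun x => ?_)
      simp only [ker, zpow_zero, zero_add, zpow_one]
      split_ifs
      · rw [one_mul]; exact Complex.ofReal_re _
      · simp
  exact hpos.ne'

end A1Rough

namespace A1Rough

variable {d : ℕ}

/-- The index of the dyadic cube of side `2^m` containing a point. -/
def idx (m : ℤ) (x : Rd d) : Fin d → ℤ := fun i => ⌊x i / 2 ^ m⌋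

/-- The dyadic cube of side `2^m` containing a point. -/
def cube (m : ℤ) (x : Rd d) : Set (Rd d) := {y | idx m y = idx m x}

/-- The volume of a dyadic cube. -/
def vol (d : ℕ) (m : ℤ) : ℝ≥0∞ := ENNReal.ofReal (((2 : ℝ) ^ m) ^ d)

theorem vol_ne_zero (m : ℤ) : vol d m ≠ 0 := by
  rw [vol, ne_eq, ENNReal.ofReal_eq_zero, not_le]; positivity

theorem vol_ne_top (m : ℤ) : vol d m ≠ ⊤ := ENNReal.ofReal_ne_top

theorem measurable_idx (m : ℤ) : Measurable (idx m : Rd d → Fin d → ℤ) := by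
  refine measurable_pi_iff.2 fun i => Int.measurable_floor.comp ?_
  have : Measurable fun x : Rd d => x i := by fun_prop
  exact this.div_const _

theorem measurableSet_cube (m : ℤ) (x : Rd d) : MeasurableSet (cube m x) :=
  measurableSet_eq_fun (measurable_idx m) measurable_const

theorem mem_cube_self (m : ℤ) (x : Rd d) : x ∈ cube m x := rfl

theorem mem_cube_comm {m : ℤ} {x y : Rd d} : y ∈ cube m x ↔ x ∈ cube m y := eq_comm

theorem cube_eq {m : ℤ} {x y : Rd d} (h : y ∈ cube m x) : cube m y = cube m x := by
  ext z; simp only [cube, Set.mem_ofPred_eq] at *; rw [h]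

theorem cube_mono {m m' : ℤ} (h : m ≤ m') (x : Rd d) : cube m x ⊆ cube m' x := by
  intro y hy
  obtain ⟨k, rfl⟩ := Int.le.dest h
  simp only [cube, idx, Set.mem_ofPred_eq, funext_iff] at *
  intro i
  have key : ∀ t : ℝ, t / 2 ^ (m + (k : ℤ)) = (t / 2 ^ m) / ((2 ^ k : ℕ) : ℝ) := by
    intro t
    rw [zpow_add₀ (by norm_num), div_div]; simp
  rw [key, key, Int.floor_div_natCast, Int.floor_div_natCast, hy i]

theorem norm_sub_le_of_mem_cube {m : ℤ} {x y : Rd d} (h : y ∈ cube m x) :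
    ‖y - x‖ ≤ √d * 2 ^ m := by
  have h0 : (0 : ℝ) < 2 ^ m := by positivity
  rw [EuclideanSpace.norm_eq]
  have : ∑ i, ‖(y - x) i‖ ^ 2 ≤ d * (2 ^ m) ^ 2 := by
    have h1 : ∀ i ∈ Finset.univ, ‖(y - x) i‖ ^ 2 ≤ ((2 : ℝ) ^ m) ^ 2 := by
      intro i _
      have hi := congrFun h i
      simp only [idx] at hi
      have := Int.abs_sub_lt_one_of_floor_eq_floor hi
      rw [← sub_div, abs_div, abs_of_pos h0, div_lt_one h0] at this
      rw [PiLp.sub_apply, Real.norm_eq_abs]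
      gcongr
    simpa using Finset.sum_le_card_nsmul _ _ _ h1
  calc √(∑ i, ‖(y - x) i‖ ^ 2) ≤ √(d * (2 ^ m) ^ 2) := Real.sqrt_le_sqrt this
    _ = _ := by rw [Real.sqrt_mul (by positivity), Real.sqrt_sq h0.le]

/-- A dyadic cube as an Euclidean box. -/
theorem mem_cube_iff {m : ℤ} {x y : Rd d} :
    y ∈ cube m x ↔ ∀ i, (idx m x i : ℝ) * 2 ^ m ≤ y i ∧ y i < ((idx m x i : ℝ) + 1) * 2 ^ m := by
  have h0 : (0 : ℝ) < 2 ^ m := by positivity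
  simp only [cube, Set.mem_ofPred_eq, funext_iff]
  refine forall_congr' fun i => ?_
  conv_lhs => rw [idx, Int.floor_eq_iff, le_div_iff₀ h0, div_lt_iff₀ h0]

theorem volume_box (a b : Fin d → ℝ) :
    volume {y : Rd d | ∀ i, a i ≤ y i ∧ y i < b i} = ∏ i, ENNReal.ofReal (b i - a i) := by
  have h2 := (PiLp.volume_preserving_ofLp (Fin d)).measure_preimage_emb
    (MeasurableEquiv.toLp 2 (Fin d → ℝ)).symm.measurableEmbedding (Set.univ.pi fun i => Set.Ico (a i) (b i))
  rw [Real.volume_pi_Ico] at h2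
  rw [← h2]
  congr 1; ext y; simp

theorem volume_cube (m : ℤ) (x : Rd d) : volume (cube m x) = vol d m := by
  have : cube m x = {y | ∀ i, (idx m x i : ℝ) * 2 ^ m ≤ y i ∧ y i < ((idx m x i : ℝ) + 1) * 2 ^ m} := by
    ext y; exact mem_cube_iff
  rw [this, volume_box]
  simp [add_mul, vol, ← ENNReal.ofReal_pow (show (0:ℝ) ≤ 2 ^ m by positivity)]

theorem measurableSet_cube_rel (m : ℤ) : MeasurableSet {q : Rd d × Rd d | q.2 ∈ cube m q.1} :=
  measurableSet_eq_fun ((measurable_idx m).comp measurable_snd) ((measurable_idx m).comp measurable_fst)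

/-- Dyadic averages of nonnegative functions. -/
def El (m : ℤ) (g : Rd d → ℝ≥0∞) (x : Rd d) : ℝ≥0∞ := (vol d m)⁻¹ * ∫⁻ y in cube m x, g y

/-- Dyadic averages. -/
def E (m : ℤ) (f : Rd d → ℂ) (x : Rd d) : ℂ := ((((2 : ℝ) ^ m) ^ d)⁻¹ : ℝ) * ∫ y in cube m x, f y

/-- Dyadic oscillations. -/
def D (m : ℤ) (f : Rd d → ℂ) (x : Rd d) : ℂ := f x - E m f x

theorem E_congr {m : ℤ} {x y : Rd d} (h : y ∈ cube m x) (f : Rd d → ℂ) : E m f y = E m f x := by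
  rw [E, E, cube_eq h]

theorem El_congr {m : ℤ} {x y : Rd d} (h : y ∈ cube m x) (f : Rd d → ℝ≥0∞) : El m f y = El m f x := by
  rw [El, El, cube_eq h]

/-- Rectangular kernel of the averaging operator. -/
def rel (m : ℤ) (x y : Rd d) : ℝ≥0∞ := (cube m x).indicator (fun _ => 1) y

theorem rel_comm (m : ℤ) (x y : Rd d) : rel m x y = rel m y x := by
  by_cases h : y ∈ cube m x
  · simp [rel, h, mem_cube_comm.1 h]
  · simp [rel, h, mt mem_cube_comm.1 h]

theorem measurable_rel (m : ℤ) : Measurable fun q : Rd d × Rd d => rel m q.1 q.2 :=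
  (measurable_const (a := (1 : ℝ≥0∞))).indicator (measurableSet_cube_rel m)

theorem El_eq (m : ℤ) (g : Rd d → ℝ≥0∞) (x : Rd d) :
    El m g x = (vol d m)⁻¹ * ∫⁻ y, rel m x y * g y := by
  rw [El, ← lintegral_indicator (measurableSet_cube m x)]
  simp only [rel, Set.indicator, ite_mul, one_mul, zero_mul]

theorem measurable_El (m : ℤ) {g : Rd d → ℝ≥0∞} (hg : Measurable g) : Measurable (El m g) := by
  simp only [funext (El_eq m g)]
  have := measurable_rel (d := d) m
  refine Measurable.const_mul ?_ _
  exact Measurable.lintegral_prod_right' (f := fun q : Rd d × Rd d => rel m q.1 q.2 * g q.2)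
    (this.mul (hg.comp measurable_snd))

theorem lintegral_El_mul (m : ℤ) {f g : Rd d → ℝ≥0∞} (hf : Measurable f) (hg : Measurable g) :
    ∫⁻ x, El m f x * g x = ∫⁻ x, f x * El m g x := by
  have hr := measurable_rel (d := d) m
  simp only [El_eq]
  have h1 : ∀ x, (vol d m)⁻¹ * (∫⁻ y, rel m x y * f y) * g x =
      ∫⁻ y, (vol d m)⁻¹ * (rel m x y * f y * g x) := by
    intro x
    have : Measurable fun y => rel m x y * f y := (hr.comp measurable_prodMk_left).mul hf
    rw [lintegral_const_mul _ (this.mul_const _), lintegral_mul_const _ this, mul_assoc]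
  have h2 : ∀ x, f x * ((vol d m)⁻¹ * (∫⁻ y, rel m x y * g y)) =
      ∫⁻ y, (vol d m)⁻¹ * (rel m y x * f x * g y) := by
    intro x
    have : Measurable fun y => rel m x y * g y := (hr.comp measurable_prodMk_left).mul hg
    simp only [rel_comm m _ x, mul_right_comm _ (f x)]
    rw [lintegral_const_mul _ (this.mul_const _), lintegral_mul_const _ this]
    ring
  simp only [h1, h2]
  rw [lintegral_lintegral_swap]
  refine Measurable.aemeasurable ?_
  exact ((hr.mul (hf.comp measurable_snd)).mul (hg.comp measurable_fst)).const_mul _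

theorem El_one (m : ℤ) (x : Rd d) : El m (fun _ => 1) x = 1 := by
  rw [El, setLIntegral_one, volume_cube, ENNReal.inv_mul_cancel (vol_ne_zero m) (vol_ne_top m)]

theorem lintegral_El (m : ℤ) {f : Rd d → ℝ≥0∞} (hf : Measurable f) :
    ∫⁻ x, El m f x = ∫⁻ x, f x := by
  simpa [El_one] using lintegral_El_mul m hf (measurable_const (a := (1 : ℝ≥0∞)))

theorem lintegral_rpow_le {α : Type*} [MeasurableSpace α] (μ : Measure α) {q : ℝ} (hq : 1 ≤ q)
    {f : α → ℝ≥0∞} (hf : AEMeasurable f μ) (hμ : μ Set.univ ≠ 0) (hμ' : μ Set.univ ≠ ⊤) :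
    ((μ Set.univ)⁻¹ * ∫⁻ x, f x ∂μ) ^ q ≤ (μ Set.univ)⁻¹ * ∫⁻ x, f x ^ q ∂μ := by
  have h0 : q ≠ 0 := by linarith
  have hf' : AEMeasurable f ((μ Set.univ)⁻¹ • μ) := hf.smul_measure _
  have hp : IsProbabilityMeasure ((μ Set.univ)⁻¹ • μ) :=
    ⟨by simp [ENNReal.inv_mul_cancel hμ hμ']⟩
  have := eLpNorm'_le_eLpNorm'_of_exponent_le one_pos hq _ hf'.aestronglyMeasurable
  simp only [eLpNorm', ENNReal.rpow_one, div_one, enorm_eq_self, lintegral_smul_measure, smul_eq_mul] at this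
  refine (ENNReal.rpow_le_rpow this (by linarith)).trans_eq ?_
  rw [← ENNReal.rpow_mul, one_div_mul_cancel h0, ENNReal.rpow_one]

theorem El_rpow_le (m : ℤ) {q : ℝ} (hq : 1 ≤ q) {g : Rd d → ℝ≥0∞} (hg : Measurable g) (x : Rd d) :
    El m g x ^ q ≤ El m (fun y => g y ^ q) x := by
  have := lintegral_rpow_le (volume.restrict (cube m x)) hq hg.aemeasurable
    (by simp [volume_cube, vol_ne_zero]) (by simp [volume_cube, vol_ne_top])
  simpa [volume_cube, El] using this

theorem enorm_E_le (m : ℤ) (f : Rd d → ℂ) (x : Rd d) : ‖E m f x‖ₑ ≤ El m (fun y => ‖f y‖ₑ) x := by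
  rw [E, El, enorm_mul]
  gcongr
  · have : (0:ℝ) < ((2 : ℝ) ^ m) ^ d := by positivity
    rw [← ofReal_norm, Complex.norm_real, Real.norm_of_nonneg (by positivity), vol,
      ENNReal.ofReal_inv_of_pos this]
  · exact enorm_integral_le_lintegral_enorm _

end A1Rough

namespace A1Rough

variable {d : ℕ} {f g : Rd d → ℂ} {m : ℤ}

theorem measurable_E (m : ℤ) (hf : Measurable f) : Measurable (E m f) := by
  have h : ∀ x, E m f x = ((((2 : ℝ) ^ m) ^ d)⁻¹ : ℝ) *
      ∫ y, {q : Rd d × Rd d | q.2 ∈ cube m q.1}.indicator (fun q => f q.2) (x, y) := by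
    intro x
    rw [E, ← integral_indicator (measurableSet_cube m x)]
    rfl
  rw [funext h]
  have h1 : StronglyMeasurable
      ({q : Rd d × Rd d | q.2 ∈ cube m q.1}.indicator (fun q => f q.2)) :=
    ((hf.comp measurable_snd).indicator (measurableSet_cube_rel m)).stronglyMeasurable
  exact h1.integral_prod_right'.measurable.const_mul _

theorem norm_E_le {M : ℝ} (hM : ∀ x, ‖f x‖ ≤ M) (x : Rd d) : ‖E m f x‖ ≤ M := by
  have h0 : 0 ≤ M := (norm_nonneg _).trans (hM x)
  have h1 : ‖E m f x‖ₑ ≤ ENNReal.ofReal M := by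
    refine (enorm_E_le m f x).trans ?_
    calc El m (fun y => ‖f y‖ₑ) x ≤ (vol d m)⁻¹ * ∫⁻ y in cube m x, ENNReal.ofReal M := by
          rw [El]; gcongr with y; rw [← ofReal_norm]; exact ENNReal.ofReal_le_ofReal (hM y)
      _ = ENNReal.ofReal M := by
          rw [lintegral_const, Measure.restrict_apply_univ, volume_cube, mul_comm _ (vol d m),
            ← mul_assoc, ENNReal.inv_mul_cancel (vol_ne_zero m) (vol_ne_top m), one_mul]
  rw [← ofReal_norm] at h1
  exact (ENNReal.ofReal_le_ofReal_iff h0).1 h1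

theorem E_eq_zero {x : Rd d} (h : ∀ y ∈ cube m x, f y = 0) : E m f x = 0 := by
  rw [E, setIntegral_eq_zero_of_forall_eq_zero h, mul_zero]

theorem Nice.E (m : ℤ) (hf : Nice f) : Nice (E m f) := by
  obtain ⟨hm, ⟨M, hM⟩, R, hR⟩ := hf
  refine ⟨measurable_E m hm, ⟨M, fun x => norm_E_le hM x⟩, R + √d * 2 ^ m, fun x hx => ?_⟩
  refine E_eq_zero fun y hy => hR y ?_
  have := norm_sub_le_of_mem_cube hy
  have h2 := norm_sub_norm_le x y
  rw [norm_sub_rev] at h2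
  linarith

theorem Nice.D (m : ℤ) (hf : Nice f) : Nice (D m f) := hf.sub (hf.E m)

theorem setIntegral_cube_const (c : ℂ) (x : Rd d) :
    ((((2 : ℝ) ^ m) ^ d)⁻¹ : ℝ) * ∫ _ in cube m x, c = c := by
  have h : (volume (cube m x)).toReal = ((2 : ℝ) ^ m) ^ d := by
    rw [volume_cube, vol, ENNReal.toReal_ofReal (by positivity)]
  rw [setIntegral_const, Measure.real, h, Complex.real_smul, ← mul_assoc, ← Complex.ofReal_mul,
    inv_mul_cancel₀ (by positivity)]
  simp

theorem E_sub (hf : Nice f) (hg : Nice g) (x : Rd d) :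
    E m (fun y => f y - g y) x = E m f x - E m g x := by
  rw [E, integral_sub hf.integrable.integrableOn hg.integrable.integrableOn, mul_sub]; rfl

theorem E_sum {ι : Type*} (s : Finset ι) {F : ι → Rd d → ℂ} (h : ∀ i ∈ s, Nice (F i)) (x : Rd d) :
    E m (fun y => ∑ i ∈ s, F i y) x = ∑ i ∈ s, E m (F i) x := by
  rw [E, integral_finsetSum s fun i hi => (h i hi).integrable.integrableOn, Finset.mul_sum]; rfl

theorem D_sum {ι : Type*} (s : Finset ι) {F : ι → Rd d → ℂ} (h : ∀ i ∈ s, Nice (F i)) (x : Rd d) :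
    D m (fun y => ∑ i ∈ s, F i y) x = ∑ i ∈ s, D m (F i) x := by
  rw [D, E_sum s h, ← Finset.sum_sub_distrib]; rfl

theorem E_E (x : Rd d) : E m (E m f) x = E m f x := by
  have : ∫ y in cube m x, E m f y = ∫ y in cube m x, E m f x :=
    setIntegral_congr_fun (measurableSet_cube m x) fun y hy => E_congr hy f
  conv_lhs => rw [E, this]
  exact setIntegral_cube_const _ _

theorem E_D (hf : Nice f) (x : Rd d) : E m (D m f) x = 0 := by
  rw [show D m f = fun y => f y - E m f y from rfl, E_sub hf (hf.E m), E_E, sub_self]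

/-- Sets which are unions of dyadic cubes of a fixed scale. -/
def Sat (m : ℤ) (A : Set (Rd d)) : Prop := ∀ x ∈ A, cube m x ⊆ A

theorem Sat.mem_iff {A : Set (Rd d)} (hA : Sat m A) {x y : Rd d} (h : y ∈ cube m x) : y ∈ A ↔ x ∈ A :=
  ⟨fun hy => hA y hy (mem_cube_comm.1 h), fun hx => hA x hx h⟩

theorem Sat.E_indicator {A : Set (Rd d)} (hA : Sat m A) (f : Rd d → ℂ) :
    E m (A.indicator f) = A.indicator (E m f) := by
  ext x
  by_cases hx : x ∈ A
  · rw [Set.indicator_of_mem hx, E, E,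
      setIntegral_congr_fun (measurableSet_cube m x) fun y hy => Set.indicator_of_mem (hA x hx hy) f]
  · rw [Set.indicator_of_notMem hx]
    exact E_eq_zero fun y hy => Set.indicator_of_notMem (mt (hA.mem_iff hy).1 hx) _

theorem Sat.El_indicator {A : Set (Rd d)} (hA : Sat m A) (f : Rd d → ℝ≥0∞) :
    El m (A.indicator f) = A.indicator (El m f) := by
  ext x
  by_cases hx : x ∈ A
  · rw [Set.indicator_of_mem hx, El, El,
      setLIntegral_congr_fun (measurableSet_cube m x) fun y hy => Set.indicator_of_mem (hA x hx hy) f]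
  · rw [Set.indicator_of_notMem hx, El,
      setLIntegral_congr_fun (measurableSet_cube m x)
        fun y hy => Set.indicator_of_notMem (mt (hA.mem_iff hy).1 hx) f]
    simp

theorem integral_E_mul (hf : Nice f) (hg : Nice g) :
    ∫ x, E m f x * g x = ∫ x, f x * E m g x := by
  set c : ℂ := (((((2 : ℝ) ^ m) ^ d)⁻¹ : ℝ) : ℂ)
  set S : Set (Rd d × Rd d) := {q | q.2 ∈ cube m q.1} with hS
  have hSm : MeasurableSet S := measurableSet_cube_rel m
  have h1 : ∀ x, E m f x * g x = ∫ y, c * S.indicator (fun q => f q.2 * g q.1) (x, y) := by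
    intro x
    rw [integral_const_mul, E, mul_assoc, ← integral_mul_const, ← integral_indicator (measurableSet_cube m x)]
    rfl
  have h2 : ∀ x, f x * E m g x = ∫ y, c * S.indicator (fun q => f q.2 * g q.1) (y, x) := by
    intro x
    rw [integral_const_mul, E, mul_left_comm, ← integral_const_mul, ← integral_indicator (measurableSet_cube m x)]
    congr 2
    ext y
    by_cases h : y ∈ cube m x
    · have h' : (y, x) ∈ S := mem_cube_comm.1 h
      rw [Set.indicator_of_mem h, Set.indicator_of_mem h']
    · have h' : (y, x) ∉ S := mt mem_cube_comm.1 h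
      rw [Set.indicator_of_notMem h, Set.indicator_of_notMem h']
  simp only [h1, h2]
  have hi : Integrable (S.indicator fun q : Rd d × Rd d => f q.2 * g q.1) (volume.prod volume) := by
    refine Integrable.indicator ?_ hSm
    exact (hg.integrable.mul_prod hf.integrable).congr (Filter.Eventually.of_forall fun q => mul_comm _ _)
  exact integral_integral_swap (f := fun x y => c * S.indicator (fun q => f q.2 * g q.1) (x, y)) (hi.const_mul c)

theorem integral_mul_D (hf : Nice f) (hg : Nice g) (h : ∀ x, E m f x = 0) :
    ∫ x, f x * g x = ∫ x, f x * D m g x := by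
  have h1 := integral_E_mul (m := m) hf hg
  simp only [h, zero_mul, integral_zero] at h1
  have h2 : ∀ x, f x * D m g x = f x * g x - f x * E m g x := fun x => by rw [D, mul_sub]
  simp only [h2]
  rw [integral_sub, ← h1, sub_zero]
  · exact hf.integrable.mul_bdd (c := hg.2.1.choose) hg.1.aestronglyMeasurable (Filter.Eventually.of_forall hg.2.1.choose_spec)
  · exact hf.integrable.mul_bdd (c := (hg.E m).2.1.choose) (hg.E m).1.aestronglyMeasurable
      (Filter.Eventually.of_forall (hg.E m).2.1.choose_spec)

theorem enorm_D_sq_le (hf : Nice f) (x : Rd d) :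
    ‖D m f x‖ₑ ^ 2 ≤ (vol d m)⁻¹ *
      ∫⁻ u in Metric.closedBall (0 : Rd d) (√d * 2 ^ m), ‖f (x + u) - f x‖ₑ ^ 2 := by
  have h0 : Measurable fun y => ‖f x - f y‖ₑ := (measurable_const.sub hf.1).enorm
  have h1 : D m f x = E m (fun y => f x - f y) x := by
    rw [E, integral_sub (integrableOn_const (s := cube m x) (C := f x) (by rw [volume_cube]; exact vol_ne_top m)) hf.integrable.integrableOn,
      mul_sub, setIntegral_cube_const]; rfl
  have h2 := El_rpow_le m (q := 2) (by norm_num) h0 x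
  simp only [ENNReal.rpow_two] at h2
  rw [h1]
  refine (pow_le_pow_left' (enorm_E_le m _ x) 2).trans (h2.trans ?_)
  rw [El]
  have h3 : ∫⁻ u in Metric.closedBall (0 : Rd d) (√d * 2 ^ m), ‖f (x + u) - f x‖ₑ ^ 2 =
      ∫⁻ y in Metric.closedBall x (√d * 2 ^ m), ‖f x - f y‖ₑ ^ 2 := by
    rw [← lintegral_indicator Metric.isClosed_closedBall.measurableSet,
      ← lintegral_indicator Metric.isClosed_closedBall.measurableSet,
      ← lintegral_add_left_eq_self ((Metric.closedBall x (√d * 2 ^ m)).indicator _) x]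
    congr 1; ext u
    simp only [Set.indicator, Metric.mem_closedBall, dist_zero_right, dist_self_add_left, enorm_sub_rev]
  rw [h3]
  refine mul_le_mul_right (lintegral_mono_set fun y hy => ?_) _
  rw [Metric.mem_closedBall, dist_eq_norm]
  exact norm_sub_le_of_mem_cube hy

theorem lintegral_D_sq_le (hf : Nice f) :
    ∫⁻ x, ‖D m f x‖ₑ ^ 2 ≤ (vol d m)⁻¹ *
      ∫⁻ u in Metric.closedBall (0 : Rd d) (√d * 2 ^ m), ∫⁻ x, ‖f (x + u) - f x‖ₑ ^ 2 := by
  have h : Measurable fun q : Rd d × Rd d => ‖f (q.1 + q.2) - f q.1‖ₑ ^ 2 :=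
    (((hf.1.comp (measurable_fst.add measurable_snd)).sub (hf.1.comp measurable_fst)).enorm).pow_const 2
  refine (lintegral_mono fun x => enorm_D_sq_le hf x).trans_eq ?_
  rw [lintegral_const_mul, lintegral_lintegral_swap h.aemeasurable]
  exact Measurable.lintegral_prod_right' (ν := volume.restrict _)
    (f := fun q : Rd d × Rd d => ‖f (q.1 + q.2) - f q.1‖ₑ ^ 2) h

end A1Rough

namespace A1Rough

variable {d : ℕ} {Ω : Rd d → ℂ} {C : ℝ} {f : Rd d → ℂ}

/-- Bounded homogeneous kernels with cancellation. -/
def MZ (Ω : Rd d → ℂ) (C : ℝ) : Prop := Homog Ω C ∧ ∫ x, ker Ω 0 x = 0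

/-- The dyadic logarithm of the norm. -/
def lg (ξ : Rd d) : ℤ := ⌊Real.logb 2 ‖ξ‖⌋

theorem measurable_lg : Measurable (lg : Rd d → ℤ) :=
  Int.measurable_floor.comp ((Real.measurable_log.comp measurable_norm).div_const _)

theorem lg_bounds {ξ : Rd d} (h : ξ ≠ 0) : (2 : ℝ) ^ lg ξ ≤ ‖ξ‖ ∧ ‖ξ‖ < (2 : ℝ) ^ (lg ξ + 1) := by
  have h0 : 0 < ‖ξ‖ := norm_pos_iff.2 h
  have h1 := (Real.le_logb_iff_rpow_le one_lt_two h0).1 (Int.floor_le (Real.logb 2 ‖ξ‖))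
  have h2 := (Real.logb_lt_iff_lt_rpow one_lt_two h0).1 (Int.lt_floor_add_one (Real.logb 2 ‖ξ‖))
  rw [Real.rpow_intCast] at h1
  exact ⟨h1, by rw [← Real.rpow_intCast]; push_cast; exact h2⟩

/-- Two-sided geometric series. -/
def geoZ : ℝ≥0∞ := ∑' N : ℤ, ENNReal.ofReal (kap ^ (4 * N.natAbs))

theorem kap_four_lt_one : kap ^ 4 < 1 := pow_lt_one₀ kap_pos.le kap_lt_one (by norm_num)

theorem geoZ_ne_top : geoZ ≠ ⊤ := by
  have h : Summable fun N : ℤ => kap ^ (4 * N.natAbs) := by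
    have h0 : Summable fun n : ℕ => kap ^ (4 * n) := by
      simp only [pow_mul]
      exact summable_geometric_of_lt_one (pow_nonneg kap_pos.le 4) kap_four_lt_one
    exact Summable.of_nat_of_neg (by simpa using h0) (by simpa using h0)
  rw [geoZ, ← ENNReal.ofReal_tsum_of_nonneg (fun N => pow_nonneg kap_pos.le _) h]
  exact ENNReal.ofReal_ne_top

theorem tsum_kap (l : ℤ) : ∑' N : ℤ, ENNReal.ofReal (kap ^ (4 * (N + l).natAbs)) = geoZ :=
  (Equiv.addRight l).tsum_eq fun N : ℤ => ENNReal.ofReal (kap ^ (4 * N.natAbs))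

open FourierTransform

theorem tsum_lintegral_weight_le (hf : Nice f) (k : ℕ) :
    ∑' m : ℤ, ∫⁻ ξ, ENNReal.ofReal (kap ^ (4 * k + 4 * (m + lg ξ).natAbs)) * ‖𝓕 f ξ‖ₑ ^ 2 ≤
      geoZ * ENNReal.ofReal (kap ^ (4 * k)) * ∫⁻ x, ‖f x‖ₑ ^ 2 := by
  have hm : Measurable fun ξ => ‖𝓕 f ξ‖ₑ ^ 2 := ((continuous_fourier_nice hf).enorm.measurable).pow_const 2
  have hmm : ∀ m : ℤ, Measurable fun ξ : Rd d => ENNReal.ofReal (kap ^ (4 * k + 4 * (m + lg ξ).natAbs)) :=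
    fun m => (measurable_of_countable fun l : ℤ => ENNReal.ofReal (kap ^ (4 * k + 4 * (m + l).natAbs))).comp
      measurable_lg
  rw [← lintegral_tsum (f := fun (m : ℤ) (ξ : Rd d) => ENNReal.ofReal (kap ^ (4 * k + 4 * (m + lg ξ).natAbs)) * ‖𝓕 f ξ‖ₑ ^ 2)
    fun m => ((hmm m).mul hm).aemeasurable, ← plancherel hf, ← lintegral_const_mul _ hm]
  refine lintegral_mono fun ξ => ?_
  rw [ENNReal.tsum_mul_right]
  gcongr
  simp only [pow_add _ (4 * k), ENNReal.ofReal_mul (pow_nonneg kap_pos.le (4 * k))]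
  rw [ENNReal.tsum_mul_left, tsum_kap, mul_comm]

/-- A pointwise bound of multipliers gives an `L²` bound. -/
theorem lintegral_sq_le_weight (hd : 1 ≤ d) {h : Rd d → ℂ} (hh : Nice h) {B : ℝ} {e : ℤ → ℕ} {e' : ℤ → ℕ}
    (he : ∀ l, e' l ≤ 2 * e l)
    (H : ∀ ξ, ξ ≠ 0 → ‖𝓕 h ξ‖ ≤ B * kap ^ e (lg ξ) * ‖𝓕 f ξ‖) :
    ∫⁻ x, ‖h x‖ₑ ^ 2 ≤ ENNReal.ofReal (B ^ 2) * ∫⁻ ξ, ENNReal.ofReal (kap ^ e' (lg ξ)) * ‖𝓕 f ξ‖ₑ ^ 2 := by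
  have : Nonempty (Fin d) := ⟨⟨0, hd⟩⟩
  rw [← plancherel hh, ← lintegral_const_mul' _ _ ENNReal.ofReal_ne_top]
  refine lintegral_mono_ae ?_
  have : ∀ᵐ ξ : Rd d, ξ ≠ 0 := by simp [ae_iff]
  filter_upwards [this] with ξ hξ
  have h1 : ‖𝓕 h ξ‖ ^ 2 ≤ B ^ 2 * kap ^ e' (lg ξ) * ‖𝓕 f ξ‖ ^ 2 := by
    calc ‖𝓕 h ξ‖ ^ 2 ≤ (B * kap ^ e (lg ξ) * ‖𝓕 f ξ‖) ^ 2 := by gcongr; exact H ξ hξ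
      _ = B ^ 2 * kap ^ (2 * e (lg ξ)) * ‖𝓕 f ξ‖ ^ 2 := by ring
      _ ≤ _ := by gcongr ?_ * ?_ * ?_; exact kap_pow_le (he _)
  have h2 := ENNReal.ofReal_le_ofReal h1
  rw [ENNReal.ofReal_mul (mul_nonneg (sq_nonneg B) (pow_nonneg kap_pos.le _)), ENNReal.ofReal_mul (sq_nonneg B), ENNReal.ofReal_pow (norm_nonneg _),
    ENNReal.ofReal_pow (norm_nonneg _), ofReal_norm, ofReal_norm, mul_assoc] at h2
  exact h2

theorem fourier_diff {h : Rd d → ℂ} (hh : Nice h) (u ξ : Rd d) :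
    𝓕 (fun x => h (x + u) - h x) ξ = ((Real.fourierChar (inner ℝ u ξ) : ℂ) - 1) * 𝓕 h ξ := by
  rw [fourier_sub (hh.shift u) hh, fourier_shift, sub_mul, one_mul]

/-- Dyadic oscillations of the kernel pieces at finer scales. -/
theorem exists_D_cv_le (hd : 1 ≤ d) (C : ℝ) : ∃ B : ℝ≥0∞, B ≠ ⊤ ∧ ∀ Ω : Rd d → ℂ, MZ Ω C → ∀ f, Nice f →
    ∀ k : ℕ, ∑' m : ℤ, ∫⁻ x, ‖D m (cv (ker Ω (m + k)) f) x‖ₑ ^ 2 ≤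
      B * ENNReal.ofReal (kap ^ (4 * k)) * ∫⁻ x, ‖f x‖ₑ ^ 2 := by
  obtain ⟨B, hB, H⟩ := exists_fourier_ker_le d C
  obtain ⟨B', hB', H'⟩ := exists_fourierChar_sub_one_le (√d) (Real.sqrt_nonneg _)
  set V : ℝ≥0∞ := ENNReal.ofReal (√d ^ d) * volume (Metric.closedBall (0 : Rd d) 1)
  have hV : V ≠ ⊤ := ENNReal.mul_ne_top ENNReal.ofReal_ne_top measure_closedBall_lt_top.ne
  refine ⟨V * ENNReal.ofReal ((B' * B) ^ 2) * geoZ, by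
    exact ENNReal.mul_ne_top (ENNReal.mul_ne_top hV ENNReal.ofReal_ne_top) geoZ_ne_top, fun Ω hΩ f hf k => ?_⟩
  have key : ∀ m : ℤ, ∫⁻ x, ‖D m (cv (ker Ω (m + k)) f) x‖ₑ ^ 2 ≤
      V * ENNReal.ofReal ((B' * B) ^ 2) *
        ∫⁻ ξ, ENNReal.ofReal (kap ^ (4 * k + 4 * (m + lg ξ).natAbs)) * ‖𝓕 f ξ‖ₑ ^ 2 := by
    intro m
    have hh : Nice (cv (ker Ω (m + k)) f) := (nice_ker hΩ.1 _).cv hf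
    refine (lintegral_D_sq_le hh).trans ?_
    calc _ ≤ (vol d m)⁻¹ * ∫⁻ u in Metric.closedBall (0 : Rd d) (√d * 2 ^ m),
          (ENNReal.ofReal ((B' * B) ^ 2) *
            ∫⁻ ξ, ENNReal.ofReal (kap ^ (4 * k + 4 * (m + lg ξ).natAbs)) * ‖𝓕 f ξ‖ₑ ^ 2) := by
          refine mul_le_mul_right ?_ _
          refine setLIntegral_mono' (Metric.isClosed_closedBall (x := (0 : Rd d))).measurableSet fun u hu => ?_
          rw [mem_closedBall_zero_iff] at hu
          refine lintegral_sq_le_weight hd ((hh.shift u).sub hh) (B := B' * B)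
            (e := fun l => 8 * (-(m + l)).toNat + 4 * (m + k + l).natAbs)
            (e' := fun l => 4 * k + 4 * (m + l).natAbs) (fun l => by omega) fun ξ hξ => ?_
          obtain ⟨h1, h2⟩ := lg_bounds hξ
          rw [fourier_diff hh, fourier_cv (nice_ker hΩ.1 _) hf, norm_mul, norm_mul, ← mul_assoc]
          have a1 := H' d u ξ m (lg ξ) hu h1 h2
          have a2 := (H Ω hΩ.1 (m + k) (lg ξ) ξ h1 h2).2.2 hΩ.2
          refine mul_le_mul_of_nonneg_right ?_ (norm_nonneg _)
          calc _ ≤ (B' * kap ^ (8 * (-(m + lg ξ)).toNat)) * (B * kap ^ (4 * (m + k + lg ξ).natAbs)) :=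
                mul_le_mul a1 a2 (norm_nonneg _) (mul_nonneg hB' (pow_nonneg kap_pos.le _))
            _ = _ := by rw [pow_add]; ring
      _ = _ := by
          have hv : volume (Metric.closedBall (0 : Rd d) (√d * 2 ^ m)) = vol d m * V := by
            rw [Measure.addHaar_closedBall' _ _ (by positivity), Measure.addHaar_closedBall' _ (0 : Rd d) zero_le_one]
            simp only [one_pow, ENNReal.ofReal_one, one_mul, V, vol, finrank_euclideanSpace, Fintype.card_fin]
            rw [mul_pow, ENNReal.ofReal_mul (by positivity)]
            rw [Measure.addHaar_closedBall' _ (0 : Rd d) zero_le_one]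
            simp only [one_pow, ENNReal.ofReal_one, one_mul]; ring
          rw [lintegral_const, Measure.restrict_apply_univ, hv]
          rw [mul_left_comm, ← mul_assoc (vol d m)⁻¹,
            ENNReal.inv_mul_cancel (vol_ne_zero m) (vol_ne_top m)]
          ring
  refine (ENNReal.tsum_le_tsum key).trans ?_
  rw [ENNReal.tsum_mul_left]
  refine (mul_le_mul_right (tsum_lintegral_weight_le hf k) _).trans_eq ?_
  ring

end A1Rough

namespace A1Rough

variable {d : ℕ} {Ω : Rd d → ℂ} {C : ℝ} {f : Rd d → ℂ}

theorem lintegral_mul_sq_le {α : Type*} [MeasurableSpace α] (μ : Measure α) {f g : α → ℝ≥0∞}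
    (hf : AEMeasurable f μ) (hg : AEMeasurable g μ) :
    (∫⁻ x, f x * g x ∂μ) ^ 2 ≤ (∫⁻ x, f x ^ 2 ∂μ) * ∫⁻ x, g x ^ 2 ∂μ := by
  have h := ENNReal.lintegral_mul_le_Lp_mul_Lq μ Real.HolderConjugate.two_two hf hg
  simp only [Pi.mul_apply, ENNReal.rpow_two] at h
  refine (pow_le_pow_left' h 2).trans_eq ?_
  rw [mul_pow, ← ENNReal.rpow_two, ← ENNReal.rpow_two, ← ENNReal.rpow_mul, ← ENNReal.rpow_mul]
  norm_num

theorem tsum_mul_sq_le {ι : Type*} (a b : ι → ℝ≥0∞) :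
    (∑' i, a i * b i) ^ 2 ≤ (∑' i, a i ^ 2) * ∑' i, b i ^ 2 := by
  let _ : MeasurableSpace ι := ⊤
  have := lintegral_mul_sq_le (Measure.count (α := ι)) (f := a) (g := b)
    measurable_from_top.aemeasurable measurable_from_top.aemeasurable
  simpa only [lintegral_count] using this

theorem sum_mul_sq_le {ι : Type*} (s : Finset ι) (a b : ι → ℝ≥0∞) :
    (∑ i ∈ s, a i * b i) ^ 2 ≤ (∑ i ∈ s, a i ^ 2) * ∑ i ∈ s, b i ^ 2 := by
  simp only [← Finset.tsum_subtype s]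
  exact tsum_mul_sq_le (fun i : s => a i) (fun i : s => b i)

theorem sum_lintegral_mul_sq_le {ι α : Type*} [MeasurableSpace α] (μ : Measure α) (s : Finset ι)
    {f g : ι → α → ℝ≥0∞} (hf : ∀ i, AEMeasurable (f i) μ) (hg : ∀ i, AEMeasurable (g i) μ) :
    (∑ i ∈ s, ∫⁻ x, f i x * g i x ∂μ) ^ 2 ≤
      (∑ i ∈ s, ∫⁻ x, f i x ^ 2 ∂μ) * ∑ i ∈ s, ∫⁻ x, g i x ^ 2 ∂μ := by
  have h2 : ∀ y : ℝ≥0∞, (y ^ (1 / 2 : ℝ)) ^ 2 = y := fun y => by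
    rw [← ENNReal.rpow_two, ← ENNReal.rpow_mul]; norm_num
  have h1 : ∀ i, ∫⁻ x, f i x * g i x ∂μ ≤
      (∫⁻ x, f i x ^ 2 ∂μ) ^ (1 / 2 : ℝ) * (∫⁻ x, g i x ^ 2 ∂μ) ^ (1 / 2 : ℝ) := by
    intro i
    have h := ENNReal.lintegral_mul_le_Lp_mul_Lq μ Real.HolderConjugate.two_two (hf i) (hg i)
    simpa only [Pi.mul_apply, ENNReal.rpow_two] using h
  refine (pow_le_pow_left' (Finset.sum_le_sum fun i _ => h1 i) 2).trans ((sum_mul_sq_le s _ _).trans_eq ?_)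
  simp only [h2]

theorem le_of_sq_le_mul {X Y : ℝ≥0∞} (hX : X ≠ ⊤) (h : X ^ 2 ≤ Y * X) : X ≤ Y := by
  rcases eq_or_ne X 0 with rfl | h0
  · simp
  · rw [sq] at h
    exact (ENNReal.mul_le_mul_iff_left h0 hX).1 h

theorem Nice.lintegral_sq_ne_top (hf : Nice f) : ∫⁻ x, ‖f x‖ₑ ^ 2 ≠ ⊤ := by
  rw [← eLpNorm_two_sq]
  exact ENNReal.pow_ne_top (hf.memLp 2).2.ne

theorem ker_neg (Ω : Rd d → ℂ) (j : ℤ) : (fun z => ker Ω j (-z)) = ker (fun x => Ω (-x)) j := by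
  ext z; simp [ker]

theorem MZ.neg (h : MZ Ω C) : MZ (fun x => Ω (-x)) C := by
  obtain ⟨⟨h1, h2, h3, h4⟩, h5⟩ := h
  refine ⟨⟨h1, h2.comp measurable_neg, fun r x hr hx => ?_, fun x hx => h4 _ (by simpa using hx)⟩, ?_⟩
  · show Ω (-(r • x)) = Ω (-x)
    rw [← smul_neg]; exact h3 r _ hr (by simpa using hx)
  · rw [← ker_neg, integral_neg_eq_self (ker Ω 0), h5]

open FourierTransform

theorem tsum_multiplier_le (hd : 1 ≤ d) (hf : Nice f) {h : ℤ → Rd d → ℂ} (hh : ∀ J, Nice (h J)) {B : ℝ}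
    (k : ℕ) {e : ℤ → ℤ → ℕ} (he : ∀ J l, 4 * k + 4 * (J + l).natAbs ≤ 2 * e J l)
    (H : ∀ J ξ, ξ ≠ 0 → ‖𝓕 (h J) ξ‖ ≤ B * kap ^ e J (lg ξ) * ‖𝓕 f ξ‖) :
    ∑' J, ∫⁻ x, ‖h J x‖ₑ ^ 2 ≤
      ENNReal.ofReal (B ^ 2) * geoZ * ENNReal.ofReal (kap ^ (4 * k)) * ∫⁻ x, ‖f x‖ₑ ^ 2 := by
  refine (ENNReal.tsum_le_tsum fun J => lintegral_sq_le_weight hd (hh J) (he J) (H J)).trans ?_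
  rw [ENNReal.tsum_mul_left]
  refine (mul_le_mul_right (tsum_lintegral_weight_le hf k) _).trans_eq ?_
  ring

theorem Nice.phi (hf : Nice f) (J : ℤ) : Nice (A1Rough.cv (phi d J) f) := (nice_phi d J).cv hf

theorem exists_phi_bounds (hd : 1 ≤ d) : ∃ B : ℝ, 0 ≤ B ∧
    ∀ (J : ℤ) (ξ : Rd d), ξ ≠ 0 → ‖𝓕 (phi d J) ξ‖ ≤ B * kap ^ (4 * (J + lg ξ).toNat) ∧
      ‖1 - 𝓕 (phi d J) ξ‖ ≤ B * kap ^ (8 * (-(J + lg ξ)).toNat) := by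
  obtain ⟨B, hB, H⟩ := exists_fourier_ker_le d (phiC d)
  refine ⟨B, hB, fun J ξ hξ => ?_⟩
  obtain ⟨h1, h2⟩ := lg_bounds hξ
  have h := H _ (homog_phi d) J (lg ξ) ξ h1 h2
  refine ⟨h.1, ?_⟩
  have h3 : ∫ x, ker (fun _ : Rd d => (phiC d : ℂ)) 0 x = 1 := integral_phi hd
  rw [h3, norm_sub_rev _ 1] at h
  exact h.2.1

/-- Large scale pieces are almost invariant under small scale averaging. -/
theorem exists_sub_phi_le (hd : 1 ≤ d) (C : ℝ) : ∃ B : ℝ≥0∞, B ≠ ⊤ ∧ ∀ Ω : Rd d → ℂ, MZ Ω C → ∀ f, Nice f →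
    ∀ k : ℕ, ∑' J : ℤ, ∫⁻ x, ‖cv (ker Ω (J + k)) f x - cv (phi d J) (cv (ker Ω (J + k)) f) x‖ₑ ^ 2 ≤
      B * ENNReal.ofReal (kap ^ (4 * k)) * ∫⁻ x, ‖f x‖ₑ ^ 2 := by
  obtain ⟨B, hB, H⟩ := exists_fourier_ker_le d C
  obtain ⟨B', hB', H'⟩ := exists_phi_bounds hd
  refine ⟨ENNReal.ofReal ((B' * B) ^ 2) * geoZ, ENNReal.mul_ne_top ENNReal.ofReal_ne_top geoZ_ne_top,
    fun Ω hΩ f hf k => ?_⟩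
  have hh : ∀ J : ℤ, Nice (cv (ker Ω (J + k)) f) := fun J => (nice_ker hΩ.1 _).cv hf
  refine tsum_multiplier_le hd hf (fun J => (hh J).sub ((hh J).phi J)) k
    (e := fun J l => 8 * (-(J + l)).toNat + 4 * (J + k + l).natAbs) (fun J l => by omega) fun J ξ hξ => ?_
  obtain ⟨h1, h2⟩ := lg_bounds hξ
  have a1 := (H' J ξ hξ).2
  have a2 := (H Ω hΩ.1 (J + k) (lg ξ) ξ h1 h2).2.2 hΩ.2
  rw [fourier_sub (hh J) ((hh J).phi J), fourier_cv (nice_phi d J) (hh J), fourier_cv (nice_ker hΩ.1 _) hf,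
    ← one_sub_mul, norm_mul, norm_mul, ← mul_assoc]
  refine mul_le_mul_of_nonneg_right ?_ (norm_nonneg _)
  calc _ ≤ (B' * kap ^ (8 * (-(J + lg ξ)).toNat)) * (B * kap ^ (4 * (J + k + lg ξ).natAbs)) :=
        mul_le_mul a1 a2 (norm_nonneg _) (mul_nonneg hB' (pow_nonneg kap_pos.le _))
    _ = _ := by rw [pow_add]; ring

/-- Large scale averages of small scale pieces are small. -/
theorem exists_phi_le (hd : 1 ≤ d) (C : ℝ) : ∃ B : ℝ≥0∞, B ≠ ⊤ ∧ ∀ Ω : Rd d → ℂ, MZ Ω C → ∀ f, Nice f →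
    ∀ k : ℕ, ∑' J : ℤ, ∫⁻ x, ‖cv (phi d J) (cv (ker Ω (J - k)) f) x‖ₑ ^ 2 ≤
      B * ENNReal.ofReal (kap ^ (4 * k)) * ∫⁻ x, ‖f x‖ₑ ^ 2 := by
  obtain ⟨B, hB, H⟩ := exists_fourier_ker_le d C
  obtain ⟨B', hB', H'⟩ := exists_phi_bounds hd
  refine ⟨ENNReal.ofReal ((B' * B) ^ 2) * geoZ, ENNReal.mul_ne_top ENNReal.ofReal_ne_top geoZ_ne_top,
    fun Ω hΩ f hf k => ?_⟩
  have hh : ∀ J : ℤ, Nice (cv (ker Ω (J - k)) f) := fun J => (nice_ker hΩ.1 _).cv hf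
  refine tsum_multiplier_le hd hf (fun J => (hh J).phi J) k
    (e := fun J l => 4 * (J + l).toNat + 4 * (J - k + l).natAbs) (fun J l => by omega) fun J ξ hξ => ?_
  obtain ⟨h1, h2⟩ := lg_bounds hξ
  have a1 := (H' J ξ hξ).1
  have a2 := (H Ω hΩ.1 (J - k) (lg ξ) ξ h1 h2).2.2 hΩ.2
  rw [fourier_cv (nice_phi d J) (hh J), fourier_cv (nice_ker hΩ.1 _) hf, norm_mul, norm_mul, ← mul_assoc]
  refine mul_le_mul_of_nonneg_right ?_ (norm_nonneg _)
  calc _ ≤ (B' * kap ^ (4 * (J + lg ξ).toNat)) * (B * kap ^ (4 * (J - k + lg ξ).natAbs)) :=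
        mul_le_mul a1 a2 (norm_nonneg _) (mul_nonneg hB' (pow_nonneg kap_pos.le _))
    _ = _ := by rw [pow_add]; ring

theorem exists_phi_sq_le (hd : 1 ≤ d) : ∃ B : ℝ≥0∞, B ≠ ⊤ ∧ ∀ f : Rd d → ℂ, Nice f → ∀ J,
    ∫⁻ x, ‖cv (phi d J) f x‖ₑ ^ 2 ≤ B * ∫⁻ x, ‖f x‖ₑ ^ 2 ∧
    ∫⁻ x, ‖f x - cv (phi d J) f x‖ₑ ^ 2 ≤ B * ∫⁻ x, ‖f x‖ₑ ^ 2 := by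
  obtain ⟨B', hB', H'⟩ := exists_phi_bounds hd
  refine ⟨ENNReal.ofReal (B' ^ 2), ENNReal.ofReal_ne_top, fun f hf J => ?_⟩
  have hm : ∫⁻ ξ, ENNReal.ofReal (kap ^ 0) * ‖𝓕 f ξ‖ₑ ^ 2 = ∫⁻ x, ‖f x‖ₑ ^ 2 := by
    simp [plancherel hf]
  have hk : ∀ n, kap ^ n ≤ kap ^ 0 := fun n => kap_pow_le (by omega)
  rw [← hm]
  constructor
  · refine lintegral_sq_le_weight hd (hf.phi J) (e := fun _ => 0) (e' := fun _ => 0) (by simp) fun ξ hξ => ?_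
    rw [fourier_cv (nice_phi d J) hf, norm_mul]
    exact mul_le_mul_of_nonneg_right ((H' J ξ hξ).1.trans (mul_le_mul_of_nonneg_left (hk _) hB')) (norm_nonneg _)
  · refine lintegral_sq_le_weight hd (hf.sub (hf.phi J)) (e := fun _ => 0) (e' := fun _ => 0) (by simp) fun ξ hξ => ?_
    rw [fourier_sub hf (hf.phi J), fourier_cv (nice_phi d J) hf, ← one_sub_mul, norm_mul]
    exact mul_le_mul_of_nonneg_right ((H' J ξ hξ).2.trans (mul_le_mul_of_nonneg_left (hk _) hB')) (norm_nonneg _)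

/-- `L²` bound for the sum of the kernel pieces. -/
theorem exists_sum_ker_le (hd : 1 ≤ d) (C : ℝ) : ∃ B : ℝ≥0∞, B ≠ ⊤ ∧ ∀ Ω : Rd d → ℂ, MZ Ω C → ∀ f, Nice f →
    ∀ s : Finset ℤ, ∫⁻ x, ‖∑ j ∈ s, cv (ker Ω j) f x‖ₑ ^ 2 ≤ B * ∫⁻ x, ‖f x‖ₑ ^ 2 := by
  obtain ⟨B, hB, H⟩ := exists_fourier_ker_le d C
  refine ⟨ENNReal.ofReal ((B * geoZ.toReal) ^ 2), ENNReal.ofReal_ne_top, fun Ω hΩ f hf s => ?_⟩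
  have hm : ∫⁻ ξ, ENNReal.ofReal (kap ^ 0) * ‖𝓕 f ξ‖ₑ ^ 2 = ∫⁻ x, ‖f x‖ₑ ^ 2 := by
    simp [plancherel hf]
  have hh : ∀ j ∈ s, Nice (cv (ker Ω j) f) := fun j _ => (nice_ker hΩ.1 _).cv hf
  rw [← hm]
  refine lintegral_sq_le_weight hd (Nice.sum s hh) (e := fun _ => 0) (e' := fun _ => 0) (by simp) fun ξ hξ => ?_
  obtain ⟨h1, h2⟩ := lg_bounds hξ
  have hsum : ∑ j ∈ s, kap ^ (4 * (j + lg ξ).natAbs) ≤ geoZ.toReal := by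
    rw [← ENNReal.toReal_ofReal (Finset.sum_nonneg fun j _ => pow_nonneg kap_pos.le _),
      ENNReal.ofReal_sum_of_nonneg fun j _ => pow_nonneg kap_pos.le _]
    refine ENNReal.toReal_mono geoZ_ne_top ?_
    rw [← tsum_kap (lg ξ)]
    exact ENNReal.sum_le_tsum s
  rw [fourier_sum s hh, pow_zero, mul_one]
  calc ‖∑ j ∈ s, 𝓕 (cv (ker Ω j) f) ξ‖ ≤ ∑ j ∈ s, B * kap ^ (4 * (j + lg ξ).natAbs) * ‖𝓕 f ξ‖ := by
        refine (norm_sum_le _ _).trans (Finset.sum_le_sum fun j _ => ?_)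
        rw [fourier_cv (nice_ker hΩ.1 _) hf, norm_mul]
        exact mul_le_mul_of_nonneg_right ((H Ω hΩ.1 j (lg ξ) ξ h1 h2).2.2 hΩ.2) (norm_nonneg _)
    _ = B * (∑ j ∈ s, kap ^ (4 * (j + lg ξ).natAbs)) * ‖𝓕 f ξ‖ := by
        rw [Finset.mul_sum, Finset.sum_mul]
    _ ≤ _ := by gcongr

/-- Kernel pieces acting on functions oscillating at smaller scales. -/
theorem exists_sum_ker_osc_le (hd : 1 ≤ d) (C : ℝ) : ∃ B : ℝ≥0∞, B ≠ ⊤ ∧ ∀ Ω : Rd d → ℂ, MZ Ω C →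
    ∀ (s : Finset ℤ) (b : ℤ → Rd d → ℂ), (∀ m, Nice (b m)) → (∀ m ∈ s, ∀ x, E m (b m) x = 0) → ∀ i : ℕ,
    ∫⁻ x, ‖∑ m ∈ s, cv (ker Ω (m + i)) (b m) x‖ₑ ^ 2 ≤
      B * ENNReal.ofReal (kap ^ (4 * i)) * ∑ m ∈ s, ∫⁻ x, ‖b m x‖ₑ ^ 2 := by
  obtain ⟨B, hB, H⟩ := exists_D_cv_le hd C
  refine ⟨B, hB, fun Ω hΩ s b hb hE i => ?_⟩
  have hk : ∀ m ∈ s, Nice (cv (ker Ω (m + i)) (b m)) := fun m _ => (nice_ker hΩ.1 _).cv (hb m)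
  set h : Rd d → ℂ := fun x => ∑ m ∈ s, cv (ker Ω (m + i)) (b m) x with hh
  have hn : Nice h := Nice.sum s hk
  set g : Rd d → ℂ := fun x => (starRingEnd ℂ) (h x) with hg
  have hgn : Nice g := hn.conj
  have hgK : ∀ m : ℤ, Nice (cv (ker (fun x => Ω (-x)) (m + i)) g) := fun m => (nice_ker hΩ.neg.1 _).cv hgn
  have hX : ∫⁻ x, ‖h x‖ₑ ^ 2 ≤ ∑ m ∈ s, ∫⁻ x, ‖b m x‖ₑ * ‖D m (cv (ker (fun x => Ω (-x)) (m + i)) g) x‖ₑ := by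
    have e1 : ∫ x, h x * g x = ∑ m ∈ s, ∫ x, b m x * D m (cv (ker (fun x => Ω (-x)) (m + i)) g) x := by
      have : ∀ x, h x * g x = ∑ m ∈ s, cv (ker Ω (m + i)) (b m) x * g x := fun x => Finset.sum_mul _ _ _
      simp only [this]
      rw [integral_finsetSum]
      · refine Finset.sum_congr rfl fun m hm => ?_
        rw [cv_transpose (nice_ker hΩ.1 _) (hb m) hgn, ker_neg, integral_mul_D (hb m) (hgK m) (hE m hm)]
      · intro m hm
        exact (hk m hm).integrable.mul_bdd (c := hgn.2.1.choose) hgn.1.aestronglyMeasurable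
          (Filter.Eventually.of_forall hgn.2.1.choose_spec)
    have e2 : ∫⁻ x, ‖h x‖ₑ ^ 2 = ‖∫ x, h x * g x‖ₑ := by
      have : ∀ x, h x * g x = ((‖h x‖ ^ 2 : ℝ) : ℂ) := fun x => by rw [hg, Complex.mul_conj']; push_cast; rfl
      simp only [this]
      rw [integral_complex_ofReal, ← ofReal_norm, Complex.norm_real,
        Real.norm_of_nonneg (integral_nonneg fun x => sq_nonneg _),
        ofReal_integral_eq_lintegral_ofReal ((hn.memLp 2).integrable_norm_pow two_ne_zero)
          (Filter.Eventually.of_forall fun x => sq_nonneg _)]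
      simp only [ENNReal.ofReal_pow (norm_nonneg _), ofReal_norm]
    rw [e2, e1]
    refine (enorm_sum_le _ _).trans (Finset.sum_le_sum fun m _ => ?_)
    refine (enorm_integral_le_lintegral_enorm _).trans_eq ?_
    simp only [enorm_mul]
  refine le_of_sq_le_mul hn.lintegral_sq_ne_top ?_
  refine (pow_le_pow_left' hX 2).trans ?_
  refine (sum_lintegral_mul_sq_le volume s (fun m => (hb m).1.enorm.aemeasurable)
    (fun m => ((hgK m).D m).1.enorm.aemeasurable)).trans ?_
  have h3 := (ENNReal.sum_le_tsum s).trans (H _ hΩ.neg g hgn i)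
  refine (mul_le_mul_right h3 _).trans_eq ?_
  have : ∫⁻ x, ‖g x‖ₑ ^ 2 = ∫⁻ x, ‖h x‖ₑ ^ 2 := by simp [hg]
  rw [this]; ring

end A1Rough

namespace A1Rough

/-- The centred maximal function, normalised by `r ^ d`. -/
def Mx {d : ℕ} (g : Rd d → ℝ≥0∞) (x : Rd d) : ℝ≥0∞ :=
  ⨆ (r : ℝ) (_ : 0 < r), (ENNReal.ofReal (r ^ d))⁻¹ * ∫⁻ y in Metric.ball x r, g y

variable {d : ℕ}

lemma ofReal_pow_ne_zero {r : ℝ} (hr : 0 < r) : ENNReal.ofReal (r ^ d) ≠ 0 := by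
  simpa using pow_pos hr d

lemma lintegral_ball_le_Mx (g : Rd d → ℝ≥0∞) (x : Rd d) {r : ℝ} (hr : 0 < r) :
    ∫⁻ y in Metric.ball x r, g y ≤ ENNReal.ofReal (r ^ d) * Mx g x := by
  have h : (ENNReal.ofReal (r ^ d))⁻¹ * ∫⁻ y in Metric.ball x r, g y ≤ Mx g x :=
    le_iSup₂_of_le r hr le_rfl
  rwa [ENNReal.inv_mul_le_iff (ofReal_pow_ne_zero hr) ENNReal.ofReal_ne_top] at h

lemma lt_Mx_iff {g : Rd d → ℝ≥0∞} {x : Rd d} {l : ℝ≥0∞} :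
    l < Mx g x ↔ ∃ r : ℝ, 0 < r ∧ ENNReal.ofReal (r ^ d) * l < ∫⁻ y in Metric.ball x r, g y := by
  simp only [Mx, lt_iSup_iff, exists_prop]
  refine exists_congr fun r => and_congr_right fun hr => ?_
  rw [← ENNReal.div_eq_inv_mul, ENNReal.lt_div_iff_mul_lt (Or.inl (ofReal_pow_ne_zero hr))
    (Or.inl ENNReal.ofReal_ne_top), mul_comm]

lemma lintegral_ball_eq_iSup (g : Rd d → ℝ≥0∞) (x : Rd d) (r : ℝ) :
    ∫⁻ y in Metric.ball x r, g y =
      ⨆ n : ℕ, ∫⁻ y in Metric.ball x (r - 1 / ((n : ℝ) + 1)), g y := by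
  have hU : Metric.ball x r = ⋃ n : ℕ, Metric.ball x (r - 1 / ((n : ℝ) + 1)) := by
    ext y
    simp only [Metric.mem_ball, Set.mem_iUnion]
    constructor
    · intro h
      obtain ⟨n, hn⟩ := exists_nat_one_div_lt (sub_pos.2 h)
      exact ⟨n, by linarith⟩
    · rintro ⟨n, hn⟩
      have : (0 : ℝ) < 1 / ((n : ℝ) + 1) := by positivity
      linarith
  conv_lhs => rw [hU]
  rw [setLIntegral_iUnion_of_directed]
  refine Monotone.directed_le fun a b hab => Metric.ball_subset_ball ?_
  have : 1 / ((b : ℝ) + 1) ≤ 1 / ((a : ℝ) + 1) := by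
    apply one_div_le_one_div_of_le (by positivity); simpa using hab
  linarith

lemma isOpen_lt_Mx (g : Rd d → ℝ≥0∞) (l : ℝ≥0∞) : IsOpen {x | l < Mx g x} := by
  rw [Metric.isOpen_iff]
  intro x hx
  obtain ⟨r, hr, h⟩ := lt_Mx_iff.1 hx
  rw [lintegral_ball_eq_iSup, lt_iSup_iff] at h
  obtain ⟨n, hn⟩ := h
  have hpos : (0 : ℝ) < 1 / ((n : ℝ) + 1) := by positivity
  refine ⟨1 / ((n : ℝ) + 1), hpos, fun y hy => lt_Mx_iff.2 ⟨r, hr, hn.trans_le ?_⟩⟩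
  refine lintegral_mono_set fun z hz => ?_
  rw [Metric.mem_ball] at *
  have := dist_triangle z x y
  rw [dist_comm x y] at this
  linarith

lemma measurable_Mx (g : Rd d → ℝ≥0∞) : Measurable (Mx g) :=
  measurable_of_Ioi fun l => (isOpen_lt_Mx g l).measurableSet

/-- The volume of the unit ball. -/
def volB (d : ℕ) : ℝ≥0∞ := volume (Metric.ball (0 : Rd d) 1)

lemma volB_ne_top : volB d ≠ ⊤ := measure_ball_lt_top.ne

lemma volB_ne_zero : volB d ≠ 0 := (Metric.measure_ball_pos volume _ one_pos).ne'

lemma volume_ball_eq (x : Rd d) {r : ℝ} (hr : 0 < r) :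
    volume (Metric.ball x r) = ENNReal.ofReal (r ^ d) * volB d := by
  rw [Measure.addHaar_ball_of_pos _ _ hr]; simp [volB]

lemma volume_closedBall_eq (x : Rd d) {r : ℝ} (hr : 0 ≤ r) :
    volume (Metric.closedBall x r) = ENNReal.ofReal (r ^ d) * volB d := by
  rw [Measure.addHaar_closedBall _ _ hr]; simp [volB]

/-- Weak type (1,1). -/
lemma volume_lt_Mx_le (hd : 1 ≤ d) (g : Rd d → ℝ≥0∞) (l : ℝ≥0∞) :
    l * volume {x | l < Mx g x} ≤ volB d * 5 ^ d * ∫⁻ x, g x := by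
  have hC : volB d * 5 ^ d ≠ 0 := mul_ne_zero volB_ne_zero (by simp)
  rcases eq_or_ne l 0 with rfl | hl
  · simp
  rcases eq_or_ne (∫⁻ x, g x) ⊤ with hG | hG
  · rw [hG, ENNReal.mul_top hC]; exact le_top
  rcases eq_or_ne l ⊤ with rfl | hlt
  · simp
  set t : Set (Rd d) := {x | l < Mx g x}
  have hch : ∀ x : t, ∃ r : ℝ, 0 < r ∧
      ENNReal.ofReal (r ^ d) * l < ∫⁻ y in Metric.ball (x : Rd d) r, g y :=
    fun x => lt_Mx_iff.1 x.2
  choose r hr hrl using hch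
  have hbd : ∀ x : t, r x ≤ max 1 ((∫⁻ x, g x) / l).toReal := by
    intro x
    rcases le_total (r x) 1 with h1 | h1
    · exact h1.trans (le_max_left _ _)
    refine le_trans ?_ (le_max_right _ _)
    have h2 : ENNReal.ofReal (r x ^ d) ≤ (∫⁻ x, g x) / l := by
      rw [ENNReal.le_div_iff_mul_le (Or.inl hl) (Or.inl hlt)]
      exact (hrl x).le.trans (setLIntegral_le_lintegral _ _)
    have h3 := (ENNReal.ofReal_le_iff_le_toReal (ENNReal.div_ne_top hG hl)).1 h2
    exact (le_self_pow₀ h1 (by omega)).trans h3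
  obtain ⟨u, -, hdisj, hcov⟩ := Vitali.exists_disjoint_subfamily_covering_enlargement_closedBall
    (Set.univ : Set t) (fun x => (x : Rd d)) r _ (fun x _ => hbd x) 5 (by norm_num)
  have hcount : u.Countable := by
    refine hdisj.countable_of_nonempty_interior fun x _ => ?_
    refine ⟨(x : Rd d), ?_⟩
    exact interior_mono Metric.ball_subset_closedBall
      (by rw [Metric.isOpen_ball.interior_eq]; exact Metric.mem_ball_self (hr x))
  have := hcount.to_subtype
  have hsub : t ⊆ ⋃ b ∈ u, Metric.closedBall (b : Rd d) (5 * r b) := by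
    intro x hx
    obtain ⟨b, hb, hxb⟩ := hcov ⟨x, hx⟩ trivial
    exact Set.mem_biUnion hb (hxb (Metric.mem_closedBall_self (hr _).le))
  calc l * volume t ≤ l * ∑' b : u, volume (Metric.closedBall (b.1 : Rd d) (5 * r b)) :=
        mul_le_mul_right ((measure_mono hsub).trans (measure_biUnion_le _ hcount _)) _
    _ = ∑' b : u, volB d * 5 ^ d * (ENNReal.ofReal (r b ^ d) * l) := by
        rw [← ENNReal.tsum_mul_left]
        refine tsum_congr fun b => ?_
        rw [volume_closedBall_eq _ (by have := hr b.1; positivity), mul_pow,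
          ENNReal.ofReal_mul (by positivity), ENNReal.ofReal_pow (by norm_num)]
        simp only [ENNReal.ofReal_ofNat]
        ring
    _ ≤ ∑' b : u, volB d * 5 ^ d * ∫⁻ y in Metric.closedBall (b.1 : Rd d) (r b), g y :=
        ENNReal.tsum_le_tsum fun b => mul_le_mul_right ((hrl _).le.trans
          (lintegral_mono_set Metric.ball_subset_closedBall)) _
    _ = volB d * 5 ^ d * ∫⁻ y in ⋃ b : u, Metric.closedBall (b.1 : Rd d) (r b), g y := by
        rw [ENNReal.tsum_mul_left, lintegral_iUnion (fun _ => Metric.isClosed_closedBall.measurableSet)]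
        intro a b hab
        exact hdisj a.2 b.2 (fun h => hab (Subtype.ext h))
    _ ≤ _ := mul_le_mul_right (setLIntegral_le_lintegral _ _) _

lemma tsum_two_zpow_rpow_le {s : ℝ} (hs : 0 < s) (a : ℝ≥0∞) :
    ∑' k : ℤ, (if (2 : ℝ≥0∞) ^ k < a then ((2 : ℝ≥0∞) ^ k) ^ s else 0) ≤
      a ^ s * (1 - (2 : ℝ≥0∞) ^ (-s))⁻¹ := by
  rcases eq_or_ne a ⊤ with rfl | hat
  · rw [ENNReal.top_rpow_of_pos hs, ENNReal.top_mul]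
    · exact le_top
    · simp
  rcases eq_or_ne a 0 with rfl | ha
  · simp
  obtain ⟨N, hN1, hN2⟩ := ENNReal.exists_mem_Ioc_zpow (x := a) (y := 2) ha hat (by norm_num) (by simp)
  have key : ∀ i : ℕ, ((2 : ℝ≥0∞) ^ (N - (i : ℤ))) ^ s = ((2 : ℝ≥0∞) ^ N) ^ s * ((2 : ℝ≥0∞) ^ (-s)) ^ i := by
    intro i
    rw [← ENNReal.rpow_intCast, ← ENNReal.rpow_intCast, ← ENNReal.rpow_natCast, ← ENNReal.rpow_mul,
      ← ENNReal.rpow_mul, ← ENNReal.rpow_mul, ← ENNReal.rpow_add _ _ (by simp) (by simp)]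
    congr 1
    push_cast
    ring
  have hle : ∑' k : ℤ, (if (2 : ℝ≥0∞) ^ k < a then ((2 : ℝ≥0∞) ^ k) ^ s else 0) ≤
      ∑' i : ℕ, ((2 : ℝ≥0∞) ^ (N - (i : ℤ))) ^ s := by
    have hinj : Function.Injective (fun i : ℕ => N - (i : ℤ)) := fun i j h => by simpa using h
    refine le_trans (le_of_eq ?_) (ENNReal.tsum_le_tsum fun i => ?_) (b := ∑' i : ℕ, (fun k : ℤ => if (2 : ℝ≥0∞) ^ k < a then ((2 : ℝ≥0∞) ^ k) ^ s else 0) (N - (i : ℤ)))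
    · refine (hinj.tsum_eq ?_).symm
      intro k hk
      simp only [Function.mem_support, ne_eq, ite_eq_right_iff, Classical.not_imp] at hk
      have hkN : k ≤ N := by
        by_contra hcon
        have : (2 : ℝ≥0∞) ^ (N + 1) ≤ 2 ^ k := ENNReal.zpow_le_of_le (by norm_num) (by omega)
        exact absurd (hN2.trans this) (not_le.2 hk.1)
      exact ⟨(N - k).toNat, by simp; omega⟩
    · dsimp only
      split_ifs
      · exact le_rfl
      · exact zero_le
  refine hle.trans ?_
  simp_rw [key]
  rw [ENNReal.tsum_mul_left, ENNReal.tsum_geometric]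
  exact mul_le_mul_left (ENNReal.rpow_le_rpow hN1.le hs.le) _

lemma rpow_le_tsum_two_zpow {q : ℝ} (hq : 0 < q) (a : ℝ≥0∞) :
    a ^ q ≤ ∑' k : ℤ, (if (2 : ℝ≥0∞) ^ k < a then ((2 : ℝ≥0∞) ^ (k + 1)) ^ q else 0) := by
  rcases eq_or_ne a 0 with rfl | ha
  · simp [hq]
  rcases eq_or_ne a ⊤ with rfl | hat
  · have h1 : ∑' i : ℕ, (1 : ℝ≥0∞) ≤
        ∑' k : ℤ, (if (2 : ℝ≥0∞) ^ k < ⊤ then ((2 : ℝ≥0∞) ^ (k + 1)) ^ q else 0) := by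
      refine le_trans (ENNReal.tsum_le_tsum fun i => ?_)
        (ENNReal.tsum_comp_le_tsum_of_injective (f := fun i : ℕ => (i : ℤ)) Nat.cast_injective _)
      have : (2 : ℝ≥0∞) ^ (i : ℤ) < ⊤ := ENNReal.zpow_lt_top (by simp) (by simp) _
      rw [if_pos this]
      refine ENNReal.one_le_rpow ?_ hq
      exact_mod_cast one_le_pow₀ (n := i + 1) (by norm_num : (1 : ℝ≥0∞) ≤ 2)
    rw [ENNReal.tsum_const_eq_top_of_ne_zero one_ne_zero] at h1
    exact le_top.trans h1
  obtain ⟨N, hN1, hN2⟩ := ENNReal.exists_mem_Ioc_zpow (x := a) (y := 2) ha hat (by norm_num) (by simp)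
  refine le_trans ?_ (ENNReal.le_tsum N)
  rw [if_pos hN1]
  exact ENNReal.rpow_le_rpow hN2 hq.le

lemma inv_one_sub_two_rpow_le {s : ℝ} (hs : 0 < s) (hs1 : s ≤ 1) :
    (1 - (2 : ℝ≥0∞) ^ (-s))⁻¹ ≤ ENNReal.ofReal (2 / s) := by
  have h1 : (2 : ℝ) ^ (-s) ≤ 1 - s / 2 := by
    have := _root_.rpow_one_add_le_one_add_mul_self (s := -1/2) (by norm_num) hs.le hs1
    rw [Real.rpow_neg (by norm_num), ← Real.inv_rpow (by norm_num)]
    norm_num at this ⊢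
    linarith
  have h2 : (2 : ℝ≥0∞) ^ (-s) = ENNReal.ofReal ((2 : ℝ) ^ (-s)) := by
    rw [← ENNReal.ofReal_rpow_of_pos (by norm_num)]; simp
  rw [h2, ← ENNReal.ofReal_one, ← ENNReal.ofReal_sub _ (by positivity),
    ENNReal.inv_le_iff_inv_le, ← ENNReal.ofReal_inv_of_pos (by positivity)]
  apply ENNReal.ofReal_le_ofReal
  rw [inv_div]; linarith

lemma Mx_le_of_le_add {g h : Rd d → ℝ≥0∞} {c : ℝ≥0∞} (hgh : ∀ x, g x ≤ h x + c) (x : Rd d) :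
    Mx g x ≤ Mx h x + volB d * c := by
  refine iSup₂_le fun r hr => ?_
  rw [ENNReal.inv_mul_le_iff (ofReal_pow_ne_zero hr) ENNReal.ofReal_ne_top, mul_add]
  calc ∫⁻ y in Metric.ball x r, g y ≤ ∫⁻ y in Metric.ball x r, (h y + c) := lintegral_mono hgh
    _ = (∫⁻ y in Metric.ball x r, h y) + c * (ENNReal.ofReal (r ^ d) * volB d) := by
        rw [lintegral_add_right _ measurable_const, setLIntegral_const, volume_ball_eq _ hr]
    _ ≤ _ := by
        refine add_le_add (lintegral_ball_le_Mx _ _ hr) (le_of_eq ?_)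
        ring

/-- Strong type. -/
lemma exists_Mx_rpow_le (hd : 1 ≤ d) {S : ℝ} (hS : 1 ≤ S) :
    ∃ C : ℝ≥0∞, C ≠ ⊤ ∧ ∀ s : ℝ, 0 < s → s ≤ S → ∀ g : Rd d → ℝ≥0∞, Measurable g →
      ∫⁻ x, Mx g x ^ (1 + s) ≤ C * ENNReal.ofReal s⁻¹ * ∫⁻ x, g x ^ (1 + s) := by
  set K := volB d
  set c : ℝ≥0∞ := (2 * K)⁻¹ with hc
  have hK0 : K ≠ 0 := volB_ne_zero
  have hKt : K ≠ ⊤ := volB_ne_top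
  have hc0 : c ≠ 0 := ENNReal.inv_ne_zero.2 (ENNReal.mul_ne_top (by simp) hKt)
  have hct : c ≠ ⊤ := ENNReal.inv_ne_top.2 (mul_ne_zero (by simp) hK0)
  have hKc : ∀ a : ℝ≥0∞, K * (c * (2 * a)) = a := by
    intro a
    rw [show K * (c * (2 * a)) = (2 * K) * c * a by ring, hc, ENNReal.mul_inv_cancel
      (mul_ne_zero (by simp) hK0) (ENNReal.mul_ne_top (by simp) hKt), one_mul]
  set C : ℝ≥0∞ := (2 : ℝ≥0∞) ^ (1 + S) * 2 * (K * 5 ^ d) * max 1 (c⁻¹ ^ S) * ENNReal.ofReal (2 * S)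
  refine ⟨C, ?_, fun s hs hsS g hg => ?_⟩
  · have h1 : (2 : ℝ≥0∞) ^ (1 + S) ≠ ⊤ := ENNReal.rpow_ne_top_of_nonneg (by linarith) (by simp)
    have h2 : c⁻¹ ^ S ≠ ⊤ := ENNReal.rpow_ne_top_of_nonneg (by linarith) (ENNReal.inv_ne_top.2 hc0)
    have h3 : max 1 (c⁻¹ ^ S) ≠ ⊤ := by simp [h2]
    have h4 : (5 : ℝ≥0∞) ^ d ≠ ⊤ := ENNReal.pow_ne_top (by simp)
    finiteness
  set G : ℤ → Rd d → ℝ≥0∞ := fun k => {x | c * 2 ^ (k + 1) < g x}.indicator g with hG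
  have hGm : ∀ k : ℤ, MeasurableSet {x | c * 2 ^ k < g x} := fun k : ℤ => measurableSet_lt measurable_const hg
  have h2k : ∀ k : ℤ, (2 : ℝ≥0∞) ^ (k + 1) = 2 * 2 ^ k := fun k => by
    rw [ENNReal.zpow_add (by simp) (by simp), zpow_one, mul_comm]
  have hsplit : ∀ (k : ℤ) x, (2 : ℝ≥0∞) ^ (k + 1) < Mx g x → 2 ^ k < Mx (G k) x := by
    intro k x hx
    by_contra hcon
    push Not at hcon
    have := Mx_le_of_le_add (g := g) (h := G k) (c := c * 2 ^ (k + 1)) (fun y => by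
      by_cases hy : c * 2 ^ (k + 1) < g y
      · simp [hG, hy]
      · simp [hG, hy, not_lt.1 hy]) x
    rw [h2k, hKc] at this
    refine absurd hx (not_lt.2 (this.trans ?_))
    rw [h2k, two_mul]
    exact add_le_add hcon le_rfl
  have hvol : ∀ k : ℤ, (2 : ℝ≥0∞) ^ (k + 1) * volume {x | (2 : ℝ≥0∞) ^ (k + 1) < Mx g x} ≤
      2 * (K * 5 ^ d * ∫⁻ x, G k x) := by
    intro k
    rw [h2k, mul_assoc]
    refine mul_le_mul_right (le_trans (mul_le_mul_right (measure_mono ?_) _)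
      (volume_lt_Mx_le hd (G k) (2 ^ k))) _
    exact fun x hx => hsplit k x (by simpa [h2k] using hx)
  have hpow : ∀ k : ℤ, ((2 : ℝ≥0∞) ^ (k + 1)) ^ (1 + s) =
      2 ^ (1 + s) * (((2 : ℝ≥0∞) ^ k) ^ s * 2 ^ k) := by
    intro k
    have h1 : ((2 : ℝ≥0∞) ^ k) ^ (1 + s) = ((2 : ℝ≥0∞) ^ k) ^ s * 2 ^ k := by
      rw [ENNReal.rpow_add _ _ (ENNReal.zpow_pos (by simp) (by simp) _).ne' (ENNReal.zpow_ne_top (by simp) (by simp) _), ENNReal.rpow_one, mul_comm]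
    rw [h2k, ENNReal.mul_rpow_of_nonneg _ _ (by linarith), h1]
  have hinner : ∀ x, ∑' k : ℤ, ((2 : ℝ≥0∞) ^ (k + 1)) ^ s * G k x ≤
      max 1 (c⁻¹ ^ S) * ENNReal.ofReal (2 * S) * ENNReal.ofReal s⁻¹ * g x ^ (1 + s) := by
    intro x
    have hgeo : (1 - (2 : ℝ≥0∞) ^ (-s))⁻¹ ≤ ENNReal.ofReal (2 * S) * ENNReal.ofReal s⁻¹ := by
      rw [← ENNReal.ofReal_mul (by linarith)]
      rcases le_total s 1 with h1 | h1
      · refine (inv_one_sub_two_rpow_le hs h1).trans (ENNReal.ofReal_le_ofReal ?_)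
        rw [div_eq_mul_inv]
        gcongr; linarith
      · have : (1 - (2 : ℝ≥0∞) ^ (-s))⁻¹ ≤ (1 - (2 : ℝ≥0∞) ^ (-(1:ℝ)))⁻¹ := by
          refine ENNReal.inv_le_inv.2 (tsub_le_tsub_left ?_ _)
          exact ENNReal.rpow_le_rpow_of_exponent_le (by norm_num) (by linarith)
        refine this.trans ((inv_one_sub_two_rpow_le one_pos le_rfl).trans (ENNReal.ofReal_le_ofReal ?_))
        have : 1 ≤ S * s⁻¹ := by rw [← div_eq_mul_inv, one_le_div hs]; exact hsS
        linarith
    have hcs : c⁻¹ ^ s ≤ max 1 (c⁻¹ ^ S) := by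
      rcases le_total 1 c⁻¹ with h1 | h1
      · exact (ENNReal.rpow_le_rpow_of_exponent_le h1 hsS).trans (le_max_right _ _)
      · exact (ENNReal.rpow_le_one h1 hs.le).trans (le_max_left _ _)
    have e1 : ∀ k : ℤ, ((2 : ℝ≥0∞) ^ (k + 1)) ^ s * G k x =
        (fun k : ℤ => (if (2 : ℝ≥0∞) ^ k < g x * c⁻¹ then ((2 : ℝ≥0∞) ^ k) ^ s else 0) * g x) (k + 1) := by
      intro k
      have : (c * 2 ^ (k + 1) < g x) ↔ (2 : ℝ≥0∞) ^ (k + 1) < g x * c⁻¹ := by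
        rw [← div_eq_mul_inv, ENNReal.lt_div_iff_mul_lt (Or.inl hc0) (Or.inl hct), mul_comm]
      by_cases h : c * 2 ^ (k + 1) < g x
      · simp [hG, h, this.1 h]
      · simp [hG, h, mt this.2 h]
    rw [tsum_congr e1]
    refine ((Equiv.addRight (1 : ℤ)).tsum_eq (fun k : ℤ =>
      (if (2 : ℝ≥0∞) ^ k < g x * c⁻¹ then ((2 : ℝ≥0∞) ^ k) ^ s else 0) * g x)).trans_le ?_
    rw [ENNReal.tsum_mul_right]
    refine (mul_le_mul_left (tsum_two_zpow_rpow_le hs _) _).trans ?_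
    rw [ENNReal.mul_rpow_of_nonneg _ _ hs.le]
    have e2 : g x ^ (1 + s) = g x * g x ^ s := by
      rw [ENNReal.rpow_add_of_nonneg _ _ zero_le_one hs.le, ENNReal.rpow_one]
    rw [e2]
    calc g x ^ s * c⁻¹ ^ s * (1 - (2 : ℝ≥0∞) ^ (-s))⁻¹ * g x
        ≤ g x ^ s * max 1 (c⁻¹ ^ S) * (ENNReal.ofReal (2 * S) * ENNReal.ofReal s⁻¹) * g x := by gcongr
      _ = _ := by ring
  calc ∫⁻ x, Mx g x ^ (1 + s)
      ≤ ∫⁻ x, ∑' k : ℤ, (if (2 : ℝ≥0∞) ^ (k + 1) < Mx g x then ((2 : ℝ≥0∞) ^ (k + 1 + 1)) ^ (1 + s) else 0) := by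
        refine lintegral_mono fun x => (rpow_le_tsum_two_zpow (by linarith) _).trans (le_of_eq ?_)
        exact ((Equiv.addRight (1 : ℤ)).tsum_eq (fun k : ℤ => (if (2 : ℝ≥0∞) ^ k < Mx g x then
          ((2 : ℝ≥0∞) ^ (k + 1)) ^ (1 + s) else 0))).symm
    _ = ∑' k : ℤ, ((2 : ℝ≥0∞) ^ (k + 1 + 1)) ^ (1 + s) * volume {x | (2 : ℝ≥0∞) ^ (k + 1) < Mx g x} := by
        have hms : ∀ k : ℤ, MeasurableSet {x | (2 : ℝ≥0∞) ^ (k + 1) < Mx g x} := fun k =>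
          (isOpen_lt_Mx g _).measurableSet
        rw [lintegral_tsum]
        · refine tsum_congr fun k => ?_
          rw [← setLIntegral_const, ← lintegral_indicator (hms k)]
          simp [Set.indicator_apply]
        · exact fun k => (Measurable.ite (hms k) measurable_const measurable_const).aemeasurable
    _ ≤ ∑' k : ℤ, 2 ^ (1 + s) * 2 * (K * 5 ^ d) * ∫⁻ x, ((2 : ℝ≥0∞) ^ (k + 1)) ^ s * G k x := by
        refine ENNReal.tsum_le_tsum fun k => ?_
        rw [hpow, lintegral_const_mul _ (show Measurable (G k) from hg.indicator (hGm _))]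
        calc 2 ^ (1 + s) * (((2 : ℝ≥0∞) ^ (k + 1)) ^ s * 2 ^ (k + 1)) * volume {x | (2 : ℝ≥0∞) ^ (k + 1) < Mx g x}
            = 2 ^ (1 + s) * ((2 : ℝ≥0∞) ^ (k + 1)) ^ s * (2 ^ (k + 1) * volume {x | (2 : ℝ≥0∞) ^ (k + 1) < Mx g x}) := by ring
          _ ≤ 2 ^ (1 + s) * ((2 : ℝ≥0∞) ^ (k + 1)) ^ s * (2 * (K * 5 ^ d * ∫⁻ x, G k x)) :=
              mul_le_mul_right (hvol k) _
          _ = _ := by ring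
    _ = 2 ^ (1 + s) * 2 * (K * 5 ^ d) * ∫⁻ x, ∑' k : ℤ, ((2 : ℝ≥0∞) ^ (k + 1)) ^ s * G k x := by
        rw [ENNReal.tsum_mul_left, lintegral_tsum]
        exact fun k => ((show Measurable (G k) from hg.indicator (hGm _)).const_mul _).aemeasurable
    _ ≤ 2 ^ (1 + S) * 2 * (K * 5 ^ d) * ∫⁻ x, max 1 (c⁻¹ ^ S) * ENNReal.ofReal (2 * S) * ENNReal.ofReal s⁻¹ * g x ^ (1 + s) := by
        refine mul_le_mul' (mul_le_mul_left (mul_le_mul_left ?_ _) _) (lintegral_mono hinner)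
        exact ENNReal.rpow_le_rpow_of_exponent_le (by norm_num) (by linarith)
    _ = _ := by
        rw [lintegral_const_mul _ (hg.pow_const _)]
        ring

end A1Rough

namespace A1Rough

variable {d : ℕ} {Ω : Rd d → ℂ} {C : ℝ}

lemma enorm_cv_ker_le (hΩ : Homog Ω C) (J : ℤ) (f : Rd d → ℂ) (x : Rd d) :
    ‖cv (ker Ω J) f x‖ₑ ≤ ENNReal.ofReal (C * (((2 : ℝ) ^ J) ^ d)⁻¹) *
      ∫⁻ y in Metric.ball x ((2 : ℝ) ^ (J + 2)), ‖f y‖ₑ := by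
  have hC : (0 : ℝ) ≤ C := hΩ.1
  rw [← lintegral_const_mul' _ _ ENNReal.ofReal_ne_top, ← lintegral_indicator Metric.isOpen_ball.measurableSet]
  refine (enorm_integral_le_lintegral_enorm _).trans (lintegral_mono fun y => ?_)
  rw [enorm_mul]
  by_cases hy : y ∈ Metric.ball x ((2 : ℝ) ^ (J + 2))
  · rw [Set.indicator_of_mem hy]
    refine mul_le_mul_left ?_ _
    rw [← ofReal_norm]
    exact ENNReal.ofReal_le_ofReal (norm_ker_le hΩ J _)
  · rw [ker_eq_zero (x := x - y)]
    · simp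
    · rw [Metric.mem_ball, dist_comm, dist_eq_norm, not_lt] at hy
      refine lt_of_lt_of_le ?_ hy
      exact zpow_lt_zpow_right₀ (by norm_num) (by omega)

lemma enorm_cv_ker_le_Mx (hΩ : Homog Ω C) (J : ℤ) (f : Rd d → ℂ) (x : Rd d) :
    ‖cv (ker Ω J) f x‖ₑ ≤ ENNReal.ofReal (C * 4 ^ d) * Mx (fun y => ‖f y‖ₑ) x := by
  have hC : (0 : ℝ) ≤ C := hΩ.1
  refine (enorm_cv_ker_le hΩ J f x).trans ?_
  refine (mul_le_mul_right (lintegral_ball_le_Mx _ x (by positivity)) _).trans (le_of_eq ?_)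
  rw [← mul_assoc, ← ENNReal.ofReal_mul (by positivity)]
  congr 2
  rw [zpow_add₀ (by norm_num), mul_pow]
  have : ((2 : ℝ) ^ J) ^ d ≠ 0 := by positivity
  field_simp
  norm_num

/-- The maximal truncation of the series `∑ u j` over the window `[J0, s]`. -/
def SM (J0 s : ℤ) (u : ℤ → Rd d → ℂ) (x : Rd d) : ℝ≥0∞ :=
  ⨆ J ∈ Finset.Icc J0 s, ‖∑ j ∈ Finset.Icc J s, u j x‖ₑ

lemma measurable_SM {J0 s : ℤ} {u : ℤ → Rd d → ℂ} (hu : ∀ j, Measurable (u j)) :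
    Measurable (SM J0 s u) := by
  unfold SM
  refine Measurable.iSup fun J => Measurable.iSup fun _ => ?_
  exact (Finset.measurable_sum _ fun j _ => hu j).enorm

lemma SM_sq_le {J0 s : ℤ} {u : ℤ → Rd d → ℂ} {x : Rd d} {X : ℝ≥0∞}
    (h : ∀ J ∈ Finset.Icc J0 s, ‖∑ j ∈ Finset.Icc J s, u j x‖ₑ ^ 2 ≤ X) : SM J0 s u x ^ 2 ≤ X := by
  have : SM J0 s u x ≤ X ^ (1 / 2 : ℝ) := by
    refine iSup₂_le fun J hJ => ?_
    have := ENNReal.rpow_le_rpow (h J hJ) (by norm_num : (0 : ℝ) ≤ 1 / 2)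
    rwa [← ENNReal.rpow_natCast, ← ENNReal.rpow_mul, show ((2 : ℕ) : ℝ) * (1 / 2) = 1 by norm_num,
      ENNReal.rpow_one] at this
  calc SM J0 s u x ^ 2 ≤ (X ^ (1 / 2 : ℝ)) ^ 2 := pow_le_pow_left₀ zero_le this 2
    _ = X := by
      rw [← ENNReal.rpow_natCast, ← ENNReal.rpow_mul]; norm_num

lemma add_three_sq_le (a b c : ℝ≥0∞) : (a + b + c) ^ 2 ≤ 3 * (a ^ 2 + b ^ 2 + c ^ 2) := by
  have := sum_mul_sq_le (Finset.univ : Finset (Fin 3)) (fun _ => 1) ![a, b, c]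
  simpa [Fin.sum_univ_three] using this

/-- The geometric series with ratio `kap`. -/
def geoN : ℝ≥0∞ := ∑' k : ℕ, ENNReal.ofReal (kap ^ k)

lemma geoN_ne_top : geoN ≠ ⊤ := by
  unfold geoN
  rw [← ENNReal.ofReal_tsum_of_nonneg (fun k => pow_nonneg kap_pos.le k)
    (summable_geometric_of_lt_one kap_pos.le kap_lt_one)]
  exact ENNReal.ofReal_ne_top

lemma tsum_sq_le_weight (a : ℕ → ℝ≥0∞) :
    (∑' k, a k) ^ 2 ≤ geoN * ∑' k, ENNReal.ofReal (kap ^ k)⁻¹ * a k ^ 2 := by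
  have h := tsum_mul_sq_le (fun k : ℕ => ENNReal.ofReal (kap ^ k) ^ (1 / 2 : ℝ))
    (fun k : ℕ => ENNReal.ofReal (kap ^ k)⁻¹ ^ (1 / 2 : ℝ) * a k)
  have e : ∀ x : ℝ≥0∞, (x ^ (1 / 2 : ℝ)) ^ 2 = x := fun x => by
    rw [← ENNReal.rpow_natCast, ← ENNReal.rpow_mul]; norm_num
  have hk : ∀ k : ℕ, ENNReal.ofReal (kap ^ k) * ENNReal.ofReal (kap ^ k)⁻¹ = 1 := fun k => by
    have : 0 < kap ^ k := pow_pos kap_pos k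
    rw [← ENNReal.ofReal_mul this.le, mul_inv_cancel₀ this.ne', ENNReal.ofReal_one]
  simp only [mul_pow, e] at h
  refine le_trans (le_of_eq ?_) h
  congr 1
  refine tsum_congr fun k => ?_
  rw [← mul_assoc, ← ENNReal.mul_rpow_of_nonneg _ _ (by norm_num), hk]
  simp

/-- Maximal truncations are controlled by the full sum and by almost orthogonality. -/
theorem exists_SM_le (hd : 1 ≤ d) : ∃ B : ℝ≥0∞, B ≠ ⊤ ∧ ∀ (u : ℤ → Rd d → ℂ) (A : ℝ≥0∞),
    (∀ j, Nice (u j)) →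
    (∀ k : ℕ, ∑' J : ℤ, ∫⁻ x, ‖u (J + k) x - cv (phi d J) (u (J + k)) x‖ₑ ^ 2 ≤
      A * ENNReal.ofReal (kap ^ (2 * k))) →
    (∀ k : ℕ, ∑' J : ℤ, ∫⁻ x, ‖cv (phi d J) (u (J - k)) x‖ₑ ^ 2 ≤
      A * ENNReal.ofReal (kap ^ (2 * k))) →
    ∀ J0 s : ℤ, ∫⁻ x, SM J0 s u x ^ 2 ≤
      B * ((∫⁻ x, ‖∑ j ∈ Finset.Icc J0 s, u j x‖ₑ ^ 2) + A) := by
  obtain ⟨CM, hCM, hM⟩ := exists_Mx_rpow_le hd (S := 1) le_rfl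
  set c := ENNReal.ofReal (phiC d * 4 ^ d)
  refine ⟨3 * (c ^ 2 * CM + geoN * geoN + geoN * geoN), ?_, ?_⟩
  · have := geoN_ne_top
    have : c ≠ ⊤ := ENNReal.ofReal_ne_top
    finiteness
  intro u A hu h1 h2 J0 s
  set H : Rd d → ℂ := fun x => ∑ j ∈ Finset.Icc J0 s, u j x with hH
  have hHn : Nice H := Nice.sum _ fun j _ => hu j
  set a : ℤ → ℕ → Rd d → ℂ := fun J k x => u (J + k) x - cv (phi d J) (u (J + k)) x with ha
  set b : ℤ → ℕ → Rd d → ℂ := fun J k x => cv (phi d J) (u (J - k)) x with hb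
  have ham : ∀ J k, Measurable (a J k) := fun J k => ((hu _).sub ((hu _).phi J)).1
  have hbm : ∀ J k, Measurable (b J k) := fun J k => ((hu _).phi J).1
  set X : (ℤ → ℕ → Rd d → ℂ) → Rd d → ℝ≥0∞ := fun a x =>
    ∑' k : ℕ, ENNReal.ofReal (kap ^ k)⁻¹ * ∑' J : ℤ, ‖a J k x‖ₑ ^ 2 with hX
  have hXm : ∀ a : ℤ → ℕ → Rd d → ℂ, (∀ J k, Measurable (a J k)) → Measurable (X a) := by
    intro a ha
    refine Measurable.tsum fun k => Measurable.const_mul ?_ _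
    exact Measurable.tsum fun J => ((ha J k).enorm.pow_const 2)
  have hXi : ∀ a : ℤ → ℕ → Rd d → ℂ, (∀ J k, Measurable (a J k)) →
      (∀ k : ℕ, ∑' J : ℤ, ∫⁻ x, ‖a J k x‖ₑ ^ 2 ≤ A * ENNReal.ofReal (kap ^ (2 * k))) →
      ∫⁻ x, X a x ≤ geoN * A := by
    intro a ha h
    simp only [hX]
    rw [lintegral_tsum fun k => ((Measurable.tsum fun J =>
      ((ha J k).enorm.pow_const 2)).const_mul _).aemeasurable]
    unfold geoN
    rw [← ENNReal.tsum_mul_right]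
    refine ENNReal.tsum_le_tsum fun k => ?_
    rw [lintegral_const_mul _ (Measurable.tsum fun J => ((ha J k).enorm.pow_const 2)),
      lintegral_tsum fun J => ((ha J k).enorm.pow_const 2).aemeasurable]
    refine (mul_le_mul_right (h k) _).trans (le_of_eq ?_)
    have : 0 < kap ^ k := pow_pos kap_pos k
    rw [mul_left_comm, ← ENNReal.ofReal_mul (by positivity), mul_comm A]
    congr 2
    rw [two_mul, pow_add]
    field_simp
  have hXb : ∀ (a : ℤ → ℕ → Rd d → ℂ) J x, (∑' k, ‖a J k x‖ₑ) ^ 2 ≤ geoN * X a x := by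
    intro a J x
    refine (tsum_sq_le_weight _).trans (mul_le_mul_right ?_ _)
    exact ENNReal.tsum_le_tsum fun k => mul_le_mul_right (ENNReal.le_tsum (f := fun J => ‖a J k x‖ₑ ^ 2) J) _
  have hpt : ∀ x, SM J0 s u x ^ 2 ≤
      3 * ((c * Mx (fun y => ‖H y‖ₑ) x) ^ 2 + geoN * X a x + geoN * X b x) := by
    intro x
    refine SM_sq_le fun J hJ => ?_
    rw [Finset.mem_Icc] at hJ
    have hdec : ∑ j ∈ Finset.Icc J s, u j x = cv (phi d J) H x +
        ∑ j ∈ Finset.Icc J s, (u j x - cv (phi d J) (u j) x) -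
        ∑ j ∈ Finset.Ico J0 J, cv (phi d J) (u j) x := by
      rw [hH, cv_sum _ (nice_phi d J) fun i _ => hu i, Finset.sum_sub_distrib]
      have : Finset.Icc J0 s = Finset.Ico J0 J ∪ Finset.Icc J s := by
        ext j; simp only [Finset.mem_union, Finset.mem_Icc, Finset.mem_Ico]; omega
      rw [this, Finset.sum_union]
      · ring
      · rw [Finset.disjoint_left]; intro j; simp only [Finset.mem_Icc, Finset.mem_Ico]; omega
    have hA : ‖∑ j ∈ Finset.Icc J s, (u j x - cv (phi d J) (u j) x)‖ₑ ≤ ∑' k, ‖a J k x‖ₑ := by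
      refine (enorm_sum_le _ _).trans ?_
      have : Finset.Icc J s = (Finset.range (s + 1 - J).toNat).image (fun k : ℕ => J + (k : ℤ)) := by
        ext j; simp only [Finset.mem_Icc, Finset.mem_image, Finset.mem_range]
        constructor
        · intro h; exact ⟨(j - J).toNat, by omega, by omega⟩
        · rintro ⟨k, hk, rfl⟩; omega
      rw [this, Finset.sum_image (by intro a _ b _ h; simpa using h)]
      exact ENNReal.sum_le_tsum (f := fun k => ‖a J k x‖ₑ) _
    have hB : ‖∑ j ∈ Finset.Ico J0 J, cv (phi d J) (u j) x‖ₑ ≤ ∑' k, ‖b J k x‖ₑ := by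
      refine (enorm_sum_le _ _).trans ?_
      have : Finset.Ico J0 J = (Finset.Ico 1 (J - J0 + 1).toNat).image (fun k : ℕ => J - (k : ℤ)) := by
        ext j; simp only [Finset.mem_Ico, Finset.mem_image]
        constructor
        · intro h; exact ⟨(J - j).toNat, by omega, by omega⟩
        · rintro ⟨k, hk, rfl⟩; omega
      rw [this, Finset.sum_image (by intro a _ b _ h; simpa using h)]
      exact ENNReal.sum_le_tsum (f := fun k => ‖b J k x‖ₑ) _
    have h3 : ‖∑ j ∈ Finset.Icc J s, u j x‖ₑ ≤ ‖cv (phi d J) H x‖ₑ + ∑' k, ‖a J k x‖ₑ + ∑' k, ‖b J k x‖ₑ := by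
      rw [hdec]
      exact (enorm_sub_le).trans (add_le_add ((enorm_add_le _ _).trans (add_le_add le_rfl hA)) hB)
    refine (pow_le_pow_left₀ zero_le h3 2).trans ((add_three_sq_le _ _ _).trans (mul_le_mul_right ?_ _))
    refine add_le_add (add_le_add (pow_le_pow_left₀ zero_le ?_ 2) (hXb a J x)) (hXb b J x)
    exact enorm_cv_ker_le_Mx (homog_phi d) J H x
  have hMH : ∫⁻ x, Mx (fun y => ‖H y‖ₑ) x ^ 2 ≤ CM * ∫⁻ x, ‖H x‖ₑ ^ 2 := by
    have := hM 1 one_pos le_rfl (fun y => ‖H y‖ₑ) hHn.1.enorm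
    norm_num at this
    exact this
  calc ∫⁻ x, SM J0 s u x ^ 2
      ≤ ∫⁻ x, 3 * ((c * Mx (fun y => ‖H y‖ₑ) x) ^ 2 + geoN * X a x + geoN * X b x) := lintegral_mono hpt
    _ = 3 * (c ^ 2 * (∫⁻ x, Mx (fun y => ‖H y‖ₑ) x ^ 2) + geoN * (∫⁻ x, X a x) + geoN * (∫⁻ x, X b x)) := by
        have hm1 := measurable_Mx (fun y => ‖H y‖ₑ)
        have hm2 := hXm a ham
        have hm3 := hXm b hbm
        simp only [mul_pow]
        rw [lintegral_const_mul _ (by fun_prop), lintegral_add_right _ (by fun_prop),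
          lintegral_add_right _ (by fun_prop), lintegral_const_mul _ (by fun_prop),
          lintegral_const_mul _ (by fun_prop), lintegral_const_mul _ (by fun_prop)]
    _ ≤ 3 * (c ^ 2 * (CM * ∫⁻ x, ‖H x‖ₑ ^ 2) + geoN * (geoN * A) + geoN * (geoN * A)) := by
        gcongr
        · exact hXi a ham h1
        · exact hXi b hbm h2
    _ ≤ 3 * (c ^ 2 * CM + geoN * geoN + geoN * geoN) * (∫⁻ x, ‖H x‖ₑ ^ 2) +
        3 * (c ^ 2 * CM + geoN * geoN + geoN * geoN) * A := by
        have e : 3 * (c ^ 2 * (CM * ∫⁻ x, ‖H x‖ₑ ^ 2) + geoN * (geoN * A) + geoN * (geoN * A)) =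
          3 * (c ^ 2 * CM) * (∫⁻ x, ‖H x‖ₑ ^ 2) + 3 * (geoN * geoN + geoN * geoN) * A := by ring
        rw [e]
        gcongr
        · rw [add_assoc]; exact le_self_add
        · exact le_add_self
    _ = _ := (mul_add _ _ _).symm

/-- Maximal truncations of the rough singular integral on `L²`. -/
theorem exists_SM_cv_le (hd : 1 ≤ d) (C : ℝ) : ∃ B : ℝ≥0∞, B ≠ ⊤ ∧ ∀ Ω : Rd d → ℂ, MZ Ω C →
    ∀ f, Nice f → ∀ J0 s : ℤ, ∫⁻ x, SM J0 s (fun j => cv (ker Ω j) f) x ^ 2 ≤ B * ∫⁻ x, ‖f x‖ₑ ^ 2 := by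
  obtain ⟨B0, hB0, h0⟩ := exists_SM_le hd
  obtain ⟨B1, hB1, h1⟩ := exists_sub_phi_le hd C
  obtain ⟨B2, hB2, h2⟩ := exists_phi_le hd C
  obtain ⟨B3, hB3, h3⟩ := exists_sum_ker_le hd C
  refine ⟨B0 * (B3 + (B1 + B2)), by finiteness, fun Ω hΩ f hf J0 s => ?_⟩
  have hk : ∀ k : ℕ, ENNReal.ofReal (kap ^ (4 * k)) ≤ ENNReal.ofReal (kap ^ (2 * k)) := fun k =>
    ENNReal.ofReal_le_ofReal (pow_le_pow_of_le_one kap_pos.le kap_lt_one.le (by omega))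
  refine (h0 (fun j => cv (ker Ω j) f) ((B1 + B2) * ∫⁻ x, ‖f x‖ₑ ^ 2)
    (fun j => (nice_ker hΩ.1 j).cv hf) (fun k => ?_) (fun k => ?_) J0 s).trans ?_
  · refine (h1 Ω hΩ f hf k).trans ?_
    rw [mul_right_comm]
    exact mul_le_mul' (mul_le_mul' le_self_add le_rfl) (hk k)
  · refine (h2 Ω hΩ f hf k).trans ?_
    rw [mul_right_comm]
    exact mul_le_mul' (mul_le_mul' le_add_self le_rfl) (hk k)
  · rw [mul_assoc, add_mul B3]
    exact mul_le_mul_right (add_le_add (h3 Ω hΩ f hf _) le_rfl) _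

set_option maxHeartbeats 800000 in
/-- Maximal truncations applied to functions oscillating at a smaller scale. -/
theorem exists_SM_osc_le (hd : 1 ≤ d) (C : ℝ) : ∃ B : ℝ≥0∞, B ≠ ⊤ ∧ ∀ Ω : Rd d → ℂ, MZ Ω C →
    ∀ b : ℤ → Rd d → ℂ, (∀ m, Nice (b m)) → (∀ m x, E m (b m) x = 0) → ∀ (i : ℕ) (J0 s : ℤ),
    ∫⁻ x, SM J0 s (fun j => cv (ker Ω j) (b (j - i))) x ^ 2 ≤
      B * ENNReal.ofReal (kap ^ (2 * i)) * ∑' m, ∫⁻ x, ‖b m x‖ₑ ^ 2 := by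
  obtain ⟨B0, hB0, h0⟩ := exists_SM_le hd
  obtain ⟨B1, hB1, h1⟩ := exists_sub_phi_le hd C
  obtain ⟨B2, hB2, h2⟩ := exists_phi_le hd C
  obtain ⟨B3, hB3, h3⟩ := exists_sum_ker_osc_le hd C
  obtain ⟨B4, hB4, h4⟩ := exists_phi_sq_le hd
  set B' := B1 + B2 + B4 * B3 with hB'
  refine ⟨B0 * (B3 + B'), by finiteness, fun Ω hΩ b hb hE i J0 s => ?_⟩
  set N := ∑' m, ∫⁻ x, ‖b m x‖ₑ ^ 2 with hN
  have hmono : ∀ {a c : ℕ}, c ≤ a → ENNReal.ofReal (kap ^ a) ≤ ENNReal.ofReal (kap ^ c) := fun h =>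
    ENNReal.ofReal_le_ofReal (pow_le_pow_of_le_one kap_pos.le kap_lt_one.le h)
  have hG1 : ∀ m : ℤ, ∫⁻ x, ‖cv (ker Ω (m + i)) (b m) x‖ₑ ^ 2 ≤
      B3 * ENNReal.ofReal (kap ^ (4 * i)) * ∫⁻ x, ‖b m x‖ₑ ^ 2 := by
    intro m
    have := h3 Ω hΩ {m} b hb (fun m _ x => hE m x) i
    simpa using this
  have hcomb : ∀ (k : ℕ) (X N : ℝ≥0∞), X ≤ (B1 + B2) * ENNReal.ofReal (kap ^ (4 * k)) * N →
      X ≤ B4 * (B3 * ENNReal.ofReal (kap ^ (4 * i)) * N) →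
      X ≤ B' * ENNReal.ofReal (kap ^ (2 * i)) * ENNReal.ofReal (kap ^ (2 * k)) * N := by
    intro k X N hX1 hX2
    have e : B' * ENNReal.ofReal (kap ^ (2 * i)) * ENNReal.ofReal (kap ^ (2 * k)) * N =
        B' * ENNReal.ofReal (kap ^ (2 * i + 2 * k)) * N := by
      rw [mul_assoc B', ← ENNReal.ofReal_mul (pow_nonneg kap_pos.le _), pow_add]
    rw [e]
    rcases le_total i k with h | h
    · refine hX1.trans ?_
      exact mul_le_mul' (mul_le_mul' le_self_add (hmono (by omega))) le_rfl
    · refine hX2.trans ?_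
      rw [← mul_assoc, ← mul_assoc]
      exact mul_le_mul' (mul_le_mul' le_add_self (hmono (by omega))) le_rfl
  have htwo : ∀ t : ℤ, ∑' J : ℤ, ∫⁻ x, ‖b (J + t) x‖ₑ ^ 2 = N := fun t =>
    (Equiv.addRight t).tsum_eq fun m => ∫⁻ x, ‖b m x‖ₑ ^ 2
  refine (h0 (fun j => cv (ker Ω j) (b (j - i))) (B' * ENNReal.ofReal (kap ^ (2 * i)) * N)
    (fun j => (nice_ker hΩ.1 j).cv (hb _)) (fun k => ?_) (fun k => ?_) J0 s).trans ?_
  · rw [mul_right_comm, ← htwo (k - i), ← ENNReal.tsum_mul_left]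
    refine ENNReal.tsum_le_tsum fun J => ?_
    have e : J + (k - i : ℤ) = J + k - i := by ring
    rw [e]
    refine hcomb k _ _ ?_ ?_
    · refine (ENNReal.le_tsum (f := fun J' : ℤ => ∫⁻ x, ‖cv (ker Ω (J' + k)) (b (J + k - i : ℤ)) x -
        cv (phi d J') (cv (ker Ω (J' + k)) (b (J + k - i : ℤ))) x‖ₑ ^ 2) J).trans ?_
      refine (h1 Ω hΩ _ (hb _) k).trans ?_
      gcongr
      exact le_self_add
    · refine ((h4 _ ((nice_ker hΩ.1 _).cv (hb _)) J).2).trans (mul_le_mul_right ?_ _)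
      simpa using hG1 (J + k - i)
  · rw [mul_right_comm, ← htwo (-k - i), ← ENNReal.tsum_mul_left]
    refine ENNReal.tsum_le_tsum fun J => ?_
    have e : J + (-k - i : ℤ) = J - k - i := by ring
    rw [e]
    refine hcomb k _ _ ?_ ?_
    · refine (ENNReal.le_tsum (f := fun J' : ℤ => ∫⁻ x,
        ‖cv (phi d J') (cv (ker Ω (J' - k)) (b (J - k - i : ℤ))) x‖ₑ ^ 2) J).trans ?_
      refine (h2 Ω hΩ _ (hb _) k).trans ?_
      gcongr
      exact le_add_self
    · refine ((h4 _ ((nice_ker hΩ.1 _).cv (hb _)) J).1).trans (mul_le_mul_right ?_ _)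
      simpa using hG1 (J - k - i)
  · have hinj : Function.Injective (fun j : ℤ => j - (i : ℤ)) := fun a b h => by simpa using h
    have h5 := h3 Ω hΩ ((Finset.Icc J0 s).image fun j : ℤ => j - (i : ℤ)) b hb (fun m _ x => hE m x) i
    have e : ∀ x, ∑ j ∈ Finset.Icc J0 s, cv (ker Ω j) (b (j - i)) x =
        ∑ m ∈ (Finset.Icc J0 s).image (fun j : ℤ => j - (i : ℤ)), cv (ker Ω (m + i)) (b m) x := fun x => by
      rw [Finset.sum_image hinj.injOn]
      exact Finset.sum_congr rfl fun j _ => by rw [sub_add_cancel]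
    have e1 : ∫⁻ x, ‖∑ j ∈ Finset.Icc J0 s, cv (ker Ω j) (b (j - i)) x‖ₑ ^ 2 =
        ∫⁻ x, ‖∑ m ∈ (Finset.Icc J0 s).image (fun j : ℤ => j - (i : ℤ)), cv (ker Ω (m + i)) (b m) x‖ₑ ^ 2 :=
      lintegral_congr fun x => by rw [e x]
    rw [← e1] at h5
    have e2 : B0 * (B3 + B') * ENNReal.ofReal (kap ^ (2 * i)) * N =
        B0 * (B3 * ENNReal.ofReal (kap ^ (2 * i)) * N + B' * ENNReal.ofReal (kap ^ (2 * i)) * N) := by ring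
    rw [e2]
    refine mul_le_mul_right (add_le_add (h5.trans ?_) le_rfl) _
    exact mul_le_mul' (mul_le_mul' le_rfl (hmono (by omega))) (ENNReal.sum_le_tsum _)

end A1Rough

namespace A1Rough

variable {d : ℕ} {σ : Rd d → ℤ} {J0 s : ℤ}

/-- The set of points where the stopping scale is `m`. -/
def U (σ : Rd d → ℤ) (m : ℤ) : Set (Rd d) := {x | σ x = m}

/-- A stopping scale for the window `[J0, s)`. -/
structure Stop (σ : Rd d → ℤ) (J0 s : ℤ) : Prop where
  meas : Measurable σ
  lo : ∀ x, J0 ≤ σ x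
  hi : ∀ x, σ x < s
  sat : ∀ m, Sat m (U σ m)
  sep : ∀ (x y : Rd d) (j : ℤ), σ x < j → ‖x - y‖ ≤ (2 : ℝ) ^ (j + 1) → σ y ≤ j

/-- Control of a function by the level `a`, globally and on balls larger than the stopping scale. -/
structure Ctl (σ : Rd d → ℤ) (V : ℝ≥0∞) (q : ℝ) (a : ℝ≥0∞) (G : Rd d → ℝ≥0∞) : Prop where
  meas : Measurable G
  mass : ∫⁻ x, G x ≤ a * V
  massq : ∫⁻ x, G x ^ q ≤ a ^ q * V
  loc : ∀ (x : Rd d) (R : ℝ), (2 : ℝ) ^ (σ x) ≤ R → ∫⁻ y in Metric.ball x R, G y ≤ ENNReal.ofReal (R ^ d) * a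
  locq : ∀ (x : Rd d) (R : ℝ), (2 : ℝ) ^ (σ x) ≤ R →
    ∫⁻ y in Metric.ball x R, G y ^ q ≤ ENNReal.ofReal (R ^ d) * a ^ q

lemma Stop.measurableSet_U (h : Stop σ J0 s) (m : ℤ) : MeasurableSet (U σ m) :=
  h.meas (measurableSet_singleton m)

lemma Stop.sum_indicator (h : Stop σ J0 s) {β : Type*} [AddCommMonoid β] (a : ℤ → Rd d → β) (x : Rd d) :
    ∑ m ∈ Finset.Ico J0 s, (U σ m).indicator (a m) x = a (σ x) x := by
  rw [Finset.sum_eq_single (σ x)]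
  · have hx : x ∈ U σ (σ x) := rfl
    rw [Set.indicator_of_mem hx]
  · intro m _ hm
    have hx : x ∉ U σ m := fun hx => hm (Eq.symm hx)
    rw [Set.indicator_of_notMem hx]
  · intro hx
    exact absurd (Finset.mem_Ico.2 ⟨h.lo x, h.hi x⟩) hx

lemma Stop.lintegral_eq (h : Stop σ J0 s) {a : ℤ → Rd d → ℝ≥0∞} (ha : ∀ m, Measurable (a m)) :
    ∫⁻ x, a (σ x) x = ∑ m ∈ Finset.Ico J0 s, ∫⁻ x in U σ m, a m x := by
  simp_rw [← h.sum_indicator a]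
  rw [lintegral_finsetSum _ fun m _ => (ha m).indicator (h.measurableSet_U m)]
  exact Finset.sum_congr rfl fun m _ => lintegral_indicator (h.measurableSet_U m) _

lemma Stop.measurable_comp (h : Stop σ J0 s) {a : ℤ → Rd d → ℝ≥0∞} (ha : ∀ m, Measurable (a m)) :
    Measurable fun x => a (σ x) x := by
  simp_rw [← h.sum_indicator a]
  exact Finset.measurable_sum _ fun m _ => (ha m).indicator (h.measurableSet_U m)

/-- The averaging constant. -/
def cA (d : ℕ) : ℝ≥0∞ := ENNReal.ofReal ((√d + 1) ^ d)

lemma one_le_cA : 1 ≤ cA d := by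
  rw [cA, ← ENNReal.ofReal_one]
  exact ENNReal.ofReal_le_ofReal (one_le_pow₀ (by linarith [Real.sqrt_nonneg d]))

lemma cA_ne_top : cA d ≠ ⊤ := ENNReal.ofReal_ne_top

lemma El_le_of_ball {m : ℤ} {G : Rd d → ℝ≥0∞} {x : Rd d} {a : ℝ≥0∞}
    (h : ∀ R : ℝ, (2 : ℝ) ^ m ≤ R → ∫⁻ y in Metric.ball x R, G y ≤ ENNReal.ofReal (R ^ d) * a) :
    El m G x ≤ cA d * a := by
  have h2 : (0 : ℝ) < 2 ^ m := by positivity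
  have hs := Real.sqrt_nonneg (d : ℝ)
  unfold El
  rw [ENNReal.inv_mul_le_iff (vol_ne_zero m) (vol_ne_top m)]
  calc ∫⁻ y in cube m x, G y ≤ ∫⁻ y in Metric.ball x ((√d + 1) * 2 ^ m), G y := by
        refine lintegral_mono_set fun y hy => ?_
        rw [Metric.mem_ball, dist_eq_norm]
        have := norm_sub_le_of_mem_cube hy
        nlinarith
    _ ≤ _ := h _ (by nlinarith)
    _ = _ := by
        rw [mul_pow, ENNReal.ofReal_mul (by positivity), vol, cA]; ring

namespace Ctl

variable {V a : ℝ≥0∞} {q : ℝ} {G : Rd d → ℝ≥0∞}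

lemma El_le (h : Ctl σ V q a G) (x : Rd d) : El (σ x) G x ≤ cA d * a :=
  El_le_of_ball fun R hR => h.loc x R hR

end Ctl

lemma Stop.lintegral_El (h : Stop σ J0 s) {G : Rd d → ℝ≥0∞} (hG : Measurable G) :
    ∫⁻ x, El (σ x) G x = ∫⁻ x, G x := by
  rw [h.lintegral_eq fun m => measurable_El m hG,
    show ∫⁻ x, G x = ∫⁻ x, (fun (_ : ℤ) => G) (σ x) x from rfl, h.lintegral_eq fun m => hG]
  refine Finset.sum_congr rfl fun m _ => ?_
  rw [← lintegral_indicator (h.measurableSet_U m), ← lintegral_indicator (h.measurableSet_U m),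
    ← (h.sat m).El_indicator, A1Rough.lintegral_El m (hG.indicator (h.measurableSet_U m))]

lemma Stop.lintegral_El_sq_le (h : Stop σ J0 s) {V a : ℝ≥0∞} {q : ℝ} {G : Rd d → ℝ≥0∞}
    (hG : Ctl σ V q a G) : ∫⁻ x, El (σ x) G x ^ 2 ≤ cA d * a ^ 2 * V := by
  calc ∫⁻ x, El (σ x) G x ^ 2 ≤ ∫⁻ x, cA d * a * El (σ x) G x := by
        refine lintegral_mono fun x => ?_
        rw [pow_two]
        exact mul_le_mul_left (hG.El_le x) _
    _ = cA d * a * ∫⁻ x, G x := by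
        rw [lintegral_const_mul _ (h.measurable_comp fun m => measurable_El m hG.meas),
          h.lintegral_El hG.meas]
    _ ≤ cA d * a * (a * V) := mul_le_mul_right hG.mass _
    _ = _ := by ring

section Split

variable {V a t l : ℝ≥0∞} {ε : ℝ} {G : Rd d → ℝ≥0∞}

lemma lo_sq_le (hε : 0 < ε) (hε1 : ε ≤ 1) {t x : ℝ≥0∞} (hx : x ≤ t) (ht : t ≠ ⊤) :
    x ^ 2 ≤ t ^ (1 - ε) * x ^ (1 + ε) := by
  have : x ^ 2 = x ^ (1 - ε) * x ^ (1 + ε) := by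
    rw [← ENNReal.rpow_add_of_nonneg _ _ (by linarith) (by linarith), ← ENNReal.rpow_natCast]
    congr 1; push_cast; ring
  rw [this]
  exact mul_le_mul_left (ENNReal.rpow_le_rpow hx (by linarith)) _

lemma hi_mul_le (hε : 0 < ε) {t x : ℝ≥0∞} (hx : t ≤ x) : t ^ ε * x ≤ x ^ (1 + ε) := by
  rw [ENNReal.rpow_add_of_nonneg _ _ zero_le_one hε.le, ENNReal.rpow_one, mul_comm]
  exact mul_le_mul_right (ENNReal.rpow_le_rpow hx hε.le) _

/-- The sublevel set. -/
def sub (G : Rd d → ℝ≥0∞) (t : ℝ≥0∞) : Set (Rd d) := {x | G x ≤ t}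

lemma measurableSet_sub (hG : Measurable G) (t : ℝ≥0∞) : MeasurableSet (sub G t) :=
  measurableSet_le hG measurable_const

lemma Ctl.lo_sq (h : Ctl σ V (1 + ε) a G) (hε : 0 < ε) (hε1 : ε ≤ 1) (ha : a ≠ ⊤) (ha0 : a ≠ 0)
    (hl : l ≠ ⊤) (hl1 : 1 ≤ l) :
    ∫⁻ x, (sub G (a * l)).indicator G x ^ 2 ≤ l * a ^ 2 * V := by
  have ht : a * l ≠ ⊤ := ENNReal.mul_ne_top ha hl
  calc ∫⁻ x, (sub G (a * l)).indicator G x ^ 2 ≤ ∫⁻ x, (a * l) ^ (1 - ε) * G x ^ (1 + ε) := by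
        refine lintegral_mono fun x => ?_
        by_cases hx : x ∈ sub G (a * l)
        · rw [Set.indicator_of_mem hx]; exact lo_sq_le hε hε1 hx ht
        · rw [Set.indicator_of_notMem hx]; simp
    _ = (a * l) ^ (1 - ε) * ∫⁻ x, G x ^ (1 + ε) := lintegral_const_mul _ (h.meas.pow_const _)
    _ ≤ (a * l) ^ (1 - ε) * (a ^ (1 + ε) * V) := mul_le_mul_right h.massq _
    _ = l ^ (1 - ε) * (a ^ (1 - ε) * a ^ (1 + ε)) * V := by
        rw [ENNReal.mul_rpow_of_nonneg _ _ (by linarith)]; ring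
    _ = l ^ (1 - ε) * a ^ 2 * V := by
        rw [← ENNReal.rpow_add _ _ ha0 ha, ← ENNReal.rpow_natCast]
        norm_num
    _ ≤ _ := by
        refine mul_le_mul_left (mul_le_mul_left ?_ _) _
        calc l ^ (1 - ε) ≤ l ^ (1 : ℝ) := ENNReal.rpow_le_rpow_of_exponent_le hl1 (by linarith)
          _ = l := ENNReal.rpow_one _

lemma hi_aux (hG : Measurable G) (hε : 0 < ε) (ha : a ≠ ⊤) (ha0 : a ≠ 0) (hl : l ≠ ⊤) (hl1 : 1 ≤ l)
    (A : Set (Rd d)) {V : ℝ≥0∞}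
    (h : ∫⁻ x in A, G x ^ (1 + ε) ≤ a ^ (1 + ε) * V) :
    ∫⁻ x in A, (sub G (a * l))ᶜ.indicator G x ≤ (l ^ ε)⁻¹ * a * V := by
  have hl0 : l ≠ 0 := (zero_lt_one.trans_le hl1).ne'
  have ht : a * l ≠ ⊤ := ENNReal.mul_ne_top ha hl
  have ht0 : a * l ≠ 0 := mul_ne_zero ha0 hl0
  have h1 : (a * l) ^ ε * ∫⁻ x in A, (sub G (a * l))ᶜ.indicator G x ≤ a ^ (1 + ε) * V := by
    refine le_trans ?_ h
    rw [← lintegral_const_mul _ (hG.indicator (measurableSet_sub hG _).compl)]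
    refine lintegral_mono fun x => ?_
    dsimp only
    by_cases hx : x ∈ sub G (a * l)
    · simp [hx]
    · rw [Set.indicator_of_mem (show x ∈ (sub G (a * l))ᶜ from hx)]
      exact hi_mul_le hε (le_of_lt (not_le.1 hx))
  have h0 : (a * l) ^ ε ≠ 0 := by simp [ENNReal.rpow_eq_zero_iff, ht0, ht]
  have h2 : ∫⁻ x in A, (sub G (a * l))ᶜ.indicator G x ≤ ((a * l) ^ ε)⁻¹ * (a ^ (1 + ε) * V) := by
    rw [mul_comm ((a * l) ^ ε)⁻¹, ← div_eq_mul_inv,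
      ENNReal.le_div_iff_mul_le (Or.inl h0) (Or.inl (ENNReal.rpow_ne_top_of_nonneg hε.le ht)), mul_comm]
    exact h1
  refine h2.trans (le_of_eq ?_)
  rw [ENNReal.mul_rpow_of_nonneg _ _ hε.le, ENNReal.mul_inv (Or.inr (ENNReal.rpow_ne_top_of_nonneg hε.le hl))
    (Or.inl (ENNReal.rpow_ne_top_of_nonneg hε.le ha)), ENNReal.rpow_add _ _ ha0 ha, ENNReal.rpow_one]
  calc (a ^ ε)⁻¹ * (l ^ ε)⁻¹ * (a * a ^ ε * V) = ((a ^ ε)⁻¹ * a ^ ε) * ((l ^ ε)⁻¹ * a * V) := by ring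
    _ = _ := by
      rw [ENNReal.inv_mul_cancel (by simp [ha0, ha]) (ENNReal.rpow_ne_top_of_nonneg hε.le ha), one_mul]

lemma Ctl.hi_mass (h : Ctl σ V (1 + ε) a G) (hε : 0 < ε) (ha : a ≠ ⊤) (ha0 : a ≠ 0)
    (hl : l ≠ ⊤) (hl1 : 1 ≤ l) :
    ∫⁻ x, (sub G (a * l))ᶜ.indicator G x ≤ (l ^ ε)⁻¹ * a * V := by
  have := hi_aux h.meas hε ha ha0 hl hl1 Set.univ (V := V) (by simpa using h.massq)
  simpa using this

lemma Ctl.hi_loc (h : Ctl σ V (1 + ε) a G) (hε : 0 < ε) (ha : a ≠ ⊤) (ha0 : a ≠ 0)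
    (hl : l ≠ ⊤) (hl1 : 1 ≤ l) (x : Rd d) (R : ℝ) (hR : (2 : ℝ) ^ (σ x) ≤ R) :
    ∫⁻ y in Metric.ball x R, (sub G (a * l))ᶜ.indicator G y ≤ ENNReal.ofReal (R ^ d) * ((l ^ ε)⁻¹ * a) := by
  have := hi_aux h.meas hε ha ha0 hl hl1 (Metric.ball x R) (V := ENNReal.ofReal (R ^ d))
    (by rw [mul_comm]; exact h.locq x R hR)
  exact this.trans (le_of_eq (mul_comm _ _))

end Split

/-- Averages over the stopping cubes. -/
def Es (σ : Rd d → ℤ) (f : Rd d → ℂ) (x : Rd d) : ℂ := E (σ x) f x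

variable {f : Rd d → ℂ}

lemma Stop.nice_Es (h : Stop σ J0 s) (hf : Nice f) : Nice (Es σ f) := by
  have : Es σ f = fun x => ∑ m ∈ Finset.Ico J0 s, (U σ m).indicator (E m f) x := by
    funext x; rw [h.sum_indicator fun m => E m f]; rfl
  rw [this]
  exact Nice.sum _ fun m _ => (hf.E m).indicator (h.measurableSet_U m)

lemma enorm_Es_le (x : Rd d) : ‖Es σ f x‖ₑ ≤ El (σ x) (fun y => ‖f y‖ₑ) x := enorm_E_le _ _ _

/-- Oscillation on the stopping cubes of scale `m`. -/
def bs (σ : Rd d → ℤ) (f : Rd d → ℂ) (m : ℤ) : Rd d → ℂ := (U σ m).indicator (D m f)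

lemma Stop.nice_bs (h : Stop σ J0 s) (hf : Nice f) (m : ℤ) : Nice (bs σ f m) :=
  (hf.D m).indicator (h.measurableSet_U m)

lemma Stop.E_bs (h : Stop σ J0 s) (hf : Nice f) (m : ℤ) (x : Rd d) : E m (bs σ f m) x = 0 := by
  rw [bs, (h.sat m).E_indicator]
  by_cases hx : x ∈ U σ m
  · rw [Set.indicator_of_mem hx, E_D hf]
  · rw [Set.indicator_of_notMem hx]

lemma Stop.bs_eq_zero (h : Stop σ J0 s) {m : ℤ} (hm : m ∉ Finset.Ico J0 s) (x : Rd d) : bs σ f m x = 0 := by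
  refine Set.indicator_of_notMem (fun hx => hm ?_) _
  rw [← show σ x = m from hx]
  exact Finset.mem_Ico.2 ⟨h.lo x, h.hi x⟩

lemma Stop.sum_bs (h : Stop σ J0 s) (x : Rd d) :
    f x = Es σ f x + ∑ m ∈ Finset.Ico J0 s, bs σ f m x := by
  unfold bs
  rw [h.sum_indicator fun m => D m f]
  simp [D, Es]

lemma enorm_bs_le (m : ℤ) (x : Rd d) :
    ‖bs σ f m x‖ₑ ≤ (U σ m).indicator (fun x => ‖f x‖ₑ + El m (fun y => ‖f y‖ₑ) x) x := by
  unfold bs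
  by_cases hx : x ∈ U σ m
  · rw [Set.indicator_of_mem hx, Set.indicator_of_mem hx]
    exact enorm_sub_le.trans (add_le_add le_rfl (enorm_E_le _ _ _))
  · simp [hx]

lemma Stop.sum_lintegral_bs_le (h : Stop σ J0 s) (hf : Nice f) :
    ∑ m ∈ Finset.Ico J0 s, ∫⁻ x, ‖bs σ f m x‖ₑ ≤ 2 * ∫⁻ x, ‖f x‖ₑ := by
  have hfm : Measurable fun x => ‖f x‖ₑ := hf.1.enorm
  calc ∑ m ∈ Finset.Ico J0 s, ∫⁻ x, ‖bs σ f m x‖ₑ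
      ≤ ∑ m ∈ Finset.Ico J0 s, ∫⁻ x in U σ m, (‖f x‖ₑ + El m (fun y => ‖f y‖ₑ) x) := by
        refine Finset.sum_le_sum fun m _ => ?_
        rw [← lintegral_indicator (h.measurableSet_U m)]
        exact lintegral_mono fun x => enorm_bs_le m x
    _ = ∫⁻ x, (‖f x‖ₑ + El (σ x) (fun y => ‖f y‖ₑ) x) :=
        (h.lintegral_eq (a := fun m x => ‖f x‖ₑ + El m (fun y => ‖f y‖ₑ) x)
          fun m => hfm.add (measurable_El m hfm)).symm
    _ = _ := by rw [lintegral_add_left hfm, h.lintegral_El hfm, two_mul]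

lemma enorm_add_sq_le (a b : ℝ≥0∞) : (a + b) ^ 2 ≤ 3 * (a ^ 2 + b ^ 2) := by
  simpa using add_three_sq_le a b 0

lemma Stop.tsum_lintegral_bs_sq_le (h : Stop σ J0 s) (hf : Nice f) :
    ∑' m, ∫⁻ x, ‖bs σ f m x‖ₑ ^ 2 ≤ 6 * ∫⁻ x, ‖f x‖ₑ ^ 2 := by
  have hfm : Measurable fun x => ‖f x‖ₑ := hf.1.enorm
  rw [tsum_eq_sum (s := Finset.Ico J0 s) fun m hm => by simp [h.bs_eq_zero hm]]
  have hm : ∀ m, Measurable fun x => 3 * (‖f x‖ₑ ^ 2 + El m (fun y => ‖f y‖ₑ ^ 2) x) := fun m =>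
    ((hfm.pow_const 2).add (measurable_El m (hfm.pow_const 2))).const_mul _
  calc ∑ m ∈ Finset.Ico J0 s, ∫⁻ x, ‖bs σ f m x‖ₑ ^ 2
      ≤ ∑ m ∈ Finset.Ico J0 s, ∫⁻ x in U σ m, 3 * (‖f x‖ₑ ^ 2 + El m (fun y => ‖f y‖ₑ ^ 2) x) := by
        refine Finset.sum_le_sum fun m _ => ?_
        rw [← lintegral_indicator (h.measurableSet_U m)]
        refine lintegral_mono fun x => ?_
        have := enorm_bs_le (σ := σ) (f := f) m x
        by_cases hx : x ∈ U σ m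
        · rw [Set.indicator_of_mem hx] at this
          rw [Set.indicator_of_mem hx]
          refine (pow_le_pow_left₀ zero_le this 2).trans ((enorm_add_sq_le _ _).trans ?_)
          refine mul_le_mul_right (add_le_add le_rfl ?_) _
          have := El_rpow_le m (q := 2) (by norm_num) hfm x
          simpa using this
        · rw [Set.indicator_of_notMem hx] at this
          simp [nonpos_iff_eq_zero.1 this]
    _ = ∫⁻ x, 3 * (‖f x‖ₑ ^ 2 + El (σ x) (fun y => ‖f y‖ₑ ^ 2) x) := (h.lintegral_eq hm).symm
    _ = _ := by
        have hm2 : Measurable fun x => ‖f x‖ₑ ^ 2 + El (σ x) (fun y => ‖f y‖ₑ ^ 2) x :=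
          (hfm.pow_const 2).add
            (h.measurable_comp (a := fun m x => El m (fun y => ‖f y‖ₑ ^ 2) x)
              fun m => measurable_El m (hfm.pow_const 2))
        rw [lintegral_const_mul _ hm2, lintegral_add_left (hfm.pow_const 2), h.lintegral_El (hfm.pow_const 2)]
        ring

end A1Rough

namespace A1Rough

variable {d : ℕ} {σ : Rd d → ℤ} {J0 s : ℤ}

/-- The geometric weights of the local estimate. -/
def wt (i : ℕ) : ℝ≥0∞ := ENNReal.ofReal (√kap ^ i)

lemma sqrt_kap_pos : 0 < √kap := Real.sqrt_pos.2 kap_pos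

lemma sqrt_kap_lt_one : √kap < 1 := by
  rw [Real.sqrt_lt' one_pos]; simpa using kap_lt_one

lemma wt_ne_zero (i : ℕ) : wt i ≠ 0 := by
  have : 0 < √kap ^ i := pow_pos sqrt_kap_pos i
  exact (ENNReal.ofReal_pos.2 this).ne'

lemma wt_ne_top (i : ℕ) : wt i ≠ ⊤ := ENNReal.ofReal_ne_top

lemma wt_le_one (i : ℕ) : wt i ≤ 1 := by
  rw [wt, ENNReal.ofReal_le_one]
  exact pow_le_one₀ sqrt_kap_pos.le sqrt_kap_lt_one.le

lemma one_le_inv_wt (i : ℕ) : 1 ≤ (wt i)⁻¹ := ENNReal.one_le_inv.2 (wt_le_one i)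

lemma inv_wt_ne_top (i : ℕ) : (wt i)⁻¹ ≠ ⊤ := ENNReal.inv_ne_top.2 (wt_ne_zero i)

lemma ofReal_kap_pow (k i : ℕ) : ENNReal.ofReal (kap ^ (k * i)) = wt i ^ (2 * k) := by
  rw [wt, ← ENNReal.ofReal_pow (by positivity), ← pow_mul, mul_comm i, mul_assoc, pow_mul _ 2,
    Real.sq_sqrt kap_pos.le]

lemma inv_wt_rpow_inv (i : ℕ) (ε : ℝ) : (((wt i)⁻¹) ^ ε)⁻¹ = wt i ^ ε := by
  rw [ENNReal.inv_rpow, inv_inv]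

lemma wt_le_rpow (i : ℕ) {ε : ℝ} (hε1 : ε ≤ 1) : wt i ≤ wt i ^ ε := by
  conv_lhs => rw [← ENNReal.rpow_one (wt i)]
  exact ENNReal.rpow_le_rpow_of_exponent_ge (wt_le_one i) hε1

lemma tsum_wt_le : ∃ C : ℝ≥0∞, C ≠ ⊤ ∧ ∀ ε : ℝ, 0 < ε → ε ≤ 1 →
    ∑' i, wt i ^ ε ≤ C * ENNReal.ofReal ε⁻¹ := by
  refine ⟨ENNReal.ofReal (1 - √kap)⁻¹, ENNReal.ofReal_ne_top, fun ε hε hε1 => ?_⟩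
  have h0 := sqrt_kap_pos
  have h1 := sqrt_kap_lt_one
  have hb : √kap ^ ε ≤ 1 + ε * (√kap - 1) := by
    have := _root_.rpow_one_add_le_one_add_mul_self (s := √kap - 1) (by linarith) hε.le hε1
    simpa using this
  have hpos : 0 < √kap ^ ε := Real.rpow_pos_of_pos h0 _
  have hlt : √kap ^ ε < 1 := Real.rpow_lt_one h0.le h1 hε
  have e : ∀ i, wt i ^ ε = ENNReal.ofReal ((√kap ^ ε) ^ i) := fun i => by
    rw [wt, ENNReal.ofReal_rpow_of_pos (pow_pos h0 i), ← Real.rpow_natCast, ← Real.rpow_natCast,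
      ← Real.rpow_mul h0.le, ← Real.rpow_mul h0.le, mul_comm]
  simp_rw [e]
  rw [← ENNReal.ofReal_tsum_of_nonneg (fun k => pow_nonneg hpos.le k)
    (summable_geometric_of_lt_one hpos.le hlt), tsum_geometric_of_lt_one hpos.le hlt,
    ← ENNReal.ofReal_mul (by rw [inv_nonneg]; linarith), ← mul_inv]
  refine ENNReal.ofReal_le_ofReal (inv_anti₀ (mul_pos (by linarith) hε) ?_)
  linarith

lemma lintegral_mul_le_of_sq {f g : Rd d → ℝ≥0∞} (hf : Measurable f) (hg : Measurable g) {A B : ℝ≥0∞}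
    (h1 : ∫⁻ x, f x ^ 2 ≤ A ^ 2) (h2 : ∫⁻ x, g x ^ 2 ≤ B ^ 2) : ∫⁻ x, f x * g x ≤ A * B := by
  have := (lintegral_mul_sq_le volume hf.aemeasurable hg.aemeasurable).trans (mul_le_mul' h1 h2)
  rw [← mul_pow] at this
  exact le_of_not_gt fun h => absurd this (not_le.2 (ENNReal.pow_lt_pow_left two_ne_zero h))

lemma le_one_add_sq (B : ℝ≥0∞) : B ≤ (1 + B) ^ 2 := by
  rw [sq]
  calc B ≤ 1 + B := le_add_self
    _ = (1 + B) * 1 := (mul_one _).symm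
    _ ≤ _ := mul_le_mul_right le_self_add _

lemma le_SM {u : ℤ → Rd d → ℂ} {J : ℤ} (hJ : J ∈ Finset.Icc J0 s) (x : Rd d) :
    ‖∑ j ∈ Finset.Icc J s, u j x‖ₑ ≤ SM J0 s u x := le_iSup₂ (f := fun J (_ : J ∈ Finset.Icc J0 s) =>
      ‖∑ j ∈ Finset.Icc J s, u j x‖ₑ) J hJ

lemma SM_mono {J1 : ℤ} (h : J0 ≤ J1) (u : ℤ → Rd d → ℂ) (x : Rd d) : SM J1 s u x ≤ SM J0 s u x :=
  iSup₂_le fun _ hJ => le_SM (Finset.Icc_subset_Icc_left h hJ) x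

lemma SM_le_add {u v w : ℤ → Rd d → ℂ} {x : Rd d} (h : ∀ j ∈ Finset.Icc J0 s, u j x = v j x + w j x) :
    SM J0 s u x ≤ SM J0 s v x + SM J0 s w x := by
  refine iSup₂_le fun J hJ => ?_
  rw [Finset.sum_congr rfl fun j hj => h j (Finset.Icc_subset_Icc_left (Finset.mem_Icc.1 hJ).1 hj),
    Finset.sum_add_distrib]
  exact (enorm_add_le _ _).trans (add_le_add (le_SM hJ x) (le_SM hJ x))

lemma SM_le_sum {ι : Type*} (t : Finset ι) {u : ℤ → Rd d → ℂ} {v : ι → ℤ → Rd d → ℂ} {x : Rd d}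
    (h : ∀ j ∈ Finset.Icc J0 s, u j x = ∑ i ∈ t, v i j x) : SM J0 s u x ≤ ∑ i ∈ t, SM J0 s (v i) x := by
  refine iSup₂_le fun J hJ => ?_
  rw [Finset.sum_congr rfl fun j hj => h j (Finset.Icc_subset_Icc_left (Finset.mem_Icc.1 hJ).1 hj),
    Finset.sum_comm]
  exact (enorm_sum_le _ _).trans (Finset.sum_le_sum fun i _ => le_SM hJ x)

lemma SM_le_sum_enorm (u : ℤ → Rd d → ℂ) (x : Rd d) : SM J0 s u x ≤ ∑ j ∈ Finset.Icc J0 s, ‖u j x‖ₑ := by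
  refine iSup₂_le fun J hJ => (enorm_sum_le _ _).trans ?_
  exact Finset.sum_le_sum_of_subset (Finset.Icc_subset_Icc_left (Finset.mem_Icc.1 hJ).1)

section Good

variable {V a b : ℝ≥0∞} {ε : ℝ} {F : Rd d → ℂ} {g : Rd d → ℝ≥0∞}

lemma Stop.lintegral_El_mul (h : Stop σ J0 s) {G g : Rd d → ℝ≥0∞} (hG : Measurable G) (hg : Measurable g) :
    ∫⁻ x, El (σ x) G x * g x = ∫⁻ x, G x * El (σ x) g x := by
  rw [h.lintegral_eq (a := fun m x => El m G x * g x) fun m => (measurable_El m hG).mul hg,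
    h.lintegral_eq (a := fun m x => G x * El m g x) fun m => hG.mul (measurable_El m hg)]
  refine Finset.sum_congr rfl fun m _ => ?_
  have hU := h.measurableSet_U m
  rw [← lintegral_indicator hU, ← lintegral_indicator hU]
  have := A1Rough.lintegral_El_mul m hG (hg.indicator hU)
  rw [(h.sat m).El_indicator] at this
  simpa only [Set.indicator_mul_right] using this

lemma enorm_Es_le_const (hF : Ctl σ V (1 + ε) a (fun x => ‖F x‖ₑ)) (x : Rd d) : ‖Es σ F x‖ₑ ≤ cA d * a :=
  (enorm_Es_le x).trans (hF.El_le x)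

lemma Stop.lintegral_Es_sq_le (h : Stop σ J0 s) (hF : Ctl σ V (1 + ε) a (fun x => ‖F x‖ₑ)) :
    ∫⁻ x, ‖Es σ F x‖ₑ ^ 2 ≤ cA d * a ^ 2 * V :=
  (lintegral_mono fun x => pow_le_pow_left₀ zero_le (enorm_Es_le x) 2).trans (h.lintegral_El_sq_le hF)

lemma enorm_cv_ker_le_const {Ω : Rd d → ℂ} {C : ℝ} (hΩ : Homog Ω C) (j : ℤ) {f : Rd d → ℂ} {M : ℝ≥0∞}
    (hf : ∀ x, ‖f x‖ₑ ≤ M) (x : Rd d) :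
    ‖cv (ker Ω j) f x‖ₑ ≤ ENNReal.ofReal (C * 4 ^ d) * volB d * M := by
  have h2 : (0 : ℝ) < 2 ^ j := by positivity
  refine (enorm_cv_ker_le hΩ j f x).trans ?_
  calc _ ≤ ENNReal.ofReal (C * (((2 : ℝ) ^ j) ^ d)⁻¹) * ∫⁻ _ in Metric.ball x ((2 : ℝ) ^ (j + 2)), M :=
        mul_le_mul_right (lintegral_mono fun y => hf y) _
    _ = ENNReal.ofReal (C * (((2 : ℝ) ^ j) ^ d)⁻¹) * ENNReal.ofReal (((2 : ℝ) ^ (j + 2)) ^ d) * volB d * M := by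
        rw [setLIntegral_const, volume_ball_eq x (by positivity)]; ring
    _ = _ := by
        rw [← ENNReal.ofReal_mul (mul_nonneg hΩ.1 (by positivity)), zpow_add₀ two_ne_zero]
        congr 3
        field_simp
        rw [mul_pow]; norm_num; ring

lemma enorm_D_le_const (m : ℤ) {f : Rd d → ℂ} {M : ℝ≥0∞} (hf : ∀ x, ‖f x‖ₑ ≤ M) (x : Rd d) :
    ‖D m f x‖ₑ ≤ 2 * M := by
  refine enorm_sub_le.trans ((add_le_add (hf x) ((enorm_E_le m f x).trans ?_)).trans (two_mul M).ge)
  unfold El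
  rw [ENNReal.inv_mul_le_iff (vol_ne_zero m) (vol_ne_top m)]
  refine (lintegral_mono fun y => hf y).trans ?_
  rw [setLIntegral_const, volume_cube, mul_comm]

lemma sub_add_compl (G : Rd d → ℝ≥0∞) (t : ℝ≥0∞) (x : Rd d) :
    G x = (sub G t).indicator G x + (sub G t)ᶜ.indicator G x :=
  (congrFun (Set.indicator_self_add_compl (sub G t) G) x).symm

/-- The stopped oscillation of a single convolution. -/
def TD (Ω : Rd d → ℂ) (σ : Rd d → ℤ) (f : Rd d → ℂ) (i : ℕ) (x : Rd d) : ℝ≥0∞ :=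
  ‖D (σ x) (cv (ker Ω (σ x + i)) f) x‖ₑ

lemma Stop.measurable_TD (h : Stop σ J0 s) {Ω : Rd d → ℂ} {C : ℝ} (hΩ : Homog Ω C) {f : Rd d → ℂ}
    (hf : Nice f) (i : ℕ) : Measurable (TD Ω σ f i) :=
  h.measurable_comp (a := fun m x => ‖D m (cv (ker Ω (m + i)) f) x‖ₑ)
    fun _ => (((nice_ker hΩ _).cv hf).D _).1.enorm

lemma exists_TD_le (hd : 1 ≤ d) (C : ℝ) : ∃ B : ℝ≥0∞, B ≠ ⊤ ∧ ∀ Ω : Rd d → ℂ, MZ Ω C →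
    ∀ (σ : Rd d → ℤ) (J0 s : ℤ), Stop σ J0 s → ∀ ε : ℝ, 0 < ε → ε ≤ 1 →
    ∀ F : Rd d → ℂ, Nice F → ∀ (g : Rd d → ℝ≥0∞) (V a b : ℝ≥0∞),
    Ctl σ V (1 + ε) a (fun x => ‖F x‖ₑ) → Ctl σ V (1 + ε) b g → b ≠ 0 → b ≠ ⊤ →
    ∀ i : ℕ, ∫⁻ x, TD Ω σ (Es σ F) i x * g x ≤ B * wt i ^ ε * (a * b * V) := by
  obtain ⟨B1, hB1, H1⟩ := exists_D_cv_le hd C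
  refine ⟨(1 + B1) * cA d + 2 * (ENNReal.ofReal (C * 4 ^ d) * volB d * cA d), ?_, ?_⟩
  · have := volB_ne_top (d := d)
    have := cA_ne_top (d := d)
    finiteness
  intro Ω hΩ σ J0 s h ε hε hε1 F hF g V a b hFc hg hb0 hb i
  have hTm := h.measurable_TD hΩ.1 (h.nice_Es hF) i
  have hT2 : ∫⁻ x, TD Ω σ (Es σ F) i x ^ 2 ≤ B1 * wt i ^ 8 * (cA d * a ^ 2 * V) := by
    unfold TD
    rw [h.lintegral_eq (a := fun m x => ‖D m (cv (ker Ω (m + i)) (Es σ F)) x‖ₑ ^ 2)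
      fun _ => (((nice_ker hΩ.1 _).cv (h.nice_Es hF)).D _).1.enorm.pow_const 2]
    calc _ ≤ ∑ m ∈ Finset.Ico J0 s, ∫⁻ x, ‖D m (cv (ker Ω (m + i)) (Es σ F)) x‖ₑ ^ 2 :=
          Finset.sum_le_sum fun m _ => setLIntegral_le_lintegral _ _
      _ ≤ ∑' m : ℤ, ∫⁻ x, ‖D m (cv (ker Ω (m + i)) (Es σ F)) x‖ₑ ^ 2 := ENNReal.sum_le_tsum _
      _ ≤ _ := by
          refine (H1 Ω hΩ _ (h.nice_Es hF) i).trans ?_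
          rw [ofReal_kap_pow]
          exact mul_le_mul_right (h.lintegral_Es_sq_le hFc) _
  set l := (wt i)⁻¹ with hl
  have hl1 : 1 ≤ l := one_le_inv_wt i
  have hlt : l ≠ ⊤ := inv_wt_ne_top i
  have hwl : wt i * l = 1 := ENNReal.mul_inv_cancel (wt_ne_zero i) (wt_ne_top i)
  have hgl := hg.meas.indicator (measurableSet_sub hg.meas (b * l))
  have e : ∫⁻ x, TD Ω σ (Es σ F) i x * g x =
      (∫⁻ x, TD Ω σ (Es σ F) i x * (sub g (b * l)).indicator g x) +
        ∫⁻ x, TD Ω σ (Es σ F) i x * (sub g (b * l))ᶜ.indicator g x := by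
    refine Eq.trans ?_ (lintegral_add_left (hTm.mul hgl) _)
    refine lintegral_congr fun x => ?_
    rw [Pi.mul_apply, ← mul_add, ← sub_add_compl]
  rw [e]
  have h1 : ∫⁻ x, TD Ω σ (Es σ F) i x * (sub g (b * l)).indicator g x ≤
      (1 + B1) * cA d * wt i ^ ε * (a * b * V) := by
    rcases eq_or_ne V ⊤ with rfl | hV
    · rcases eq_or_ne a 0 with rfl | ha0
      · have : ∫⁻ x, TD Ω σ (Es σ F) i x ^ 2 ≤ 0 := hT2.trans (by simp)
        have := lintegral_mul_le_of_sq hTm hgl (A := 0) (B := ⊤) (by simpa using this) (by simp)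
        simpa using this
      · have : (1 + B1) * cA d * wt i ^ ε ≠ 0 := by
          have h1 : wt i ^ ε ≠ 0 := by simp [ENNReal.rpow_eq_zero_iff, wt_ne_zero, wt_ne_top]
          have h2 : cA d ≠ 0 := (zero_lt_one.trans_le one_le_cA).ne'
          simp [h1, h2]
        have h3 : a * b * ⊤ = ⊤ := ENNReal.mul_top (mul_ne_zero ha0 hb0)
        rw [h3, ENNReal.mul_top this]; exact le_top
    set v := V ^ (1 / 2 : ℝ) with hv
    have hv2 : v ^ 2 = V := by
      rw [hv, ← ENNReal.rpow_natCast, ← ENNReal.rpow_mul]; norm_num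
    have hA : ∫⁻ x, TD Ω σ (Es σ F) i x ^ 2 ≤ ((1 + B1) * wt i ^ 4 * cA d * a * v) ^ 2 := by
      refine hT2.trans ?_
      calc B1 * wt i ^ 8 * (cA d * a ^ 2 * V) ≤ (1 + B1) ^ 2 * wt i ^ 8 * (cA d ^ 2 * a ^ 2 * V) := by
            refine mul_le_mul' (mul_le_mul_left (le_one_add_sq B1) _) (mul_le_mul_left (mul_le_mul_left ?_ _) _)
            exact le_self_pow₀ one_le_cA two_ne_zero
        _ = _ := by rw [← hv2]; ring
    have hB : ∫⁻ x, (sub g (b * l)).indicator g x ^ 2 ≤ (l * b * v) ^ 2 := by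
      refine (hg.lo_sq hε hε1 hb hb0 hlt hl1).trans ?_
      rw [mul_pow, mul_pow, hv2]
      exact mul_le_mul_left (mul_le_mul_left (le_self_pow₀ hl1 two_ne_zero) _) _
    refine (lintegral_mul_le_of_sq hTm hgl hA hB).trans ?_
    calc (1 + B1) * wt i ^ 4 * cA d * a * v * (l * b * v)
        = (1 + B1) * cA d * (wt i ^ 3 * (wt i * l)) * (a * b * v ^ 2) := by ring
      _ = (1 + B1) * cA d * wt i ^ 3 * (a * b * V) := by rw [hwl, hv2, mul_one]
      _ ≤ _ := by
        refine mul_le_mul_left (mul_le_mul_right ?_ _) _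
        exact (pow_le_of_le_one (zero_le) (wt_le_one i) (by norm_num)).trans (wt_le_rpow i hε1)
  have h2 : ∫⁻ x, TD Ω σ (Es σ F) i x * (sub g (b * l))ᶜ.indicator g x ≤
      2 * (ENNReal.ofReal (C * 4 ^ d) * volB d * cA d) * wt i ^ ε * (a * b * V) := by
    calc _ ≤ ∫⁻ x, 2 * (ENNReal.ofReal (C * 4 ^ d) * volB d * (cA d * a)) * (sub g (b * l))ᶜ.indicator g x :=
          lintegral_mono fun x => mul_le_mul_left (enorm_D_le_const _
            (fun y => enorm_cv_ker_le_const hΩ.1 _ (enorm_Es_le_const hFc) y) x) _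
      _ = 2 * (ENNReal.ofReal (C * 4 ^ d) * volB d * (cA d * a)) * ∫⁻ x, (sub g (b * l))ᶜ.indicator g x :=
          lintegral_const_mul _ (hg.meas.indicator (measurableSet_sub hg.meas _).compl)
      _ ≤ 2 * (ENNReal.ofReal (C * 4 ^ d) * volB d * (cA d * a)) * (wt i ^ ε * b * V) := by
          refine mul_le_mul_right ((hg.hi_mass hε hb hb0 hlt hl1).trans (le_of_eq ?_)) _
          rw [hl, inv_wt_rpow_inv]
      _ = _ := by ring
  refine (add_le_add h1 h2).trans (le_of_eq ?_)
  ring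

end Good

end A1Rough

namespace A1Rough

variable {d : ℕ} {σ : Rd d → ℤ} {J0 s : ℤ} {Ω : Rd d → ℂ} {C : ℝ}

/-- The stopped maximal truncation. -/
def SS (Ω : Rd d → ℂ) (σ : Rd d → ℤ) (s : ℤ) (f : Rd d → ℂ) (x : Rd d) : ℝ≥0∞ :=
  SM (σ x + 1) s (fun j => cv (ker Ω j) f) x

lemma Stop.measurable_SS (h : Stop σ J0 s) (hΩ : Homog Ω C) {f : Rd d → ℂ} (hf : Nice f) :
    Measurable (SS Ω σ s f) :=
  h.measurable_comp (a := fun m x => SM (m + 1) s (fun j => cv (ker Ω j) f) x)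
    fun _ => measurable_SM fun j => ((nice_ker hΩ j).cv hf).1

lemma SS_good_le (h : Stop σ J0 s) (hΩ : Homog Ω C) {f : Rd d → ℂ} (hf : Nice f) (x : Rd d) :
    SS Ω σ s f x ≤ El (σ x) (SM J0 s (fun j => cv (ker Ω j) f)) x + ∑' i, TD Ω σ f i x := by
  have hn : ∀ j, Nice (cv (ker Ω j) f) := fun j => (nice_ker hΩ j).cv hf
  refine iSup₂_le fun J hJ => ?_
  rw [Finset.mem_Icc] at hJ
  have hJ0 : J ∈ Finset.Icc J0 s := Finset.mem_Icc.2 ⟨by linarith [h.lo x], hJ.2⟩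
  have e : ∑ j ∈ Finset.Icc J s, cv (ker Ω j) f x =
      E (σ x) (fun y => ∑ j ∈ Finset.Icc J s, cv (ker Ω j) f y) x +
        ∑ j ∈ Finset.Icc J s, D (σ x) (cv (ker Ω j) f) x := by
    rw [← D_sum _ fun j _ => hn j]; simp [D]
  rw [e]
  refine (enorm_add_le _ _).trans (add_le_add ?_ ?_)
  · refine (enorm_E_le _ _ _).trans ?_
    unfold El
    exact mul_le_mul_right (lintegral_mono fun y => le_SM hJ0 y) _
  · refine (enorm_sum_le _ _).trans ?_
    have hinj : Set.InjOn (fun j : ℤ => (j - σ x).toNat) (Finset.Icc J s : Set ℤ) := by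
      intro j hj k hk hjk
      simp only [Finset.coe_Icc, Set.mem_Icc] at hj hk
      simp only at hjk
      omega
    calc ∑ j ∈ Finset.Icc J s, ‖D (σ x) (cv (ker Ω j) f) x‖ₑ
        = ∑ j ∈ Finset.Icc J s, TD Ω σ f (j - σ x).toNat x := by
          refine Finset.sum_congr rfl fun j hj => ?_
          rw [Finset.mem_Icc] at hj
          rw [TD, show σ x + ((j - σ x).toNat : ℤ) = j by omega]
      _ = ∑ i ∈ (Finset.Icc J s).image (fun j : ℤ => (j - σ x).toNat), TD Ω σ f i x :=
          (Finset.sum_image (f := fun i => TD Ω σ f i x) hinj).symm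
      _ ≤ _ := ENNReal.sum_le_tsum _

lemma exists_good_le (hd : 1 ≤ d) (C : ℝ) : ∃ B : ℝ≥0∞, B ≠ ⊤ ∧ ∀ Ω : Rd d → ℂ, MZ Ω C →
    ∀ (σ : Rd d → ℤ) (J0 s : ℤ), Stop σ J0 s → ∀ ε : ℝ, 0 < ε → ε ≤ 1 →
    ∀ F : Rd d → ℂ, Nice F → ∀ (g : Rd d → ℝ≥0∞) (V a b : ℝ≥0∞),
    Ctl σ V (1 + ε) a (fun x => ‖F x‖ₑ) → Ctl σ V (1 + ε) b g → b ≠ 0 → b ≠ ⊤ →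
    ∫⁻ x, SS Ω σ s (Es σ F) x * g x ≤ B * ENNReal.ofReal ε⁻¹ * (a * b * V) := by
  obtain ⟨B1, hB1, H1⟩ := exists_SM_cv_le hd C
  obtain ⟨B2, hB2, H2⟩ := exists_TD_le hd C
  obtain ⟨B3, hB3, H3⟩ := tsum_wt_le
  refine ⟨(1 + B1) * cA d + B2 * B3, by have := cA_ne_top (d := d); finiteness, ?_⟩
  intro Ω hΩ σ J0 s h ε hε hε1 F hF g V a b hFc hg hb0 hb
  set u : ℤ → Rd d → ℂ := fun j => cv (ker Ω j) (Es σ F) with hu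
  have hum : Measurable (SM J0 s u) := measurable_SM fun j => ((nice_ker hΩ.1 j).cv (h.nice_Es hF)).1
  have hEm : Measurable fun x => El (σ x) (SM J0 s u) x := h.measurable_comp fun m => measurable_El m hum
  have hTm := fun i => h.measurable_TD hΩ.1 (h.nice_Es hF) i
  have hε' : 1 ≤ ENNReal.ofReal ε⁻¹ := by
    rw [← ENNReal.ofReal_one]; exact ENNReal.ofReal_le_ofReal ((one_le_inv₀ hε).2 hε1)
  have h1 : ∫⁻ x, El (σ x) (SM J0 s u) x * g x ≤ (1 + B1) * cA d * ENNReal.ofReal ε⁻¹ * (a * b * V) := by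
    rw [h.lintegral_El_mul hum hg.meas]
    set v := V ^ (1 / 2 : ℝ) with hv
    have hv2 : v ^ 2 = V := by
      rw [hv, ← ENNReal.rpow_natCast, ← ENNReal.rpow_mul]; norm_num
    set c := cA d ^ (1 / 2 : ℝ) with hc
    have hc2 : c ^ 2 = cA d := by
      rw [hc, ← ENNReal.rpow_natCast, ← ENNReal.rpow_mul]; norm_num
    have hA : ∫⁻ x, SM J0 s u x ^ 2 ≤ ((1 + B1) * c * a * v) ^ 2 := by
      refine (H1 Ω hΩ _ (h.nice_Es hF) J0 s).trans ?_
      calc _ ≤ (1 + B1) ^ 2 * (cA d * a ^ 2 * V) :=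
            mul_le_mul' (le_one_add_sq B1) (h.lintegral_Es_sq_le hFc)
        _ = _ := by rw [← hv2, ← hc2]; ring
    have hB : ∫⁻ x, El (σ x) g x ^ 2 ≤ (c * b * v) ^ 2 := by
      refine (h.lintegral_El_sq_le hg).trans (le_of_eq ?_)
      rw [← hv2, ← hc2]; ring
    refine (lintegral_mul_le_of_sq hum (h.measurable_comp fun m => measurable_El m hg.meas) hA hB).trans ?_
    calc (1 + B1) * c * a * v * (c * b * v) = (1 + B1) * c ^ 2 * 1 * (a * b * v ^ 2) := by ring
      _ ≤ _ := by
        rw [hc2, hv2]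
        exact mul_le_mul_left (mul_le_mul_right hε' _) _
  have h2 : ∫⁻ x, (∑' i, TD Ω σ (Es σ F) i x) * g x ≤ B2 * B3 * ENNReal.ofReal ε⁻¹ * (a * b * V) := by
    simp_rw [← ENNReal.tsum_mul_right]
    rw [lintegral_tsum (f := fun i x => TD Ω σ (Es σ F) i x * g x)
      fun i => ((hTm i).mul hg.meas).aemeasurable]
    calc _ ≤ ∑' i, B2 * wt i ^ ε * (a * b * V) :=
          ENNReal.tsum_le_tsum fun i => H2 Ω hΩ σ J0 s h ε hε hε1 F hF g V a b hFc hg hb0 hb i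
      _ = B2 * (∑' i, wt i ^ ε) * (a * b * V) := by
          rw [ENNReal.tsum_mul_right, ENNReal.tsum_mul_left]
      _ ≤ B2 * (B3 * ENNReal.ofReal ε⁻¹) * (a * b * V) :=
          mul_le_mul_left (mul_le_mul_right (H3 ε hε hε1) _) _
      _ = _ := by ring
  calc _ ≤ ∫⁻ x, (El (σ x) (SM J0 s u) x * g x + (∑' i, TD Ω σ (Es σ F) i x) * g x) :=
        lintegral_mono fun x => (mul_le_mul_left (SS_good_le h hΩ.1 (h.nice_Es hF) x) _).trans
          (add_mul _ _ _).le
    _ = (∫⁻ x, El (σ x) (SM J0 s u) x * g x) + ∫⁻ x, (∑' i, TD Ω σ (Es σ F) i x) * g x :=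
        lintegral_add_left (hEm.mul hg.meas) _
    _ ≤ _ := (add_le_add h1 h2).trans (le_of_eq (by ring))

/-- The size estimate for a convolution with a function living on the stopping cubes of scale `m`. -/
lemma lintegral_cv_ker_mul_le (hΩ : Homog Ω C) {G : Rd d → ℝ≥0∞} (hG : Measurable G) {A : ℝ≥0∞}
    (hA : ∀ (x : Rd d) (R : ℝ), (2 : ℝ) ^ (σ x) ≤ R →
      ∫⁻ y in Metric.ball x R, G y ≤ ENNReal.ofReal (R ^ d) * A)
    {m j : ℤ} (hj : m ≤ j) {f : Rd d → ℂ} (hf : Nice f) (hfm : ∀ x, σ x ≠ m → f x = 0) :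
    ∫⁻ x, ‖cv (ker Ω j) f x‖ₑ * G x ≤ ENNReal.ofReal (C * 4 ^ d) * A * ∫⁻ x, ‖f x‖ₑ := by
  have h2 : (0 : ℝ) < 2 ^ j := by positivity
  set c := ENNReal.ofReal (C * (((2 : ℝ) ^ j) ^ d)⁻¹) with hc
  set r : ℝ := 2 ^ (j + 2) with hr
  have hmeas : Measurable fun z : Rd d × Rd d => (Metric.ball z.1 r).indicator (fun y => ‖f y‖ₑ) z.2 * G z.1 := by
    refine Measurable.mul ?_ (hG.comp measurable_fst)
    have hs : MeasurableSet {z : Rd d × Rd d | dist z.2 z.1 < r} :=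
      measurableSet_lt (measurable_snd.dist measurable_fst) measurable_const
    exact (hf.1.enorm.comp measurable_snd).indicator hs
  calc ∫⁻ x, ‖cv (ker Ω j) f x‖ₑ * G x
      ≤ ∫⁻ x, c * ∫⁻ y, (Metric.ball x r).indicator (fun y => ‖f y‖ₑ) y * G x := by
        refine lintegral_mono fun x => (mul_le_mul_left (enorm_cv_ker_le hΩ j f x) _).trans (le_of_eq ?_)
        rw [lintegral_mul_const _ (hf.1.enorm.indicator measurableSet_ball),
          lintegral_indicator measurableSet_ball, mul_assoc]
    _ = c * ∫⁻ x, ∫⁻ y, (Metric.ball x r).indicator (fun y => ‖f y‖ₑ) y * G x :=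
        lintegral_const_mul _ hmeas.lintegral_prod_right'
    _ = c * ∫⁻ y, ∫⁻ x, (Metric.ball x r).indicator (fun y => ‖f y‖ₑ) y * G x := by
        rw [lintegral_lintegral_swap hmeas.aemeasurable]
    _ ≤ c * ∫⁻ y, ‖f y‖ₑ * (ENNReal.ofReal (r ^ d) * A) := by
        refine mul_le_mul_right (lintegral_mono fun y => ?_) _
        by_cases hy : σ y = m
        · calc _ = ∫⁻ x, ‖f y‖ₑ * (Metric.ball y r).indicator G x := by
                refine lintegral_congr fun x => ?_
                by_cases hx : x ∈ Metric.ball y r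
                · rw [Set.indicator_of_mem hx, Set.indicator_of_mem (Metric.mem_ball_comm.1 hx)]
                · rw [Set.indicator_of_notMem hx, Set.indicator_of_notMem fun h => hx (Metric.mem_ball_comm.1 h)]
                  simp
            _ = ‖f y‖ₑ * ∫⁻ x in Metric.ball y r, G x := by
                rw [lintegral_const_mul _ (hG.indicator measurableSet_ball), lintegral_indicator measurableSet_ball]
            _ ≤ _ := mul_le_mul_right (hA y r (by
                rw [hr, hy]; exact zpow_le_zpow_right₀ one_le_two (by omega))) _
        · rw [hfm y hy]
          simp [Set.indicator, hfm y hy]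
    _ = c * ENNReal.ofReal (r ^ d) * A * ∫⁻ y, ‖f y‖ₑ := by
        rw [lintegral_mul_const _ hf.1.enorm]; ring
    _ = _ := by
        rw [hc, hr, ← ENNReal.ofReal_mul (mul_nonneg hΩ.1 (by positivity)), zpow_add₀ two_ne_zero]
        congr 3
        field_simp
        rw [mul_pow]; norm_num; ring

lemma bs_eq_zero_of_ne {f : Rd d → ℂ} {m : ℤ} {x : Rd d} (h : σ x ≠ m) : bs σ f m x = 0 :=
  Set.indicator_of_notMem (s := U σ m) h _

lemma Stop.lintegral_SM_bs_mul_le (h : Stop σ J0 s) (hΩ : Homog Ω C) {G : Rd d → ℝ≥0∞} (hG : Measurable G)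
    {A : ℝ≥0∞} (hA : ∀ (x : Rd d) (R : ℝ), (2 : ℝ) ^ (σ x) ≤ R →
      ∫⁻ y in Metric.ball x R, G y ≤ ENNReal.ofReal (R ^ d) * A) {f : Rd d → ℂ} (hf : Nice f) (i : ℕ) :
    ∫⁻ x, SM J0 s (fun j => cv (ker Ω j) (bs σ f (j - i))) x * G x ≤
      2 * ENNReal.ofReal (C * 4 ^ d) * A * ∫⁻ x, ‖f x‖ₑ := by
  have hn : ∀ j, Nice (cv (ker Ω j) (bs σ f (j - i))) := fun j => (nice_ker hΩ j).cv (h.nice_bs hf _)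
  calc _ ≤ ∫⁻ x, ∑ j ∈ Finset.Icc J0 s, ‖cv (ker Ω j) (bs σ f (j - i)) x‖ₑ * G x :=
        lintegral_mono fun x => (mul_le_mul_left (SM_le_sum_enorm _ x) _).trans (Finset.sum_mul _ _ _).le
    _ = ∑ j ∈ Finset.Icc J0 s, ∫⁻ x, ‖cv (ker Ω j) (bs σ f (j - i)) x‖ₑ * G x :=
        lintegral_finsetSum _ fun j _ => (hn j).1.enorm.mul hG
    _ ≤ ∑ j ∈ Finset.Icc J0 s, ENNReal.ofReal (C * 4 ^ d) * A * ∫⁻ x, ‖bs σ f (j - i) x‖ₑ :=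
        Finset.sum_le_sum fun j _ => lintegral_cv_ker_mul_le hΩ hG hA (by omega) (h.nice_bs hf _)
          fun x hx => bs_eq_zero_of_ne hx
    _ = ENNReal.ofReal (C * 4 ^ d) * A * ∑ j ∈ Finset.Icc J0 s, ∫⁻ x, ‖bs σ f (j - i) x‖ₑ :=
        (Finset.mul_sum _ _ _).symm
    _ ≤ ENNReal.ofReal (C * 4 ^ d) * A * (2 * ∫⁻ x, ‖f x‖ₑ) := by
        refine mul_le_mul_right ?_ _
        refine le_trans ?_ (h.sum_lintegral_bs_le hf)
        rw [← Finset.sum_image (s := Finset.Icc J0 s) (g := fun j : ℤ => j - i)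
          (f := fun m => ∫⁻ x, ‖bs σ f m x‖ₑ) (fun a _ b _ hab => by simpa using hab)]
        refine (ENNReal.sum_le_tsum _).trans (le_of_eq ?_)
        exact tsum_eq_sum fun m hm => by simp [h.bs_eq_zero hm]
    _ = _ := by ring

lemma bs_sub {F G : Rd d → ℂ} (hF : Nice F) (hG : Nice G) (m : ℤ) (x : Rd d) :
    bs σ (fun y => F y - G y) m x = bs σ F m x - bs σ G m x := by
  unfold bs
  by_cases hx : x ∈ U σ m
  · rw [Set.indicator_of_mem hx, Set.indicator_of_mem hx, Set.indicator_of_mem hx, D, E_sub hF hG, D, D]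
    ring
  · rw [Set.indicator_of_notMem hx, Set.indicator_of_notMem hx, Set.indicator_of_notMem hx, sub_zero]

lemma exists_SM_bs_le (hd : 1 ≤ d) (C : ℝ) : ∃ B : ℝ≥0∞, B ≠ ⊤ ∧ ∀ Ω : Rd d → ℂ, MZ Ω C →
    ∀ (σ : Rd d → ℤ) (J0 s : ℤ), Stop σ J0 s → ∀ ε : ℝ, 0 < ε → ε ≤ 1 →
    ∀ F : Rd d → ℂ, Nice F → ∀ (g : Rd d → ℝ≥0∞) (V a b : ℝ≥0∞),
    Ctl σ V (1 + ε) a (fun x => ‖F x‖ₑ) → Ctl σ V (1 + ε) b g → a ≠ 0 → a ≠ ⊤ → b ≠ 0 → b ≠ ⊤ →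
    ∀ i : ℕ, ∫⁻ x, SM J0 s (fun j => cv (ker Ω j) (bs σ F (j - i))) x * g x ≤
      B * wt i ^ ε * (a * b * V) := by
  obtain ⟨B1, hB1, H1⟩ := exists_SM_osc_le hd C
  refine ⟨(1 + 6 * B1) + 2 * (2 * ENNReal.ofReal (C * 4 ^ d)), by finiteness, ?_⟩
  intro Ω hΩ σ J0 s h ε hε hε1 F hF g V a b hFc hg ha0 ha hb0 hb i
  set l := (wt i)⁻¹ with hl
  have hl1 : 1 ≤ l := one_le_inv_wt i
  have hlt : l ≠ ⊤ := inv_wt_ne_top i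
  have hwl : wt i * l = 1 := ENNReal.mul_inv_cancel (wt_ne_zero i) (wt_ne_top i)
  set P := sub (fun x => ‖F x‖ₑ) (a * l) with hP
  have hPm : MeasurableSet P := measurableSet_sub hFc.meas _
  have hlo : Nice (P.indicator F) := hF.indicator hPm
  have hhi : Nice (fun x => F x - P.indicator F x) := hF.sub hlo
  have hn : ∀ {f : Rd d → ℂ}, Nice f → ∀ j : ℤ, Nice (cv (ker Ω j) (bs σ f (j - i))) :=
    fun hf j => (nice_ker hΩ.1 j).cv (h.nice_bs hf _)
  have hSm : ∀ {f : Rd d → ℂ}, Nice f → Measurable (SM J0 s fun j => cv (ker Ω j) (bs σ f (j - i))) :=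
    fun hf => measurable_SM fun j => (hn hf j).1
  have hglm := hg.meas.indicator (measurableSet_sub hg.meas (b * l))
  have hghm := hg.meas.indicator (measurableSet_sub hg.meas (b * l)).compl
  have elo : ∀ x, ‖P.indicator F x‖ₑ = P.indicator (fun x => ‖F x‖ₑ) x := fun x => by
    by_cases hx : x ∈ P <;> simp [hx]
  have ehi : ∀ x, ‖F x - P.indicator F x‖ₑ = Pᶜ.indicator (fun x => ‖F x‖ₑ) x := fun x => by
    by_cases hx : x ∈ P <;> simp [hx]
  have h1 : ∫⁻ x, SM J0 s (fun j => cv (ker Ω j) (bs σ (P.indicator F) (j - i))) x *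
      (sub g (b * l)).indicator g x ≤ (1 + 6 * B1) * wt i ^ ε * (a * b * V) := by
    set v := V ^ (1 / 2 : ℝ) with hv
    have hv2 : v ^ 2 = V := by
      rw [hv, ← ENNReal.rpow_natCast, ← ENNReal.rpow_mul]; norm_num
    set k := l ^ (1 / 2 : ℝ) with hk
    have hk2 : k ^ 2 = l := by
      rw [hk, ← ENNReal.rpow_natCast, ← ENNReal.rpow_mul]; norm_num
    have hA : ∫⁻ x, SM J0 s (fun j => cv (ker Ω j) (bs σ (P.indicator F) (j - i))) x ^ 2 ≤
        ((1 + 6 * B1) * wt i ^ 2 * k * a * v) ^ 2 := by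
      refine (H1 Ω hΩ _ (h.nice_bs hlo) (h.E_bs hlo) i J0 s).trans ?_
      rw [ofReal_kap_pow]
      calc B1 * wt i ^ (2 * 2) * ∑' m, ∫⁻ x, ‖bs σ (P.indicator F) m x‖ₑ ^ 2
          ≤ B1 * wt i ^ (2 * 2) * (6 * (l * a ^ 2 * V)) := by
            refine mul_le_mul_right ((h.tsum_lintegral_bs_sq_le hlo).trans (mul_le_mul_right ?_ _)) _
            simp_rw [elo]
            exact hFc.lo_sq hε hε1 ha ha0 hlt hl1
        _ = 6 * B1 * (wt i ^ 4 * (l * a ^ 2 * V)) := by ring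
        _ ≤ (1 + 6 * B1) ^ 2 * (wt i ^ 4 * (l * a ^ 2 * V)) := mul_le_mul_left (le_one_add_sq _) _
        _ = _ := by rw [← hv2, ← hk2]; ring
    have hB : ∫⁻ x, (sub g (b * l)).indicator g x ^ 2 ≤ (k * b * v) ^ 2 := by
      refine (hg.lo_sq hε hε1 hb hb0 hlt hl1).trans (le_of_eq ?_)
      rw [mul_pow, mul_pow, hv2, hk2]
    refine (lintegral_mul_le_of_sq (hSm hlo) hglm hA hB).trans ?_
    calc (1 + 6 * B1) * wt i ^ 2 * k * a * v * (k * b * v)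
        = (1 + 6 * B1) * (wt i * (wt i * k ^ 2)) * (a * b * v ^ 2) := by ring
      _ = (1 + 6 * B1) * wt i * (a * b * V) := by rw [hk2, hwl, hv2, mul_one]
      _ ≤ _ := mul_le_mul_left (mul_le_mul_right (wt_le_rpow i hε1) _) _
  have h2 : ∫⁻ x, SM J0 s (fun j => cv (ker Ω j) (bs σ (P.indicator F) (j - i))) x *
      (sub g (b * l))ᶜ.indicator g x ≤ 2 * ENNReal.ofReal (C * 4 ^ d) * wt i ^ ε * (a * b * V) := by
    refine (h.lintegral_SM_bs_mul_le hΩ.1 hghm (A := wt i ^ ε * b) (fun x R hR => ?_) hlo i).trans ?_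
    · rw [← inv_wt_rpow_inv]
      exact hg.hi_loc hε hb hb0 hlt hl1 x R hR
    · calc _ ≤ 2 * ENNReal.ofReal (C * 4 ^ d) * (wt i ^ ε * b) * (a * V) := by
            refine mul_le_mul_right (le_trans (lintegral_mono fun x => ?_) hFc.mass) _
            rw [elo]
            exact Set.indicator_le_self _ _ _
        _ = _ := by ring
  have h3 : ∫⁻ x, SM J0 s (fun j => cv (ker Ω j) (bs σ (fun x => F x - P.indicator F x) (j - i))) x * g x ≤
      2 * ENNReal.ofReal (C * 4 ^ d) * wt i ^ ε * (a * b * V) := by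
    refine (h.lintegral_SM_bs_mul_le hΩ.1 hg.meas (fun x R hR => hg.loc x R hR) hhi i).trans ?_
    calc _ ≤ 2 * ENNReal.ofReal (C * 4 ^ d) * b * (wt i ^ ε * a * V) := by
          refine mul_le_mul_right ?_ _
          simp_rw [ehi]
          rw [← inv_wt_rpow_inv]
          exact hFc.hi_mass hε ha ha0 hlt hl1
      _ = _ := by ring
  have hpt : ∀ x, SM J0 s (fun j => cv (ker Ω j) (bs σ F (j - i))) x * g x ≤
      SM J0 s (fun j => cv (ker Ω j) (bs σ (P.indicator F) (j - i))) x * (sub g (b * l)).indicator g x +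
      (SM J0 s (fun j => cv (ker Ω j) (bs σ (P.indicator F) (j - i))) x * (sub g (b * l))ᶜ.indicator g x +
      SM J0 s (fun j => cv (ker Ω j) (bs σ (fun x => F x - P.indicator F x) (j - i))) x * g x) := by
    intro x
    rw [← add_assoc, ← mul_add, ← sub_add_compl, ← add_mul]
    refine mul_le_mul_left (SM_le_add fun j _ => ?_) _
    rw [← cv_add (nice_ker hΩ.1 j) (h.nice_bs hlo _) (h.nice_bs hhi _)]
    congr 1
    funext y
    rw [bs_sub hF hlo]; ring
  refine (lintegral_mono hpt).trans ?_
  have e1 := lintegral_add_left (μ := volume) ((hSm hlo).mul hglm) fun x =>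
    SM J0 s (fun j => cv (ker Ω j) (bs σ (P.indicator F) (j - i))) x * (sub g (b * l))ᶜ.indicator g x +
      SM J0 s (fun j => cv (ker Ω j) (bs σ (fun x => F x - P.indicator F x) (j - i))) x * g x
  have e2 := lintegral_add_left (μ := volume) ((hSm hlo).mul hghm) fun x =>
      SM J0 s (fun j => cv (ker Ω j) (bs σ (fun x => F x - P.indicator F x) (j - i))) x * g x
  refine e1.trans_le ((add_le_add h1 (e2.trans_le (add_le_add h2 h3))).trans (le_of_eq ?_))
  ring

lemma Stop.cv_bs_eq_zero (h : Stop σ J0 s) {f : Rd d → ℂ} {x : Rd d} {j m : ℤ} (hx : σ x < j) (hm : j < m) :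
    cv (ker Ω j) (bs σ f m) x = 0 := by
  unfold cv
  refine integral_eq_zero_of_ae (Filter.Eventually.of_forall fun y => ?_)
  rcases le_or_gt ‖x - y‖ ((2 : ℝ) ^ (j + 1)) with hy | hy
  · have : σ y ≤ j := h.sep x y j hx hy
    simp [bs_eq_zero_of_ne (show σ y ≠ m by omega)]
  · simp [ker_eq_zero hy]

lemma Stop.SS_bad_le (h : Stop σ J0 s) (hΩ : Homog Ω C) {f : Rd d → ℂ} (hf : Nice f) (x : Rd d) :
    SS Ω σ s (fun y => ∑ m ∈ Finset.Ico J0 s, bs σ f m y) x ≤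
      ∑' i : ℕ, SM J0 s (fun j => cv (ker Ω j) (bs σ f (j - i))) x := by
  refine le_trans ?_ (ENNReal.sum_le_tsum (Finset.range ((s - J0).toNat + 1)))
  have hlo := h.lo x
  refine (SM_le_sum (Finset.range ((s - J0).toNat + 1))
    (v := fun i j => cv (ker Ω j) (bs σ f (j - i))) fun j hj => ?_).trans
    (Finset.sum_le_sum fun i _ => SM_mono (by omega) _ x)
  rw [Finset.mem_Icc] at hj
  rw [cv_sum _ (nice_ker hΩ j) fun m _ => h.nice_bs hf m,
    ← Finset.sum_image (s := Finset.range ((s - J0).toNat + 1)) (g := fun i : ℕ => j - i)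
      (f := fun m => cv (ker Ω j) (bs σ f m) x) (fun a _ b _ hab => by simpa using hab)]
  refine Finset.sum_congr_of_eq_on_inter (fun m hm hm' => ?_) (fun m _ hm => ?_) fun m _ _ => rfl
  · refine h.cv_bs_eq_zero (by omega) (not_le.1 fun hmj => hm' ?_)
    rw [Finset.mem_Ico] at hm
    exact Finset.mem_image.2 ⟨(j - m).toNat, Finset.mem_range.2 (by omega), by omega⟩
  · rw [show bs σ f m = fun _ => (0 : ℂ) from funext fun y => h.bs_eq_zero hm y]
    simp [cv]

/-- The local estimate: the stopped maximal truncation is controlled by the product of the levels. -/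
theorem exists_SS_le (hd : 1 ≤ d) (C : ℝ) : ∃ B : ℝ≥0∞, B ≠ ⊤ ∧ ∀ Ω : Rd d → ℂ, MZ Ω C →
    ∀ (σ : Rd d → ℤ) (J0 s : ℤ), Stop σ J0 s → ∀ ε : ℝ, 0 < ε → ε ≤ 1 →
    ∀ F : Rd d → ℂ, Nice F → ∀ (g : Rd d → ℝ≥0∞) (V a b : ℝ≥0∞),
    Ctl σ V (1 + ε) a (fun x => ‖F x‖ₑ) → Ctl σ V (1 + ε) b g → a ≠ ⊤ → b ≠ ⊤ →
    ∫⁻ x, SS Ω σ s F x * g x ≤ B * ENNReal.ofReal ε⁻¹ * (a * b * V) := by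
  obtain ⟨B1, hB1, H1⟩ := exists_good_le hd C
  obtain ⟨B2, hB2, H2⟩ := exists_SM_bs_le hd C
  obtain ⟨B3, hB3, H3⟩ := tsum_wt_le
  refine ⟨B1 + B2 * B3, by finiteness, ?_⟩
  intro Ω hΩ σ J0 s h ε hε hε1 F hF g V a b hFc hg ha hb
  rcases eq_or_ne b 0 with rfl | hb0
  · have h0 : ∫⁻ x, g x = 0 := by simpa using hg.mass
    rw [lintegral_eq_zero_iff hg.meas] at h0
    have : ∫⁻ x, SS Ω σ s F x * g x = ∫⁻ _ : Rd d, 0 := lintegral_congr_ae <| by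
      filter_upwards [h0] with x hx
      simp [hx]
    simp [this]
  rcases eq_or_ne a 0 with rfl | ha0
  · have h0 : ∫⁻ x, ‖F x‖ₑ = 0 := by simpa using hFc.mass
    rw [lintegral_eq_zero_iff hFc.meas] at h0
    have hc : ∀ j x, cv (ker Ω j) F x = 0 := fun j x => by
      unfold cv
      refine integral_eq_zero_of_ae ?_
      filter_upwards [h0] with y hy
      simp [enorm_eq_zero.1 hy]
    have : ∀ x, SS Ω σ s F x = 0 := fun x => by simp [SS, SM, hc]
    simp [this]
  have hg1 := H1 Ω hΩ σ J0 s h ε hε hε1 F hF g V a b hFc hg hb0 hb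
  have hβ : Nice fun y => ∑ m ∈ Finset.Ico J0 s, bs σ F m y := Nice.sum _ fun m _ => h.nice_bs hF m
  have hSm : ∀ i : ℕ, Measurable (SM J0 s fun j => cv (ker Ω j) (bs σ F (j - i))) :=
    fun i => measurable_SM fun j => ((nice_ker hΩ.1 j).cv (h.nice_bs hF _)).1
  have hg2 : ∫⁻ x, SS Ω σ s (fun y => ∑ m ∈ Finset.Ico J0 s, bs σ F m y) x * g x ≤
      B2 * B3 * ENNReal.ofReal ε⁻¹ * (a * b * V) := by
    calc _ ≤ ∫⁻ x, ∑' i : ℕ, SM J0 s (fun j => cv (ker Ω j) (bs σ F (j - i))) x * g x :=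
          lintegral_mono fun x => (mul_le_mul_left (h.SS_bad_le hΩ.1 hF x) _).trans
            ENNReal.tsum_mul_right.ge
      _ = ∑' i : ℕ, ∫⁻ x, SM J0 s (fun j => cv (ker Ω j) (bs σ F (j - i))) x * g x :=
          lintegral_tsum fun i => ((hSm i).mul hg.meas).aemeasurable
      _ ≤ ∑' i, B2 * wt i ^ ε * (a * b * V) :=
          ENNReal.tsum_le_tsum fun i => H2 Ω hΩ σ J0 s h ε hε hε1 F hF g V a b hFc hg ha0 ha hb0 hb i
      _ = B2 * (∑' i, wt i ^ ε) * (a * b * V) := by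
          rw [ENNReal.tsum_mul_right, ENNReal.tsum_mul_left]
      _ ≤ B2 * (B3 * ENNReal.ofReal ε⁻¹) * (a * b * V) :=
          mul_le_mul_left (mul_le_mul_right (H3 ε hε hε1) _) _
      _ = _ := by ring
  have hpt : ∀ x, SS Ω σ s F x * g x ≤ SS Ω σ s (Es σ F) x * g x +
      SS Ω σ s (fun y => ∑ m ∈ Finset.Ico J0 s, bs σ F m y) x * g x := fun x => by
    rw [← add_mul]
    refine mul_le_mul_left (SM_le_add fun j _ => ?_) _
    rw [← cv_add (nice_ker hΩ.1 j) (h.nice_Es hF) hβ]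
    congr 1
    funext y
    exact h.sum_bs y
  refine (lintegral_mono hpt).trans ?_
  have e1 := lintegral_add_left (μ := volume) ((h.measurable_SS hΩ.1 (h.nice_Es hF)).mul hg.meas) fun x =>
    SS Ω σ s (fun y => ∑ m ∈ Finset.Ico J0 s, bs σ F m y) x * g x
  refine e1.trans_le ((add_le_add hg1 hg2).trans (le_of_eq ?_))
  ring

end A1Rough

namespace A1Rough

variable {d : ℕ} {J0 s : ℤ}

lemma Sat.measurableSet {m : ℤ} {A : Set (Rd d)} (hA : Sat m A) : MeasurableSet A := by
  have : A = idx m ⁻¹' (idx m '' A) := by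
    refine (Set.subset_preimage_image _ _).antisymm fun x hx => ?_
    obtain ⟨y, hy, hyx⟩ := hx
    exact hA y hy hyx.symm
  rw [this]
  exact measurable_idx m (Set.to_countable _).measurableSet

/-- Whitney type stopping scale for a small set. -/
lemma exists_stop_of_set (hJ : J0 < s) {O : Set (Rd d)} (hO : 2 * volume O ≤ vol d s) :
    ∃ σ : Rd d → ℤ, Stop σ J0 s ∧ {x | J0 < σ x} ⊆ O ∧
      ∀ x, ∃ z, z ∉ O ∧ ‖z - x‖ ≤ (4 * √d + 4) * 2 ^ (σ x) := by
  set L : ℝ := √d + 2 with hL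
  have hsd : 0 ≤ √(d : ℝ) := Real.sqrt_nonneg _
  set A : ℤ → Set (Rd d) := fun m => {x | ∀ y ∈ cube m x, Metric.ball y (L * 2 ^ m) ⊆ O} with hA
  have hAc : ∀ {m : ℤ} {x y : Rd d}, y ∈ cube m x → x ∈ A m → y ∈ A m := by
    intro m x y hy hx z hz
    rw [cube_eq hy] at hz
    exact hx z hz
  have hAO : ∀ {m : ℤ} {x : Rd d}, x ∈ A m → Metric.ball x (L * 2 ^ m) ⊆ O :=
    fun hx => hx _ (mem_cube_self _ _)
  have hAe : ∀ {m : ℤ} {x : Rd d}, x ∈ A m → m < s := by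
    intro m x hx
    by_contra! hm
    have h1 : vol d s ≤ volume O := by
      rw [← volume_cube s x]
      refine measure_mono fun y hy => hAO hx ?_
      have h2 := norm_sub_le_of_mem_cube (cube_mono hm x hy)
      have : (0 : ℝ) < 2 ^ m := by positivity
      rw [Metric.mem_ball, dist_eq_norm]
      nlinarith
    have h3 : 2 * vol d s ≤ vol d s := (mul_le_mul_right h1 2).trans hO
    rw [two_mul] at h3
    have h4 := ENNReal.lt_add_right (vol_ne_top (d := d) s) (vol_ne_zero (d := d) s)
    exact absurd (h4.trans_le h3) (lt_irrefl _)
  set P : Rd d → ℤ → Prop := fun x m => J0 ≤ m ∧ (J0 < m → x ∈ A m) with hP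
  have hex : ∀ x, ∃ m, P x m ∧ ∀ z, P x z → z ≤ m := by
    intro x
    refine Int.exists_greatest_of_bdd ⟨s, fun z hz => ?_⟩ ⟨J0, le_rfl, fun h => absurd h (lt_irrefl _)⟩
    rcases hz.1.lt_or_eq with h | h
    · exact (hAe (hz.2 h)).le
    · exact h ▸ hJ.le
  choose σ hσ hσmax using hex
  have hsat : ∀ m, Sat m (U σ m) := by
    intro m x hx y hy
    have hx' : σ x = m := hx
    have hPx := hσ x
    rw [hx'] at hPx
    refine le_antisymm ?_ (hσmax y m ⟨hPx.1, fun h => hAc hy (hPx.2 h)⟩)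
    by_contra! hlt
    have hJy : J0 < σ y := hPx.1.trans_lt hlt
    have hy' : x ∈ A (σ y) := hAc (mem_cube_comm.1 (cube_mono hlt.le x hy)) ((hσ y).2 hJy)
    have := hσmax x (σ y) ⟨hJy.le, fun _ => hy'⟩
    omega
  refine ⟨σ, ⟨?_, fun x => (hσ x).1, ?_, hsat, ?_⟩, ?_, ?_⟩
  · exact measurable_to_countable' fun m => (hsat m).measurableSet
  · intro x
    rcases (hσ x).1.lt_or_eq with h | h
    · exact hAe ((hσ x).2 h)
    · exact h ▸ hJ
  · intro x y j hj hxy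
    by_contra! hlt
    have hJx := (hσ x).1
    have hy := hAO ((hσ y).2 (by omega))
    have hx : x ∈ A (σ x + 1) := by
      intro z hz w hw
      refine hy ?_
      have h1 := norm_sub_le_of_mem_cube hz
      rw [Metric.mem_ball, dist_eq_norm] at hw ⊢
      have h2 : (2 : ℝ) ^ (σ x + 1) ≤ 2 ^ (σ y - 1) := zpow_le_zpow_right₀ (by norm_num) (by omega)
      have h3 : (2 : ℝ) ^ (j + 1) ≤ 2 ^ (σ y) := zpow_le_zpow_right₀ (by norm_num) (by omega)
      rw [zpow_sub_one₀ (by norm_num)] at h2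
      have h4 : (0 : ℝ) < 2 ^ (σ y) := by positivity
      have h5 : ‖w - y‖ ≤ ‖w - z‖ + ‖z - x‖ + ‖x - y‖ := by
        have e : w - y = (w - z) + (z - x) + (x - y) := by abel
        rw [e]; exact norm_add₃_le
      have h6 := mul_le_mul_of_nonneg_left h2 hsd
      have h7 := mul_le_mul_of_nonneg_left h2 (show 0 ≤ L by positivity)
      nlinarith
    have := hσmax x (σ x + 1) ⟨by omega, fun _ => hx⟩
    omega
  · intro x hx
    refine hAO ((hσ x).2 hx) (Metric.mem_ball_self ?_)
    positivity
  · intro x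
    have hx : x ∉ A (σ x + 1) := by
      intro hx
      have := hσmax x (σ x + 1) ⟨(hσ x).1.trans (by omega), fun _ => hx⟩
      omega
    simp only [hA, Set.mem_ofPred_eq] at hx
    push Not at hx
    obtain ⟨y, hy, hyO⟩ := hx
    obtain ⟨z, hz, hzO⟩ := Set.not_subset.1 hyO
    refine ⟨z, hzO, ?_⟩
    have h1 := norm_sub_le_of_mem_cube hy
    rw [Metric.mem_ball, dist_eq_norm] at hz
    rw [zpow_add_one₀ (by norm_num)] at h1 hz
    have h5 : ‖z - x‖ ≤ ‖z - y‖ + ‖y - x‖ := norm_sub_le_norm_sub_add_norm_sub _ _ _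
    nlinarith

lemma lintegral_le_of_rpow {α : Type*} [MeasurableSpace α] {μ : Measure α} {q : ℝ} (hq : 1 ≤ q)
    {G : α → ℝ≥0∞} (hG : Measurable G) {a v : ℝ≥0∞} (ha : a ≠ ⊤) (h : ∫⁻ x, G x ^ q ∂μ ≤ a ^ q * v) :
    ∫⁻ x, G x ∂μ ≤ a * (μ Set.univ + v) := by
  have hq0 : 0 < q := by linarith
  rcases eq_or_ne a 0 with rfl | ha0
  · rw [ENNReal.zero_rpow_of_pos hq0, zero_mul, nonpos_iff_eq_zero,
      lintegral_eq_zero_iff (hG.pow_const q)] at h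
    have : G =ᵐ[μ] 0 := h.mono fun x hx => by
      simpa [ENNReal.rpow_eq_zero_iff, hq0, hq0.not_gt] using hx
    rw [lintegral_congr_ae this]; simp
  · have h1 : ∀ x, G x ≤ a + a * (a ^ q)⁻¹ * G x ^ q := by
      intro x
      rcases le_total (G x) a with hx | hx
      · exact hx.trans le_self_add
      · refine le_trans ?_ le_add_self
        rw [mul_assoc, ← ENNReal.inv_rpow, ← ENNReal.mul_rpow_of_nonneg _ _ hq0.le]
        have h2 : 1 ≤ a⁻¹ * G x := by
          rw [← ENNReal.inv_mul_cancel ha0 ha]; exact mul_le_mul_right hx _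
        calc G x = a * (a⁻¹ * G x) := by rw [← mul_assoc, ENNReal.mul_inv_cancel ha0 ha, one_mul]
          _ ≤ _ := by
            refine mul_le_mul_right ?_ _
            conv_lhs => rw [← ENNReal.rpow_one (a⁻¹ * G x)]
            exact ENNReal.rpow_le_rpow_of_exponent_le h2 hq
    have haq0 : a ^ q ≠ 0 := by simp [ENNReal.rpow_eq_zero_iff, ha0, ha]
    have haqt : a ^ q ≠ ⊤ := ENNReal.rpow_ne_top_of_nonneg hq0.le ha
    calc ∫⁻ x, G x ∂μ ≤ ∫⁻ x, a + a * (a ^ q)⁻¹ * G x ^ q ∂μ := lintegral_mono h1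
      _ = a * μ Set.univ + a * (a ^ q)⁻¹ * ∫⁻ x, G x ^ q ∂μ := by
        rw [lintegral_add_left measurable_const, lintegral_const, lintegral_const_mul _ (hG.pow_const q)]
      _ ≤ a * μ Set.univ + a * (a ^ q)⁻¹ * (a ^ q * v) := by gcongr
      _ = _ := by
        rw [mul_assoc a, ← mul_assoc (a ^ q)⁻¹, ENNReal.inv_mul_cancel haq0 haqt, one_mul, mul_add]

lemma four_mul_volume_lt_Mx_le (hd : 1 ≤ d) {H : Rd d → ℝ≥0∞} (hH : Measurable H) {v V : ℝ≥0∞}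
    (hv : v ≠ ⊤) (h : ∫⁻ x, H x ≤ v * V) :
    4 * volume {x | 4 * volB d * 5 ^ d * v < Mx H x} ≤ V := by
  rcases eq_or_ne v 0 with rfl | hv0
  · rw [zero_mul, nonpos_iff_eq_zero, lintegral_eq_zero_iff hH] at h
    have h0 : {x | 4 * volB d * 5 ^ d * 0 < Mx H x} = ∅ := by
      ext x
      simp only [Set.mem_ofPred_eq, Set.mem_empty_iff_false, iff_false, mul_zero, not_lt, nonpos_iff_eq_zero]
      simp only [Mx, ENNReal.iSup_eq_zero, mul_eq_zero]
      intro r hr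
      right
      rw [lintegral_congr_ae (ae_restrict_of_ae h)]; simp
    rw [h0]; simp
  · have h1 := (volume_lt_Mx_le hd H (4 * volB d * 5 ^ d * v)).trans (mul_le_mul_right h _)
    have hc0 : volB d * 5 ^ d * v ≠ 0 := by simp [volB_ne_zero, hv0]
    have hct : volB d * 5 ^ d * v ≠ ⊤ :=
      ENNReal.mul_ne_top (ENNReal.mul_ne_top volB_ne_top (ENNReal.pow_ne_top (by simp))) hv
    refine (ENNReal.mul_le_mul_iff_right hc0 hct).1 ?_
    calc _ = 4 * volB d * 5 ^ d * v * volume {x | 4 * volB d * 5 ^ d * v < Mx H x} := by ring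
      _ ≤ _ := h1
      _ = _ := by ring

lemma Ctl.mono {σ : Rd d → ℤ} {V a : ℝ≥0∞} {q : ℝ} (hq : 0 ≤ q) {G H : Rd d → ℝ≥0∞} (h : Ctl σ V q a G)
    (hH : Measurable H) (hle : ∀ x, H x ≤ G x) : Ctl σ V q a H where
  meas := hH
  mass := (lintegral_mono hle).trans h.mass
  massq := (lintegral_mono fun x => ENNReal.rpow_le_rpow (hle x) hq).trans h.massq
  loc x R hR := (lintegral_mono hle).trans (h.loc x R hR)
  locq x R hR := (lintegral_mono fun x => ENNReal.rpow_le_rpow (hle x) hq).trans (h.locq x R hR)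

/-- Constant of the stopping construction. -/
def cS (d : ℕ) (κ : ℝ≥0∞) : ℝ≥0∞ :=
  volB d + ENNReal.ofReal ((4 * √d + 5) ^ d) * (4 * volB d * 5 ^ d) + κ + 1

lemma cS_ne_top {κ : ℝ≥0∞} (hκ : κ ≠ ⊤) : cS d κ ≠ ⊤ := by
  have h := volB_ne_top (d := d)
  unfold cS
  finiteness

lemma ctl_of_not_lt {σ : Rd d → ℤ} {κ : ℝ≥0∞} {q : ℝ} (hq : 1 ≤ q) {G : Rd d → ℝ≥0∞}
    (hG : Measurable G) {a V : ℝ≥0∞} (ha : a ≠ ⊤) {B : Set (Rd d)} (hB : volume B ≤ κ * V)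
    (hG0 : ∀ x ∉ B, G x = 0) (hm : ∫⁻ x, G x ^ q ≤ a ^ q * V)
    (hz : ∀ x, ∃ z, Mx (fun y => G y ^ q) z ≤ 4 * volB d * 5 ^ d * a ^ q ∧
      ‖z - x‖ ≤ (4 * √d + 4) * 2 ^ (σ x)) : Ctl σ V q (cS d κ * a) G := by
  have hq0 : 0 ≤ q := by linarith
  have hS1 : 1 ≤ cS d κ := le_add_self
  set Λ : ℝ≥0∞ := ENNReal.ofReal ((4 * √d + 5) ^ d) * (4 * volB d * 5 ^ d) with hΛ
  have hΛS : volB d + Λ ≤ cS d κ := by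
    rw [cS, ← hΛ, add_assoc]; exact le_self_add
  have hpow : ∀ c : ℝ≥0∞, c ≤ cS d κ → c * a ^ q ≤ (cS d κ * a) ^ q := by
    intro c hc
    rw [ENNReal.mul_rpow_of_nonneg _ _ hq0]
    refine mul_le_mul_left (hc.trans ?_) _
    conv_lhs => rw [← ENNReal.rpow_one (cS d κ)]
    exact ENNReal.rpow_le_rpow_of_exponent_le hS1 hq
  have hlq : ∀ (x : Rd d) (R : ℝ), (2 : ℝ) ^ (σ x) ≤ R →
      ∫⁻ y in Metric.ball x R, G y ^ q ≤ a ^ q * (ENNReal.ofReal (R ^ d) * Λ) := by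
    intro x R hR
    obtain ⟨z, hz1, hz2⟩ := hz x
    have h0 : (0 : ℝ) < 2 ^ (σ x) := by positivity
    have hsd : 0 ≤ √(d : ℝ) := Real.sqrt_nonneg _
    have hR0 : 0 < R := h0.trans_le hR
    calc ∫⁻ y in Metric.ball x R, G y ^ q ≤ ∫⁻ y in Metric.ball z ((4 * √d + 5) * R), G y ^ q := by
          refine lintegral_mono_set fun y hy => ?_
          rw [Metric.mem_ball, dist_eq_norm] at hy ⊢
          have h1 : ‖y - z‖ ≤ ‖y - x‖ + ‖x - z‖ := norm_sub_le_norm_sub_add_norm_sub _ _ _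
          rw [norm_sub_rev x z] at h1
          nlinarith
      _ ≤ ENNReal.ofReal (((4 * √d + 5) * R) ^ d) * Mx (fun y => G y ^ q) z :=
          lintegral_ball_le_Mx _ z (by positivity)
      _ ≤ ENNReal.ofReal (((4 * √d + 5) * R) ^ d) * (4 * volB d * 5 ^ d * a ^ q) := mul_le_mul_right hz1 _
      _ = _ := by rw [mul_pow, ENNReal.ofReal_mul (by positivity), hΛ]; ring
  refine ⟨hG, ?_, ?_, ?_, ?_⟩
  · have h1 : ∫⁻ x, G x = ∫⁻ x in B, G x := by
      rw [setLIntegral_eq_of_support_subset fun x hx => by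
        by_contra h; exact hx (hG0 x h)]
    have h2 := lintegral_le_of_rpow (μ := volume.restrict B) hq hG ha
      ((setLIntegral_le_lintegral B _).trans hm)
    rw [h1]
    refine h2.trans ?_
    rw [Measure.restrict_apply_univ]
    calc a * (volume B + V) ≤ a * (κ * V + V) := by gcongr
      _ = (κ + 1) * a * V := by ring
      _ ≤ _ := by
        refine mul_le_mul_left (mul_le_mul_left ?_ _) _
        rw [cS, add_assoc]; exact le_add_self
  · refine hm.trans (mul_le_mul_left ?_ _)
    simpa using hpow 1 hS1
  · intro x R hR
    have h0 : (0 : ℝ) < 2 ^ (σ x) := by positivity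
    have h2 := lintegral_le_of_rpow (μ := volume.restrict (Metric.ball x R)) hq hG ha (hlq x R hR)
    refine h2.trans ?_
    rw [Measure.restrict_apply_univ, volume_ball_eq x (h0.trans_le hR), ← mul_add, ← mul_assoc,
      mul_comm a, mul_assoc, mul_comm a]
    exact mul_le_mul_right (mul_le_mul_left hΛS _) _
  · intro x R hR
    refine (hlq x R hR).trans ?_
    rw [mul_comm, mul_assoc]
    exact mul_le_mul_right (hpow Λ (le_add_self.trans hΛS)) _

/-- Stopping scale adapted to two functions at once. -/
theorem exists_stop (hd : 1 ≤ d) (hJ : J0 < s) {κ : ℝ≥0∞} {q : ℝ} (hq : 1 ≤ q) {G₁ G₂ : Rd d → ℝ≥0∞}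
    (hG₁ : Measurable G₁) (hG₂ : Measurable G₂) {a b : ℝ≥0∞} (ha : a ≠ ⊤) (hb : b ≠ ⊤)
    {B : Set (Rd d)} (hB : volume B ≤ κ * vol d s) (h1 : ∀ x ∉ B, G₁ x = 0) (h2 : ∀ x ∉ B, G₂ x = 0)
    (hm₁ : ∫⁻ x, G₁ x ^ q ≤ a ^ q * vol d s) (hm₂ : ∫⁻ x, G₂ x ^ q ≤ b ^ q * vol d s) :
    ∃ σ, Stop σ J0 s ∧ Ctl σ (vol d s) q (cS d κ * a) G₁ ∧ Ctl σ (vol d s) q (cS d κ * b) G₂ ∧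
      2 * volume {x | J0 < σ x} ≤ vol d s := by
  have hq0 : 0 ≤ q := by linarith
  set O₁ : Set (Rd d) := {x | 4 * volB d * 5 ^ d * a ^ q < Mx (fun y => G₁ y ^ q) x} with hO₁
  set O₂ : Set (Rd d) := {x | 4 * volB d * 5 ^ d * b ^ q < Mx (fun y => G₂ y ^ q) x} with hO₂
  have e1 := four_mul_volume_lt_Mx_le hd (hG₁.pow_const q) (ENNReal.rpow_ne_top_of_nonneg hq0 ha) hm₁
  have e2 := four_mul_volume_lt_Mx_le hd (hG₂.pow_const q) (ENNReal.rpow_ne_top_of_nonneg hq0 hb) hm₂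
  have hO : 2 * volume (O₁ ∪ O₂) ≤ vol d s := by
    have e3 : 2 * (2 * volume (O₁ ∪ O₂)) ≤ 2 * vol d s := by
      calc 2 * (2 * volume (O₁ ∪ O₂)) ≤ 2 * (2 * (volume O₁ + volume O₂)) := by
            gcongr; exact measure_union_le _ _
        _ = 4 * volume O₁ + 4 * volume O₂ := by ring
        _ ≤ vol d s + vol d s := add_le_add e1 e2
        _ = _ := (two_mul _).symm
    exact (ENNReal.mul_le_mul_iff_right (by simp) (by simp)).1 e3
  obtain ⟨σ, hσ, hσO, hz⟩ := exists_stop_of_set hJ hO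
  refine ⟨σ, hσ, ctl_of_not_lt hq hG₁ ha hB h1 hm₁ fun x => ?_,
    ctl_of_not_lt hq hG₂ hb hB h2 hm₂ fun x => ?_, (mul_le_mul_right (measure_mono hσO) 2).trans hO⟩
  · obtain ⟨z, hz, hzx⟩ := hz x
    exact ⟨z, not_lt.1 fun h => hz (Or.inl h), hzx⟩
  · obtain ⟨z, hz, hzx⟩ := hz x
    exact ⟨z, not_lt.1 fun h => hz (Or.inr h), hzx⟩

end A1Rough

namespace A1Rough

section Cordes

variable {A : Type*} [CStarAlgebra A] [PartialOrder A] [StarOrderedRing A]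

lemma smul_rpow_cfc (r : NNReal) (a : A) (s : ℝ) (hs : 0 ≤ s) (ha : 0 ≤ a) :
    (r • a) ^ s = r ^ s • a ^ s := by
  have hc : Continuous fun x : NNReal => x ^ s := NNReal.continuous_rpow_const hs
  rw [CFC.rpow_def, CFC.rpow_def, ← cfc_comp_smul r (fun x : NNReal => x ^ s) a hc.continuousOn ha,
    ← cfc_smul (r ^ s) (fun x : NNReal => x ^ s) a hc.continuousOn]
  simp [NNReal.mul_rpow]

/-- The Cordes inequality. -/
theorem norm_rpow_mul_rpow_le {a b : A} (ha : IsStrictlyPositive a) (hb : IsStrictlyPositive b)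
    {s : ℝ} (hs0 : 0 ≤ s) (hs1 : s ≤ 1) : ‖a ^ s * b ^ s‖ ≤ ‖a * b‖ ^ s := by
  rcases eq_or_ne (a * b) 0 with h0 | h0
  · have hu : IsUnit (a * b) := ha.isUnit.mul hb.isUnit
    rw [h0, isUnit_zero_iff] at hu
    have : Subsingleton A := subsingleton_of_zero_eq_one hu
    rw [Subsingleton.elim (a ^ s * b ^ s) 0, norm_zero]
    positivity
  have key : ∀ a : A, IsStrictlyPositive a → ‖a * b‖ ≤ 1 → ‖a ^ s * b ^ s‖ ≤ 1 := by
    intro a ha hab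
    have hsq : ∀ x : A, IsStrictlyPositive x → ∀ t : ℝ, CFC.sqrt ((x ^ (2 : ℝ)) ^ t) = x ^ t := by
      intro x hx t
      rcases eq_or_ne t 0 with rfl | ht
      · rw [CFC.rpow_zero _ (hx.rpow x 2).nonneg, CFC.rpow_zero _ hx.nonneg, CFC.sqrt_one]
      · rw [CFC.rpow_rpow x _ _ (by norm_num) hx, CFC.sqrt_rpow hx.isUnit (by simpa using ht)]
        congr 1; ring
    have hiff : ∀ t : ℝ, (a ^ (2 : ℝ)) ^ t ≤ ((b ^ (2 : ℝ)) ^ (-t)) ↔ ‖a ^ t * b ^ t‖ ≤ 1 := by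
      intro t
      have hb2 := hb.rpow b 2
      have := le_iff_norm_sqrt_mul_sqrt_inv (a := (a ^ (2 : ℝ)) ^ t)
        (b := ⟨(b ^ (2 : ℝ)) ^ (-t), (b ^ (2 : ℝ)) ^ t, CFC.rpow_neg_mul_rpow t hb2, CFC.rpow_mul_rpow_neg t hb2⟩)
        CFC.rpow_nonneg CFC.rpow_nonneg
      rw [this]
      change ‖_ * CFC.sqrt ((b ^ (2 : ℝ)) ^ t)‖ ≤ 1 ↔ _
      rw [hsq a ha, hsq b hb]
    have h1 := (hiff 1).2 (by rwa [CFC.rpow_one a ha.nonneg, CFC.rpow_one b hb.nonneg])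
    refine (hiff s).1 ?_
    have h2 := CFC.monotone_rpow (A := A) ⟨hs0, hs1⟩ h1
    have e1 : ((b ^ (2 : ℝ)) ^ (-1 : ℝ)) ^ s = (b ^ (2 : ℝ)) ^ (-s) := by
      rw [CFC.rpow_rpow _ _ _ (by norm_num) (hb.rpow b 2)]
      congr 1; ring
    simpa only [e1, CFC.rpow_one _ (CFC.rpow_nonneg (a := a) (y := 2))] using h2
  have hc : 0 < ‖a * b‖₊ := nnnorm_pos.2 h0
  set c := ‖a * b‖₊ with hcdef
  have hca : IsStrictlyPositive (c⁻¹ • a) := ha.smul (inv_pos.2 hc)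
  have h1 := key (c⁻¹ • a) hca (by
    rw [smul_mul_assoc, NNReal.smul_def, norm_smul, ← coe_nnnorm (a * b), ← hcdef]
    simp [hc.ne'])
  rw [smul_rpow_cfc _ _ _ hs0 ha.nonneg, smul_mul_assoc, NNReal.smul_def, norm_smul] at h1
  rw [← coe_nnnorm (a * b), ← hcdef]
  rw [NNReal.inv_rpow] at h1
  simp only [NNReal.coe_inv, NNReal.coe_rpow, norm_inv, Real.norm_eq_abs, abs_of_nonneg (Real.rpow_nonneg c.coe_nonneg s)] at h1
  rwa [inv_mul_le_iff₀ (by positivity), mul_one] at h1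

end Cordes

end A1Rough

namespace A1Rough

variable {n : ℕ}

lemma opNorm_nonneg (A : Mat n) : 0 ≤ opNorm A := norm_nonneg _

lemma mvec_eq (A : Mat n) (v : Vec n) : mvec A v = Matrix.toEuclideanCLM (𝕜 := ℂ) (n := Fin n) A v := rfl

lemma norm_mvec_le (A : Mat n) (v : Vec n) : ‖mvec A v‖ ≤ opNorm A * ‖v‖ :=
  (Matrix.toEuclideanCLM (𝕜 := ℂ) (n := Fin n) A).le_opNorm v

lemma opNorm_le {A : Mat n} {M : ℝ} (hM : 0 ≤ M) (h : ∀ v, ‖mvec A v‖ ≤ M * ‖v‖) : opNorm A ≤ M :=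
  ContinuousLinearMap.opNorm_le_bound _ hM h

lemma mvec_mul (A B : Mat n) (v : Vec n) : mvec (A * B) v = mvec A (mvec B v) := by
  rw [mvec_eq, map_mul]; rfl

lemma mvec_one (v : Vec n) : mvec 1 v = v := by
  rw [mvec_eq, map_one]; rfl

lemma mvec_add (A : Mat n) (v w : Vec n) : mvec A (v + w) = mvec A v + mvec A w := map_add _ _ _

lemma mvec_smul (A : Mat n) (c : ℂ) (v : Vec n) : mvec A (c • v) = c • mvec A v := map_smul _ _ _

lemma mvec_sum {ι : Type*} (A : Mat n) (s : Finset ι) (v : ι → Vec n) :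
    mvec A (∑ i ∈ s, v i) = ∑ i ∈ s, mvec A (v i) := map_sum _ _ _

lemma mvec_apply (A : Mat n) (v : Vec n) (i : Fin n) : mvec A v i = ∑ j, A i j * v j := rfl

/-- Standard basis vectors. -/
def eb (i : Fin n) : Vec n := EuclideanSpace.single i 1

lemma vec_eq_sum (v : Vec n) : v = ∑ i, v i • eb i := by
  ext j
  simp [eb, Finset.sum_apply, Pi.single_apply]

lemma norm_eb (i : Fin n) : ‖(eb i : Vec n)‖ = 1 := by simp [eb]

lemma norm_apply_le (v : Vec n) (i : Fin n) : ‖v i‖ ≤ ‖v‖ := PiLp.norm_apply_le v i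

lemma norm_le_sum (v : Vec n) : ‖v‖ ≤ ∑ i, ‖v i‖ := by
  conv_lhs => rw [vec_eq_sum v]
  refine (norm_sum_le _ _).trans_eq (Finset.sum_congr rfl fun i _ => ?_)
  rw [norm_smul, norm_eb, mul_one]

lemma opNorm_le_sum (A : Mat n) : opNorm A ≤ ∑ i, ‖mvec A (eb i)‖ := by
  refine opNorm_le (Finset.sum_nonneg fun _ _ => norm_nonneg _) fun v => ?_
  conv_lhs => rw [vec_eq_sum v, mvec_sum]
  rw [Finset.sum_mul]
  refine (norm_sum_le _ _).trans (Finset.sum_le_sum fun i _ => ?_)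
  rw [mvec_smul, norm_smul, mul_comm]
  exact mul_le_mul_of_nonneg_left (norm_apply_le v i) (norm_nonneg _)

section

open scoped Matrix.Norms.L2Operator MatrixOrder

lemma matPow_eq_cfc {A : Mat n} (hA : A.IsHermitian) (s : ℝ) : matPow A s = cfc (fun x : ℝ => x ^ s) A := by
  rw [hA.cfc_eq, matPow, dif_pos hA]
  rfl

lemma matPow_eq {A : Mat n} (hA : A.PosDef) (s : ℝ) : matPow A s = A ^ s := by
  rw [matPow_eq_cfc hA.isHermitian, CFC.rpow_eq_cfc_real hA.posSemidef.nonneg]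

lemma posDef_matPow {A : Mat n} (hA : A.PosDef) (s : ℝ) : (matPow A s).PosDef := by
  rw [matPow_eq hA, ← Matrix.isStrictlyPositive_iff_posDef]
  exact hA.isStrictlyPositive.rpow A s

lemma matPow_neg_mul {A : Mat n} (hA : A.PosDef) (s : ℝ) : matPow A (-s) * matPow A s = 1 := by
  rw [matPow_eq hA, matPow_eq hA, CFC.rpow_neg_mul_rpow s hA.isStrictlyPositive]

lemma matPow_one {A : Mat n} (hA : A.PosDef) : matPow A 1 = A := by
  rw [matPow_eq hA, CFC.rpow_one A hA.posSemidef.nonneg]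

lemma matPow_neg {A : Mat n} (hA : A.PosDef) (s : ℝ) : matPow A (-s) = matPow A⁻¹ s := by
  have hu : IsUnit A := hA.isUnit
  have h := CFC.rpow_neg hu.unit s hA.posSemidef.nonneg
  rw [matPow_eq hA, matPow_eq hA.inv]
  rw [Matrix.coe_units_inv] at h
  exact h

lemma opNorm_matPow_mul_le {A B : Mat n} (hA : A.PosDef) (hB : B.PosDef) {s : ℝ} (hs0 : 0 ≤ s) (hs1 : s ≤ 1) :
    opNorm (matPow A s * matPow B s) ≤ opNorm (A * B) ^ s := by
  rw [matPow_eq hA, matPow_eq hB]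
  exact norm_rpow_mul_rpow_le hA.isStrictlyPositive hB.isStrictlyPositive hs0 hs1

/-- Every invertible matrix has the same modulus as a positive definite one. -/
lemma exists_posDef_norm_eq {P : Mat n} (hP : IsUnit P) :
    ∃ B : Mat n, B.PosDef ∧ ∀ v, ‖mvec B v‖ = ‖mvec P v‖ := by
  have hn : ∀ (X : Mat n) (v : Vec n), (‖mvec X v‖ : ℂ) ^ 2 = inner ℂ v (mvec (star X * X) v) := by
    intro X v
    rw [mvec_mul, mvec_eq (star X), map_star, ContinuousLinearMap.star_eq_adjoint,
      ContinuousLinearMap.adjoint_inner_right, ← mvec_eq, inner_self_eq_norm_sq_to_K]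
    rfl
  have hPP : (star P * P).PosDef := by
    rw [Matrix.star_eq_conjTranspose]
    exact Matrix.PosDef.conjTranspose_mul_self P (Matrix.mulVec_injective_of_isUnit hP)
  refine ⟨matPow (star P * P) (1/2), posDef_matPow hPP _, fun v => ?_⟩
  have hB := posDef_matPow hPP (1/2)
  have h2 : star (matPow (star P * P) (1/2)) * matPow (star P * P) (1/2) = star P * P := by
    rw [Matrix.star_eq_conjTranspose, hB.isHermitian.eq, matPow_eq hPP, ← CFC.rpow_add hPP.isUnit]
    norm_num
    exact CFC.rpow_one _ hPP.posSemidef.nonneg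
  have h3 : (‖mvec (matPow (star P * P) (1/2)) v‖ : ℂ) ^ 2 = (‖mvec P v‖ : ℂ) ^ 2 := by
    rw [hn, hn, h2]
  exact (pow_left_inj₀ (norm_nonneg _) (norm_nonneg _) two_ne_zero).1 (by exact_mod_cast h3)

end

end A1Rough

namespace A1Rough

variable {n : ℕ}

lemma seminorm_sum_le (ρ : Seminorm ℂ (Vec n)) {ι : Type*} (s : Finset ι) (f : ι → Vec n) :
    ρ (∑ i ∈ s, f i) ≤ ∑ i ∈ s, ρ (f i) :=
  Finset.le_sum_of_subadditive ρ (map_zero ρ).le (map_add_le_add ρ) s f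

lemma seminorm_le_sum (ρ : Seminorm ℂ (Vec n)) (v : Vec n) : ρ v ≤ ∑ i, ‖v i‖ * ρ (eb i) := by
  conv_lhs => rw [vec_eq_sum v]
  refine (seminorm_sum_le ρ _ _).trans_eq (Finset.sum_congr rfl fun i _ => ?_)
  rw [map_smul_eq_mul]

lemma exists_le_seminorm (ρ : Seminorm ℂ (Vec n)) (hρ : ∀ v, ρ v = 0 → v = 0) :
    ∃ c : ℝ, 0 < c ∧ ∀ v, c * ‖v‖ ≤ ρ v := by
  have hcont : Continuous ρ := by
    set K : ℝ := ∑ i, ρ (eb i) with hK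
    have hK0 : 0 ≤ K := Finset.sum_nonneg fun i _ => apply_nonneg _ _
    refine Seminorm.continuous_of_le (q := K.toNNReal • normSeminorm ℂ (Vec n)) ?_ ?_
    · have : ((K.toNNReal • normSeminorm ℂ (Vec n) : Seminorm ℂ (Vec n)) : Vec n → ℝ) = fun v => K.toNNReal • ‖v‖ := rfl
      rw [this]
      fun_prop
    · intro v
      refine (seminorm_le_sum ρ v).trans ?_
      change _ ≤ K.toNNReal • ‖v‖
      rw [NNReal.smul_def, Real.coe_toNNReal _ hK0, smul_eq_mul, hK, Finset.sum_mul]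
      refine Finset.sum_le_sum fun i _ => ?_
      rw [mul_comm]
      exact mul_le_mul_of_nonneg_left (norm_apply_le v i) (apply_nonneg _ _)
  rcases (Metric.sphere (0 : Vec n) 1).eq_empty_or_nonempty with he | hne
  · refine ⟨1, one_pos, fun v => ?_⟩
    have : v = 0 := by
      by_contra hv
      have : ((‖v‖⁻¹ : ℝ) : ℂ) • v ∈ Metric.sphere (0 : Vec n) 1 := by
        rw [mem_sphere_zero_iff_norm, norm_smul, Complex.norm_real, norm_inv, norm_norm,
          inv_mul_cancel₀ (norm_ne_zero_iff.2 hv)]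
      rw [he] at this
      exact this
    rw [this]; simp
  · obtain ⟨u, hu, hmin⟩ := (isCompact_sphere (0 : Vec n) 1).exists_isMinOn hne hcont.continuousOn
    have hu1 : ‖u‖ = 1 := by simpa using hu
    refine ⟨ρ u, (apply_nonneg ρ u).lt_of_ne fun h => ?_, fun v => ?_⟩
    · rw [hρ u h.symm] at hu1; simp at hu1
    · rcases eq_or_ne v 0 with rfl | hv
      · simp
      have hv' := norm_ne_zero_iff.2 hv
      have h1 : ((‖v‖⁻¹ : ℝ) : ℂ) • v ∈ Metric.sphere (0 : Vec n) 1 := by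
        rw [mem_sphere_zero_iff_norm, norm_smul, Complex.norm_real, norm_inv, norm_norm,
          inv_mul_cancel₀ hv']
      have h2 : ρ u ≤ ρ (((‖v‖⁻¹ : ℝ) : ℂ) • v) := hmin h1
      rw [map_smul_eq_mul, Complex.norm_real, norm_inv, norm_norm, ← div_eq_inv_mul,
        le_div_iff₀ (norm_pos_iff.2 hv)] at h2
      exact h2

/-- A norm on `ℂⁿ` is equivalent, with constants depending on `n` only, to one given by a positive
definite matrix. -/
theorem exists_reducing (ρ : Seminorm ℂ (Vec n)) (hρ : ∀ v, ρ v = 0 → v = 0) :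
    ∃ B : Mat n, B.PosDef ∧ ∀ v, ‖mvec B v‖ ≤ 2 * n * ρ v ∧ ρ v ≤ n * ‖mvec B v‖ := by
  obtain ⟨c, hc, hcρ⟩ := exists_le_seminorm ρ hρ
  set S : Set (Mat n) := {P | ∀ j, ρ (mvec P (eb j)) ≤ 1} with hS
  have hcol : ∀ (P : Mat n) (i j : Fin n), P i j = mvec P (eb j) i := by
    intro P i j
    simp [mvec_apply, eb]
  have hbd : BddAbove ((fun P : Mat n => ‖P.det‖) '' S) := by
    refine ⟨n.factorial • c⁻¹ ^ n, ?_⟩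
    rintro _ ⟨P, hP, rfl⟩
    have := Matrix.det_le (A := P) (abv := NormedField.toAbsoluteValue ℂ) (x := c⁻¹) (fun i j => by
      change ‖P i j‖ ≤ c⁻¹
      rw [hcol P i j]
      refine (norm_apply_le _ _).trans ?_
      rw [← one_div, le_div_iff₀' hc]
      exact (hcρ _).trans (hP j))
    rw [Fintype.card_fin] at this
    exact this
  set K : ℝ := (∑ i, ρ (eb i : Vec n)) + 1 with hK
  have hK0 : 0 < K := by
    have : 0 ≤ ∑ i, ρ (eb i : Vec n) := Finset.sum_nonneg fun i _ => apply_nonneg _ _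
    linarith
  have h0S : (((K⁻¹ : ℝ) : ℂ) • (1 : Mat n)) ∈ S := by
    intro j
    have : mvec (((K⁻¹ : ℝ) : ℂ) • (1 : Mat n)) (eb j) = ((K⁻¹ : ℝ) : ℂ) • eb j := by
      rw [mvec_eq, map_smul, map_one]; rfl
    rw [this, map_smul_eq_mul, Complex.norm_real, norm_inv, Real.norm_of_nonneg hK0.le,
      inv_mul_le_iff₀ hK0, mul_one]
    have := Finset.single_le_sum (f := fun i => ρ (eb i : Vec n)) (fun i _ => apply_nonneg _ _) (Finset.mem_univ j)
    linarith
  set M : ℝ := sSup ((fun P : Mat n => ‖P.det‖) '' S) with hM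
  have hMle : ∀ P ∈ S, ‖P.det‖ ≤ M := fun P hP => le_csSup hbd ⟨P, hP, rfl⟩
  have hM0 : 0 < M := by
    refine lt_of_lt_of_le ?_ (hMle _ h0S)
    rw [norm_pos_iff, Matrix.det_smul]
    simp [hK0.ne']
  obtain ⟨_, ⟨P, hPS, rfl⟩, hPM⟩ := exists_lt_of_lt_csSup (s := (fun P : Mat n => ‖P.det‖) '' S) ⟨_, _, h0S, rfl⟩
    (show M / 2 < sSup _ by rw [← hM]; linarith)
  simp only at hPM
  have hdet : P.det ≠ 0 := by
    intro h; rw [h, norm_zero] at hPM; linarith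
  have hU : IsUnit P := (Matrix.isUnit_iff_isUnit_det P).2 hdet.isUnit
  have hPi : P * P⁻¹ = 1 := Matrix.mul_nonsing_inv P hdet.isUnit
  have hUi : IsUnit P⁻¹ := Matrix.isUnit_nonsing_inv_iff.2 hU
  have hc1 : ∀ v : Vec n, ρ v ≤ 1 → ∀ i, ‖mvec P⁻¹ v i‖ ≤ 2 := by
    intro v hv i
    have h1 : mvec P⁻¹ v i = P.det⁻¹ * (P.updateCol i v).det := by
      rw [← Matrix.cramer_apply, Matrix.cramer_eq_adjugate_mulVec]
      have : mvec P⁻¹ v i = (P⁻¹.mulVec v) i := rfl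
      rw [this, Matrix.inv_def, Matrix.smul_mulVec, Pi.smul_apply, smul_eq_mul, Ring.inverse_eq_inv']
    have h2 : P.updateCol i v ∈ S := by
      intro j
      have h3 : mvec (P.updateCol i v) (eb j) = if j = i then v else mvec P (eb j) := by
        ext k
        rw [← hcol (P.updateCol i v) k j, Matrix.updateCol_apply]
        split_ifs with h
        · rfl
        · rw [← hcol P k j]
      rw [h3]
      split_ifs
      · exact hv
      · exact hPS j
    rw [h1, norm_mul, norm_inv, inv_mul_le_iff₀ (norm_pos_iff.2 hdet)]
    linarith [hMle _ h2]
  have hc2 : ∀ (v : Vec n) (i : Fin n), ‖mvec P⁻¹ v i‖ ≤ 2 * ρ v := by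
    intro v i
    rcases eq_or_ne v 0 with rfl | hv
    · have : mvec P⁻¹ (0 : Vec n) = 0 := map_zero _
      rw [this]; simp
    have hρ0 : 0 < ρ v := (apply_nonneg ρ v).lt_of_ne fun h => hv (hρ v h.symm)
    have h1 := hc1 ((((ρ v)⁻¹ : ℝ) : ℂ) • v) (by
      rw [map_smul_eq_mul, Complex.norm_real, norm_inv, Real.norm_of_nonneg hρ0.le, inv_mul_cancel₀ hρ0.ne']) i
    have h2 : mvec P⁻¹ ((((ρ v)⁻¹ : ℝ) : ℂ) • v) i = (((ρ v)⁻¹ : ℝ) : ℂ) * mvec P⁻¹ v i := by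
      rw [mvec_smul]; rfl
    rw [h2, norm_mul, Complex.norm_real, norm_inv, Real.norm_of_nonneg hρ0.le, inv_mul_le_iff₀ hρ0] at h1
    linarith
  obtain ⟨B, hB, hBP⟩ := exists_posDef_norm_eq hUi
  refine ⟨B, hB, fun v => ?_⟩
  rw [hBP]
  constructor
  · refine (norm_le_sum _).trans ((Finset.sum_le_sum fun i _ => hc2 v i).trans_eq ?_)
    simp; ring
  · have h1 : v = ∑ i, mvec P⁻¹ v i • mvec P (eb i) := by
      conv_lhs => rw [← mvec_one v, ← hPi, mvec_mul, vec_eq_sum (mvec P⁻¹ v), mvec_sum]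
      exact Finset.sum_congr rfl fun i _ => mvec_smul _ _ _
    conv_lhs => rw [h1]
    refine (seminorm_sum_le ρ _ _).trans ?_
    calc ∑ i, ρ (mvec P⁻¹ v i • mvec P (eb i)) ≤ ∑ _i : Fin n, ‖mvec P⁻¹ v‖ := by
          refine Finset.sum_le_sum fun i _ => ?_
          rw [map_smul_eq_mul]
          have h2 := norm_apply_le (mvec P⁻¹ v) i
          have h3 : ρ (mvec P (eb i)) ≤ 1 := hPS i
          have := mul_le_mul h2 h3 (apply_nonneg _ _) (norm_nonneg _)
          simpa using this
      _ = _ := by simp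

/-- Fractional powers of a measurable positive definite matrix function are measurable. -/
theorem measurable_matPow {α : Type*} [MeasurableSpace α] {W : α → Mat n} (hW : ∀ i j, Measurable fun x => W x i j)
    (hp : ∀ x, (W x).PosDef) (s : ℝ) (i j : Fin n) : Measurable fun x => matPow (W x) s i j := by
  have hex : ∀ N : ℕ, ∃ q : Polynomial ℝ, ∀ t ∈ Set.Icc ((N + 1 : ℝ)⁻¹) (N + 1), |q.eval t - t ^ s| < (N + 1 : ℝ)⁻¹ := by
    intro N
    have hc : ContinuousOn (fun t : ℝ => t ^ s) (Set.Icc ((N + 1 : ℝ)⁻¹) (N + 1)) := by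
      refine ContinuousOn.rpow_const continuousOn_id fun t ht => Or.inl ?_
      have : (0 : ℝ) < (N + 1 : ℝ)⁻¹ := by positivity
      exact (this.trans_le ht.1).ne'
    exact exists_polynomial_near_of_continuousOn _ _ _ hc _ (by positivity)
  choose q hq using hex
  have hpm : ∀ (q : Polynomial ℝ) (i j : Fin n), Measurable fun x => (Polynomial.aeval (W x) q) i j := by
    intro q
    have hmul : ∀ k : ℕ, ∀ i j, Measurable fun x => (W x ^ k) i j := by
      intro k
      induction k with
      | zero => intro i j; simp
      | succ k ih =>
        intro i j
        simp only [pow_succ, Matrix.mul_apply]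
        exact Finset.measurable_fun_sum _ fun l _ => (ih i l).mul (hW l j)
    intro i j
    simp only [Polynomial.aeval_eq_sum_range, Matrix.sum_apply, Matrix.smul_apply]
    exact Finset.measurable_fun_sum _ fun l _ => (hmul l i j).const_smul (q.coeff l)
  refine measurable_of_tendsto_metrizable (f := fun N x => (Polynomial.aeval (W x) (q N)) i j)
    (fun N => hpm (q N) i j) ?_
  rw [tendsto_pi_nhds]
  intro x
  have hH := (hp x).isHermitian
  have hval : ∀ f : ℝ → ℝ, cfc f (W x) i j = ∑ k, (hH.eigenvectorUnitary : Mat n) i k * (f (hH.eigenvalues k) : ℂ) *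
      star (hH.eigenvectorUnitary : Mat n) k j := by
    intro f
    rw [hH.cfc_eq]
    have : hH.cfc f = (hH.eigenvectorUnitary : Mat n) * Matrix.diagonal (fun i => ((f (hH.eigenvalues i) : ℝ) : ℂ)) *
      star (hH.eigenvectorUnitary : Mat n) := rfl
    rw [this, Matrix.mul_apply]
    simp only [Matrix.mul_diagonal]
  have h1 : ∀ N, (Polynomial.aeval (W x) (q N)) i j = cfc (q N).eval (W x) i j := by
    intro N
    exact congrFun (congrFun (cfc_polynomial (q N) (W x) hH).symm i) j
  rw [matPow_eq_cfc hH, hval]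
  simp only [h1, hval]
  refine tendsto_finsetSum _ fun k _ => Filter.Tendsto.mul_const _ (Filter.Tendsto.const_mul _ ?_)
  refine (Complex.continuous_ofReal.tendsto _).comp ?_
  have hpos := (hp x).eigenvalues_pos k
  set t := hH.eigenvalues k
  rw [tendsto_iff_norm_sub_tendsto_zero]
  obtain ⟨N0, hN0⟩ := exists_nat_gt (max t t⁻¹)
  refine squeeze_zero' (Filter.Eventually.of_forall fun _ => norm_nonneg _)
    (g := fun N : ℕ => (N + 1 : ℝ)⁻¹) ?_ ?_
  · filter_upwards [Filter.eventually_ge_atTop N0] with N hN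
    have hN' : (N0 : ℝ) ≤ N := by exact_mod_cast hN
    refine (hq N t ⟨?_, ?_⟩).le
    · rw [inv_le_comm₀ (by positivity) hpos]
      linarith [le_max_right t t⁻¹]
    · linarith [le_max_left t t⁻¹]
  · simpa [one_div] using tendsto_one_div_add_atTop_nhds_zero_nat (𝕜 := ℝ)

end A1Rough

namespace A1Rough

variable {d : ℕ} {w : Rd d → ℝ≥0∞}

/-- The dyadic maximal function over the scales `s - k, …, s`. -/
def dM (w : Rd d → ℝ≥0∞) (s : ℤ) : ℕ → Rd d → ℝ≥0∞
  | 0 => El s w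
  | k + 1 => fun x => dM w s k x ⊔ El (s - (k + 1 : ℕ)) w x

lemma measurable_dM (hw : Measurable w) (s : ℤ) (k : ℕ) : Measurable (dM w s k) := by
  induction k with
  | zero => exact measurable_El s hw
  | succ k ih => exact ih.sup (measurable_El _ hw)

lemma dM_congr {s : ℤ} {k : ℕ} {x y : Rd d} (h : y ∈ cube (s - k) x) : dM w s k y = dM w s k x := by
  induction k with
  | zero =>
    have : y ∈ cube s x := by simpa using h
    exact El_congr this w
  | succ k ih =>
    simp only [dM]
    rw [ih (cube_mono (by push_cast; omega) x h), El_congr h]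

lemma dM_split (s : ℤ) (k l : ℕ) (x : Rd d) :
    dM w s (k + 1 + l) x = dM w s k x ⊔ dM w (s - (k + 1 : ℕ)) l x := by
  induction l with
  | zero => rfl
  | succ l ih =>
    change dM w s (k + 1 + l) x ⊔ _ = _
    rw [ih, sup_assoc]
    simp only [dM]
    congr 3
    rw [Nat.add_eq]
    push_cast; ring

lemma El_le_dM (s : ℤ) (k : ℕ) (x : Rd d) : El (s - k) w x ≤ dM w s k x := by
  cases k with
  | zero => simp [dM]
  | succ k => exact le_sup_right

lemma dM_le_succ (s : ℤ) (k : ℕ) (x : Rd d) : dM w s k x ≤ dM w s (k + 1) x := le_sup_left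

lemma El_le_dM' (s : ℤ) (k : ℕ) (x : Rd d) : El s w x ≤ dM w s k x := by
  induction k with
  | zero => exact le_rfl
  | succ k ih => exact ih.trans (dM_le_succ s k x)

lemma El_le_succ (m : ℤ) (x : Rd d) : El m w x ≤ 2 ^ d * El (m + 1) w x := by
  have h : (vol d m)⁻¹ = 2 ^ d * (vol d (m + 1))⁻¹ := by
    have : vol d (m + 1) = vol d m * 2 ^ d := by
      rw [vol, vol, zpow_add₀ two_ne_zero, zpow_one, mul_pow, ENNReal.ofReal_mul (by positivity)]
      simp [ENNReal.ofReal_pow]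
    rw [this, ENNReal.mul_inv (Or.inl (vol_ne_zero m)) (Or.inl (vol_ne_top m)), mul_left_comm,
      ENNReal.mul_inv_cancel (by simp) (by simp), mul_one]
  rw [El, El, h, mul_assoc]
  exact mul_le_mul' le_rfl (mul_le_mul' le_rfl (lintegral_mono_set (cube_mono (by omega) x)))

lemma dM_succ_le (s : ℤ) (k : ℕ) (x : Rd d) : dM w s (k + 1) x ≤ 2 ^ d * dM w s k x := by
  refine sup_le ?_ ?_
  · exact le_mul_of_one_le_left' (one_le_pow₀ one_le_two)
  · refine (El_le_succ _ x).trans (mul_le_mul' le_rfl ?_)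
    have : s - ((k + 1 : ℕ) : ℤ) + 1 = s - k := by push_cast; ring
    rw [this]; exact El_le_dM s k x

lemma dM_le_El (s : ℤ) (k : ℕ) (x : Rd d) : dM w s k x ≤ (2 ^ d) ^ k * El s w x := by
  induction k with
  | zero => simp [dM]
  | succ k ih =>
    refine (dM_succ_le s k x).trans ?_
    rw [pow_succ', mul_assoc]
    exact mul_le_mul' le_rfl ih

lemma El_of_congr {m : ℤ} {h : Rd d → ℝ≥0∞} (hc : ∀ x, ∀ y ∈ cube m x, h y = h x) : El m h = h := by
  ext x
  rw [El, setLIntegral_congr_fun (measurableSet_cube m x) (hc x), setLIntegral_const, volume_cube,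
    mul_comm (h x), ← mul_assoc, ENNReal.inv_mul_cancel (vol_ne_zero m) (vol_ne_top m), one_mul]

lemma setLIntegral_mul_El {m s : ℤ} (hms : m ≤ s) (x0 : Rd d) {h f : Rd d → ℝ≥0∞} (hh : Measurable h)
    (hf : Measurable f) (hc : ∀ x, ∀ y ∈ cube m x, h y = h x) :
    ∫⁻ x in cube s x0, h x * El m f x = ∫⁻ x in cube s x0, h x * f x := by
  have hQ := measurableSet_cube s x0
  have e : ∀ u : Rd d → ℝ≥0∞, ∫⁻ x in cube s x0, h x * u x = ∫⁻ x, (cube s x0).indicator h x * u x := by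
    intro u
    rw [← lintegral_indicator hQ]
    simp only [Set.indicator_mul_left]
  rw [e, e, ← lintegral_El_mul m (hh.indicator hQ) hf, El_of_congr]
  intro x y hy
  by_cases hx : x ∈ cube s x0
  · have : y ∈ cube s x0 := by rw [← cube_eq hx]; exact cube_mono hms x hy
    rw [Set.indicator_of_mem hx, Set.indicator_of_mem this, hc x y hy]
  · have : y ∉ cube s x0 := fun h' => hx (by
      rw [← cube_eq h']; exact cube_mono hms y (mem_cube_comm.1 hy))
    rw [Set.indicator_of_notMem hx, Set.indicator_of_notMem this]

lemma rpow_sub_mul_le {a b K ε : ℝ} (hb : 0 < b) (hab : b ≤ a) (haK : a ≤ K * b) (hε : 0 < ε) (hε1 : ε ≤ 1) :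
    (a ^ ε - b ^ ε) * a + ε * K * b ^ (1 + ε) ≤ ε * K * a ^ (1 + ε) := by
  obtain ⟨t, rfl⟩ : ∃ t, a = t * b := ⟨a / b, by field_simp⟩
  have ht1 : 1 ≤ t := by
    by_contra h; push Not at h; nlinarith
  have htK : t ≤ K := le_of_mul_le_mul_right haK hb
  have h1 : t ^ ε ≤ 1 + ε * (t - 1) := by
    have := rpow_one_add_le_one_add_mul_self (s := t - 1) (p := ε) (by linarith) hε.le hε1
    simpa using this
  have h2 : t ≤ t ^ (1 + ε) := Real.self_le_rpow_of_one_le ht1 (by linarith)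
  have h3 : (0 : ℝ) < b ^ (1 + ε) := Real.rpow_pos_of_pos hb _
  have h4 : b ^ ε * b = b ^ (1 + ε) := by rw [add_comm, Real.rpow_add_one hb.ne']
  rw [Real.mul_rpow (by linarith) hb.le, Real.mul_rpow (by linarith) hb.le]
  have h5 : (t ^ ε - 1) * t ≤ ε * K * (t ^ (1 + ε) - 1) := by
    have hK0 : 0 ≤ K := by linarith
    calc (t ^ ε - 1) * t ≤ ε * (t - 1) * t := mul_le_mul_of_nonneg_right (by linarith) (by linarith)
      _ ≤ ε * (t - 1) * K := mul_le_mul_of_nonneg_left htK (mul_nonneg hε.le (by linarith))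
      _ = ε * K * (t - 1) := by ring
      _ ≤ _ := mul_le_mul_of_nonneg_left (by linarith) (by positivity)
  have h6 := mul_le_mul_of_nonneg_right h5 h3.le
  have h7 : (t ^ ε * b ^ ε - b ^ ε) * (t * b) = (t ^ ε - 1) * t * (b ^ ε * b) := by ring
  rw [h7, h4]
  linarith

lemma enn_rpow_sub_mul_le {a b : ℝ≥0∞} {ε : ℝ} (hb : b ≠ ⊤) (hab : b ≤ a) (haK : a ≤ 2 ^ d * b)
    (hε : 0 < ε) (hε1 : ε ≤ 1) :
    (a ^ ε - b ^ ε) * a + ENNReal.ofReal ε * 2 ^ d * b ^ (1 + ε) ≤ ENNReal.ofReal ε * 2 ^ d * a ^ (1 + ε) := by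
  rcases eq_or_ne b 0 with rfl | hb0
  · have : a = 0 := by simpa using haK
    simp [this]
  have ha : a ≠ ⊤ := (haK.trans_lt (ENNReal.mul_lt_top (by simp) hb.lt_top)).ne
  have hbr := ENNReal.toReal_pos hb0 hb
  have har : b.toReal ≤ a.toReal := ENNReal.toReal_mono ha hab
  have h := rpow_sub_mul_le (K := 2 ^ d) hbr har (by
    have := ENNReal.toReal_mono (ENNReal.mul_ne_top (by simp) hb) haK
    simpa using this) hε hε1
  have h' := ENNReal.ofReal_le_ofReal h
  have hsub : (0 : ℝ) ≤ a.toReal ^ ε - b.toReal ^ ε := by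
    have := Real.rpow_le_rpow hbr.le har hε.le
    linarith
  have ha0 : 0 ≤ a.toReal := ENNReal.toReal_nonneg
  rw [ENNReal.ofReal_add (by positivity) (by positivity), ENNReal.ofReal_mul hsub,
    ENNReal.ofReal_sub _ (by positivity), ENNReal.ofReal_mul (by positivity), ENNReal.ofReal_mul (by positivity),
    ENNReal.ofReal_mul (by positivity), ← ENNReal.ofReal_rpow_of_nonneg ha0 hε.le,
    ← ENNReal.ofReal_rpow_of_nonneg hbr.le hε.le, ← ENNReal.ofReal_rpow_of_nonneg ha0 (by linarith),
    ← ENNReal.ofReal_rpow_of_nonneg hbr.le (by linarith), ENNReal.ofReal_toReal ha, ENNReal.ofReal_toReal hb] at h'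
  simpa [ENNReal.ofReal_pow, ENNReal.ofReal_mul hε.le] using h'

lemma le_two_mul_of_le_add {X Y k : ℝ≥0∞} (hX : X ≠ ⊤) (hk : k ≤ 2⁻¹) (h : X ≤ Y + k * X) : X ≤ 2 * Y := by
  have h1 : X ≤ Y + 2⁻¹ * X := h.trans (by gcongr)
  have h2 : 2⁻¹ * X + 2⁻¹ * X = X := by rw [← add_mul, ENNReal.inv_two_add_inv_two, one_mul]
  have h3 : 2⁻¹ * X ≤ Y := by
    rw [← ENNReal.add_le_add_iff_right (a := 2⁻¹ * X) (ENNReal.mul_ne_top (by simp) hX), h2]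
    exact h1
  calc X = 2 * (2⁻¹ * X) := by rw [← mul_assoc, ENNReal.mul_inv_cancel (by simp) (by simp), one_mul]
    _ ≤ _ := by gcongr

theorem lintegral_dM_rpow_mul_le (hw : Measurable w) {S : ℝ≥0∞}
    (hS : ∀ m N x, ∫⁻ y in cube m x, dM w m N y ≤ S * ∫⁻ y in cube m x, w y)
    (hfin : ∀ m x, El m w x ≠ ⊤) {ε : ℝ} (hε : 0 < ε) (hε1 : ε ≤ 1)
    (hεS : ENNReal.ofReal ε * 2 ^ d * S ≤ 2⁻¹) (s : ℤ) (x0 : Rd d) (N : ℕ) :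
    ∫⁻ x in cube s x0, dM w s N x ^ ε * w x ≤ 2 * (El s w x0 ^ ε * ∫⁻ x in cube s x0, w x) := by
  have hQ := measurableSet_cube s x0
  set c : ℝ≥0∞ := ENNReal.ofReal ε * 2 ^ d with hc
  have hmd : ∀ k, Measurable fun x => dM w s k x ^ ε := fun k => (measurable_dM hw s k).pow_const ε
  have hmd1 : ∀ k, Measurable fun x => dM w s k x ^ (1 + ε) := fun k => (measurable_dM hw s k).pow_const _
  have hmono : ∀ k x, dM w s k x ^ ε ≤ dM w s (k + 1) x ^ ε := fun k x =>
    ENNReal.rpow_le_rpow (dM_le_succ s k x) hε.le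
  set h : ℕ → Rd d → ℝ≥0∞ := fun k x => dM w s (k + 1) x ^ ε - dM w s k x ^ ε with hh
  have hhm : ∀ k, Measurable (h k) := fun k => (hmd (k + 1)).sub (hmd k)
  have hsplit : ∀ k x, dM w s (k + 1) x ^ ε = dM w s k x ^ ε + h k x := fun k x =>
    (add_tsub_cancel_of_le (hmono k x)).symm
  have hhc : ∀ k, ∀ x, ∀ y ∈ cube (s - (k + 1 : ℕ)) x, h k y = h k x := by
    intro k x y hy
    simp only [hh]
    rw [dM_congr hy, dM_congr (cube_mono (by push_cast; omega) x hy)]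
  have hstep : ∀ k (f : Rd d → ℝ≥0∞), Measurable f → ∫⁻ x in cube s x0, dM w s (k + 1) x ^ ε * f x =
      (∫⁻ x in cube s x0, dM w s k x ^ ε * f x) + ∫⁻ x in cube s x0, h k x * f x := by
    intro k f hf
    refine Eq.trans ?_ (lintegral_add_left ((hmd k).mul hf) fun x => h k x * f x)
    exact lintegral_congr fun x => by rw [hsplit, add_mul]; rfl
  have hbase : ∀ f : Rd d → ℝ≥0∞, Measurable f → ∫⁻ x in cube s x0, dM w s 0 x ^ ε * f x =
      El s w x0 ^ ε * ∫⁻ x in cube s x0, f x := by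
    intro f hf
    rw [← lintegral_const_mul _ hf]
    refine setLIntegral_congr_fun hQ fun x hx => ?_
    simp only [dM]
    rw [El_congr hx]
  have hA : ∀ k, ∫⁻ x in cube s x0, dM w s k x ^ ε * w x ≤
      (El s w x0 ^ ε * ∫⁻ x in cube s x0, w x) + c * ∫⁻ x in cube s x0, dM w s k x ^ (1 + ε) := by
    intro k
    induction k with
    | zero => rw [hbase w hw]; exact le_self_add
    | succ k ih =>
      rw [hstep k w hw]
      refine (add_le_add_left ih _).trans ?_
      rw [add_assoc]
      refine add_le_add_right ?_ _
      rw [← setLIntegral_mul_El (by omega) x0 (hhm k) hw (hhc k), ← lintegral_const_mul _ (hmd1 k),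
        ← lintegral_const_mul _ (hmd1 (k + 1)), ← lintegral_add_left ((hmd1 k).const_mul c)]
      refine lintegral_mono fun x => ?_
      have hbt : dM w s k x ≠ ⊤ := ((dM_le_El s k x).trans_lt (ENNReal.mul_lt_top (by simp) (hfin s x).lt_top)).ne
      have := enn_rpow_sub_mul_le hbt (dM_le_succ s k x) (dM_succ_le s k x) hε hε1
      rw [add_comm]
      refine le_trans (add_le_add_left (mul_le_mul' le_rfl ?_) _) this
      exact le_sup_right
  have hB : ∀ k ≤ N, ∫⁻ x in cube s x0, dM w s k x ^ ε * dM w s N x ≤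
      S * ∫⁻ x in cube s x0, dM w s k x ^ ε * w x := by
    intro k
    induction k with
    | zero =>
      intro _
      rw [hbase _ (measurable_dM hw s N), hbase w hw, mul_left_comm]
      exact mul_le_mul' le_rfl (hS s N x0)
    | succ k ih =>
      intro hk
      obtain ⟨l, rfl⟩ := Nat.exists_eq_add_of_le hk
      rw [hstep k _ (measurable_dM hw s _), hstep k w hw, mul_add]
      refine add_le_add (ih (by omega)) ?_
      have e1 : ∀ x, h k x * dM w s (k + 1 + l) x ≤ h k x * dM w (s - (k + 1 : ℕ)) l x := by
        intro x
        rcases eq_or_ne (h k x) 0 with h0 | h0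
        · simp [h0]
        refine mul_le_mul' le_rfl ?_
        rw [dM_split]
        refine sup_le ?_ le_rfl
        by_contra hlt
        push Not at hlt
        apply h0
        have : dM w s (k + 1) x = dM w s k x := sup_eq_left.2 ((El_le_dM' _ l x).trans hlt.le)
        simp only [hh]
        rw [this, tsub_self]
      refine (lintegral_mono e1).trans ?_
      rw [← setLIntegral_mul_El (by omega) x0 (hhm k) (measurable_dM hw _ l) (hhc k),
        ← setLIntegral_mul_El (by omega) x0 (hhm k) hw (hhc k)]
      refine le_of_le_of_eq ?_ (lintegral_const_mul S ((hhm k).mul (measurable_El (s - (k + 1 : ℕ)) hw)))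
      refine lintegral_mono fun x => ?_
      change _ ≤ S * (h k x * El _ w x)
      rw [mul_left_comm]
      refine mul_le_mul' le_rfl ?_
      rw [El, El, mul_left_comm]
      exact mul_le_mul' le_rfl (hS _ l x)
  have hW : ∫⁻ x in cube s x0, w x ≠ ⊤ := by
    have := hfin s x0
    rw [El] at this
    intro hw'
    rw [hw', ENNReal.mul_top (ENNReal.inv_ne_zero.2 (vol_ne_top s))] at this
    exact this rfl
  have hX : ∫⁻ x in cube s x0, dM w s N x ^ ε * w x ≠ ⊤ := by
    refine ne_top_of_le_ne_top (b := ((2 ^ d) ^ N * El s w x0) ^ ε * ∫⁻ x in cube s x0, w x) ?_ ?_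
    · exact ENNReal.mul_ne_top (ENNReal.rpow_ne_top_of_nonneg hε.le (ENNReal.mul_ne_top (by simp) (hfin s x0))) hW
    · rw [← lintegral_const_mul _ hw]
      refine setLIntegral_mono' hQ fun x hx => mul_le_mul' (ENNReal.rpow_le_rpow ?_ hε.le) le_rfl
      rw [← El_congr hx w]
      exact dM_le_El s N x
  refine le_two_mul_of_le_add (k := c * S) hX hεS ?_
  refine (hA N).trans (add_le_add_right ?_ _)
  rw [mul_assoc c S]
  refine mul_le_mul' le_rfl (le_trans (le_of_eq ?_) (hB N le_rfl))
  refine lintegral_congr fun x => ?_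
  rw [add_comm, ENNReal.rpow_add_of_nonneg _ _ hε.le zero_le_one, ENNReal.rpow_one]

end A1Rough

namespace A1Rough

variable {d : ℕ} {w : Rd d → ℝ≥0∞}

lemma cube_subset_closedBall (m : ℤ) (x : Rd d) : cube m x ⊆ Metric.closedBall x ((√d + 1) * 2 ^ m) := by
  intro y hy
  rw [Metric.mem_closedBall, dist_eq_norm]
  refine (norm_sub_le_of_mem_cube hy).trans ?_
  have : (0 : ℝ) < 2 ^ m := by positivity
  nlinarith

lemma El_ne_top (hloc : ∀ R : ℝ, ∫⁻ y in Metric.closedBall (0 : Rd d) R, w y ≠ ⊤) (m : ℤ) (x : Rd d) :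
    El m w x ≠ ⊤ := by
  refine ENNReal.mul_ne_top (ENNReal.inv_ne_top.2 (vol_ne_zero m))
    (ne_top_of_le_ne_top (hloc ((√d + 1) * 2 ^ m + dist x 0)) (lintegral_mono_set ?_))
  exact (cube_subset_closedBall m x).trans (Metric.closedBall_subset_closedBall' le_rfl)

lemma ae_le_iSup_dM (hw : Measurable w) (hwt : ∀ x, w x ≠ ⊤)
    (hloc : ∀ R : ℝ, ∫⁻ y in Metric.closedBall (0 : Rd d) R, w y ≠ ⊤) (s : ℤ) :
    ∀ᵐ x, w x ≤ ⨆ N, dM w s N x := by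
  set f : Rd d → ℝ := fun x => (w x).toReal with hf
  have hfm : Measurable f := hw.ennreal_toReal
  have hfe : ∀ x, ‖f x‖ₑ = w x := fun x => by
    rw [hf, Real.enorm_eq_ofReal ENNReal.toReal_nonneg, ENNReal.ofReal_toReal (hwt x)]
  have hint : LocallyIntegrable f := by
    rw [locallyIntegrable_iff]
    intro K hK
    obtain ⟨R, hR⟩ := hK.isBounded.subset_closedBall (0 : Rd d)
    refine IntegrableOn.mono_set ?_ hR
    refine ⟨hfm.aestronglyMeasurable, ?_⟩
    rw [hasFiniteIntegral_iff_enorm]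
    simp only [hfe]
    exact (hloc R).lt_top
  filter_upwards [IsUnifLocDoublingMeasure.ae_tendsto_average_norm_sub volume hint 1] with x hx
  set δ : ℕ → ℝ := fun N => (√d + 1) * 2 ^ (s - N) with hδ
  have hδ0 : ∀ N, 0 < δ N := fun N => by simp only [hδ]; positivity
  have hδt : Filter.Tendsto δ Filter.atTop (nhdsWithin 0 (Set.Ioi 0)) := by
    refine tendsto_nhdsWithin_iff.2 ⟨?_, Filter.Eventually.of_forall fun N => hδ0 N⟩
    have h1 : δ = fun N : ℕ => (√d + 1) * 2 ^ s * (2⁻¹ : ℝ) ^ N := by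
      ext N
      simp only [hδ]
      rw [zpow_sub₀ two_ne_zero, zpow_natCast, inv_pow, mul_assoc]; rfl
    rw [h1, ← mul_zero ((√d + 1) * 2 ^ s : ℝ)]
    exact (_root_.tendsto_pow_atTop_nhds_zero_of_lt_one (by norm_num) (by norm_num)).const_mul _
  have ht := hx (fun _ => x) δ hδt (Filter.Eventually.of_forall fun N => by
    rw [one_mul]; exact Metric.mem_closedBall_self (hδ0 N).le)
  set C : ℝ≥0∞ := ENNReal.ofReal ((√d + 1) ^ d) * volB d with hC
  have hCt : C ≠ ⊤ := ENNReal.mul_ne_top ENNReal.ofReal_ne_top volB_ne_top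
  have hlim : Filter.Tendsto (fun N => (⨆ N, dM w s N x) +
      C * ENNReal.ofReal (⨍ y in Metric.closedBall x (δ N), ‖f y - f x‖)) Filter.atTop
      (nhds ((⨆ N, dM w s N x) + C * ENNReal.ofReal 0)) :=
    (ENNReal.Tendsto.const_mul (ENNReal.tendsto_ofReal ht) (Or.inr hCt)).const_add _
  rw [ENNReal.ofReal_zero, mul_zero, add_zero] at hlim
  refine ge_of_tendsto' hlim fun N => ?_
  have hv : volume (Metric.closedBall x (δ N)) = C * vol d (s - N) := by
    rw [volume_closedBall_eq x (hδ0 N).le, hC, vol, mul_right_comm, ← ENNReal.ofReal_mul (by positivity), ← mul_pow]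
  have hI : IntegrableOn (fun y => ‖f y - f x‖) (Metric.closedBall x (δ N)) := by
    refine Integrable.norm (Integrable.sub ?_ (integrableOn_const (measure_closedBall_lt_top.ne)))
    exact hint.integrableOn_isCompact (isCompact_closedBall x _)
  calc w x = El (s - N) (fun _ => w x) x := by
        rw [El_of_congr fun _ _ _ => rfl]
    _ ≤ El (s - N) (fun y => w y + ‖f y - f x‖ₑ) x := by
        refine mul_le_mul' le_rfl (lintegral_mono fun y => ?_)
        change w x ≤ w y + ‖f y - f x‖ₑ
        rw [← hfe x, ← hfe y]
        calc ‖f x‖ₑ = ‖f y - (f y - f x)‖ₑ := by rw [_root_.sub_sub_cancel]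
          _ ≤ _ := enorm_sub_le
    _ = El (s - N) w x + (vol d (s - N))⁻¹ * ∫⁻ y in cube (s - N) x, ‖f y - f x‖ₑ := by
        rw [El, lintegral_add_left hw, mul_add]; rfl
    _ ≤ (⨆ N, dM w s N x) + (vol d (s - N))⁻¹ * ∫⁻ y in Metric.closedBall x (δ N), ‖f y - f x‖ₑ := by
        refine add_le_add ((El_le_dM s N x).trans (le_iSup (fun N => dM w s N x) N)) ?_
        exact mul_le_mul' le_rfl (lintegral_mono_set (cube_subset_closedBall _ x))
    _ = _ := by
        congr 1
        have e1 : ∫⁻ y in Metric.closedBall x (δ N), ‖f y - f x‖ₑ =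
            ENNReal.ofReal (∫ y in Metric.closedBall x (δ N), ‖f y - f x‖) := by
          rw [ofReal_integral_eq_lintegral_ofReal hI (Filter.Eventually.of_forall fun _ => norm_nonneg _)]
          simp only [ofReal_norm]
        have e2 : ∫ y in Metric.closedBall x (δ N), ‖f y - f x‖ =
            (C * vol d (s - N)).toReal * ⨍ y in Metric.closedBall x (δ N), ‖f y - f x‖ := by
          rw [setAverage_eq, smul_eq_mul, measureReal_def, hv, ← mul_assoc, mul_inv_cancel₀, one_mul]
          refine (ENNReal.toReal_pos ?_ ?_).ne'
          · rw [← hv]; exact (Metric.measure_closedBall_pos volume x (hδ0 N)).ne'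
          · exact ENNReal.mul_ne_top hCt (vol_ne_top _)
        rw [e1, e2, ENNReal.ofReal_mul ENNReal.toReal_nonneg,
          ENNReal.ofReal_toReal (ENNReal.mul_ne_top hCt (vol_ne_top _)), mul_comm C, mul_assoc, ← mul_assoc,
          ENNReal.inv_mul_cancel (vol_ne_zero _) (vol_ne_top _), one_mul]

/-- Sharp reverse Hölder inequality on dyadic cubes. -/
theorem reverse_holder (hw : Measurable w) (hwt : ∀ x, w x ≠ ⊤)
    (hloc : ∀ R : ℝ, ∫⁻ y in Metric.closedBall (0 : Rd d) R, w y ≠ ⊤) {S : ℝ≥0∞}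
    (hS : ∀ m N x, ∫⁻ y in cube m x, dM w m N y ≤ S * ∫⁻ y in cube m x, w y)
    {ε : ℝ} (hε : 0 < ε) (hε1 : ε ≤ 1)
    (hεS : ENNReal.ofReal ε * 2 ^ d * S ≤ 2⁻¹) (s : ℤ) (x0 : Rd d) :
    El s (fun x => w x ^ (1 + ε)) x0 ≤ 2 * El s w x0 ^ (1 + ε) := by
  have h1 : ∫⁻ x in cube s x0, w x ^ (1 + ε) ≤ 2 * (El s w x0 ^ ε * ∫⁻ x in cube s x0, w x) := by
    have hm : Monotone fun N => fun x => dM w s N x ^ ε * w x := by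
      refine monotone_nat_of_le_succ fun N x => ?_
      exact mul_le_mul' (ENNReal.rpow_le_rpow (dM_le_succ s N x) hε.le) le_rfl
    calc ∫⁻ x in cube s x0, w x ^ (1 + ε) ≤ ∫⁻ x in cube s x0, ⨆ N, dM w s N x ^ ε * w x := by
          refine lintegral_mono_ae (ae_restrict_of_ae ?_)
          filter_upwards [ae_le_iSup_dM hw hwt hloc s] with x hx
          rw [add_comm, ENNReal.rpow_add_of_nonneg _ _ hε.le zero_le_one, ENNReal.rpow_one, ← ENNReal.iSup_mul]
          refine mul_le_mul' ((ENNReal.rpow_le_rpow hx hε.le).trans_eq ?_) le_rfl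
          exact (ENNReal.orderIsoRpow ε hε).map_iSup _
      _ = ⨆ N, ∫⁻ x in cube s x0, dM w s N x ^ ε * w x :=
          lintegral_iSup (fun N => ((measurable_dM hw s N).pow_const ε).mul hw) hm
      _ ≤ _ := iSup_le fun N => lintegral_dM_rpow_mul_le hw hS (El_ne_top hloc) hε hε1 hεS s x0 N
  rw [El]
  refine (mul_le_mul' le_rfl h1).trans_eq ?_
  rw [add_comm 1 ε, ENNReal.rpow_add_of_nonneg _ _ hε.le zero_le_one, ENNReal.rpow_one, mul_left_comm, mul_left_comm _ (El s w x0 ^ ε)]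
  rfl

end A1Rough

namespace A1Rough

variable {d n : ℕ} {W : Rd d → Mat n}

lemma measurable_opNorm {α : Type*} [MeasurableSpace α] {A : α → Mat n} (h : ∀ i j, Measurable fun x => A x i j) :
    Measurable fun x => opNorm (A x) := by
  let L : (Fin n → Fin n → ℂ) →ₗ[ℂ] (Vec n →L[ℂ] Vec n) :=
    { toFun := fun A => Matrix.toEuclideanCLM (𝕜 := ℂ) (n := Fin n) (Matrix.of A)
      map_add' := fun A B => map_add (Matrix.toEuclideanCLM (𝕜 := ℂ) (n := Fin n)) (Matrix.of A) (Matrix.of B)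
      map_smul' := fun c A => map_smul (Matrix.toEuclideanCLM (𝕜 := ℂ) (n := Fin n)) c (Matrix.of A) }
  have hc : Continuous fun A : Fin n → Fin n → ℂ => ‖L A‖ :=
    continuous_norm.comp (LinearMap.continuous_of_finiteDimensional L)
  have hm : Measurable fun x => (fun i j => A x i j : Fin n → Fin n → ℂ) :=
    measurable_pi_iff.2 fun i => measurable_pi_iff.2 fun j => h i j
  exact hc.measurable.comp hm

lemma measurable_mvec {α : Type*} [MeasurableSpace α] {A : α → Mat n} (h : ∀ i j, Measurable fun x => A x i j)
    {v : α → Vec n} (hv : ∀ i, Measurable fun x => v x i) (i : Fin n) : Measurable fun x => mvec (A x) (v x) i := by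
  simp only [mvec_apply]
  exact Finset.measurable_fun_sum _ fun j _ => (h i j).mul (hv j)

lemma measurable_enorm_vec {α : Type*} [MeasurableSpace α] {v : α → Vec n} (hv : ∀ i, Measurable fun x => v x i) :
    Measurable fun x => ‖v x‖ₑ := by
  have : Measurable v := (WithLp.measurable_toLp 2 (Fin n → ℂ)).comp (measurable_pi_iff.2 hv)
  exact this.enorm

lemma measurable_const_mvec {α : Type*} [MeasurableSpace α] {A : α → Mat n} (h : ∀ i j, Measurable fun x => A x i j)
    (e : Vec n) : Measurable fun x => ‖mvec (A x) e‖ₑ :=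
  measurable_enorm_vec (measurable_mvec h fun _ => measurable_const)

lemma volume_Cube (Q : Cube d) : volume Q.set = ENNReal.ofReal (Q.side ^ d) := by
  have h2 := (PiLp.volume_preserving_ofLp (Fin d)).measure_preimage_emb
    (MeasurableEquiv.toLp 2 (Fin d → ℝ)).symm.measurableEmbedding
    (Set.univ.pi fun i => Set.Icc (Q.corner i) (Q.corner i + Q.side))
  have h3 : (volume : Measure (Fin d → ℝ)) (Set.univ.pi fun i =>
      Set.Icc (Q.corner i) (Q.corner i + Q.side)) = ENNReal.ofReal (Q.side ^ d) := by
    rw [volume_pi_pi]; simp [Real.volume_Icc, ENNReal.ofReal_pow Q.side_pos.le]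
  rw [h3] at h2
  rw [← h2]
  congr 1
  ext y
  simp only [Cube.set, Set.mem_preimage, Set.mem_pi, Set.mem_univ, Set.mem_Icc, true_implies]
  rfl

lemma measurableSet_Cube (Q : Cube d) : MeasurableSet Q.set := by
  have : Q.set = ⋂ i, {x : Rd d | Q.corner i ≤ x i ∧ x i ≤ Q.corner i + Q.side} := by
    ext x; simp [Cube.set]
  rw [this]
  refine MeasurableSet.iInter fun i => ?_
  have : Measurable fun x : Rd d => x i := by fun_prop
  exact (measurableSet_le measurable_const this).inter (measurableSet_le this measurable_const)

lemma volume_Cube_ne_zero (Q : Cube d) : volume Q.set ≠ 0 := by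
  rw [volume_Cube, ne_eq, ENNReal.ofReal_eq_zero, not_le]
  exact pow_pos Q.side_pos d

lemma volume_Cube_ne_top (Q : Cube d) : volume Q.set ≠ ⊤ := by
  rw [volume_Cube]; exact ENNReal.ofReal_ne_top

/-- Cubes with rational data. -/
def ratCube (c : (Fin d → ℚ) × {q : ℚ // 0 < q}) : Cube d where
  corner := WithLp.toLp 2 fun i => (c.1 i : ℝ)
  side := (c.2.1 : ℝ)
  side_pos := by exact_mod_cast c.2.2

lemma exists_ratCube (Q : Cube d) {η : ℝ} (hη : 0 < η) :
    ∃ c, Q.set ⊆ (ratCube c).set ∧ (ratCube c : Cube d).side ≤ Q.side + 2 * η := by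
  have h1 : ∀ i, ∃ r : ℚ, Q.corner i - η < r ∧ (r : ℝ) < Q.corner i := fun i => exists_rat_btwn (by linarith)
  choose r hr1 hr2 using h1
  obtain ⟨q, hq1, hq2⟩ := exists_rat_btwn (show Q.side + η < Q.side + 2 * η by linarith)
  have hs := Q.side_pos
  have hq0 : (0 : ℚ) < q := by
    have : (0 : ℝ) < q := by linarith
    exact_mod_cast this
  refine ⟨⟨r, q, hq0⟩, fun x hx i => ?_, hq2.le⟩
  have := hx i
  change (r i : ℝ) ≤ x i ∧ x i ≤ r i + q
  exact ⟨by linarith [hr2 i], by linarith [hr1 i]⟩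

lemma ae_A1 (W : Rd d → Mat n) : ∀ᵐ y, ∀ Q : Cube d, y ∈ Q.set →
    ∫⁻ x in Q.set, ENNReal.ofReal (opNorm (W x * (W y)⁻¹)) ≤ A1Const W * volume Q.set := by
  have h : ∀ c : (Fin d → ℚ) × {q : ℚ // 0 < q}, ∀ᵐ y, y ∈ (ratCube c).set →
      ∫⁻ x in (ratCube c).set, ENNReal.ofReal (opNorm (W x * (W y)⁻¹)) ≤ A1Const W * volume (ratCube c).set := by
    intro c
    rw [← ae_restrict_iff' (measurableSet_Cube _)]
    filter_upwards [ENNReal.ae_le_essSup (μ := volume.restrict (ratCube c).set) (fun y => (volume (ratCube c).set)⁻¹ *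
      ∫⁻ x in (ratCube c).set, ENNReal.ofReal (opNorm (W x * (W y)⁻¹)))] with y hy
    have h2 := hy.trans (le_iSup (fun Q : Cube d => essSup (fun y => (volume Q.set)⁻¹ *
      ∫⁻ x in Q.set, ENNReal.ofReal (opNorm (W x * (W y)⁻¹))) (volume.restrict Q.set)) (ratCube c))
    rwa [ENNReal.inv_mul_le_iff (volume_Cube_ne_zero _) (volume_Cube_ne_top _), mul_comm] at h2
  filter_upwards [ae_all_iff.2 h] with y hy Q hQ
  have hlim : Filter.Tendsto (fun k : ℕ => A1Const W * ENNReal.ofReal ((Q.side + 2 * (1 / ((k : ℝ) + 1))) ^ d))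
      Filter.atTop (nhds (A1Const W * ENNReal.ofReal ((Q.side + 2 * 0) ^ d))) := by
    refine ENNReal.Tendsto.const_mul (ENNReal.tendsto_ofReal ?_) (Or.inl ?_)
    · exact ((tendsto_one_div_add_atTop_nhds_zero_nat.const_mul 2).const_add Q.side).pow d
    · rw [mul_zero, add_zero, ← volume_Cube]; exact volume_Cube_ne_zero Q
  rw [mul_zero, add_zero, ← volume_Cube] at hlim
  refine ge_of_tendsto' hlim fun k => ?_
  obtain ⟨c, hc1, hc2⟩ := exists_ratCube Q (η := 1 / ((k : ℝ) + 1)) (by positivity)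
  refine (lintegral_mono_set hc1).trans ((hy c (hc1 hQ)).trans (mul_le_mul' le_rfl ?_))
  rw [volume_Cube]
  exact ENNReal.ofReal_le_ofReal (pow_le_pow_left₀ (ratCube c).side_pos.le hc2 d)

lemma enorm_mvec_le (A : Mat n) (v : Vec n) : ‖mvec A v‖ₑ ≤ ENNReal.ofReal (opNorm A) * ‖v‖ₑ := by
  rw [← ofReal_norm, ← ofReal_norm, ← ENNReal.ofReal_mul (opNorm_nonneg A)]
  exact ENNReal.ofReal_le_ofReal (norm_mvec_le A v)

lemma PosDef_inv_mul {A : Mat n} (h : A.PosDef) : A⁻¹ * A = 1 :=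
  Matrix.nonsing_inv_mul A ((Matrix.isUnit_iff_isUnit_det A).1 h.isUnit)

lemma PosDef_mul_inv {A : Mat n} (h : A.PosDef) : A * A⁻¹ = 1 :=
  Matrix.mul_nonsing_inv A ((Matrix.isUnit_iff_isUnit_det A).1 h.isUnit)

lemma measurable_mul_mat {α : Type*} [MeasurableSpace α] {A B : α → Mat n} (hA : ∀ i j, Measurable fun x => A x i j)
    (hB : ∀ i j, Measurable fun x => B x i j) (i j : Fin n) : Measurable fun x => (A x * B x) i j := by
  simp only [Matrix.mul_apply]
  exact Finset.measurable_fun_sum _ fun l _ => (hA i l).mul (hB l j)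

lemma ae_scalar_A1 (hW : ∀ i j, Measurable fun x => W x i j) (hp : ∀ x, (W x).PosDef) :
    ∀ᵐ y, ∀ Q : Cube d, y ∈ Q.set → ∀ e : Vec n,
      ∫⁻ x in Q.set, ‖mvec (W x) e‖ₑ ≤ A1Const W * volume Q.set * ‖mvec (W y) e‖ₑ := by
  filter_upwards [ae_A1 W] with y hy Q hQ e
  have hm : Measurable fun x => ENNReal.ofReal (opNorm (W x * (W y)⁻¹)) :=
    (measurable_opNorm (measurable_mul_mat (B := fun _ => (W y)⁻¹) hW fun i j => measurable_const)).ennreal_ofReal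
  refine le_trans ?_ (mul_le_mul' (hy Q hQ) (le_refl ‖mvec (W y) e‖ₑ))
  rw [← lintegral_mul_const _ hm]
  refine lintegral_mono fun x => ?_
  have : mvec (W x) e = mvec (W x * (W y)⁻¹) (mvec (W y) e) := by
    rw [← mvec_mul, mul_assoc, PosDef_inv_mul (hp y), mul_one]
  rw [this]
  exact enorm_mvec_le _ _

lemma exists_mem_of_ae {A : Set (Rd d)} (hA : volume A ≠ 0) {P : Rd d → Prop} (h : ∀ᵐ y, P y) : ∃ y ∈ A, P y := by
  by_contra hc
  push Not at hc
  exact hA (measure_mono_null (fun y hy => hc y hy) (ae_iff.1 h))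

lemma lintegral_cube_ne_top (hW : ∀ i j, Measurable fun x => W x i j) (hp : ∀ x, (W x).PosDef)
    (hA : A1Const W ≠ ⊤) (e : Vec n) (Q : Cube d) : ∫⁻ x in Q.set, ‖mvec (W x) e‖ₑ ≠ ⊤ := by
  obtain ⟨y, hy, h⟩ := exists_mem_of_ae (volume_Cube_ne_zero Q) (ae_scalar_A1 hW hp)
  exact ne_top_of_le_ne_top (ENNReal.mul_ne_top (ENNReal.mul_ne_top hA (volume_Cube_ne_top Q)) enorm_ne_top) (h Q hy e)

/-- The cube centred at `x` of half side `r`. -/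
def cenCube (x : Rd d) (r : ℝ) (hr : 0 < r) : Cube d where
  corner := WithLp.toLp 2 fun i => x i - r
  side := 2 * r
  side_pos := by positivity

lemma closedBall_subset_cenCube (x : Rd d) {r : ℝ} (hr : 0 < r) : Metric.closedBall x r ⊆ (cenCube x r hr).set := by
  intro y hy i
  rw [Metric.mem_closedBall, dist_eq_norm] at hy
  have h : |y i - x i| ≤ r := by
    have := (PiLp.norm_apply_le (y - x) i).trans hy
    simpa using this
  rw [abs_le] at h
  change x i - r ≤ y i ∧ y i ≤ x i - r + 2 * r
  constructor <;> linarith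

lemma lintegral_closedBall_ne_top (hW : ∀ i j, Measurable fun x => W x i j) (hp : ∀ x, (W x).PosDef)
    (hA : A1Const W ≠ ⊤) (e : Vec n) (R : ℝ) : ∫⁻ x in Metric.closedBall (0 : Rd d) R, ‖mvec (W x) e‖ₑ ≠ ⊤ := by
  refine ne_top_of_le_ne_top (lintegral_cube_ne_top hW hp hA e (cenCube 0 (|R| + 1) (by positivity))) (lintegral_mono_set ?_)
  refine Set.Subset.trans (Metric.closedBall_subset_closedBall ?_) (closedBall_subset_cenCube 0 _)
  linarith [le_abs_self R]

lemma scalar_weight_eq (hp : ∀ x, (W x).PosDef) (e : Vec n) (x : Rd d) :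
    (‖mvec (matPow (W x) (1 / 1)) e‖₊ : ℝ≥0∞) ^ (1 : ℝ) = ‖mvec (W x) e‖ₑ := by
  rw [ENNReal.rpow_one, div_one, matPow_one (hp x)]; rfl

lemma AqScConst_le (hW : ∀ i j, Measurable fun x => W x i j) (hp : ∀ x, (W x).PosDef) :
    AqScConst W 1 ≤ A1Const W := by
  refine iSup_le fun e => ?_
  simp only [scalar_weight_eq hp]
  refine iSup_le fun Q => ?_
  have h : ∫⁻ x in Q.set, HLM (Q.set.indicator fun x => ‖mvec (W x) e‖ₑ) x ≤
      A1Const W * ∫⁻ x in Q.set, ‖mvec (W x) e‖ₑ := by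
    rw [← lintegral_const_mul _ (measurable_const_mvec hW e)]
    refine lintegral_mono_ae (ae_restrict_of_ae ?_)
    filter_upwards [ae_scalar_A1 hW hp] with y hy
    refine iSup₂_le fun R hR => ?_
    rw [ENNReal.inv_mul_le_iff (volume_Cube_ne_zero _) (volume_Cube_ne_top _)]
    refine (lintegral_mono fun x => Set.indicator_le_self _ _ x).trans ((hy R hR e).trans_eq (by ring))
  refine (mul_le_mul' le_rfl h).trans ?_
  rw [mul_left_comm]
  exact mul_le_of_le_one_right' (ENNReal.inv_mul_le_one _)

lemma lintegral_HLM_le (hW : ∀ i j, Measurable fun x => W x i j) (hp : ∀ x, (W x).PosDef)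
    (hA : A1Const W ≠ ⊤) (e : Vec n) (Q : Cube d) :
    ∫⁻ x in Q.set, HLM (Q.set.indicator fun x => ‖mvec (W x) e‖ₑ) x ≤ AqScConst W 1 * ∫⁻ x in Q.set, ‖mvec (W x) e‖ₑ := by
  have h1 : (∫⁻ x in Q.set, ‖mvec (W x) e‖ₑ)⁻¹ * ∫⁻ x in Q.set, HLM (Q.set.indicator fun x => ‖mvec (W x) e‖ₑ) x ≤
      AqScConst W 1 := by
    have := le_iSup (fun e : Vec n => AInftyConst (fun x => (‖mvec (matPow (W x) (1 / 1)) e‖₊ : ℝ≥0∞) ^ (1 : ℝ))) e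
    simp only [scalar_weight_eq hp] at this
    have h2 : AInftyConst (fun x => ‖mvec (W x) e‖ₑ) ≤ AqScConst W 1 := by
      rw [AqScConst]
      simp only [scalar_weight_eq hp]
      exact this
    exact (le_iSup (fun Q : Cube d => (∫⁻ x in Q.set, ‖mvec (W x) e‖ₑ)⁻¹ *
      ∫⁻ x in Q.set, HLM (Q.set.indicator fun x => ‖mvec (W x) e‖ₑ) x) Q).trans h2
  have hS : AqScConst W 1 ≠ ⊤ := ne_top_of_le_ne_top hA (AqScConst_le hW hp)
  rcases eq_or_ne (∫⁻ x in Q.set, ‖mvec (W x) e‖ₑ) 0 with h0 | h0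
  · rw [h0, ENNReal.inv_zero] at h1
    have : ∫⁻ x in Q.set, HLM (Q.set.indicator fun x => ‖mvec (W x) e‖ₑ) x = 0 := by
      by_contra hne
      rw [ENNReal.top_mul hne, top_le_iff] at h1
      exact hS h1
    rw [this]; exact zero_le
  · rwa [ENNReal.inv_mul_le_iff h0 (lintegral_cube_ne_top hW hp hA e Q), mul_comm] at h1

lemma one_le_AqScConst (hn : 1 ≤ n) (hW : ∀ i j, Measurable fun x => W x i j) (hp : ∀ x, (W x).PosDef)
    (hA : A1Const W ≠ ⊤) : 1 ≤ AqScConst W 1 := by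
  set e : Vec n := eb ⟨0, hn⟩
  set Q : Cube d := cenCube 0 1 one_pos
  set I := ∫⁻ x in Q.set, ‖mvec (W x) e‖ₑ with hI
  have hIt : I ≠ ⊤ := lintegral_cube_ne_top hW hp hA e Q
  have hI0 : I ≠ 0 := by
    intro h0
    rw [hI, lintegral_eq_zero_iff (measurable_const_mvec hW e), Filter.EventuallyEq,
      ae_restrict_iff' (measurableSet_Cube Q)] at h0
    obtain ⟨y, hy, h⟩ := exists_mem_of_ae (volume_Cube_ne_zero Q) h0
    have h' : mvec (W y) e = 0 := by simpa using h hy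
    have : e = 0 := by
      rw [← mvec_one e, ← PosDef_inv_mul (hp y), mvec_mul, h']
      exact map_zero _
    have hne := norm_eb (n := n) ⟨0, hn⟩
    change ‖e‖ = 1 at hne
    rw [this, norm_zero] at hne
    exact zero_ne_one hne
  have h1 : I ≤ AqScConst W 1 * I := by
    refine le_trans ?_ (lintegral_HLM_le hW hp hA e Q)
    calc I = ∫⁻ _ in Q.set, (volume Q.set)⁻¹ * I := by
          rw [setLIntegral_const, mul_right_comm, ENNReal.inv_mul_cancel (volume_Cube_ne_zero Q) (volume_Cube_ne_top Q), one_mul]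
      _ ≤ _ := by
          refine setLIntegral_mono' (measurableSet_Cube Q) fun x hx => ?_
          refine le_iSup₂_of_le Q hx (mul_le_mul' le_rfl ?_)
          rw [hI]
          refine setLIntegral_mono' (measurableSet_Cube Q) fun y hy => ?_
          rw [Set.indicator_of_mem hy]
  have h2 : 1 * I ≤ AqScConst W 1 * I := by rwa [one_mul]
  exact (ENNReal.mul_le_mul_iff_left hI0 hIt).1 h2

/-- The closed cube corresponding to a dyadic cube. -/
def dyCube (m : ℤ) (x : Rd d) : Cube d where
  corner := WithLp.toLp 2 fun i => (idx m x i : ℝ) * 2 ^ m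
  side := 2 ^ m
  side_pos := by positivity

lemma cube_subset_dyCube (m : ℤ) (x : Rd d) : cube m x ⊆ (dyCube m x).set := by
  intro y hy i
  have := mem_cube_iff.1 hy i
  change (idx m x i : ℝ) * 2 ^ m ≤ y i ∧ y i ≤ (idx m x i : ℝ) * 2 ^ m + 2 ^ m
  exact ⟨this.1, by linarith [this.2]⟩

lemma volume_dyCube (m : ℤ) (x : Rd d) : volume (dyCube m x).set = vol d m := volume_Cube _

lemma lintegral_dyCube (m : ℤ) (x : Rd d) (f : Rd d → ℝ≥0∞) :
    ∫⁻ y in (dyCube m x).set, f y = ∫⁻ y in cube m x, f y := by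
  refine (setLIntegral_congr (ae_eq_of_subset_of_measure_ge (cube_subset_dyCube m x) ?_
    (measurableSet_cube m x).nullMeasurableSet ?_)).symm
  · rw [volume_dyCube, volume_cube]
  · exact volume_Cube_ne_top _

lemma lintegral_dM_le (hW : ∀ i j, Measurable fun x => W x i j) (hp : ∀ x, (W x).PosDef)
    (hA : A1Const W ≠ ⊤) (e : Vec n) (m : ℤ) (N : ℕ) (x : Rd d) :
    ∫⁻ y in cube m x, dM (fun x => ‖mvec (W x) e‖ₑ) m N y ≤ AqScConst W 1 * ∫⁻ y in cube m x, ‖mvec (W y) e‖ₑ := by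
  rw [← lintegral_dyCube m x fun y => ‖mvec (W y) e‖ₑ]
  refine le_trans ?_ (lintegral_HLM_le hW hp hA e (dyCube m x))
  rw [lintegral_dyCube]
  refine setLIntegral_mono' (measurableSet_cube m x) fun y hy => ?_
  have h : ∀ k : ℕ, El (m - k) (fun x => ‖mvec (W x) e‖ₑ) y ≤
      HLM ((dyCube m x).set.indicator fun x => ‖mvec (W x) e‖ₑ) y := by
    intro k
    refine le_iSup₂_of_le (dyCube (m - k) y) (cube_subset_dyCube _ _ (mem_cube_self _ _)) ?_
    rw [volume_dyCube, lintegral_dyCube, El]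
    refine mul_le_mul' le_rfl (setLIntegral_mono' (measurableSet_cube _ _) fun z hz => ?_)
    have : z ∈ cube m x := by rw [← cube_eq hy]; exact cube_mono (by omega) y hz
    rw [Set.indicator_of_mem (cube_subset_dyCube m x this)]
  induction N with
  | zero => simpa [dM] using h 0
  | succ N ih => exact sup_le ih (h (N + 1))

end A1Rough

namespace A1Rough

variable {d n : ℕ} {W : Rd d → Mat n}

lemma exists_avg_seminorm (hW : ∀ i j, Measurable fun x => W x i j) (hp : ∀ x, (W x).PosDef)
    (hA : A1Const W ≠ ⊤) (s : ℤ) (x0 : Rd d) :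
    ∃ ρ : Seminorm ℂ (Vec n), (∀ v, ENNReal.ofReal (ρ v) = El s (fun x => ‖mvec (W x) v‖ₑ) x0) ∧
      ∀ v, ρ v = 0 → v = 0 := by
  have hfin : ∀ v, El s (fun x => ‖mvec (W x) v‖ₑ) x0 ≠ ⊤ := fun v =>
    El_ne_top (lintegral_closedBall_ne_top hW hp hA v) s x0
  have hadd : ∀ u v, El s (fun x => ‖mvec (W x) (u + v)‖ₑ) x0 ≤
      El s (fun x => ‖mvec (W x) u‖ₑ) x0 + El s (fun x => ‖mvec (W x) v‖ₑ) x0 := by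
    intro u v
    rw [El, El, El, ← mul_add, ← lintegral_add_left (measurable_const_mvec hW u)]
    refine mul_le_mul' le_rfl (lintegral_mono fun x => ?_)
    rw [mvec_add]
    exact enorm_add_le _ _
  have hsmul : ∀ (a : ℂ) v, El s (fun x => ‖mvec (W x) (a • v)‖ₑ) x0 = ‖a‖ₑ * El s (fun x => ‖mvec (W x) v‖ₑ) x0 := by
    intro a v
    rw [El, El, mul_left_comm, ← lintegral_const_mul _ (measurable_const_mvec hW v)]
    simp only [mvec_smul, enorm_smul]
  refine ⟨Seminorm.of (fun v => (El s (fun x => ‖mvec (W x) v‖ₑ) x0).toReal) (fun u v => ?_) (fun a v => ?_),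
    fun v => ENNReal.ofReal_toReal (hfin v), fun v hv => ?_⟩
  · rw [← ENNReal.toReal_add (hfin u) (hfin v)]
    exact ENNReal.toReal_mono (ENNReal.add_ne_top.2 ⟨hfin u, hfin v⟩) (hadd u v)
  · rw [hsmul, ENNReal.toReal_mul, toReal_enorm]
  · have h0 : El s (fun x => ‖mvec (W x) v‖ₑ) x0 = 0 := by
      rw [← ENNReal.ofReal_toReal (hfin v)]
      exact (congrArg ENNReal.ofReal hv).trans ENNReal.ofReal_zero
    rw [El, mul_eq_zero, or_iff_right (ENNReal.inv_ne_zero.2 (vol_ne_top s)),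
      lintegral_eq_zero_iff (measurable_const_mvec hW v), Filter.EventuallyEq,
      ae_restrict_iff' (measurableSet_cube s x0)] at h0
    have hc : volume (cube s x0) ≠ 0 := by rw [volume_cube]; exact vol_ne_zero s
    obtain ⟨y, hy, h⟩ := exists_mem_of_ae hc h0
    have h' : mvec (W y) v = 0 := by simpa using h hy
    rw [← mvec_one v, ← PosDef_inv_mul (hp y), mvec_mul, h']
    exact map_zero _

lemma ofReal_opNorm_mul_le {A B : Mat n} {p : ℝ} (hp : 1 ≤ p) (hA : A.PosDef) (hB : B.PosDef) :
    ENNReal.ofReal (opNorm (matPow A (1 / p) * matPow B (1 / p))) ≤ ENNReal.ofReal (opNorm (A * B)) ^ (1 / p) := by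
  have h0 : 0 ≤ 1 / p := by positivity
  rw [ENNReal.ofReal_rpow_of_nonneg (opNorm_nonneg _) h0]
  exact ENNReal.ofReal_le_ofReal (opNorm_matPow_mul_le hA hB h0 ((div_le_one (by linarith)).2 hp))

lemma ofReal_opNorm_le_sum (A : Mat n) : ENNReal.ofReal (opNorm A) ≤ ∑ i, ‖mvec A (eb i)‖ₑ := by
  refine (ENNReal.ofReal_le_ofReal (opNorm_le_sum A)).trans_eq ?_
  rw [ENNReal.ofReal_sum_of_nonneg fun _ _ => norm_nonneg _]
  simp only [ofReal_norm]

lemma ofReal_opNorm_le {A : Mat n} {M : ℝ≥0∞} (h : ∀ v, ‖mvec A v‖ₑ ≤ M * ‖v‖ₑ) : ENNReal.ofReal (opNorm A) ≤ M := by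
  rcases eq_or_ne M ⊤ with rfl | hM
  · exact le_top
  rw [← ENNReal.ofReal_toReal hM]
  refine ENNReal.ofReal_le_ofReal (opNorm_le ENNReal.toReal_nonneg fun v => ?_)
  have := ENNReal.toReal_mono (ENNReal.mul_ne_top hM enorm_ne_top) (h v)
  rwa [ENNReal.toReal_mul, toReal_enorm, toReal_enorm] at this

theorem exists_reducing_pair (hW : ∀ i j, Measurable fun x => W x i j) (hpd : ∀ x, (W x).PosDef)
    (hA : A1Const W ≠ ⊤) {p : ℝ} (hp : 1 < p) {γ : ℝ} (hγ : 0 < γ) (hγ1 : γ ≤ 1)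
    (hγS : ENNReal.ofReal γ * 2 ^ d * AqScConst W 1 ≤ 2⁻¹) {L : ℝ} (hL : √d ≤ L) (hL0 : 0 < L) (s : ℤ) (x0 : Rd d) :
    ∃ R R' : Mat n, R' * R = 1 ∧
      ∫⁻ x in cube s x0, ENNReal.ofReal (opNorm (matPow (W x) (1 / p) * R')) ^ (p * (1 + γ)) ≤
        2 * (n : ℝ≥0∞) ^ 2 * (n + 1) ^ 2 * vol d s ∧
      ∀ᵐ y, ‖y - x0‖ ≤ L * 2 ^ s → ENNReal.ofReal (opNorm (R * matPow (W y) (-(1 / p)))) ≤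
        (2 * n * ENNReal.ofReal ((2 * L) ^ d) * A1Const W) ^ (1 / p) := by
  obtain ⟨ρ, hρ, hρ0⟩ := exists_avg_seminorm hW hpd hA s x0
  obtain ⟨B, hB, hBρ⟩ := exists_reducing ρ hρ0
  have hp0 : 0 < p := by linarith
  refine ⟨matPow B (1 / p), matPow B (-(1 / p)), matPow_neg_mul hB _, ?_, ?_⟩
  · set u : Fin n → Vec n := fun i => mvec B⁻¹ (eb i) with hu
    have hρu : ∀ i, El s (fun x => ‖mvec (W x) (u i)‖ₑ) x0 ≤ n := by
      intro i
      rw [← hρ]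
      refine ENNReal.ofReal_le_of_le_toReal ?_
      have := (hBρ (u i)).2
      rw [hu] at this
      dsimp only at this
      rwa [← mvec_mul, PosDef_mul_inv hB, mvec_one, norm_eb, mul_one] at this
    have hmeas : ∀ i, Measurable fun x => ‖mvec (W x) (u i)‖ₑ := fun i => measurable_const_mvec hW _
    have hpt : ∀ x, ENNReal.ofReal (opNorm (matPow (W x) (1 / p) * matPow B (-(1 / p)))) ^ (p * (1 + γ)) ≤
        (n : ℝ≥0∞) ^ γ * ∑ i, ‖mvec (W x) (u i)‖ₑ ^ (1 + γ) := by
      intro x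
      rw [ENNReal.rpow_mul, matPow_neg hB]
      have h1 := ENNReal.rpow_le_rpow (ofReal_opNorm_mul_le hp.le (hpd x) hB.inv) hp0.le
      rw [← ENNReal.rpow_mul, one_div_mul_cancel hp0.ne', ENNReal.rpow_one] at h1
      have h2 := ENNReal.rpow_le_rpow (h1.trans (ofReal_opNorm_le_sum _)) (show 0 ≤ 1 + γ by linarith)
      refine h2.trans ?_
      simp only [mvec_mul]
      have h3 := ENNReal.rpow_sum_le_const_mul_sum_rpow Finset.univ (fun i => ‖mvec (W x) (u i)‖ₑ)
        (show 1 ≤ 1 + γ by linarith)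
      rwa [Finset.card_univ, Fintype.card_fin, add_sub_cancel_left] at h3
    have hRH : ∀ i, ∫⁻ x in cube s x0, ‖mvec (W x) (u i)‖ₑ ^ (1 + γ) ≤ 2 * (n + 1) ^ 2 * vol d s := by
      intro i
      have h := reverse_holder (hmeas i) (fun x => enorm_ne_top) (lintegral_closedBall_ne_top hW hpd hA _)
        (lintegral_dM_le hW hpd hA (u i)) hγ hγ1 hγS s x0
      rw [El, ENNReal.inv_mul_le_iff (vol_ne_zero s) (vol_ne_top s), mul_comm] at h
      refine h.trans (mul_le_mul' (mul_le_mul' le_rfl ?_) le_rfl)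
      refine (ENNReal.rpow_le_rpow ((hρu i).trans (le_self_add (b := 1))) (by linarith)).trans ?_
      rw [← ENNReal.rpow_natCast]
      exact ENNReal.rpow_le_rpow_of_exponent_le le_add_self (by push_cast; linarith)
    refine (lintegral_mono hpt).trans ?_
    have hm' : ∀ i, Measurable fun x => ‖mvec (W x) (u i)‖ₑ ^ (1 + γ) := fun i => (hmeas i).pow_const _
    rw [lintegral_const_mul _ (Finset.measurable_fun_sum _ fun i _ => hm' i), lintegral_finsetSum _ fun i _ => hm' i]
    refine (mul_le_mul' le_rfl (Finset.sum_le_sum fun i _ => hRH i)).trans ?_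
    rw [Finset.sum_const, Finset.card_univ, Fintype.card_fin, nsmul_eq_mul]
    rcases Nat.eq_zero_or_pos n with rfl | hn
    · simp
    have : (n : ℝ≥0∞) ^ γ ≤ n := by
      conv_rhs => rw [← ENNReal.rpow_one (n : ℝ≥0∞)]
      exact ENNReal.rpow_le_rpow_of_exponent_le (by exact_mod_cast hn) hγ1
    refine (mul_le_mul' this le_rfl).trans_eq (by ring)
  · have hr : 0 < L * (2 : ℝ) ^ s := by positivity
    set Q := cenCube x0 (L * 2 ^ s) hr with hQ
    have hcube : cube s x0 ⊆ Q.set := by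
      refine Set.Subset.trans (fun y hy => ?_) (closedBall_subset_cenCube x0 hr)
      rw [Metric.mem_closedBall, dist_eq_norm]
      exact (norm_sub_le_of_mem_cube hy).trans (by gcongr)
    have hvol : (vol d s)⁻¹ * volume Q.set = ENNReal.ofReal ((2 * L) ^ d) := by
      have : volume Q.set = vol d s * ENNReal.ofReal ((2 * L) ^ d) := by
        rw [volume_Cube, vol, ← ENNReal.ofReal_mul (by positivity)]
        congr 1
        change (2 * (L * 2 ^ s)) ^ d = _
        rw [← mul_pow]
        ring
      rw [this, ← mul_assoc, ENNReal.inv_mul_cancel (vol_ne_zero s) (vol_ne_top s), one_mul]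
    filter_upwards [ae_A1 W] with y hy hyx
    rw [matPow_neg (hpd y)]
    refine (ofReal_opNorm_mul_le hp.le hB (hpd y).inv).trans (ENNReal.rpow_le_rpow ?_ (by positivity))
    refine ofReal_opNorm_le fun v => ?_
    have hyQ : y ∈ Q.set := closedBall_subset_cenCube x0 hr (by rwa [Metric.mem_closedBall, dist_eq_norm])
    have h1 : ‖mvec (B * (W y)⁻¹) v‖ₑ ≤ 2 * n * El s (fun x => ‖mvec (W x) (mvec (W y)⁻¹ v)‖ₑ) x0 := by
      rw [← hρ, mvec_mul, ← ofReal_norm]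
      refine (ENNReal.ofReal_le_ofReal (hBρ (mvec (W y)⁻¹ v)).1).trans_eq ?_
      rw [ENNReal.ofReal_mul (by positivity), ENNReal.ofReal_mul (by norm_num)]
      simp
    have hm : Measurable fun x => ENNReal.ofReal (opNorm (W x * (W y)⁻¹)) :=
      (measurable_opNorm (measurable_mul_mat (B := fun _ => (W y)⁻¹) hW fun i j => measurable_const)).ennreal_ofReal
    have h2 : El s (fun x => ‖mvec (W x) (mvec (W y)⁻¹ v)‖ₑ) x0 ≤
        (vol d s)⁻¹ * (A1Const W * volume Q.set * ‖v‖ₑ) := by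
      refine mul_le_mul' le_rfl ?_
      refine le_trans ?_ (mul_le_mul' (hy Q hyQ) (le_refl ‖v‖ₑ))
      rw [← lintegral_mul_const _ hm]
      refine (lintegral_mono_set hcube).trans (lintegral_mono fun x => ?_)
      dsimp only
      rw [← mvec_mul]
      exact enorm_mvec_le _ _
    refine h1.trans ((mul_le_mul' le_rfl h2).trans_eq ?_)
    rw [← hvol]
    ring

end A1Rough

namespace A1Rough

variable {d : ℕ} {J0 : ℤ}

lemma Sat.lintegral_le_of_cube {m : ℤ} {A : Set (Rd d)} (hA : Sat m A) {u v : Rd d → ℝ≥0∞} (hu : Measurable u)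
    (hv : Measurable v) {C : ℝ≥0∞} (h : ∀ x, ∫⁻ y in cube m x, u y ≤ C * ∫⁻ y in cube m x, v y) :
    ∫⁻ x in A, u x ≤ C * ∫⁻ x in A, v x := by
  have hm := hA.measurableSet
  rw [← lintegral_indicator hm, ← lintegral_indicator hm, ← lintegral_El m (hu.indicator hm),
    ← lintegral_El m (hv.indicator hm), hA.El_indicator, hA.El_indicator,
    ← lintegral_const_mul _ ((measurable_El m hv).indicator hm)]
  refine lintegral_mono fun x => ?_
  by_cases hx : x ∈ A
  · rw [Set.indicator_of_mem hx, Set.indicator_of_mem hx, El, El, mul_left_comm]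
    exact mul_le_mul' le_rfl (h x)
  · rw [Set.indicator_of_notMem hx]
    exact zero_le

lemma Sat.cube {m s : ℤ} (h : m ≤ s) (x0 : Rd d) : Sat m (cube s x0) := by
  intro x hx
  rw [← cube_eq hx]
  exact cube_mono h x

lemma Sat.inter {m : ℤ} {A B : Set (Rd d)} (hA : Sat m A) (hB : Sat m B) : Sat m (A ∩ B) :=
  fun x hx => Set.subset_inter (hA x hx.1) (hB x hx.2)

lemma Stop.setLIntegral_eq {σ : Rd d → ℤ} {s : ℤ} (h : Stop σ J0 s) {a : ℤ → Rd d → ℝ≥0∞} (ha : ∀ m, Measurable (a m))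
    {A : Set (Rd d)} (hA : MeasurableSet A) :
    ∫⁻ x in A, a (σ x) x = ∑ m ∈ Finset.Ico J0 s, ∫⁻ x in A ∩ U σ m, a m x := by
  rw [← lintegral_indicator hA]
  have e : (A.indicator fun x => a (σ x) x) = fun x => (fun m => A.indicator (a m)) (σ x) x := by
    funext x
    by_cases hx : x ∈ A
    · simp [Set.indicator_of_mem hx]
    · simp [Set.indicator_of_notMem hx]
  rw [e, h.lintegral_eq (a := fun m => A.indicator (a m)) fun m => (ha m).indicator hA]
  refine Finset.sum_congr rfl fun m _ => ?_
  rw [setLIntegral_indicator hA]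

theorem stop_induction {T : ℤ → Rd d → ℝ≥0∞} (hT : ∀ m, Measurable (T m)) {g Φ : Rd d → ℝ≥0∞} (hg : Measurable g)
    (hΦ : Measurable Φ) (h0 : ∀ x, T J0 x = 0) {C : ℝ≥0∞}
    (step : ∀ s, J0 < s → ∀ x0, ∃ σ, Stop σ J0 s ∧ ∫⁻ x in cube s x0, T s x * g x ≤
      C * (∫⁻ x in cube s x0 ∩ U σ J0, Φ x) + ∫⁻ x in cube s x0, T (σ x) x * g x) (k : ℕ) (x0 : Rd d) :
    ∫⁻ x in cube (J0 + k) x0, T (J0 + k) x * g x ≤ C * ∫⁻ x in cube (J0 + k) x0, Φ x := by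
  induction k using Nat.strong_induction_on generalizing x0 with
  | _ k ih =>
  rcases Nat.eq_zero_or_pos k with rfl | hk
  · simp [h0]
  set s := J0 + (k : ℤ) with hs
  have hJs : J0 < s := by omega
  obtain ⟨σ, hσ, hstep⟩ := step s hJs x0
  refine hstep.trans ?_
  have hQ := measurableSet_cube s x0
  have hmem : J0 ∈ Finset.Ico J0 s := Finset.mem_Ico.2 ⟨le_rfl, hJs⟩
  rw [hσ.setLIntegral_eq (a := fun m x => T m x * g x) (fun m => (hT m).mul hg) hQ,
    hσ.setLIntegral_eq (a := fun _ => Φ) (fun _ => hΦ) hQ, ← Finset.add_sum_erase _ _ hmem,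
    ← Finset.add_sum_erase _ (fun m => ∫⁻ x in cube s x0 ∩ U σ m, Φ x) hmem, mul_add]
  refine add_le_add le_rfl ?_
  simp only [h0, zero_mul, lintegral_zero, zero_add]
  rw [Finset.mul_sum]
  refine Finset.sum_le_sum fun m hm => ?_
  obtain ⟨hm1, hm2⟩ := Finset.mem_erase.1 hm
  rw [Finset.mem_Ico] at hm2
  refine ((Sat.cube hm2.2.le x0).inter (hσ.sat m)).lintegral_le_of_cube ((hT m).mul hg) hΦ fun x => ?_
  have := ih (m - J0).toNat (by omega) x
  rwa [show J0 + ((m - J0).toNat : ℤ) = m by omega] at this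

theorem lintegral_le_of_step {T : ℤ → Rd d → ℝ≥0∞} (hT : ∀ m, Measurable (T m)) {g Φ : Rd d → ℝ≥0∞} (hg : Measurable g)
    (hΦ : Measurable Φ) (h0 : ∀ x, T J0 x = 0) {C : ℝ≥0∞}
    (step : ∀ s, J0 < s → ∀ x0, ∃ σ, Stop σ J0 s ∧ ∫⁻ x in cube s x0, T s x * g x ≤
      C * (∫⁻ x in cube s x0 ∩ U σ J0, Φ x) + ∫⁻ x in cube s x0, T (σ x) x * g x) {s : ℤ} (hs : J0 ≤ s) :
    ∫⁻ x, T s x * g x ≤ C * ∫⁻ x, Φ x := by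
  have hu : Sat s (Set.univ : Set (Rd d)) := fun x _ => Set.subset_univ _
  have h := stop_induction hT hg hΦ h0 step (s - J0).toNat
  rw [show J0 + ((s - J0).toNat : ℤ) = s by omega] at h
  have := hu.lintegral_le_of_cube ((hT s).mul hg) hΦ h
  simpa only [Measure.restrict_univ, Pi.mul_apply] using this

end A1Rough

namespace A1Rough

variable {d n : ℕ} {J0 s : ℤ} {Ω : Rd d → ℂ} {C : ℝ} {V : Rd d → Mat n} {h : Rd d → Vec n}

/-- Componentwise convolution of a vector function. -/
def cvv (k : Rd d → ℂ) (h : Rd d → Vec n) (x : Rd d) : Vec n := WithLp.toLp 2 fun i => cv k (fun y => h y i) x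

/-- Maximal dyadic truncations, weighted by `V`. -/
def TS (Ω : Rd d → ℂ) (V : Rd d → Mat n) (h : Rd d → Vec n) (J0 s : ℤ) (x : Rd d) : ℝ≥0∞ :=
  ⨆ J ∈ Finset.Icc (J0 + 1) s, ‖mvec (V x) (∑ j ∈ Finset.Icc J s, cvv (ker Ω j) h x)‖ₑ

/-- Weighted averages over balls centred at `x`. -/
def avgN (V : Rd d → Mat n) (h : Rd d → Vec n) (J : ℤ) (x : Rd d) : ℝ≥0∞ :=
  (ENNReal.ofReal (((2 : ℝ) ^ J) ^ d))⁻¹ * ∫⁻ y in Metric.ball x (2 ^ (J + 2)), ‖mvec (V x) (h y)‖ₑ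

/-- Maximal weighted averages. -/
def TN (V : Rd d → Mat n) (h : Rd d → Vec n) (J0 s : ℤ) (x : Rd d) : ℝ≥0∞ :=
  ⨆ J ∈ Finset.Icc (J0 + 1) s, avgN V h J x

lemma TS_self (x : Rd d) : TS Ω V h J0 J0 x = 0 := by simp [TS]

lemma TN_self (x : Rd d) : TN V h J0 J0 x = 0 := by simp [TN]

lemma mvec_cvv {k : Rd d → ℂ} (hk : Nice k) (hh : ∀ i, Nice fun y => h y i) (R : Mat n) (x : Rd d) (i : Fin n) :
    mvec R (cvv k h x) i = cv k (fun y => mvec R (h y) i) x := by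
  simp only [mvec_apply]
  rw [show (fun y => ∑ j, R i j * h y j) = fun y => ∑ j, (fun j y => R i j * h y j) j y from rfl,
    cv_sum Finset.univ hk fun j _ => (hh j).const_mul (R i j)]
  refine Finset.sum_congr rfl fun j _ => ?_
  change R i j * (∫ y, k (x - y) * h y j) = ∫ y, k (x - y) * (R i j * h y j)
  rw [← integral_const_mul]
  exact integral_congr_ae (Filter.Eventually.of_forall fun y => by ring)

lemma measurable_TS (hΩ : Homog Ω C) (hV : ∀ i j, Measurable fun x => V x i j) (hh : ∀ i, Nice fun y => h y i) :
    Measurable (TS Ω V h J0 s) := by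
  unfold TS
  refine Measurable.iSup fun J => Measurable.iSup fun _ => ?_
  refine measurable_enorm_vec (measurable_mvec hV fun i => ?_)
  have : (fun x => (∑ j ∈ Finset.Icc J s, cvv (ker Ω j) h x) i) =
      fun x => ∑ j ∈ Finset.Icc J s, cv (ker Ω j) (fun y => h y i) x := by
    funext x
    simp [cvv]
  rw [this]
  exact Finset.measurable_fun_sum _ fun j _ => ((nice_ker hΩ j).cv (hh i)).1

lemma measurable_avgN (hV : ∀ i j, Measurable fun x => V x i j) (hh : ∀ i, Measurable fun y => h y i) (J : ℤ) :
    Measurable (avgN V h J) := by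
  refine Measurable.const_mul ?_ _
  set r : ℝ := 2 ^ (J + 2)
  have hF : Measurable fun z : Rd d × Rd d => {z : Rd d × Rd d | dist z.2 z.1 < r}.indicator
      (fun z => ‖mvec (V z.1) (h z.2)‖ₑ) z := by
    refine Measurable.indicator (measurable_enorm_vec (measurable_mvec (fun i j => (hV i j).comp measurable_fst)
      fun i => (hh i).comp measurable_snd)) ?_
    exact measurableSet_lt (measurable_snd.dist measurable_fst) measurable_const
  have := hF.lintegral_prod_right' (ν := volume)
  refine (congrArg Measurable (funext fun x => ?_)).mp this
  rw [← lintegral_indicator Metric.isOpen_ball.measurableSet]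
  rfl

lemma measurable_TN (hV : ∀ i j, Measurable fun x => V x i j) (hh : ∀ i, Measurable fun y => h y i) :
    Measurable (TN V h J0 s) :=
  Measurable.iSup fun J => Measurable.iSup fun _ => measurable_avgN hV hh J

lemma TS_le_add {σ : ℤ} (h1 : J0 ≤ σ) (h2 : σ < s) (x : Rd d) : TS Ω V h J0 s x ≤ TS Ω V h σ s x + TS Ω V h J0 σ x := by
  refine iSup₂_le fun J hJ => ?_
  rw [Finset.mem_Icc] at hJ
  rcases lt_or_ge σ J with hσ | hσ
  · exact (le_iSup₂ (f := fun J (_ : J ∈ Finset.Icc (σ + 1) s) =>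
      ‖mvec (V x) (∑ j ∈ Finset.Icc J s, cvv (ker Ω j) h x)‖ₑ) J (Finset.mem_Icc.2 ⟨hσ, hJ.2⟩)).trans le_self_add
  · have hd : Finset.Icc J s = Finset.Icc (σ + 1) s ∪ Finset.Icc J σ := by
      ext j; simp only [Finset.mem_union, Finset.mem_Icc]; omega
    have hdj : Disjoint (Finset.Icc (σ + 1) s) (Finset.Icc J σ) := by
      rw [Finset.disjoint_left]
      intro j
      simp only [Finset.mem_Icc]
      omega
    rw [hd, Finset.sum_union hdj, mvec_add]
    refine (enorm_add_le _ _).trans (add_le_add ?_ ?_)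
    · exact le_iSup₂ (f := fun J (_ : J ∈ Finset.Icc (σ + 1) s) =>
        ‖mvec (V x) (∑ j ∈ Finset.Icc J s, cvv (ker Ω j) h x)‖ₑ) (σ + 1) (Finset.mem_Icc.2 ⟨le_rfl, h2⟩)
    · exact le_iSup₂ (f := fun J (_ : J ∈ Finset.Icc (J0 + 1) σ) =>
        ‖mvec (V x) (∑ j ∈ Finset.Icc J σ, cvv (ker Ω j) h x)‖ₑ) J (Finset.mem_Icc.2 ⟨hJ.1, hσ⟩)

lemma TN_le_add {σ : ℤ} (x : Rd d) : TN V h J0 s x ≤ TN V h σ s x + TN V h J0 σ x := by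
  refine iSup₂_le fun J hJ => ?_
  rw [Finset.mem_Icc] at hJ
  rcases lt_or_ge σ J with hσ | hσ
  · exact (le_iSup₂ (f := fun J (_ : J ∈ Finset.Icc (σ + 1) s) => avgN V h J x) J
      (Finset.mem_Icc.2 ⟨hσ, hJ.2⟩)).trans le_self_add
  · exact (le_iSup₂ (f := fun J (_ : J ∈ Finset.Icc (J0 + 1) σ) => avgN V h J x) J
      (Finset.mem_Icc.2 ⟨hJ.1, hσ⟩)).trans le_add_self

/-- The localization radius of the cube of scale `0`. -/
def rL (d : ℕ) : ℝ := √d + 4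

lemma rL_pos : 0 < rL d := by unfold rL; positivity

/-- Localized and renormalized components. -/
def Floc (R : Mat n) (h : Rd d → Vec n) (s : ℤ) (x0 : Rd d) (k : Fin n) : Rd d → ℂ :=
  (Metric.closedBall x0 (rL d * 2 ^ s)).indicator fun y => mvec R (h y) k

lemma nice_mvec (hh : ∀ i, Nice fun y => h y i) (R : Mat n) (k : Fin n) : Nice fun y => mvec R (h y) k := by
  simp only [mvec_apply]
  exact Nice.sum _ fun j _ => (hh j).const_mul (R k j)

lemma nice_Floc (hh : ∀ i, Nice fun y => h y i) (R : Mat n) (x0 : Rd d) (k : Fin n) : Nice (Floc R h s x0 k) :=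
  (nice_mvec hh R k).indicator Metric.isClosed_closedBall.measurableSet

lemma mem_ball_rL {x0 x y : Rd d} (hx : x ∈ cube s x0) (hy : ‖x - y‖ ≤ 4 * 2 ^ s) :
    y ∈ Metric.closedBall x0 (rL d * 2 ^ s) := by
  rw [Metric.mem_closedBall, dist_eq_norm]
  have h1 := norm_sub_le_of_mem_cube hx
  have h2 : ‖y - x0‖ ≤ ‖x - y‖ + ‖x - x0‖ := by
    rw [norm_sub_rev x y]
    exact norm_sub_le_norm_sub_add_norm_sub y x x0
  unfold rL
  linarith

lemma cv_Floc {x0 x : Rd d} (hx : x ∈ cube s x0) {j : ℤ} (hj : j ≤ s) (R : Mat n) (k : Fin n) :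
    cv (ker Ω j) (Floc R h s x0 k) x = cv (ker Ω j) (fun y => mvec R (h y) k) x := by
  refine integral_congr_ae (Filter.Eventually.of_forall fun y => ?_)
  dsimp only
  rcases le_or_gt ‖x - y‖ (2 ^ (j + 1)) with hy | hy
  · rw [Floc, Set.indicator_of_mem]
    refine mem_ball_rL hx (hy.trans ?_)
    have : (2 : ℝ) ^ (j + 1) ≤ 2 ^ (s + 1) := zpow_le_zpow_right₀ (by norm_num) (by omega)
    rw [zpow_add₀ (by norm_num : (2 : ℝ) ≠ 0) s] at this
    have h2 : (0 : ℝ) < 2 ^ s := by positivity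
    norm_num at this
    linarith
  · rw [ker_eq_zero hy, zero_mul, zero_mul]

lemma enorm_mvec_renorm {R R' : Mat n} (hR : R' * R = 1) (A : Mat n) (v : Vec n) :
    ‖mvec A v‖ₑ ≤ ENNReal.ofReal (opNorm (A * R')) * ∑ k, ‖mvec R v k‖ₑ := by
  have e : mvec A v = mvec (A * R') (mvec R v) := by rw [← mvec_mul, mul_assoc, hR, mul_one]
  rw [e]
  refine (enorm_mvec_le _ _).trans (mul_le_mul' le_rfl ?_)
  rw [← ofReal_norm]
  refine (ENNReal.ofReal_le_ofReal (norm_le_sum _)).trans_eq ?_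
  rw [ENNReal.ofReal_sum_of_nonneg fun _ _ => norm_nonneg _]
  simp only [ofReal_norm]

lemma TS_local (hΩ : Homog Ω C) (hh : ∀ i, Nice fun y => h y i) {R R' : Mat n} (hR : R' * R = 1) {x0 x : Rd d}
    (hx : x ∈ cube s x0) (σ : ℤ) : TS Ω V h σ s x ≤
      ENNReal.ofReal (opNorm (V x * R')) * ∑ k, SM (σ + 1) s (fun j => cv (ker Ω j) (Floc R h s x0 k)) x := by
  refine iSup₂_le fun J hJ => ?_
  refine (enorm_mvec_renorm hR _ _).trans (mul_le_mul' le_rfl (Finset.sum_le_sum fun k _ => ?_))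
  refine le_trans (le_of_eq ?_) (le_SM hJ x)
  congr 1
  rw [mvec_sum, WithLp.ofLp_sum, Finset.sum_apply]
  refine Finset.sum_congr rfl fun j hj => ?_
  rw [cv_Floc hx (Finset.mem_Icc.1 hj).2]
  exact mvec_cvv (nice_ker hΩ j) hh R x k

lemma TN_local {R R' : Mat n} (hR : R' * R = 1) {x0 x : Rd d}
    (hx : x ∈ cube s x0) {σ : Rd d → ℤ} {v a : ℝ≥0∞} {q : ℝ}
    (hc : Ctl σ v q a fun y => ∑ k, ‖Floc R h s x0 k y‖ₑ) : TN V h (σ x) s x ≤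
      ENNReal.ofReal (opNorm (V x * R')) * (4 ^ d * a) := by
  refine iSup₂_le fun J hJ => ?_
  rw [Finset.mem_Icc] at hJ
  have hpos : (0 : ℝ) < 2 ^ J := by positivity
  have h0 := ofReal_pow_ne_zero (d := d) hpos
  rw [avgN, ENNReal.inv_mul_le_iff h0 ENNReal.ofReal_ne_top]
  have hm := hc.meas
  calc ∫⁻ y in Metric.ball x (2 ^ (J + 2)), ‖mvec (V x) (h y)‖ₑ
      ≤ ∫⁻ y in Metric.ball x (2 ^ (J + 2)), ENNReal.ofReal (opNorm (V x * R')) * ∑ k, ‖Floc R h s x0 k y‖ₑ := by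
        refine setLIntegral_mono' Metric.isOpen_ball.measurableSet fun y hy => ?_
        refine (enorm_mvec_renorm hR _ _).trans_eq ?_
        have : y ∈ Metric.closedBall x0 (rL d * 2 ^ s) := by
          refine mem_ball_rL hx ?_
          rw [Metric.mem_ball, dist_eq_norm, norm_sub_rev] at hy
          refine hy.le.trans ?_
          rw [zpow_add₀ (by norm_num : (2 : ℝ) ≠ 0)]
          have : (2 : ℝ) ^ J ≤ 2 ^ s := zpow_le_zpow_right₀ (by norm_num) hJ.2
          norm_num
          linarith
        simp only [Floc, Set.indicator_of_mem this]
    _ = ENNReal.ofReal (opNorm (V x * R')) * ∫⁻ y in Metric.ball x (2 ^ (J + 2)), ∑ k, ‖Floc R h s x0 k y‖ₑ :=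
        lintegral_const_mul _ hm
    _ ≤ ENNReal.ofReal (opNorm (V x * R')) * (ENNReal.ofReal (((2 : ℝ) ^ (J + 2)) ^ d) * a) :=
        mul_le_mul' le_rfl (hc.loc x _ (zpow_le_zpow_right₀ (by norm_num) (by omega)))
    _ = _ := by
        have : ENNReal.ofReal (((2 : ℝ) ^ (J + 2)) ^ d) = ENNReal.ofReal (((2 : ℝ) ^ J) ^ d) * 4 ^ d := by
          rw [zpow_add₀ (by norm_num : (2 : ℝ) ≠ 0), mul_pow, ENNReal.ofReal_mul (by positivity)]
          congr 1
          rw [ENNReal.ofReal_pow (by positivity)]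
          norm_num
        rw [this]
        ring

end A1Rough

namespace A1Rough

variable {d n : ℕ}

/-- The sum of the two maximal operators. -/
def TT (Ω : Rd d → ℂ) (V : Rd d → Mat n) (h : Rd d → Vec n) (J0 s : ℤ) (x : Rd d) : ℝ≥0∞ :=
  TS Ω V h J0 s x + TN V h J0 s x

lemma measurable_TT {Ω : Rd d → ℂ} {C : ℝ} {V : Rd d → Mat n} {h : Rd d → Vec n} {J0 s : ℤ} (hΩ : Homog Ω C)
    (hV : ∀ i j, Measurable fun x => V x i j) (hh : ∀ i, Nice fun y => h y i) : Measurable (TT Ω V h J0 s) :=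
  (measurable_TS hΩ hV hh).add (measurable_TN hV fun i => (hh i).1)

theorem exists_local_step (hd : 1 ≤ d) (n : ℕ) (C : ℝ) : ∃ K : ℝ≥0∞, K ≠ ⊤ ∧ ∀ Ω : Rd d → ℂ, MZ Ω C →
    ∀ V : Rd d → Mat n, (∀ i j, Measurable fun x => V x i j) → ∀ h : Rd d → Vec n, (∀ i, Nice fun y => h y i) →
    ∀ g : Rd d → ℝ≥0∞, Measurable g → ∀ ε : ℝ, 0 < ε → ε ≤ 1 → ∀ J0 s : ℤ, J0 < s → ∀ x0 : Rd d,
    ∀ R R' : Mat n, R' * R = 1 → ∀ a b : ℝ≥0∞, a ≠ ⊤ → b ≠ ⊤ →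
    ∫⁻ y, (∑ k, ‖Floc R h s x0 k y‖ₑ) ^ (1 + ε) ≤ a ^ (1 + ε) * vol d s →
    ∫⁻ x in cube s x0, (ENNReal.ofReal (opNorm (V x * R')) * g x) ^ (1 + ε) ≤ b ^ (1 + ε) * vol d s →
    ∃ σ, Stop σ J0 s ∧ 2 * volume {x | J0 < σ x} ≤ vol d s ∧
      ∫⁻ x in cube s x0, TT Ω V h J0 s x * g x ≤ K * ENNReal.ofReal ε⁻¹ * (a * b * vol d s) +
        ∫⁻ x in cube s x0, TT Ω V h J0 (σ x) x * g x := by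
  obtain ⟨B, hB, H⟩ := exists_SS_le hd C
  set κ : ℝ≥0∞ := ENNReal.ofReal (rL d ^ d) * volB d with hκ
  have hκt : κ ≠ ⊤ := ENNReal.mul_ne_top ENNReal.ofReal_ne_top volB_ne_top
  refine ⟨cS d κ ^ 2 * (n * B + 4 ^ d), ?_, ?_⟩
  · exact ENNReal.mul_ne_top (ENNReal.pow_ne_top (cS_ne_top hκt)) (ENNReal.add_ne_top.2
      ⟨ENNReal.mul_ne_top (ENNReal.natCast_ne_top n) hB, ENNReal.pow_ne_top (by norm_num)⟩)
  intro Ω hΩ V hV h hh g hg ε hε hε1 J0 s hJs x0 R R' hR a b ha hb hma hmb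
  set Q := cube s x0 with hQdef
  have hQ : MeasurableSet Q := measurableSet_cube s x0
  set ν : Rd d → ℝ≥0∞ := fun x => ENNReal.ofReal (opNorm (V x * R')) with hν
  have hνm : Measurable ν := (measurable_opNorm (measurable_mul_mat (B := fun _ => R') hV
    fun i j => measurable_const)).ennreal_ofReal
  set F := Floc R h s x0 with hF
  have hFn : ∀ k, Nice (F k) := nice_Floc hh R x0
  set G₁ : Rd d → ℝ≥0∞ := fun y => ∑ k, ‖F k y‖ₑ with hG₁
  set G₂ : Rd d → ℝ≥0∞ := Q.indicator fun x => ν x * g x with hG₂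
  have hG₁m : Measurable G₁ := Finset.measurable_fun_sum _ fun k _ => (hFn k).1.enorm
  have hG₂m : Measurable G₂ := (hνm.mul hg).indicator hQ
  set Bs := Metric.closedBall x0 (rL d * (2 : ℝ) ^ s) with hBs
  have hBv : volume Bs ≤ κ * vol d s := by
    have h2 : (0 : ℝ) ≤ rL d := rL_pos.le
    rw [hBs, volume_closedBall_eq x0 (by positivity), hκ, vol, mul_pow, ENNReal.ofReal_mul (by positivity)]
    exact le_of_eq (by ring)
  have h1 : ∀ x ∉ Bs, G₁ x = 0 := fun x hx => Finset.sum_eq_zero fun k _ => by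
    rw [hF, Floc, Set.indicator_of_notMem hx, enorm_zero]
  have hQB : Q ⊆ Bs := fun x hx => mem_ball_rL hx (by rw [sub_self, norm_zero]; positivity)
  have h2 : ∀ x ∉ Bs, G₂ x = 0 := fun x hx => Set.indicator_of_notMem (fun hq => hx (hQB hq)) _
  have hm2 : ∫⁻ x, G₂ x ^ (1 + ε) ≤ b ^ (1 + ε) * vol d s := by
    refine le_trans (le_of_eq ?_) hmb
    rw [← lintegral_indicator hQ]
    refine lintegral_congr fun x => ?_
    by_cases hx : x ∈ Q
    · simp only [hG₂, Set.indicator_of_mem hx]; rfl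
    · simp only [hG₂, Set.indicator_of_notMem hx]
      exact ENNReal.zero_rpow_of_pos (by linarith)
  obtain ⟨σ, hσ, hc1, hc2, hσv⟩ := exists_stop hd hJs (show 1 ≤ 1 + ε by linarith) hG₁m hG₂m ha hb hBv h1 h2 hma hm2
  refine ⟨σ, hσ, hσv, ?_⟩
  set c := cS d κ with hc
  have hct : c ≠ ⊤ := cS_ne_top hκt
  have hSSm : ∀ k, Measurable (SS Ω σ s (F k)) := fun k => hσ.measurable_SS hΩ.1 (hFn k)
  have hpt : ∀ x ∈ Q, TT Ω V h J0 s x * g x ≤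
      ((∑ k, SS Ω σ s (F k) x) * G₂ x + 4 ^ d * (c * a) * G₂ x) + TT Ω V h J0 (σ x) x * g x := by
    intro x hx
    have e1 := (TS_le_add (Ω := Ω) (V := V) (h := h) (hσ.lo x) (hσ.hi x) x).trans
      (add_le_add_left (TS_local (V := V) hΩ.1 hh hR hx (σ x)) _)
    have e2 := (TN_le_add (V := V) (h := h) (J0 := J0) (s := s) (σ := σ x) x).trans
      (add_le_add_left (TN_local (V := V) hR hx hc1) _)
    rw [show G₂ x = ν x * g x from Set.indicator_of_mem hx _]
    calc TT Ω V h J0 s x * g x ≤ ((ν x * (∑ k, SS Ω σ s (F k) x) + TS Ω V h J0 (σ x) x) +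
          (ν x * (4 ^ d * (c * a)) + TN V h J0 (σ x) x)) * g x := mul_le_mul' (add_le_add e1 e2) le_rfl
      _ = _ := by rw [TT]; ring
  have hεi : 1 ≤ ENNReal.ofReal ε⁻¹ := ENNReal.one_le_ofReal.2 ((one_le_inv₀ hε).2 hε1)
  have hS1 : ∀ k, ∫⁻ x, SS Ω σ s (F k) x * G₂ x ≤ B * ENNReal.ofReal ε⁻¹ * (c * a * (c * b) * vol d s) := fun k =>
    H Ω hΩ σ J0 s hσ ε hε hε1 (F k) (hFn k) G₂ _ _ _ (hc1.mono (by linarith) (hFn k).1.enorm fun x =>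
      Finset.single_le_sum (f := fun k => ‖F k x‖ₑ) (fun _ _ => zero_le) (Finset.mem_univ k)) hc2
      (ENNReal.mul_ne_top hct ha) (ENNReal.mul_ne_top hct hb)
  have hI1 : ∫⁻ x, (∑ k, SS Ω σ s (F k) x) * G₂ x ≤ n * (B * ENNReal.ofReal ε⁻¹ * (c * a * (c * b) * vol d s)) := by
    have hmk : ∀ k, Measurable fun x => SS Ω σ s (F k) x * G₂ x := fun k => (hSSm k).mul hG₂m
    simp only [Finset.sum_mul]
    rw [lintegral_finsetSum _ fun k _ => hmk k]
    refine (Finset.sum_le_sum fun k _ => hS1 k).trans_eq ?_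
    rw [Finset.sum_const, Finset.card_univ, Fintype.card_fin, nsmul_eq_mul]
  have hm1 : Measurable fun x => (∑ k, SS Ω σ s (F k) x) * G₂ x :=
    (Finset.measurable_fun_sum _ fun k _ => hSSm k).mul hG₂m
  have hm3 : Measurable fun x => (∑ k, SS Ω σ s (F k) x) * G₂ x + 4 ^ d * (c * a) * G₂ x :=
    hm1.add (hG₂m.const_mul _)
  calc ∫⁻ x in Q, TT Ω V h J0 s x * g x
      ≤ ∫⁻ x in Q, (((∑ k, SS Ω σ s (F k) x) * G₂ x + 4 ^ d * (c * a) * G₂ x) + TT Ω V h J0 (σ x) x * g x) :=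
        setLIntegral_mono' hQ hpt
    _ = (∫⁻ x in Q, ((∑ k, SS Ω σ s (F k) x) * G₂ x + 4 ^ d * (c * a) * G₂ x)) +
          ∫⁻ x in Q, TT Ω V h J0 (σ x) x * g x := lintegral_add_left hm3 _
    _ ≤ _ := by
        refine add_le_add_left ((setLIntegral_le_lintegral _ _).trans ?_) _
        rw [lintegral_add_left hm1, lintegral_const_mul _ hG₂m]
        refine (add_le_add hI1 (mul_le_mul' le_rfl hc2.mass)).trans ?_
        calc _ = n * B * ENNReal.ofReal ε⁻¹ * (c ^ 2 * (a * b * vol d s)) + 4 ^ d * 1 * (c ^ 2 * (a * b * vol d s)) := by ring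
          _ ≤ n * B * ENNReal.ofReal ε⁻¹ * (c ^ 2 * (a * b * vol d s)) +
              4 ^ d * ENNReal.ofReal ε⁻¹ * (c ^ 2 * (a * b * vol d s)) :=
              add_le_add le_rfl (mul_le_mul' (mul_le_mul' le_rfl hεi) le_rfl)
          _ = _ := by ring

end A1Rough

namespace A1Rough

variable {d n : ℕ}

lemma lintegral_closedBall_le_Mx (F : Rd d → ℝ≥0∞) {s : ℤ} {x0 x : Rd d} (hx : x ∈ cube s x0) :
    ∫⁻ y in Metric.closedBall x0 (rL d * 2 ^ s), F y ≤ ENNReal.ofReal ((2 * rL d) ^ d) * vol d s * Mx F x := by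
  have h2 : (0 : ℝ) < 2 ^ s := by positivity
  have hr := rL_pos (d := d)
  have hsub : Metric.closedBall x0 (rL d * 2 ^ s) ⊆ Metric.ball x (2 * rL d * 2 ^ s) := by
    intro y hy
    rw [Metric.mem_closedBall, dist_eq_norm] at hy
    rw [Metric.mem_ball, dist_eq_norm]
    have h1 := norm_sub_le_of_mem_cube hx
    have h3 : ‖y - x‖ ≤ ‖y - x0‖ + ‖x - x0‖ := by
      rw [norm_sub_rev x x0]
      exact norm_sub_le_norm_sub_add_norm_sub y x0 x
    have h4 : √(d : ℝ) * 2 ^ s < rL d * 2 ^ s := by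
      refine mul_lt_mul_of_pos_right ?_ h2
      unfold rL
      linarith
    linarith
  refine (lintegral_mono_set hsub).trans ((lintegral_ball_le_Mx F x (by positivity)).trans_eq ?_)
  rw [mul_pow, ENNReal.ofReal_mul (by positivity), vol]

lemma lintegral_cube_le_Mx (F : Rd d → ℝ≥0∞) {s : ℤ} {x0 x : Rd d} (hx : x ∈ cube s x0) :
    ∫⁻ y in cube s x0, F y ≤ ENNReal.ofReal ((2 * rL d) ^ d) * vol d s * Mx F x := by
  refine (lintegral_mono_set fun y hy => ?_).trans (lintegral_closedBall_le_Mx F hx)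
  exact mem_ball_rL hy (by rw [sub_self, norm_zero]; positivity)

lemma inv_vol_mul_rpow_le {A κ m : ℝ≥0∞} {s : ℤ} {q : ℝ} (hq : 1 ≤ q) (hκ : 1 ≤ κ) (h : A ≤ κ * vol d s * m) :
    ((vol d s)⁻¹ * A) ^ (1 / q) ≤ κ * m ^ (1 / q) := by
  have h0 : 0 < q := by linarith
  calc ((vol d s)⁻¹ * A) ^ (1 / q) ≤ ((vol d s)⁻¹ * (κ * vol d s * m)) ^ (1 / q) :=
        ENNReal.rpow_le_rpow (mul_le_mul' le_rfl h) (by positivity)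
    _ = (κ * m) ^ (1 / q) := by
        congr 1
        calc (vol d s)⁻¹ * (κ * vol d s * m) = ((vol d s)⁻¹ * vol d s) * (κ * m) := by ring
          _ = _ := by rw [ENNReal.inv_mul_cancel (vol_ne_zero (d := d) s) (vol_ne_top (d := d) s), one_mul]
    _ = κ ^ (1 / q) * m ^ (1 / q) := ENNReal.mul_rpow_of_nonneg _ _ (by positivity)
    _ ≤ κ * m ^ (1 / q) := by
        refine mul_le_mul' ?_ le_rfl
        refine (ENNReal.rpow_le_rpow_of_exponent_le hκ ((div_le_one h0).2 hq)).trans_eq ?_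
        rw [ENNReal.rpow_one]

theorem exists_lintegral_TT_le (hd : 1 ≤ d) (hn : 1 ≤ n) (C : ℝ) {p : ℝ} (hp : 1 < p) : ∃ K : ℝ≥0∞, K ≠ ⊤ ∧
    ∀ Ω : Rd d → ℂ, MZ Ω C → ∀ W : Rd d → Mat n, (∀ i j, Measurable fun x => W x i j) → (∀ x, (W x).PosDef) →
    A1Const W ≠ ⊤ → ∀ f : Rd d → Vec n, (∀ i, Measurable fun x => f x i) → ∀ M : ℝ≥0∞, M ≠ ⊤ → (∀ x, ‖f x‖ₑ ≤ M) →
    (∀ i, Nice fun y => mvec (matPow (W y) (-(1 / p))) (f y) i) → ∀ g : Rd d → ℝ≥0∞, Measurable g → (∀ x, g x ≤ M) →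
    ∀ γ ε t : ℝ, 0 < γ → γ ≤ 1 → ENNReal.ofReal γ * 2 ^ d * AqScConst W 1 ≤ 2⁻¹ → 0 < ε → ε ≤ 1 →
    1 + ε < p * (1 + γ) → 1 ≤ t → 1 / (1 + ε) = 1 / (p * (1 + γ)) + 1 / t → ∀ J0 s : ℤ, J0 ≤ s →
    ∫⁻ x, TT Ω (fun x => matPow (W x) (1 / p)) (fun y => mvec (matPow (W y) (-(1 / p))) (f y)) J0 s x * g x ≤
      K * ENNReal.ofReal ε⁻¹ * A1Const W ^ (1 / p) *
        ∫⁻ x, Mx (fun y => ‖f y‖ₑ ^ (1 + ε)) x ^ (1 / (1 + ε)) * Mx (fun y => g y ^ t) x ^ (1 / t) := by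
  obtain ⟨K, hK, H⟩ := exists_local_step hd n C
  have hp0 : 0 < p := by linarith
  set κ : ℝ≥0∞ := ENNReal.ofReal ((2 * rL d) ^ d) with hκ
  set c₁ : ℝ≥0∞ := 2 * (n : ℝ≥0∞) ^ 2 * (n + 1) ^ 2 with hc₁
  set c₂ : ℝ≥0∞ := n * (2 * n * κ) ^ (1 / p) with hc₂
  have hn1 : (1 : ℝ≥0∞) ≤ n := by exact_mod_cast hn
  have hrL : 1 ≤ 2 * rL d := by
    have := Real.sqrt_nonneg (d : ℝ)
    unfold rL
    linarith
  have hκ1 : 1 ≤ κ := ENNReal.one_le_ofReal.2 (one_le_pow₀ hrL)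
  have hκt : κ ≠ ⊤ := ENNReal.ofReal_ne_top
  have hc₁t : c₁ ≠ ⊤ := by finiteness
  have hc₁1 : 1 ≤ c₁ := by
    calc (1 : ℝ≥0∞) = 1 * 1 ^ 2 * 1 ^ 2 := by simp
      _ ≤ _ := mul_le_mul' (mul_le_mul' (by norm_num) (pow_le_pow_left' hn1 2)) (pow_le_pow_left' (by simp) 2)
  have hc₂t : c₂ ≠ ⊤ := ENNReal.mul_ne_top (by finiteness) (ENNReal.rpow_ne_top_of_nonneg (by positivity) (by finiteness))
  refine ⟨K * (2 * (c₂ * κ * (c₁ * κ))), by finiteness, ?_⟩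
  intro Ω hΩ W hW hpd hA f hf M hM hfM hh g hg hgM γ ε t hγ hγ1 hγS hε hε1 hqP ht htt J0 s hJs
  set V : Rd d → Mat n := fun x => matPow (W x) (1 / p) with hV
  set h : Rd d → Vec n := fun y => mvec (matPow (W y) (-(1 / p))) (f y) with hhd
  have hVm : ∀ i j, Measurable fun x => V x i j := measurable_matPow hW hpd _
  have ht0 : 0 < t := by linarith
  have hq0 : 0 < 1 + ε := by linarith
  have hP0 : 0 < p * (1 + γ) := by positivity
  set Φ : Rd d → ℝ≥0∞ := fun x => Mx (fun y => ‖f y‖ₑ ^ (1 + ε)) x ^ (1 / (1 + ε)) * Mx (fun y => g y ^ t) x ^ (1 / t) with hΦ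
  have hΦm : Measurable Φ := ((measurable_Mx _).pow_const _).mul ((measurable_Mx _).pow_const _)
  refine lintegral_le_of_step (T := TT Ω V h J0) (C := K * (2 * (c₂ * κ * (c₁ * κ))) * ENNReal.ofReal ε⁻¹ * A1Const W ^ (1 / p))
    (fun m => measurable_TT hΩ.1 hVm hh) hg hΦm (fun x => ?_) ?_ hJs
  · rw [TT, TS_self, TN_self, add_zero]
  intro s hJs x0
  obtain ⟨R, R', hRR, hI, hae⟩ := exists_reducing_pair hW hpd hA hp hγ hγ1 hγS (L := rL d)
    (by unfold rL; linarith) rL_pos s x0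
  set v := vol d s with hv
  have hv0 : v ≠ 0 := vol_ne_zero (d := d) s
  have hvt : v ≠ ⊤ := vol_ne_top (d := d) s
  set Bs := Metric.closedBall x0 (rL d * (2 : ℝ) ^ s) with hBs
  set Q := cube s x0 with hQ
  have hBm : MeasurableSet Bs := Metric.isClosed_closedBall.measurableSet
  set Ac := (2 * n * κ * A1Const W) ^ (1 / p) with hAc
  have hAct : Ac ≠ ⊤ := ENNReal.rpow_ne_top_of_nonneg (by positivity) (by finiteness)
  have hnA : n * Ac = c₂ * A1Const W ^ (1 / p) := by
    rw [hAc, ENNReal.mul_rpow_of_nonneg _ _ (by positivity), hc₂]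
    ring
  have hfm : Measurable fun y => ‖f y‖ₑ := measurable_enorm_vec hf
  set a : ℝ≥0∞ := n * Ac * (v⁻¹ * ∫⁻ y in Bs, ‖f y‖ₑ ^ (1 + ε)) ^ (1 / (1 + ε)) with ha
  set b : ℝ≥0∞ := c₁ ^ (1 / (p * (1 + γ))) * (v⁻¹ * ∫⁻ y in Q, g y ^ t) ^ (1 / t) with hb
  have hBv : volume Bs ≠ ⊤ := measure_closedBall_lt_top.ne
  have hfin : ∀ (S : Set (Rd d)) (u : Rd d → ℝ≥0∞) (r : ℝ), 0 ≤ r → volume S ≠ ⊤ → (∀ x, u x ≤ M) → ∫⁻ y in S, u y ^ r ≠ ⊤ := by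
    intro S u r hr hS hu
    refine ne_top_of_le_ne_top (b := M ^ r * volume S) ?_ ?_
    · exact ENNReal.mul_ne_top (ENNReal.rpow_ne_top_of_nonneg hr hM) hS
    · rw [← setLIntegral_const]
      exact lintegral_mono fun x => ENNReal.rpow_le_rpow (hu x) hr
  have hat : a ≠ ⊤ := ENNReal.mul_ne_top (by finiteness) (ENNReal.rpow_ne_top_of_nonneg (by positivity)
    (ENNReal.mul_ne_top (ENNReal.inv_ne_top.2 hv0) (hfin _ _ _ hq0.le hBv hfM)))
  have hbt : b ≠ ⊤ := ENNReal.mul_ne_top (ENNReal.rpow_ne_top_of_nonneg (by positivity) hc₁t)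
    (ENNReal.rpow_ne_top_of_nonneg (by positivity)
    (ENNReal.mul_ne_top (ENNReal.inv_ne_top.2 hv0) (hfin _ _ _ ht0.le (by rw [hQ, volume_cube]; exact hvt) hgM)))
  have hma : ∫⁻ y, (∑ k, ‖Floc R h s x0 k y‖ₑ) ^ (1 + ε) ≤ a ^ (1 + ε) * v := by
    have e1 : a ^ (1 + ε) * v = (n * Ac) ^ (1 + ε) * ∫⁻ y in Bs, ‖f y‖ₑ ^ (1 + ε) := by
      rw [ha, ENNReal.mul_rpow_of_nonneg _ _ hq0.le, ← ENNReal.rpow_mul, one_div_mul_cancel hq0.ne', ENNReal.rpow_one,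
        mul_assoc, mul_comm _ v, ← mul_assoc v, ENNReal.mul_inv_cancel hv0 hvt, one_mul]
    rw [e1, ← lintegral_const_mul _ (hfm.pow_const _), ← lintegral_indicator hBm]
    refine lintegral_mono_ae ?_
    filter_upwards [hae] with y hy
    by_cases hyB : y ∈ Bs
    · rw [Set.indicator_of_mem hyB, ← ENNReal.mul_rpow_of_nonneg _ _ hq0.le]
      refine ENNReal.rpow_le_rpow ?_ hq0.le
      have hy' := hy (by rwa [hBs, Metric.mem_closedBall, dist_eq_norm] at hyB)
      have e2 : ∀ k, ‖Floc R h s x0 k y‖ₑ ≤ Ac * ‖f y‖ₑ := by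
        intro k
        rw [Floc, Set.indicator_of_mem hyB]
        have e3 : ‖mvec R (h y) k‖ₑ ≤ ‖mvec R (h y)‖ₑ := by
          rw [← ofReal_norm, ← ofReal_norm]
          exact ENNReal.ofReal_le_ofReal (norm_apply_le _ _)
        refine e3.trans ?_
        rw [hhd, ← mvec_mul]
        exact (enorm_mvec_le _ _).trans (mul_le_mul' hy' le_rfl)
      refine (Finset.sum_le_sum fun k _ => e2 k).trans_eq ?_
      rw [Finset.sum_const, Finset.card_univ, Fintype.card_fin, nsmul_eq_mul, mul_assoc]
    · rw [Set.indicator_of_notMem hyB]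
      refine le_of_eq ?_
      have : ∑ k, ‖Floc R h s x0 k y‖ₑ = 0 := Finset.sum_eq_zero fun k _ => by
        rw [Floc, Set.indicator_of_notMem hyB, enorm_zero]
      rw [this, ENNReal.zero_rpow_of_pos hq0]
  have hνm : Measurable fun x => ENNReal.ofReal (opNorm (V x * R')) :=
    (measurable_opNorm (measurable_mul_mat (B := fun _ => R') hVm fun i j => measurable_const)).ennreal_ofReal
  have hmb : ∫⁻ x in Q, (ENNReal.ofReal (opNorm (V x * R')) * g x) ^ (1 + ε) ≤ b ^ (1 + ε) * v := by
    have e1 := ENNReal.lintegral_Lp_mul_le_Lq_mul_Lr hq0 hqP htt (volume.restrict Q) hνm.aemeasurable hg.aemeasurable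
    simp only [Pi.mul_apply] at e1
    have e2 := ENNReal.rpow_le_rpow e1 hq0.le
    rw [← ENNReal.rpow_mul, one_div_mul_cancel hq0.ne', ENNReal.rpow_one] at e2
    refine e2.trans ?_
    have e3 : v = (v ^ (1 / (p * (1 + γ))) * v ^ (1 / t)) ^ (1 + ε) := by
      rw [← ENNReal.rpow_add _ _ hv0 hvt, ← htt, ← ENNReal.rpow_mul, one_div_mul_cancel hq0.ne', ENNReal.rpow_one]
    have e4 : b ^ (1 + ε) * v = (b * (v ^ (1 / (p * (1 + γ))) * v ^ (1 / t))) ^ (1 + ε) := by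
      rw [ENNReal.mul_rpow_of_nonneg b _ hq0.le, ← e3]
    rw [e4]
    refine ENNReal.rpow_le_rpow ?_ hq0.le
    have e5 : ∫⁻ y in Q, g y ^ t = v * (v⁻¹ * ∫⁻ y in Q, g y ^ t) := by
      rw [← mul_assoc, ENNReal.mul_inv_cancel hv0 hvt, one_mul]
    calc _ ≤ (c₁ * v) ^ (1 / (p * (1 + γ))) * (v * (v⁻¹ * ∫⁻ y in Q, g y ^ t)) ^ (1 / t) := by
          rw [← e5]
          exact mul_le_mul' (ENNReal.rpow_le_rpow hI (by positivity)) le_rfl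
      _ = _ := by
          rw [hb, ENNReal.mul_rpow_of_nonneg c₁ _ (by positivity), ENNReal.mul_rpow_of_nonneg v _ (by positivity)]
          ring
  obtain ⟨σ, hσ, hσv, hle⟩ := H Ω hΩ V hVm h hh g hg ε hε hε1 J0 s hJs x0 R R' hRR a b hat hbt hma hmb
  refine ⟨σ, hσ, hle.trans (add_le_add_left ?_ _)⟩
  have hUm : MeasurableSet (Q ∩ U σ J0) := (measurableSet_cube s x0).inter (hσ.meas (measurableSet_singleton J0))
  have hv2 : v ≤ 2 * volume (Q ∩ U σ J0) := by
    have e1 : v ≤ volume (Q ∩ U σ J0) + volume {x | J0 < σ x} := by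
      rw [hv, ← volume_cube s x0]
      refine (measure_mono fun x hx => ?_).trans (measure_union_le _ _)
      rcases (hσ.lo x).lt_or_eq with h | h
      · exact Or.inr h
      · exact Or.inl ⟨hx, h.symm⟩
    have e2 : v + v ≤ 2 * volume (Q ∩ U σ J0) + v := by
      calc v + v = 2 * v := (two_mul v).symm
        _ ≤ 2 * (volume (Q ∩ U σ J0) + volume {x | J0 < σ x}) := mul_le_mul' le_rfl e1
        _ = 2 * volume (Q ∩ U σ J0) + 2 * volume {x | J0 < σ x} := mul_add _ _ _
        _ ≤ _ := add_le_add le_rfl hσv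
    exact (ENNReal.add_le_add_iff_right hvt).1 e2
  have hab : ∀ x ∈ Q, a * b ≤ c₂ * κ * (c₁ * κ) * A1Const W ^ (1 / p) * Φ x := by
    intro x hx
    have e1 : a ≤ n * Ac * (κ * Mx (fun y => ‖f y‖ₑ ^ (1 + ε)) x ^ (1 / (1 + ε))) :=
      mul_le_mul' le_rfl (inv_vol_mul_rpow_le (by linarith) hκ1 (lintegral_closedBall_le_Mx _ hx))
    have e2 : b ≤ c₁ * (κ * Mx (fun y => g y ^ t) x ^ (1 / t)) := by
      refine mul_le_mul' ?_ (inv_vol_mul_rpow_le ht hκ1 (lintegral_cube_le_Mx _ hx))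
      have : 1 ≤ p * (1 + γ) := by nlinarith
      refine (ENNReal.rpow_le_rpow_of_exponent_le hc₁1 ((div_le_one hP0).2 this)).trans_eq (ENNReal.rpow_one _)
    refine (mul_le_mul' e1 e2).trans_eq ?_
    rw [hnA, hΦ]
    ring
  have hfin2 : a * b * v ≤ 2 * (c₂ * κ * (c₁ * κ) * A1Const W ^ (1 / p) * ∫⁻ x in Q ∩ U σ J0, Φ x) := by
    calc a * b * v ≤ a * b * (2 * volume (Q ∩ U σ J0)) := mul_le_mul' le_rfl hv2
      _ = 2 * ∫⁻ x in Q ∩ U σ J0, a * b := by rw [setLIntegral_const]; ring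
      _ ≤ 2 * ∫⁻ x in Q ∩ U σ J0, c₂ * κ * (c₁ * κ) * A1Const W ^ (1 / p) * Φ x :=
          mul_le_mul' le_rfl (setLIntegral_mono' hUm fun x hx => hab x hx.1)
      _ = _ := by rw [lintegral_const_mul _ hΦm]
  refine (mul_le_mul' le_rfl hfin2).trans_eq ?_
  ring

end A1Rough

namespace A1Rough

variable {d n : ℕ}

lemma exponent_bounds {p γ ε : ℝ} (hp : 1 < p) (hγ : 0 < γ) (hγ1 : γ ≤ 1) (hε : 0 < ε) (hε1 : ε ≤ γ / (4 * p))
    (hε2 : ε ≤ (p - 1) / 2) : 1 + ε < p * (1 + γ) ∧ 0 < 1 / (1 + ε) - 1 / (p * (1 + γ)) ∧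
      1 / (1 + ε) - 1 / (p * (1 + γ)) ≤ 1 ∧
      1 + γ / (4 * (p - 1)) ≤ p / (p - 1) * (1 / (1 + ε) - 1 / (p * (1 + γ))) ∧
      1 + (p - 1) / (p + 1) ≤ p / (1 + ε) := by
  have hp0 : 0 < p := by linarith
  have hp1 : 0 < p - 1 := by linarith
  have hq : 0 < 1 + ε := by linarith
  have hP : 0 < p * (1 + γ) := by positivity
  have h1 : 1 + ε < p * (1 + γ) := by nlinarith
  have h2 : 1 - ε ≤ 1 / (1 + ε) := by
    rw [le_div_iff₀ hq]
    nlinarith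
  have h3 : 1 / (p * (1 + γ)) ≤ 1 / p - γ / (2 * p) := by
    rw [div_le_iff₀ hP]
    have : (1 / p - γ / (2 * p)) * (p * (1 + γ)) = (1 - γ / 2) * (1 + γ) := by field_simp
    rw [this]
    nlinarith
  have h4 : (p - 1) / p + γ / (4 * p) ≤ 1 / (1 + ε) - 1 / (p * (1 + γ)) := by
    have e1 : (p - 1) / p = 1 - 1 / p := by field_simp
    have e2 : γ / (2 * p) = γ / (4 * p) + γ / (4 * p) := by field_simp; ring
    linarith
  refine ⟨h1, lt_of_lt_of_le (by positivity) h4, ?_, ?_, ?_⟩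
  · have e1 : 1 / (1 + ε) ≤ 1 := by
      rw [div_le_one hq]
      linarith
    have : 0 < 1 / (p * (1 + γ)) := by positivity
    linarith
  · calc 1 + γ / (4 * (p - 1)) = p / (p - 1) * ((p - 1) / p + γ / (4 * p)) := by field_simp
      _ ≤ _ := mul_le_mul_of_nonneg_left h4 (by positivity)
  · have : 1 + (p - 1) / (p + 1) = p / ((1 + p) / 2) := by field_simp; ring
    rw [this]
    exact div_le_div_of_nonneg_left hp0.le hq (by linarith)

/-- The weighted estimate for the truncated maximal operators, in dual form. -/
theorem exists_lintegral_TT_mul_le (hd : 1 ≤ d) (hn : 1 ≤ n) (C : ℝ) {p : ℝ} (hp : 1 < p) : ∃ K : ℝ≥0∞, K ≠ ⊤ ∧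
    ∀ Ω : Rd d → ℂ, MZ Ω C → ∀ W : Rd d → Mat n, (∀ i j, Measurable fun x => W x i j) → (∀ x, (W x).PosDef) →
    A1Const W ≠ ⊤ → ∀ f : Rd d → Vec n, (∀ i, Measurable fun x => f x i) → ∀ M : ℝ≥0∞, M ≠ ⊤ → (∀ x, ‖f x‖ₑ ≤ M) →
    (∀ i, Nice fun y => mvec (matPow (W y) (-(1 / p))) (f y) i) → ∀ g : Rd d → ℝ≥0∞, Measurable g → (∀ x, g x ≤ M) →
    ∀ J0 s : ℤ, J0 ≤ s →
    ∫⁻ x, TT Ω (fun x => matPow (W x) (1 / p)) (fun y => mvec (matPow (W y) (-(1 / p))) (f y)) J0 s x * g x ≤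
      K * A1Const W ^ (1 / p) * AqScConst W 1 ^ (1 + (p - 1) / p) * (∫⁻ x, ‖f x‖ₑ ^ p) ^ (1 / p) *
        (∫⁻ x, g x ^ (p / (p - 1))) ^ ((p - 1) / p) := by
  obtain ⟨K, hK, H⟩ := exists_lintegral_TT_le hd hn C hp
  have hp0 : 0 < p := by linarith
  have hp1 : 0 < p - 1 := by linarith
  set p' := p / (p - 1) with hp'
  have hp'0 : 0 < p' := by positivity
  obtain ⟨B, hB, HB⟩ := exists_Mx_rpow_le hd (show 1 ≤ p + p' by linarith)
  set c := min (1 / (4 * p)) ((p - 1) / 2) with hc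
  have hc0 : 0 < c := lt_min (by positivity) (by positivity)
  set D₀ := ENNReal.ofReal (c⁻¹ * 2 ^ (d + 1)) with hD₀
  set D₁ := (B * ENNReal.ofReal ((p + 1) / (p - 1))) ^ (1 / p) with hD₁
  set D₂ := (B * ENNReal.ofReal (4 * (p - 1) * 2 ^ (d + 1))) ^ ((p - 1) / p) with hD₂
  have hD₁t : D₁ ≠ ⊤ := ENNReal.rpow_ne_top_of_nonneg (by positivity) (by finiteness)
  have hD₂t : D₂ ≠ ⊤ := ENNReal.rpow_ne_top_of_nonneg (by positivity) (by finiteness)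
  refine ⟨K * D₀ * D₁ * D₂, by finiteness, ?_⟩
  intro Ω hΩ W hW hpd hA f hf M hM hfM hh g hg hgM J0 s hJs
  set S := AqScConst W 1 with hS
  have hSt : S ≠ ⊤ := ne_top_of_le_ne_top hA (AqScConst_le hW hpd)
  have hS1 : 1 ≤ S := one_le_AqScConst hn hW hpd hA
  have hS0 : S ≠ 0 := (zero_lt_one.trans_le hS1).ne'
  have hSr : 1 ≤ S.toReal := by
    rw [← ENNReal.toReal_one]
    exact ENNReal.toReal_mono hSt hS1
  have hSo : ENNReal.ofReal S.toReal = S := ENNReal.ofReal_toReal hSt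
  set γ := (2 ^ (d + 1) * S.toReal)⁻¹ with hγd
  have hγ : 0 < γ := by positivity
  have h21 : (1 : ℝ) ≤ 2 ^ (d + 1) := one_le_pow₀ (by norm_num)
  have hγ1 : γ ≤ 1 := inv_le_one_of_one_le₀ (by nlinarith)
  have hγS : ENNReal.ofReal γ * 2 ^ d * S ≤ 2⁻¹ := by
    have e1 : (2 : ℝ≥0∞) ^ d = ENNReal.ofReal (2 ^ d) := by
      rw [ENNReal.ofReal_pow (by norm_num), ENNReal.ofReal_ofNat]
    have e2 : (2 : ℝ≥0∞)⁻¹ = ENNReal.ofReal (2⁻¹) := by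
      rw [ENNReal.ofReal_inv_of_pos (by norm_num), ENNReal.ofReal_ofNat]
    rw [← hSo, e1, e2, ← ENNReal.ofReal_mul hγ.le, ← ENNReal.ofReal_mul (by positivity)]
    refine ENNReal.ofReal_le_ofReal (le_of_eq ?_)
    rw [hγd, pow_succ]
    field_simp
  set ε := c * γ with hεd
  have hε : 0 < ε := by positivity
  have hc1 : c ≤ 1 / (4 * p) := min_le_left _ _
  have hc2 : c ≤ (p - 1) / 2 := min_le_right _ _
  have hεa : ε ≤ γ / (4 * p) := (mul_le_mul_of_nonneg_right hc1 hγ.le).trans_eq (by ring)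
  have hεb : ε ≤ (p - 1) / 2 := (mul_le_of_le_one_right hc0.le hγ1).trans hc2
  have hε1 : ε ≤ 1 := hεa.trans (by rw [div_le_one (by positivity)]; linarith)
  obtain ⟨hqP, hτ0, hτ1, hτ2, hq2⟩ := exponent_bounds hp hγ hγ1 hε hεa hεb
  set τ := 1 / (1 + ε) - 1 / (p * (1 + γ)) with hτ
  have hq0 : 0 < 1 + ε := by linarith
  refine (H Ω hΩ W hW hpd hA f hf M hM hfM hh g hg hgM γ ε τ⁻¹ hγ hγ1 hγS hε hε1 hqP ((one_le_inv₀ hτ0).2 hτ1)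
    (by rw [one_div τ⁻¹, inv_inv, hτ]; ring) J0 s hJs).trans ?_
  have hconj : p.HolderConjugate p' := Real.HolderConjugate.conjExponent hp
  have hol := ENNReal.lintegral_mul_le_Lp_mul_Lq volume hconj
    (f := fun x => Mx (fun y => ‖f y‖ₑ ^ (1 + ε)) x ^ (1 / (1 + ε)))
    (g := fun x => Mx (fun y => g y ^ τ⁻¹) x ^ (1 / τ⁻¹))
    ((measurable_Mx _).pow_const _).aemeasurable ((measurable_Mx _).pow_const _).aemeasurable
  simp only [Pi.mul_apply] at hol
  have hpp : 1 / p' = (p - 1) / p := by rw [hp', one_div_div]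
  rw [hpp] at hol
  have hfm : Measurable fun y => ‖f y‖ₑ := measurable_enorm_vec hf
  have hb1 : (∫⁻ x, (Mx (fun y => ‖f y‖ₑ ^ (1 + ε)) x ^ (1 / (1 + ε))) ^ p) ^ (1 / p) ≤
      D₁ * (∫⁻ x, ‖f x‖ₑ ^ p) ^ (1 / p) := by
    rw [hD₁, ← ENNReal.mul_rpow_of_nonneg _ _ (by positivity)]
    refine ENNReal.rpow_le_rpow ?_ (by positivity)
    set s₁ := p / (1 + ε) - 1 with hs₁
    have hs0 : (p - 1) / (p + 1) ≤ s₁ := by linarith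
    have hsp : 0 < (p - 1) / (p + 1) := by positivity
    have hsle : s₁ ≤ p + p' := by
      have : p / (1 + ε) ≤ p := div_le_self hp0.le (by linarith)
      linarith
    have e := HB s₁ (by linarith) hsle _ (hfm.pow_const (1 + ε))
    have e1 : ∀ m : ℝ≥0∞, (m ^ (1 / (1 + ε))) ^ p = m ^ (1 + s₁) := fun m => by
      rw [← ENNReal.rpow_mul]; congr 1; rw [hs₁]; ring
    have e2 : ∀ m : ℝ≥0∞, (m ^ (1 + ε)) ^ (1 + s₁) = m ^ p := fun m => by
      rw [← ENNReal.rpow_mul]; congr 1; rw [hs₁]; field_simp; ring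
    simp only [e1]
    simp only [e2] at e
    refine e.trans (mul_le_mul' (mul_le_mul' le_rfl (ENNReal.ofReal_le_ofReal ?_)) le_rfl)
    rw [← inv_div]
    exact inv_anti₀ hsp hs0
  have hb2 : (∫⁻ x, (Mx (fun y => g y ^ τ⁻¹) x ^ (1 / τ⁻¹)) ^ p') ^ ((p - 1) / p) ≤
      D₂ * S ^ ((p - 1) / p) * (∫⁻ x, g x ^ p') ^ ((p - 1) / p) := by
    rw [hD₂, ← ENNReal.mul_rpow_of_nonneg _ _ (by positivity), ← ENNReal.mul_rpow_of_nonneg _ _ (by positivity)]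
    refine ENNReal.rpow_le_rpow ?_ (by positivity)
    set s₂ := p' * τ - 1 with hs₂
    have hs0 : γ / (4 * (p - 1)) ≤ s₂ := by linarith
    have hsp : 0 < γ / (4 * (p - 1)) := by positivity
    have hsle : s₂ ≤ p + p' := by
      have : p' * τ ≤ p' := mul_le_of_le_one_right hp'0.le hτ1
      linarith
    have e := HB s₂ (by linarith) hsle _ (hg.pow_const τ⁻¹)
    have e1 : ∀ m : ℝ≥0∞, (m ^ (1 / τ⁻¹)) ^ p' = m ^ (1 + s₂) := fun m => by
      rw [← ENNReal.rpow_mul]; congr 1; rw [hs₂, one_div, inv_inv]; ring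
    have e2 : ∀ m : ℝ≥0∞, (m ^ τ⁻¹) ^ (1 + s₂) = m ^ p' := fun m => by
      rw [← ENNReal.rpow_mul]; congr 1; rw [hs₂]; field_simp; ring
    simp only [e1]
    simp only [e2] at e
    refine e.trans (mul_le_mul' ?_ le_rfl)
    rw [mul_assoc]
    refine mul_le_mul' le_rfl ?_
    rw [← hSo, ← ENNReal.ofReal_mul (by positivity)]
    refine ENNReal.ofReal_le_ofReal ((inv_anti₀ hsp hs0).trans_eq ?_)
    rw [hγd]
    field_simp
  have hεi : ENNReal.ofReal ε⁻¹ = D₀ * S := by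
    rw [hD₀]
    nth_rw 1 [← hSo]
    rw [← ENNReal.ofReal_mul (by positivity), hεd, hγd, mul_inv, inv_inv]
    congr 1
    ring
  have hSS : S ^ (1 + (p - 1) / p) = S * S ^ ((p - 1) / p) := by
    rw [ENNReal.rpow_add _ _ hS0 hSt, ENNReal.rpow_one]
  calc _ ≤ K * (D₀ * S) * A1Const W ^ (1 / p) * ((D₁ * (∫⁻ x, ‖f x‖ₑ ^ p) ^ (1 / p)) *
        (D₂ * S ^ ((p - 1) / p) * (∫⁻ x, g x ^ p') ^ ((p - 1) / p))) := by
        rw [hεi]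
        exact mul_le_mul' le_rfl (hol.trans (mul_le_mul' hb1 hb2))
    _ = _ := by rw [hSS]; ring

end A1Rough

namespace A1Rough

variable {d n : ℕ}

lemma liminf_rpow {u : ℕ → ℝ≥0∞} {p : ℝ} (hp : 0 < p) :
    (Filter.liminf u Filter.atTop) ^ p = Filter.liminf (fun k => u k ^ p) Filter.atTop :=
  OrderIso.liminf_apply (f := Filter.atTop) (u := u) (ENNReal.orderIsoRpow p hp)

lemma lintegral_liminf_rpow_le {u : ℕ → Rd d → ℝ≥0∞} (hu : ∀ k, Measurable (u k)) {p : ℝ} (hp : 0 < p) {B : ℝ≥0∞}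
    (hB : ∀ k, ∫⁻ x, u k x ^ p ≤ B) : ∫⁻ x, Filter.liminf (fun k => u k x) Filter.atTop ^ p ≤ B := by
  simp only [liminf_rpow hp]
  refine (lintegral_liminf_le fun k => (hu k).pow_const p).trans ?_
  refine (Filter.liminf_le_liminf (Filter.Eventually.of_forall hB)).trans_eq ?_
  exact Filter.liminf_const B

/-- Boundedness by duality. -/
lemma lintegral_rpow_le_of_dual {p : ℝ} (hp : 1 < p) {T : Rd d → ℝ≥0∞} (hT : Measurable T) {A : ℝ≥0∞}
    (h : ∀ g : Rd d → ℝ≥0∞, Measurable g → ∀ M : ℝ≥0∞, M ≠ ⊤ → (∀ x, g x ≤ M) →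
      ∫⁻ x, T x * g x ≤ A * (∫⁻ x, g x ^ (p / (p - 1))) ^ ((p - 1) / p)) :
    ∫⁻ x, T x ^ p ≤ A ^ p := by
  have hp0 : 0 < p := by linarith
  have hp1 : 0 < p - 1 := by linarith
  set φ : ℕ → Rd d → ℝ≥0∞ := fun N => (Metric.ball (0 : Rd d) N).indicator fun x => min (T x) N with hφ
  have hφm : ∀ N, Measurable (φ N) := fun N => (hT.min measurable_const).indicator Metric.isOpen_ball.measurableSet
  have hφN : ∀ N x, φ N x ≤ N := fun N x => Set.indicator_le' (fun _ _ => min_le_right _ _) (fun _ _ => zero_le) x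
  have hφT : ∀ N x, φ N x ≤ T x := fun N x => Set.indicator_le' (fun _ _ => min_le_left _ _) (fun _ _ => zero_le) x
  have hb : ∀ N, ∫⁻ x, φ N x ^ p ≤ A ^ p := by
    intro N
    set X := ∫⁻ x, φ N x ^ p with hX
    have hXt : X ≠ ⊤ := by
      refine ne_top_of_le_ne_top (b := (N : ℝ≥0∞) ^ p * volume (Metric.ball (0 : Rd d) N)) ?_ ?_
      · exact ENNReal.mul_ne_top (ENNReal.rpow_ne_top_of_nonneg hp0.le (ENNReal.natCast_ne_top N)) measure_ball_lt_top.ne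
      · rw [← setLIntegral_const, ← lintegral_indicator Metric.isOpen_ball.measurableSet]
        refine lintegral_mono fun x => ?_
        by_cases hx : x ∈ Metric.ball (0 : Rd d) N
        · rw [Set.indicator_of_mem hx]
          exact ENNReal.rpow_le_rpow (hφN N x) hp0.le
        · simp [hφ, Set.indicator_of_notMem hx, ENNReal.zero_rpow_of_pos hp0]
    have h1 := h (fun x => φ N x ^ (p - 1)) ((hφm N).pow_const _) ((N : ℝ≥0∞) ^ (p - 1))
      (ENNReal.rpow_ne_top_of_nonneg hp1.le (ENNReal.natCast_ne_top N)) fun x => ENNReal.rpow_le_rpow (hφN N x) hp1.le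
    have e1 : ∀ m : ℝ≥0∞, (m ^ (p - 1)) ^ (p / (p - 1)) = m ^ p := fun m => by
      rw [← ENNReal.rpow_mul]; congr 1; field_simp
    simp only [e1] at h1
    rw [← hX] at h1
    have h2 : X ≤ A * X ^ ((p - 1) / p) := by
      refine le_trans (lintegral_mono fun x => ?_) h1
      calc φ N x ^ p = φ N x ^ (1 + (p - 1)) := by congr 1; ring
        _ = φ N x * φ N x ^ (p - 1) := by
            rw [ENNReal.rpow_add_of_nonneg _ _ zero_le_one hp1.le, ENNReal.rpow_one]
        _ ≤ _ := mul_le_mul' (hφT N x) le_rfl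
    rcases eq_or_ne X 0 with h0 | h0
    · rw [h0]; exact zero_le
    have h3 : X ^ (1 / p) ≤ A := by
      have e2 : X = X ^ (1 / p) * X ^ ((p - 1) / p) := by
        rw [← ENNReal.rpow_add _ _ h0 hXt, ← add_div, add_sub_cancel, div_self hp0.ne', ENNReal.rpow_one]
      have h4 : X ^ (1 / p) * X ^ ((p - 1) / p) ≤ A * X ^ ((p - 1) / p) := by rwa [← e2]
      refine (ENNReal.mul_le_mul_iff_left ?_ ?_).1 h4
      · exact (ENNReal.rpow_pos (pos_iff_ne_zero.2 h0) hXt).ne'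
      · exact ENNReal.rpow_ne_top_of_nonneg (by positivity) hXt
    calc X = (X ^ (1 / p)) ^ p := by rw [← ENNReal.rpow_mul, one_div_mul_cancel hp0.ne', ENNReal.rpow_one]
      _ ≤ _ := ENNReal.rpow_le_rpow h3 hp0.le
  refine le_trans (lintegral_mono fun x => ?_) (lintegral_liminf_rpow_le hφm hp0 hb)
  refine ENNReal.rpow_le_rpow ?_ hp0.le
  have ht : Filter.Tendsto (fun N : ℕ => min (T x) (N : ℝ≥0∞)) Filter.atTop (nhds (min (T x) ⊤)) :=
    tendsto_const_nhds.min ENNReal.tendsto_nat_nhds_top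
  have ht' : Filter.Tendsto (fun N : ℕ => φ N x) Filter.atTop (nhds (T x)) := by
    rw [min_top_right] at ht
    refine ht.congr' ?_
    filter_upwards [Filter.eventually_gt_atTop ⌈‖x‖⌉₊] with N hN
    rw [hφ]
    have hx : x ∈ Metric.ball (0 : Rd d) N := by
      rw [mem_ball_zero_iff]
      exact (Nat.le_ceil _).trans_lt (by exact_mod_cast hN)
    exact (Set.indicator_of_mem hx fun x => min (T x) (N : ℝ≥0∞)).symm
  exact ht'.liminf_eq.ge

lemma integrable_smul_vec {k : Rd d → ℂ} (hk : Nice k) {h : Rd d → Vec n} (hh : ∀ i, Nice fun y => h y i) (x : Rd d) :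
    Integrable fun y => k (x - y) • h y :=
  integrable_piLp_iff.2 fun i => hk.int_cv (hh i) x

lemma cvv_eq_integral {k : Rd d → ℂ} (hk : Nice k) {h : Rd d → Vec n} (hh : ∀ i, Nice fun y => h y i) (x : Rd d) :
    cvv k h x = ∫ y, k (x - y) • h y := by
  ext i
  rw [eval_integral_piLp fun i => hk.int_cv (hh i) x]
  rfl

lemma enorm_mvec_cvv_le {k : Rd d → ℂ} (hk : Nice k) {h : Rd d → Vec n} (hh : ∀ i, Nice fun y => h y i) (A : Mat n)
    (x : Rd d) : ‖mvec A (cvv k h x)‖ₑ ≤ ∫⁻ y, ‖k (x - y)‖ₑ * ‖mvec A (h y)‖ₑ := by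
  have h1 : mvec A (cvv k h x) = ∫ y, k (x - y) • mvec A (h y) := by
    rw [cvv_eq_integral hk hh, mvec_eq, ← ContinuousLinearMap.integral_comp_comm _ (integrable_smul_vec hk hh x)]
    simp only [← mvec_eq, mvec_smul]
  rw [h1]
  refine (enorm_integral_le_lintegral_enorm _).trans (lintegral_mono fun y => ?_)
  rw [enorm_smul]

lemma sum_ker_eq {Ω : Rd d → ℂ} {J k : ℤ} {z : Rd d} (h1 : (2 : ℝ) ^ J < ‖z‖) (h2 : ‖z‖ ≤ 2 ^ (k + 1)) :
    ∑ j ∈ Finset.Icc J k, ker Ω j z = Ω z * (((‖z‖ ^ d)⁻¹ : ℝ) : ℂ) := by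
  obtain ⟨j, hj1, hj2⟩ := exists_mem_Ioc_zpow (lt_trans (by positivity) h1) (one_lt_two (α := ℝ))
  have hJj : J < j + 1 := (zpow_lt_zpow_iff_right₀ (one_lt_two (α := ℝ))).1 (h1.trans_le hj2)
  have hjk : j < k + 1 := (zpow_lt_zpow_iff_right₀ (one_lt_two (α := ℝ))).1 (hj1.trans_le h2)
  rw [Finset.sum_eq_single_of_mem j (Finset.mem_Icc.2 ⟨by omega, by omega⟩)]
  · rw [ker, if_pos ⟨hj1, hj2⟩]
  · intro i _ hij
    rw [ker, if_neg]
    rintro ⟨ha, hb⟩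
    have e1 : i < j + 1 := (zpow_lt_zpow_iff_right₀ (one_lt_two (α := ℝ))).1 (ha.trans_le hj2)
    have e2 : j < i + 1 := (zpow_lt_zpow_iff_right₀ (one_lt_two (α := ℝ))).1 (hj1.trans_le hb)
    omega

lemma truncRough_eq {Ω : Rd d → ℂ} {C : ℝ} (hΩ : Homog Ω C) {h : Rd d → Vec n} (hh : ∀ i, Nice fun y => h y i)
    {δ : ℝ} {J k : ℤ} (hδ1 : (2 : ℝ) ^ J ≤ δ) (hδ2 : δ < 2 ^ (J + 1)) (hJk : J ≤ k) {x : Rd d}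
    (hs : ∀ y, h y ≠ 0 → ‖x - y‖ ≤ 2 ^ (k + 1)) :
    truncRough Ω δ h x = (∑ j ∈ Finset.Icc (J + 1) k, cvv (ker Ω j) h x) +
      cvv ({z | δ < ‖z‖}.indicator (ker Ω J)) h x := by
  have hm : MeasurableSet {z : Rd d | δ < ‖z‖} := measurableSet_lt measurable_const measurable_norm
  have hn := (nice_ker hΩ J).indicator hm
  have hmx : MeasurableSet {y : Rd d | δ < ‖x - y‖} :=
    measurableSet_lt measurable_const (measurable_const.sub measurable_id).norm
  rw [cvv_eq_integral hn hh]
  simp only [cvv_eq_integral (nice_ker hΩ _) hh]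
  rw [← integral_finsetSum _ fun j _ => integrable_smul_vec (nice_ker hΩ j) hh x,
    ← integral_add (integrable_finsetSum _ fun j _ => integrable_smul_vec (nice_ker hΩ j) hh x)
      (integrable_smul_vec hn hh x), truncRough, ← integral_indicator hmx]
  refine integral_congr_ae (Filter.Eventually.of_forall fun y => ?_)
  simp only
  rw [← Finset.sum_smul, ← add_smul]
  by_cases hy : δ < ‖x - y‖
  · rw [Set.indicator_of_mem (show y ∈ {y : Rd d | δ < ‖x - y‖} from hy),
      Set.indicator_of_mem (show x - y ∈ {z : Rd d | δ < ‖z‖} from hy)]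
    by_cases h0 : h y = 0
    · simp [h0]
    · have e : Finset.Icc J k = insert J (Finset.Icc (J + 1) k) := by
        ext i; simp only [Finset.mem_Icc, Finset.mem_insert]; omega
      have e2 := sum_ker_eq (Ω := Ω) (hδ1.trans_lt hy) (hs y h0)
      rw [e, Finset.sum_insert (by simp)] at e2
      rw [add_comm, e2, Real.rpow_natCast, Complex.ofReal_inv]
  · rw [Set.indicator_of_notMem (show y ∉ {y : Rd d | δ < ‖x - y‖} from hy),
      Set.indicator_of_notMem (show x - y ∉ {z : Rd d | δ < ‖z‖} from hy), add_zero]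
    rw [Finset.sum_eq_zero, zero_smul]
    intro j hj
    rw [ker, if_neg]
    rintro ⟨ha, -⟩
    have : (2 : ℝ) ^ (J + 1) ≤ 2 ^ j := zpow_le_zpow_right₀ one_le_two (Finset.mem_Icc.1 hj).1
    exact hy (by linarith)

lemma enorm_truncRough_le {Ω : Rd d → ℂ} {C : ℝ} (hΩ : Homog Ω C) {h : Rd d → Vec n} (hh : ∀ i, Nice fun y => h y i)
    (V : Rd d → Mat n) {δ : ℝ} {J J0 s : ℤ} (hδ1 : (2 : ℝ) ^ J ≤ δ) (hδ2 : δ < 2 ^ (J + 1)) (hJ0 : J0 < J) (hJs : J < s)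
    {x : Rd d} (hs : ∀ y, h y ≠ 0 → ‖x - y‖ ≤ 2 ^ (s + 1)) :
    ‖mvec (V x) (truncRough Ω δ h x)‖ₑ ≤ max 1 (ENNReal.ofReal C) * TT Ω V h J0 s x := by
  rw [truncRough_eq hΩ hh hδ1 hδ2 hJs.le hs, mvec_add, TT, mul_add]
  refine (enorm_add_le _ _).trans (add_le_add ?_ ?_)
  · refine le_trans ?_ (le_mul_of_one_le_left zero_le (le_max_left _ _))
    exact le_iSup₂_of_le (f := fun J _ => ‖mvec (V x) (∑ j ∈ Finset.Icc J s, cvv (ker Ω j) h x)‖ₑ) (J + 1)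
      (Finset.mem_Icc.2 ⟨by omega, by omega⟩) le_rfl
  · have h1 : avgN V h J x ≤ TN V h J0 s x :=
      le_iSup₂_of_le (f := fun J _ => avgN V h J x) J (Finset.mem_Icc.2 ⟨by omega, by omega⟩) le_rfl
    refine le_trans ?_ (mul_le_mul' (le_max_right _ _) h1)
    have hn := (nice_ker hΩ J).indicator (measurableSet_lt measurable_const measurable_norm : MeasurableSet {z : Rd d | δ < ‖z‖})
    refine (enorm_mvec_cvv_le hn hh (V x) x).trans ?_
    have hJp : (0 : ℝ) < (2 ^ J) ^ d := by positivity
    have hb : ∀ y, ‖({z : Rd d | δ < ‖z‖}.indicator (ker Ω J)) (x - y)‖ₑ * ‖mvec (V x) (h y)‖ₑ ≤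
        (Metric.ball x ((2 : ℝ) ^ (J + 2))).indicator (fun y => ENNReal.ofReal (C * ((2 ^ J) ^ d)⁻¹) * ‖mvec (V x) (h y)‖ₑ) y := by
      intro y
      have e1 : ‖({z : Rd d | δ < ‖z‖}.indicator (ker Ω J)) (x - y)‖ ≤ ‖ker Ω J (x - y)‖ := norm_indicator_le_norm_self _ _
      by_cases hy : y ∈ Metric.ball x ((2 : ℝ) ^ (J + 2))
      · rw [Set.indicator_of_mem hy]
        refine mul_le_mul' ?_ le_rfl
        rw [← ofReal_norm]
        exact ENNReal.ofReal_le_ofReal (e1.trans (norm_ker_le hΩ J _))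
      · have e2 : ker Ω J (x - y) = 0 := by
          refine ker_eq_zero ?_
          rw [Metric.mem_ball', dist_eq_norm, not_lt] at hy
          exact lt_of_lt_of_le (zpow_lt_zpow_right₀ one_lt_two (by omega)) hy
        rw [e2, norm_zero] at e1
        rw [norm_eq_zero.1 (le_antisymm e1 (norm_nonneg _)), enorm_zero, zero_mul]
        exact zero_le
    refine (lintegral_mono hb).trans_eq ?_
    rw [lintegral_indicator Metric.isOpen_ball.measurableSet, lintegral_const_mul' _ _ ENNReal.ofReal_ne_top,
      ENNReal.ofReal_mul hΩ.1, ENNReal.ofReal_inv_of_pos hJp, avgN, mul_assoc]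

lemma enorm_truncRough_le_liminf {Ω : Rd d → ℂ} {C : ℝ} (hΩ : Homog Ω C) {h : Rd d → Vec n}
    (hh : ∀ i, Nice fun y => h y i) (V : Rd d → Mat n) {δ : ℝ} (hδ : 0 < δ) (x : Rd d) :
    ‖mvec (V x) (truncRough Ω δ h x)‖ₑ ≤ max 1 (ENNReal.ofReal C) *
      Filter.liminf (fun k : ℕ => TT Ω V h (-(k : ℤ)) k x) Filter.atTop := by
  obtain ⟨J, hδ1, hδ2⟩ := exists_mem_Ico_zpow hδ (one_lt_two (α := ℝ))
  choose R hR using fun i => (hh i).2.2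
  set ρ := ∑ i, |R i| with hρ
  have hsupp : ∀ y, h y ≠ 0 → ‖y‖ ≤ ρ := by
    intro y hy
    by_contra hc
    refine hy (PiLp.ext fun i => ?_)
    refine hR i y (lt_of_le_of_lt ?_ (not_le.1 hc))
    exact (le_abs_self _).trans (Finset.single_le_sum (f := fun i => |R i|) (fun _ _ => abs_nonneg _) (Finset.mem_univ i))
  set c := max 1 (ENNReal.ofReal C) with hc
  have hc0 : c ≠ 0 := (zero_lt_one.trans_le (le_max_left _ _)).ne'
  have hct : c ≠ ⊤ := by rw [hc]; finiteness
  rw [mul_comm, ← ENNReal.div_le_iff_le_mul (Or.inl hc0) (Or.inl hct)]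
  refine Filter.le_liminf_of_le (by isBoundedDefault) ?_
  obtain ⟨k₁, hk₁⟩ := pow_unbounded_of_one_lt (‖x‖ + ρ) (one_lt_two (α := ℝ))
  filter_upwards [Filter.eventually_ge_atTop k₁, Filter.eventually_gt_atTop J.natAbs] with k ha hb
  rw [ENNReal.div_le_iff_le_mul (Or.inl hc0) (Or.inl hct), mul_comm]
  refine enorm_truncRough_le hΩ hh V hδ1 hδ2 (by omega) (by omega) fun y hy => ?_
  · have h1 : ‖x - y‖ ≤ ‖x‖ + ρ := (norm_sub_le x y).trans (by linarith [hsupp y hy])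
    have h2 : (2 : ℝ) ^ k₁ ≤ 2 ^ ((k : ℤ) + 1) := by
      rw [← zpow_natCast]
      exact zpow_le_zpow_right₀ one_le_two (by omega)
    linarith

end A1Rough

namespace A1Rough

variable {d n : ℕ}

lemma measurable_vec {α : Type*} [MeasurableSpace α] {v : α → Vec n} (hv : ∀ i, Measurable fun x => v x i) :
    Measurable v := (WithLp.measurable_toLp 2 (Fin n → ℂ)).comp (measurable_pi_iff.2 hv)

lemma tendsto_truncRough {Ω : Rd d → ℂ} (hΩ : Measurable Ω) {δ : ℝ} {h : Rd d → Vec n}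
    (hh : ∀ i, Measurable fun x => h x i) {x : Rd d}
    (hI : IntegrableOn (fun y => (Ω (x - y) * ((‖x - y‖ ^ (d : ℝ) : ℝ) : ℂ)⁻¹) • h y) {y | δ < ‖x - y‖})
    {S : ℕ → Set (Rd d)} (hS : ∀ N, MeasurableSet (S N)) (hS1 : ∀ y, ∀ᶠ N in Filter.atTop, y ∈ S N) :
    Filter.Tendsto (fun N => truncRough Ω δ ((S N).indicator h) x) Filter.atTop (nhds (truncRough Ω δ h x)) := by
  have hkm : Measurable fun y => Ω (x - y) * ((‖x - y‖ ^ (d : ℝ) : ℝ) : ℂ)⁻¹ := by fun_prop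
  have e : ∀ N y, (Ω (x - y) * ((‖x - y‖ ^ (d : ℝ) : ℝ) : ℂ)⁻¹) • (S N).indicator h y =
      (S N).indicator (fun y => (Ω (x - y) * ((‖x - y‖ ^ (d : ℝ) : ℝ) : ℂ)⁻¹) • h y) y := by
    intro N y
    by_cases hy : y ∈ S N
    · rw [Set.indicator_of_mem hy, Set.indicator_of_mem hy]
    · rw [Set.indicator_of_notMem hy, Set.indicator_of_notMem hy, smul_zero]
  refine tendsto_integral_of_dominated_convergence
    (fun y => ‖(Ω (x - y) * ((‖x - y‖ ^ (d : ℝ) : ℝ) : ℂ)⁻¹) • h y‖) (fun N => ?_) hI.norm (fun N => ?_) ?_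
  · exact (hkm.smul ((measurable_vec hh).indicator (hS N))).aestronglyMeasurable
  · refine Filter.Eventually.of_forall fun y => ?_
    rw [e]
    exact norm_indicator_le_norm_self _ _
  · refine Filter.Eventually.of_forall fun y => ?_
    refine tendsto_const_nhds.congr' ?_
    filter_upwards [hS1 y] with N hN
    rw [Set.indicator_of_mem hN]

lemma enorm_truncRough_le_liminf_cut {Ω : Rd d → ℂ} (hΩ : Measurable Ω) {δ : ℝ} {h : Rd d → Vec n}
    (hh : ∀ i, Measurable fun x => h x i) (x : Rd d) (A : Mat n)
    {S : ℕ → Set (Rd d)} (hS : ∀ N, MeasurableSet (S N)) (hS1 : ∀ y, ∀ᶠ N in Filter.atTop, y ∈ S N) :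
    ‖mvec A (truncRough Ω δ h x)‖ₑ ≤ Filter.liminf (fun N => ‖mvec A (truncRough Ω δ ((S N).indicator h) x)‖ₑ) Filter.atTop := by
  by_cases hI : IntegrableOn (fun y => (Ω (x - y) * ((‖x - y‖ ^ (d : ℝ) : ℝ) : ℂ)⁻¹) • h y) {y | δ < ‖x - y‖}
  · have ht := tendsto_truncRough hΩ hh hI hS hS1
    have hc : Continuous fun v : Vec n => ‖mvec A v‖ₑ := by
      simp only [mvec_eq]
      exact (ContinuousLinearMap.continuous _).enorm
    exact ((hc.tendsto _).comp ht).liminf_eq.ge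
  · have h0 : truncRough Ω δ h x = 0 := integral_undef hI
    rw [h0, mvec_eq, map_zero, enorm_zero]
    exact zero_le

theorem exists_lintegral_Tstar_le (hd : 1 ≤ d) (hn : 1 ≤ n) (C : ℝ) {p : ℝ} (hp : 1 < p) : ∃ K : ℝ≥0∞, K ≠ ⊤ ∧
    ∀ Ω : Rd d → ℂ, MZ Ω C → ∀ W : Rd d → Mat n, (∀ i j, Measurable fun x => W x i j) → (∀ x, (W x).PosDef) →
    A1Const W ≠ ⊤ → ∀ f : Rd d → Vec n, (∀ i, Measurable fun x => f x i) →
    lpNormE p (TstarRough Ω W p f) ≤ K * A1Const W ^ (1 / p) * AqScConst W 1 ^ (1 + (p - 1) / p) * lpNormV p f := by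
  obtain ⟨K, hK, H⟩ := exists_lintegral_TT_mul_le hd hn C hp
  have hp0 : 0 < p := by linarith
  set c := max 1 (ENNReal.ofReal C) with hc
  have hct : c ≠ ⊤ := by rw [hc]; finiteness
  refine ⟨c * K, ENNReal.mul_ne_top hct hK, ?_⟩
  intro Ω hΩ W hW hpd hA f hf
  set V : Rd d → Mat n := fun x => matPow (W x) (1 / p) with hV
  set Vi : Rd d → Mat n := fun x => matPow (W x) (-(1 / p)) with hVi
  have hVm : ∀ i j, Measurable fun x => V x i j := measurable_matPow hW hpd _
  have hVim : ∀ i j, Measurable fun x => Vi x i j := measurable_matPow hW hpd _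
  have hfm : Measurable f := measurable_vec hf
  set h : Rd d → Vec n := fun y => mvec (Vi y) (f y) with hh
  have hhm : ∀ i, Measurable fun y => h y i := measurable_mvec hVim hf
  set S : ℕ → Set (Rd d) := fun N => {y | ‖y‖ ≤ N} ∩ ({y | ‖f y‖ ≤ N} ∩ {y | opNorm (Vi y) ≤ N}) with hS
  have hSm : ∀ N, MeasurableSet (S N) := fun N =>
    (measurableSet_le measurable_norm measurable_const).inter ((measurableSet_le hfm.norm measurable_const).inter
      (measurableSet_le (measurable_opNorm hVim) measurable_const))
  have hS1 : ∀ y, ∀ᶠ N in Filter.atTop, y ∈ S N := fun y => by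
    filter_upwards [Filter.eventually_ge_atTop ⌈‖y‖⌉₊, Filter.eventually_ge_atTop ⌈‖f y‖⌉₊,
      Filter.eventually_ge_atTop ⌈opNorm (Vi y)⌉₊] with N h1 h2 h3
    exact ⟨Nat.ceil_le.1 h1, Nat.ceil_le.1 h2, Nat.ceil_le.1 h3⟩
  have hcut : ∀ N y, (S N).indicator h y = mvec (Vi y) ((S N).indicator f y) := fun N y => by
    by_cases hy : y ∈ S N
    · rw [Set.indicator_of_mem hy, Set.indicator_of_mem hy]
    · rw [Set.indicator_of_notMem hy, Set.indicator_of_notMem hy, mvec_eq, map_zero]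
  have hfi : ∀ N i, Measurable fun y => (S N).indicator f y i := fun N i =>
    (measurable_pi_apply i).comp ((WithLp.measurable_ofLp 2 (Fin n → ℂ)).comp (hfm.indicator (hSm N)))
  have hfN : ∀ N y, ‖(S N).indicator f y‖ ≤ N := fun N y => by
    by_cases hy : y ∈ S N
    · rw [Set.indicator_of_mem hy]; exact hy.2.1
    · rw [Set.indicator_of_notMem hy, norm_zero]; exact Nat.cast_nonneg N
  have hnice : ∀ N i, Nice fun y => (S N).indicator h y i := fun N i => by
    refine ⟨?_, ⟨N * N, fun y => ?_⟩, N, fun y hy => ?_⟩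
    · simp only [hcut]
      exact measurable_mvec hVim (hfi N) i
    · refine (norm_apply_le _ i).trans ?_
      by_cases hy : y ∈ S N
      · rw [Set.indicator_of_mem hy]
        exact (norm_mvec_le _ _).trans (mul_le_mul hy.2.2 hy.2.1 (norm_nonneg _) (Nat.cast_nonneg N))
      · rw [Set.indicator_of_notMem hy, norm_zero]
        positivity
    · have hm : y ∉ S N := fun hm => absurd hm.1 (not_le.2 hy)
      simp only [Set.indicator_of_notMem hm]
      rfl
  set D := K * A1Const W ^ (1 / p) * AqScConst W 1 ^ (1 + (p - 1) / p) * (∫⁻ x, ‖f x‖ₑ ^ p) ^ (1 / p) with hD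
  have hTT : ∀ N, ∀ k : ℕ, ∫⁻ x, TT Ω V ((S N).indicator h) (-(k : ℤ)) k x ^ p ≤ D ^ p := by
    intro N k
    refine lintegral_rpow_le_of_dual hp (measurable_TT hΩ.1 hVm (hnice N)) fun g hg M hM hgM => ?_
    have hN : ∀ x, ‖(S N).indicator f x‖ₑ ≤ max M N := fun x => by
      rw [← ofReal_norm]
      refine le_trans (ENNReal.ofReal_le_ofReal (hfN N x)) ?_
      rw [ENNReal.ofReal_natCast]
      exact le_max_right _ _
    have e := H Ω hΩ W hW hpd hA ((S N).indicator f) (hfi N) (max M N) (by finiteness) hN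
      (fun i => by simpa only [hcut] using hnice N i) g hg (fun x => (hgM x).trans (le_max_left _ _)) (-(k : ℤ)) k (by omega)
    have e1 : (fun y => mvec (matPow (W y) (-(1 / p))) ((S N).indicator f y)) = (S N).indicator h :=
      funext fun y => (hcut N y).symm
    rw [e1] at e
    refine e.trans (mul_le_mul' (mul_le_mul' le_rfl (ENNReal.rpow_le_rpow (lintegral_mono fun x => ?_) (by positivity))) le_rfl)
    refine ENNReal.rpow_le_rpow ?_ hp0.le
    rw [← ofReal_norm, ← ofReal_norm]
    exact ENNReal.ofReal_le_ofReal (norm_indicator_le_norm_self _ _)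
  set Ψ : ℕ → Rd d → ℝ≥0∞ := fun N x => Filter.liminf (fun k : ℕ => TT Ω V ((S N).indicator h) (-(k : ℤ)) k x) Filter.atTop with hΨ
  have hΨm : ∀ N, Measurable (Ψ N) := fun N => Measurable.liminf fun k => measurable_TT hΩ.1 hVm (hnice N)
  have hΨb : ∀ N, ∫⁻ x, Ψ N x ^ p ≤ D ^ p := fun N =>
    lintegral_liminf_rpow_le (fun k => measurable_TT hΩ.1 hVm (hnice N)) hp0 (hTT N)
  have hΨ2 := lintegral_liminf_rpow_le (u := fun N x => c * Ψ N x) (B := (c * D) ^ p) (fun N => (hΨm N).const_mul c) hp0 fun N => by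
    simp only [ENNReal.mul_rpow_of_nonneg _ _ hp0.le]
    rw [lintegral_const_mul _ ((hΨm N).pow_const p)]
    exact mul_le_mul' le_rfl (hΨb N)
  have hpt : ∀ x, TstarRough Ω W p f x ≤ Filter.liminf (fun N => c * Ψ N x) Filter.atTop := fun x => by
    refine iSup₂_le fun δ hδ => ?_
    refine (enorm_truncRough_le_liminf_cut hΩ.1.2.1 hhm x (V x) hSm hS1).trans ?_
    exact Filter.liminf_le_liminf (Filter.Eventually.of_forall fun N => enorm_truncRough_le_liminf hΩ.1 (hnice N) V hδ x)
  have h1 : ∫⁻ x, TstarRough Ω W p f x ^ p ≤ (c * D) ^ p :=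
    (lintegral_mono fun x => ENNReal.rpow_le_rpow (hpt x) hp0.le).trans hΨ2
  calc lpNormE p (TstarRough Ω W p f) ≤ ((c * D) ^ p) ^ (1 / p) := ENNReal.rpow_le_rpow h1 (by positivity)
    _ = c * D := by rw [← ENNReal.rpow_mul, mul_one_div_cancel hp0.ne', ENNReal.rpow_one]
    _ = _ := by rw [hD, lpNormV]; simp only [← enorm_eq_nnnorm]; ring

lemma HLM_congr {u v : Rd d → ℝ≥0∞} (h : u =ᵐ[volume] v) : HLM u = HLM v := by
  funext x
  unfold HLM
  refine iSup_congr fun Q => iSup_congr fun _ => ?_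
  rw [lintegral_congr_ae (ae_restrict_of_ae h)]

lemma AInftyConst_congr {u v : Rd d → ℝ≥0∞} (h : u =ᵐ[volume] v) : AInftyConst u = AInftyConst v := by
  unfold AInftyConst
  refine iSup_congr fun Q => ?_
  have h1 : Q.set.indicator u =ᵐ[volume] Q.set.indicator v := by
    filter_upwards [h] with x hx
    by_cases hQ : x ∈ Q.set
    · rw [Set.indicator_of_mem hQ, Set.indicator_of_mem hQ, hx]
    · rw [Set.indicator_of_notMem hQ, Set.indicator_of_notMem hQ]
  rw [lintegral_congr_ae (ae_restrict_of_ae h), HLM_congr h1]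

lemma AqScConst_congr {W W' : Rd d → Mat n} (h : ∀ᵐ x, W x = W' x) (q : ℝ) : AqScConst W q = AqScConst W' q := by
  unfold AqScConst
  refine iSup_congr fun e => AInftyConst_congr ?_
  filter_upwards [h] with x hx
  rw [hx]

lemma A1Const_congr {W W' : Rd d → Mat n} (h : ∀ᵐ x, W x = W' x) : A1Const W = A1Const W' := by
  unfold A1Const
  refine iSup_congr fun Q => essSup_congr_ae ?_
  filter_upwards [ae_restrict_of_ae h] with y hy
  have h1 : ∫⁻ x in Q.set, ENNReal.ofReal (opNorm (W x * (W' y)⁻¹)) =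
      ∫⁻ x in Q.set, ENNReal.ofReal (opNorm (W' x * (W' y)⁻¹)) := by
    refine lintegral_congr_ae ?_
    filter_upwards [ae_restrict_of_ae h] with x hx
    rw [hx]
  simp only [hy, h1]

lemma lpNormE_Tstar_congr {W W' : Rd d → Mat n} (h : ∀ᵐ x, W x = W' x) (Ω : Rd d → ℂ) (p : ℝ) (f : Rd d → Vec n) :
    lpNormE p (TstarRough Ω W p f) = lpNormE p (TstarRough Ω W' p f) := by
  unfold lpNormE
  refine congrArg (· ^ (1 / p)) (lintegral_congr_ae ?_)
  filter_upwards [h] with x hx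
  have h1 : ∀ δ, truncRough Ω δ (fun y => mvec (matPow (W y) (-(1 / p))) (f y)) x =
      truncRough Ω δ (fun y => mvec (matPow (W' y) (-(1 / p))) (f y)) x := fun δ => by
    unfold truncRough
    refine integral_congr_ae ?_
    filter_upwards [ae_restrict_of_ae h] with y hy
    rw [hy]
  simp only [TstarRough, h1, hx]

lemma exists_everywhere_posDef {W : Rd d → Mat n} (hW : IsMatrixWeight W) : ∃ W' : Rd d → Mat n,
    (∀ i j, Measurable fun x => W' x i j) ∧ (∀ x, (W' x).PosDef) ∧ ∀ᵐ x, W x = W' x := by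
  classical
  obtain ⟨hm, hp⟩ := hW
  set s := toMeasurable volume {x | ¬ (W x).PosDef} with hs
  have hsm : MeasurableSet s := measurableSet_toMeasurable _ _
  have hs0 : volume s = 0 := by rw [hs, measure_toMeasurable]; exact hp
  refine ⟨fun x => if x ∈ s then 1 else W x, fun i j => ?_, fun x => ?_, ?_⟩
  · have : (fun x => (if x ∈ s then (1 : Mat n) else W x) i j) = fun x => if x ∈ s then (1 : Mat n) i j else W x i j := by
      funext x; split_ifs <;> rfl
    rw [this]
    exact Measurable.ite hsm measurable_const (hm i j)
  · simp only
    split_ifs with hx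
    · exact Matrix.PosDef.one
    · by_contra hc
      exact hx (subset_toMeasurable _ _ hc)
  · filter_upwards [compl_mem_ae_iff.2 hs0] with x hx
    exact (if_neg hx).symm

theorem a1_bound_rough_aux (hd : 1 ≤ d) (hn : 1 ≤ n) {p : ℝ} (hp : 1 < p) (CΩ : ℝ) :
    ∃ c : ℝ≥0∞, 0 < c ∧ c ≠ ⊤ ∧
      ∀ Ω : Rd d → ℂ, IsRoughKernel Ω CΩ →
        ∀ W : Rd d → Mat n, IsMatrixWeight W → A1Const W ≠ ⊤ →
          ∀ f : Rd d → Vec n, MeasurableV f →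
            lpNormE p (TstarRough Ω W p f) ≤
                c * A1Const W ^ (1/p) * AqScConst W 1 ^ (1 + (p-1)/p) * lpNormV p f ∧
            lpNormE p (TstarRough Ω W p f) ≤ c * A1Const W ^ (2 : ℝ) * lpNormV p f := by
  obtain ⟨K, hK, H⟩ := exists_lintegral_Tstar_le hd hn |CΩ| hp
  have hp0 : 0 < p := by linarith
  have hp1 : 0 < p - 1 := by linarith
  refine ⟨K + 1, by positivity, by finiteness, ?_⟩
  intro Ω hΩ W hW hA f hf
  obtain ⟨W', hWm, hWp, hWW⟩ := exists_everywhere_posDef hW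
  rw [lpNormE_Tstar_congr hWW, A1Const_congr hWW, AqScConst_congr hWW]
  rw [A1Const_congr hWW] at hA
  have hMZ : MZ Ω |CΩ| := ⟨⟨abs_nonneg _, hΩ.1, hΩ.2.1, fun x hx => (hΩ.2.2.1 x hx).trans (le_abs_self _)⟩,
    integral_ker_eq_zero hd hΩ⟩
  have h1 : lpNormE p (TstarRough Ω W' p f) ≤
      (K + 1) * A1Const W' ^ (1/p) * AqScConst W' 1 ^ (1 + (p-1)/p) * lpNormV p f :=
    (H Ω hMZ W' hWm hWp hA f hf).trans
      (mul_le_mul' (mul_le_mul' (mul_le_mul' le_self_add le_rfl) le_rfl) le_rfl)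
  refine ⟨h1, h1.trans (mul_le_mul' ?_ le_rfl)⟩
  rw [mul_assoc]
  refine mul_le_mul' le_rfl ?_
  calc A1Const W' ^ (1/p) * AqScConst W' 1 ^ (1 + (p-1)/p)
      ≤ A1Const W' ^ (1/p) * A1Const W' ^ (1 + (p-1)/p) :=
        mul_le_mul' le_rfl (ENNReal.rpow_le_rpow (AqScConst_le hWm hWp) (by positivity))
    _ = A1Const W' ^ (2 : ℝ) := by
        rw [← ENNReal.rpow_add_of_nonneg _ _ (by positivity) (by positivity)]
        congr 1
        field_simp
        ring

end A1Rough

/-- Sharp `A₁` bound for maximal rough singular integrals: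
`‖T*_{Ω,W,p}f‖_{L^p} ≤ c [W]_{A₁}^{1/p}[W]_{A^{sc}_{1,∞}}^{1+1/p'}‖f‖_{L^p} ≤ c [W]_{A₁}²‖f‖_{L^p}`. -/
theorem a1_bound_rough (d n : ℕ) (hd : 1 ≤ d) (hn : 1 ≤ n) (p : ℝ) (hp : 1 < p) (CΩ : ℝ) :
    ∃ c : ℝ≥0∞, 0 < c ∧ c ≠ ⊤ ∧
      ∀ Ω : Rd d → ℂ, IsRoughKernel Ω CΩ →
        ∀ W : Rd d → Mat n, IsMatrixWeight W → A1Const W ≠ ⊤ →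
          ∀ f : Rd d → Vec n, MeasurableV f →
            lpNormE p (TstarRough Ω W p f) ≤
                c * A1Const W ^ (1/p) * AqScConst W 1 ^ (1 + (p-1)/p) * lpNormV p f ∧
            lpNormE p (TstarRough Ω W p f) ≤ c * A1Const W ^ (2 : ℝ) * lpNormV p f :=
  A1Rough.a1_bound_rough_aux hd hn hp CΩ

end
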